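/- Let c be a rational number with c ∉ {−5, −5/2, −155/72, −2, −5/4, 0, 19/16}. If c ∈ Im ρ, then the fourth dynatomic polynomial Φ_{4,c} factors in ℚ[x] as a product of three irreducible polynomials of degrees 8, 2, and 2, and its Galois group G_c is isomorphic to the group ℐ. -/

import Mathlib

open Polynomial

/-- The fourth dynatomic polynomial of `x^2 + c`. -/
noncomputable def Phi4 {K : Type*} [Field K] (c : K) : K[X] :=
  X ^ 12 + C (6 * c) * X ^ 10 + X ^ 9 + C (15 * c ^ 2 + 3 * c) * X ^ 8 +
    C (4 * c) * X ^ 7 + C (20 * c ^ 3 + 12 * c ^ 2 + 1) * X ^ 6 +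
    C (6 * c ^ 2 + 2 * c) * X ^ 5 +
    C (15 * c ^ 4 + 18 * c ^ 3 + 3 * c ^ 2 + 4 * c) * X ^ 4 +
    C (4 * c ^ 3 + 4 * c ^ 2 + 1) * X ^ 3 +
    C (6 * c ^ 5 + 12 * c ^ 4 + 6 * c ^ 3 + 5 * c ^ 2 + c) * X ^ 2 +
    C (c ^ 4 + 2 * c ^ 3 + c ^ 2 + 2 * c) * X +
    C (c ^ 6 + 3 * c ^ 5 + 3 * c ^ 4 + 3 * c ^ 3 + 2 * c ^ 2 + 1)

/-- The group ℐ ⊆ S₁₂, generated by (1,4,3,2), (9,10,11,12), (1,10,4,9,3,12,2,11)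
and (1,10)(2,11)(3,12)(4,9)(5,7)(6,8) (here written on {0,…,11}). -/
def Igroup : Subgroup (Equiv.Perm (Fin 12)) :=
  Subgroup.closure
    {([0, 3, 2, 1] : List (Fin 12)).formPerm,
     ([8, 9, 10, 11] : List (Fin 12)).formPerm,
     ([0, 9, 3, 8, 2, 11, 1, 10] : List (Fin 12)).formPerm,
     ([0, 9] : List (Fin 12)).formPerm * ([1, 10] : List (Fin 12)).formPerm *
       ([2, 11] : List (Fin 12)).formPerm * ([3, 8] : List (Fin 12)).formPerm *
       ([4, 6] : List (Fin 12)).formPerm * ([5, 7] : List (Fin 12)).formPerm}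

theorem nat_sq_or_five {c1 c2 m : ℕ} (h : c1 * c2 = m ^ 2) (hm : m ≠ 0) {r : ℕ}
    (hc : ∀ p : ℕ, p.Prime → p ∣ c1 → p ∣ c2 → p = r) :
    ∃ k, c1 = k ^ 2 ∨ c1 = r * k ^ 2 := by
  obtain ⟨a, b, hab, hsq⟩ := Nat.sq_mul_squarefree c1
  have hb : b ≠ 0 := by
    rintro rfl
    apply hm
    rw [← hab] at h
    have : m ^ 2 = 0 := by rw [← h]; ring
    exact pow_eq_zero_iff two_ne_zero |>.1 this
  have key : ∀ p : ℕ, p.Prime → p ∣ a → p = r := by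
    intro p hp hpa
    have h1 : p ∣ c1 := by rw [← hab]; exact hpa.mul_left _
    refine hc p hp h1 ?_
    have hbm : b ∣ m := by
      rw [← Nat.pow_dvd_pow_iff two_ne_zero, ← h, ← hab]
      exact ⟨a * c2, by ring⟩
    obtain ⟨m', rfl⟩ := hbm
    have e : a * c2 = m' ^ 2 := by
      have : b ^ 2 * (a * c2) = b ^ 2 * m' ^ 2 := by rw [← mul_assoc, hab, h]; ring
      exact Nat.eq_of_mul_eq_mul_left (by positivity) this
    have hpm : p ∣ m' := hp.dvd_of_dvd_pow (n := 2) (e ▸ hpa.mul_right _)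
    obtain ⟨a', rfl⟩ := hpa
    have hpa' : ¬ p ∣ a' := by
      intro h'
      have := hsq p (mul_dvd_mul_left p h')
      exact hp.one_lt.ne' (Nat.isUnit_iff.1 this)
    obtain ⟨m'', rfl⟩ := hpm
    have : a' * c2 = p * m'' ^ 2 := by
      have : p * (a' * c2) = p * (p * m'' ^ 2) := by rw [← mul_assoc, e]; ring
      exact Nat.eq_of_mul_eq_mul_left hp.pos this
    have : p ∣ a' * c2 := ⟨_, this⟩
    exact (hp.dvd_mul.1 this).resolve_left hpa'
  refine ⟨b, ?_⟩
  by_cases ha : a = 1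
  · left; rw [← hab, ha]; ring
  right
  obtain ⟨p, hp, a', rfl⟩ := Nat.exists_prime_and_dvd ha
  have hpr := key p hp (dvd_mul_right _ _)
  have : a' = 1 := by
    by_contra ha'
    obtain ⟨q, hq, hqa⟩ := Nat.exists_prime_and_dvd ha'
    have hqr := key q hq (hqa.mul_left _)
    have : q * q ∣ p * a' := mul_dvd_mul (by rw [hqr, hpr]) hqa
    exact hq.one_lt.ne' (Nat.isUnit_iff.1 (hsq q this))
  rw [← hab, this, hpr]; ring

theorem nat_pow_split {k a b c : ℕ} (hk : k ≠ 0) (hab : Nat.Coprime a b) (h : a * b = c ^ k) :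
    ∃ x y, a = x ^ k ∧ b = y ^ k ∧ c = x * y := by
  have h1 := exists_eq_pow_of_mul_eq_pow (a := a) (b := b) (Nat.isUnit_iff.2 hab) h
  have h2 := exists_eq_pow_of_mul_eq_pow (a := b) (b := a)
    (Nat.isUnit_iff.2 hab.symm) (by rw [mul_comm]; exact h)
  obtain ⟨x, hx⟩ := h1
  obtain ⟨y, hy⟩ := h2
  refine ⟨x, y, hx, hy, ?_⟩
  have : c ^ k = (x * y) ^ k := by rw [← h, hx, hy, mul_pow]
  exact Nat.pow_left_injective hk this

/-- Positive integers version. -/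
theorem int_pow_split {k : ℕ} {a b c : ℤ} (hk : k ≠ 0) (ha : 0 < a) (hb : 0 < b) (hc : 0 < c)
    (hab : IsCoprime a b) (h : a * b = c ^ k) :
    ∃ x y : ℤ, 0 < x ∧ 0 < y ∧ a = x ^ k ∧ b = y ^ k ∧ c = x * y := by
  lift a to ℕ using ha.le
  lift b to ℕ using hb.le
  lift c to ℕ using hc.le
  obtain ⟨x, y, h1, h2, h3⟩ := nat_pow_split hk (Nat.isCoprime_iff_coprime.1 hab)
    (by exact_mod_cast h)
  refine ⟨x, y, ?_, ?_, by exact_mod_cast h1, by exact_mod_cast h2, by exact_mod_cast h3⟩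
  · rcases Nat.eq_zero_or_pos x with h | h
    · subst h; simp [hk] at h1; omega
    · exact_mod_cast h
  · rcases Nat.eq_zero_or_pos y with h | h
    · subst h; simp [hk] at h2; omega
    · exact_mod_cast h

/-- Coprimality from primes. -/
theorem int_coprime_of_primes {a b : ℤ}
    (h : ∀ p : ℤ, Prime p → p ∣ a → p ∣ b → False) (h0 : a ≠ 0 ∨ b ≠ 0) : IsCoprime a b := by
  refine isCoprime_of_prime_dvd ?_ fun z hz => h z hz
  rintro ⟨rfl, rfl⟩
  simp at h0

theorem int_sq_or {c1 c2 m : ℤ} (h : c1 * c2 = m ^ 2) (hm : m ≠ 0) (h1 : 0 < c1) {r : ℕ}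
    (hc : ∀ p : ℕ, p.Prime → (p : ℤ) ∣ c1 → (p : ℤ) ∣ c2 → p = r) :
    ∃ k : ℤ, c1 = k ^ 2 ∨ c1 = r * k ^ 2 := by
  have h' : c1.natAbs * c2.natAbs = m.natAbs ^ 2 := by
    rw [← Int.natAbs_mul, h, Int.natAbs_pow]
  obtain ⟨k, hk⟩ := nat_sq_or_five h' (by simpa using hm) (r := r)
    (fun p hp ha hb => hc p hp (Int.natCast_dvd.2 ha) (Int.natCast_dvd.2 hb))
  have e : (c1.natAbs : ℤ) = c1 := Int.natAbs_of_nonneg h1.le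
  refine ⟨k, hk.imp (fun h => ?_) (fun h => ?_)⟩
  · rw [← e, h]; push_cast; ring
  · rw [← e, h]; push_cast; ring

theorem natPrime_int {p : ℕ} (hp : p.Prime) : Prime (p : ℤ) := Nat.prime_iff_prime_int.1 hp

/-! Elliptic curves `y^2 = x^3 + a x`. -/

/-- The curve `y^2 = x^3 + a x`. -/
def EC {F : Type} [Field F] (a : F) : WeierstrassCurve.Affine F := ⟨0, 0, 0, a, 0⟩

/-- `P` is the affine point `(x, y)`. -/
def IsPt {F : Type} [Field F] {a : F} (P : (EC a).Point) (x y : F) : Prop :=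
  ∃ h, P = WeierstrassCurve.Affine.Point.some x y h

section EC
variable {F : Type} [Field F] {a : F}

theorem ec_equation (x y : F) : (EC a).Equation x y ↔ y ^ 2 = x ^ 3 + a * x := by
  rw [WeierstrassCurve.Affine.equation_iff]
  simp [EC]

theorem ec_nonsing (ha : a ≠ 0) (h2 : (2 : F) ≠ 0) {x y : F} (h : y ^ 2 = x ^ 3 + a * x) :
    (EC a).Nonsingular x y := by
  rw [WeierstrassCurve.Affine.nonsingular_iff]
  refine ⟨(ec_equation x y).2 h, ?_⟩
  by_contra hcon
  push Not at hcon
  simp only [EC] at hcon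
  obtain ⟨h1, h3⟩ := hcon
  have hy : y = 0 := by
    have : 2 * y = 0 := by linear_combination h3
    rcases mul_eq_zero.1 this with h | h
    · exact absurd h h2
    · exact h
  have h5 : 3 * x ^ 2 + a = 0 := by linear_combination -h1
  subst hy
  have h6 : x * (x ^ 2 + a) = 0 := by linear_combination -h
  rcases mul_eq_zero.1 h6 with h7 | h7
  · subst h7; apply ha; linear_combination h5
  · have : 2 * a = 0 := by linear_combination 3 * h7 - h5
    rcases mul_eq_zero.1 this with h | h
    · exact h2 h
    · exact ha h

theorem isPt_mk (ha : a ≠ 0) (h2 : (2 : F) ≠ 0) {x y : F} (h : y ^ 2 = x ^ 3 + a * x) :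
    ∃ P : (EC a).Point, IsPt P x y :=
  ⟨_, ec_nonsing ha h2 h, rfl⟩

theorem IsPt.eqn {P : (EC a).Point} {x y : F} (h : IsPt P x y) : y ^ 2 = x ^ 3 + a * x := by
  obtain ⟨h, rfl⟩ := h
  exact (ec_equation x y).1 h.1

theorem IsPt.unique {P : (EC a).Point} {x y x' y' : F} (h : IsPt P x y) (h' : IsPt P x' y') :
    x = x' ∧ y = y' := by
  obtain ⟨h, rfl⟩ := h
  obtain ⟨h', e⟩ := h'
  simpa using e

theorem IsPt.eq {P Q : (EC a).Point} {x y : F} (h : IsPt P x y) (h' : IsPt Q x y) : P = Q := by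
  obtain ⟨h, rfl⟩ := h
  obtain ⟨h', rfl⟩ := h'
  rfl

theorem IsPt.ne_zero {P : (EC a).Point} {x y : F} (h : IsPt P x y) : P ≠ 0 := by
  obtain ⟨h, rfl⟩ := h
  exact WeierstrassCurve.Affine.Point.some_ne_zero h

theorem pt_cases (P : (EC a).Point) : P = 0 ∨ ∃ x y, IsPt P x y := by
  cases P with
  | zero => exact Or.inl rfl
  | some x y h => exact Or.inr ⟨x, y, h, rfl⟩

theorem some_congr {x y x' y' : F} (e1 : x = x') (e2 : y = y') (h : (EC a).Nonsingular x y)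
    (h' : (EC a).Nonsingular x' y') : WeierstrassCurve.Affine.Point.some x y h =
      WeierstrassCurve.Affine.Point.some x' y' h' := by
  subst e1 e2; rfl

theorem IsPt.neg {P : (EC a).Point} {x y : F} (h : IsPt P x y) : IsPt (-P) x (-y) := by
  obtain ⟨h, rfl⟩ := h
  rw [WeierstrassCurve.Affine.Point.neg_some]
  have e : (EC a).negY x y = -y := by simp [WeierstrassCurve.Affine.negY, EC]
  have h' : (EC a).Nonsingular x (-y) := by
    rw [← e]; exact (WeierstrassCurve.Affine.nonsingular_neg x y).2 h
  exact ⟨h', some_congr rfl e _ _⟩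

variable [DecidableEq F]

theorem IsPt.add_chord {P Q : (EC a).Point} {x₁ y₁ x₂ y₂ : F} (hP : IsPt P x₁ y₁)
    (hQ : IsPt Q x₂ y₂) (hx : x₁ ≠ x₂) {l x₃ y₃ : F} (hl : l * (x₁ - x₂) = y₁ - y₂)
    (h3 : x₃ = l ^ 2 - x₁ - x₂) (h4 : y₃ = l * (x₁ - x₃) - y₁) : IsPt (P + Q) x₃ y₃ := by
  obtain ⟨hP, rfl⟩ := hP
  obtain ⟨hQ, rfl⟩ := hQ
  have hs : (EC a).slope x₁ x₂ y₁ y₂ = l := by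
    rw [WeierstrassCurve.Affine.slope_of_X_ne hx, ← hl, mul_div_cancel_right₀ _ (sub_ne_zero.2 hx)]
  have e1 : (EC a).addX x₁ x₂ ((EC a).slope x₁ x₂ y₁ y₂) = x₃ := by
    rw [hs, h3]; simp [WeierstrassCurve.Affine.addX, EC]
  have e2 : (EC a).addY x₁ x₂ y₁ ((EC a).slope x₁ x₂ y₁ y₂) = y₃ := by
    rw [WeierstrassCurve.Affine.addY, WeierstrassCurve.Affine.negAddY, e1, hs, h4]
    simp [WeierstrassCurve.Affine.negY, EC]; ring
  have key := WeierstrassCurve.Affine.Point.add_of_X_ne (h₁ := hP) (h₂ := hQ) hx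
  have hn := WeierstrassCurve.Affine.nonsingular_add hP hQ (fun h => hx h.1)
  have hn' := hn
  rw [e1, e2] at hn'
  refine ⟨hn', key.trans ?_⟩
  exact some_congr e1 e2 _ _

theorem IsPt.add_self (h2 : (2 : F) ≠ 0) {P : (EC a).Point} {x y : F} (hP : IsPt P x y)
    (hy : y ≠ 0) {l x₃ y₃ : F} (hl : l * (2 * y) = 3 * x ^ 2 + a)
    (h3 : x₃ = l ^ 2 - x - x) (h4 : y₃ = l * (x - x₃) - y) : IsPt (P + P) x₃ y₃ := by
  obtain ⟨hP, rfl⟩ := hP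
  have hne : y ≠ (EC a).negY x y := by
    simp only [WeierstrassCurve.Affine.negY, EC]
    intro h
    have : 2 * y = 0 := by linear_combination h
    rcases mul_eq_zero.1 this with h | h
    · exact h2 h
    · exact hy h
  have h2y : 2 * y ≠ 0 := mul_ne_zero h2 hy
  have hs : (EC a).slope x x y y = l := by
    rw [WeierstrassCurve.Affine.slope_of_Y_ne rfl hne]
    simp only [WeierstrassCurve.Affine.negY, EC]
    rw [div_eq_iff]
    · linear_combination -hl
    · intro h; apply h2y; linear_combination h
  have e1 : (EC a).addX x x ((EC a).slope x x y y) = x₃ := by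
    rw [hs, h3]; simp [WeierstrassCurve.Affine.addX, EC]
  have e2 : (EC a).addY x x y ((EC a).slope x x y y) = y₃ := by
    rw [WeierstrassCurve.Affine.addY, WeierstrassCurve.Affine.negAddY, e1, hs, h4]
    simp [WeierstrassCurve.Affine.negY, EC]; ring
  have key := WeierstrassCurve.Affine.Point.add_self_of_Y_ne (h₁ := hP) hne
  have hn := WeierstrassCurve.Affine.nonsingular_add hP hP (fun h => hne h.2)
  have hn' := hn
  rw [e1, e2] at hn'
  refine ⟨hn', key.trans ?_⟩
  exact some_congr e1 e2 _ _

theorem IsPt.add_neg {P Q : (EC a).Point} {x y : F} (hP : IsPt P x y) (hQ : IsPt Q x (-y)) :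
    P + Q = 0 := by
  have := hQ.eq hP.neg
  rw [this, add_neg_cancel]

end EC

/-- `x` is `ℓ`-integral with reduction `b`. -/
def Red (ℓ : ℕ) [Fact ℓ.Prime] (x : ℚ) (b : ZMod ℓ) : Prop :=
  ∃ n d : ℤ, (d : ZMod ℓ) ≠ 0 ∧ x * d = n ∧ b * d = n

section Red
variable {ℓ : ℕ} [hℓ : Fact ℓ.Prime]

theorem Red.unique {x : ℚ} {b b' : ZMod ℓ} (h : Red ℓ x b) (h' : Red ℓ x b') : b = b' := by
  obtain ⟨n, d, hd, h1, h2⟩ := h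
  obtain ⟨n', d', hd', h1', h2'⟩ := h'
  have e : n * d' = n' * d := by
    have : (n : ℚ) * d' = n' * d := by rw [← h1, ← h1']; ring
    exact_mod_cast this
  have e' : (n : ZMod ℓ) * d' = n' * d := by exact_mod_cast congrArg (Int.cast : ℤ → ZMod ℓ) e
  have : (b - b') * (d * d') = 0 := by
    linear_combination (d' : ZMod ℓ) * h2 - d * h2' + e'
  rcases mul_eq_zero.1 this with h | h
  · exact sub_eq_zero.1 h
  · exact absurd h (mul_ne_zero hd hd')

theorem Red.int (n : ℤ) : Red ℓ (n : ℚ) (n : ZMod ℓ) := ⟨n, 1, by simp, by simp, by simp⟩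

theorem Red.zero : Red ℓ 0 0 := by simpa using Red.int (ℓ := ℓ) 0
theorem Red.one : Red ℓ 1 1 := by simpa using Red.int (ℓ := ℓ) 1
theorem Red.ofNat (n : ℕ) [n.AtLeastTwo] :
    Red ℓ (OfNat.ofNat n : ℚ) (OfNat.ofNat n : ZMod ℓ) := by
  simpa using Red.int (ℓ := ℓ) (OfNat.ofNat n : ℕ)

theorem Red.add {x y : ℚ} {b c : ZMod ℓ} (h : Red ℓ x b) (h' : Red ℓ y c) :
    Red ℓ (x + y) (b + c) := by
  obtain ⟨n, d, hd, h1, h2⟩ := h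
  obtain ⟨n', d', hd', h1', h2'⟩ := h'
  refine ⟨n * d' + n' * d, d * d', by push_cast; exact mul_ne_zero hd hd', ?_, ?_⟩
  · push_cast; linear_combination (d' : ℚ) * h1 + d * h1'
  · push_cast; linear_combination (d' : ZMod ℓ) * h2 + d * h2'

theorem Red.mul {x y : ℚ} {b c : ZMod ℓ} (h : Red ℓ x b) (h' : Red ℓ y c) :
    Red ℓ (x * y) (b * c) := by
  obtain ⟨n, d, hd, h1, h2⟩ := h
  obtain ⟨n', d', hd', h1', h2'⟩ := h'
  refine ⟨n * n', d * d', by push_cast; exact mul_ne_zero hd hd', ?_, ?_⟩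
  · push_cast; rw [← h1, ← h1']; ring
  · push_cast; rw [← h2, ← h2']; ring

theorem Red.neg {x : ℚ} {b : ZMod ℓ} (h : Red ℓ x b) : Red ℓ (-x) (-b) := by
  have := (Red.int (ℓ := ℓ) (-1)).mul h
  simpa using this

theorem Red.sub {x y : ℚ} {b c : ZMod ℓ} (h : Red ℓ x b) (h' : Red ℓ y c) :
    Red ℓ (x - y) (b - c) := by
  simpa [sub_eq_add_neg] using h.add h'.neg

theorem Red.pow {x : ℚ} {b : ZMod ℓ} (h : Red ℓ x b) (k : ℕ) : Red ℓ (x ^ k) (b ^ k) := by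
  induction k with
  | zero => simpa using Red.one
  | succ k ih => simpa [pow_succ] using ih.mul h

theorem Red.ne_zero {x : ℚ} {b : ZMod ℓ} (h : Red ℓ x b) (hb : b ≠ 0) : x ≠ 0 := by
  rintro rfl
  exact hb (h.unique Red.zero)

theorem Red.inv {x : ℚ} {b : ZMod ℓ} (h : Red ℓ x b) (hb : b ≠ 0) : Red ℓ x⁻¹ b⁻¹ := by
  have hx := h.ne_zero hb
  obtain ⟨n, d, hd, h1, h2⟩ := h
  refine ⟨d, n, ?_, ?_, ?_⟩
  · rw [← h2]; exact mul_ne_zero hb hd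
  · rw [← h1]; field_simp
  · rw [← h2]; field_simp

theorem Red.div {x y : ℚ} {b c : ZMod ℓ} (h : Red ℓ x b) (h' : Red ℓ y c) (hc : c ≠ 0) :
    Red ℓ (x / y) (b / c) := by
  simpa [div_eq_mul_inv] using h.mul (h'.inv hc)

theorem Red.cancel {x y : ℚ} {b c : ZMod ℓ} (h : Red ℓ (x * y) b) (h' : Red ℓ y c) (hc : c ≠ 0) :
    Red ℓ x (b / c) := by
  have := h.div h' hc
  rwa [mul_div_cancel_right₀ _ (h'.ne_zero hc)] at this

theorem red_total (x : ℚ) : (∃ b, Red ℓ x b) ∨ (x ≠ 0 ∧ Red ℓ x⁻¹ 0) := by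
  have hx : x * x.den = x.num := by exact_mod_cast Rat.mul_den_eq_num x
  by_cases h : ((x.den : ℤ) : ZMod ℓ) = 0
  · right
    have hn : ((x.num : ℤ) : ZMod ℓ) ≠ 0 := by
      intro hn
      rw [ZMod.intCast_zmod_eq_zero_iff_dvd] at h hn
      have h1 : ℓ ∣ x.num.natAbs := Int.natCast_dvd.1 hn
      have h2 : ℓ ∣ x.den := by exact_mod_cast h
      have := Nat.dvd_gcd h1 h2
      rw [x.reduced] at this
      exact hℓ.1.one_lt.ne' (Nat.dvd_one.1 this)
    have hx0 : x ≠ 0 := by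
      rintro rfl
      simp at hn
    refine ⟨hx0, x.den, x.num, hn, ?_, by rw [h]; ring⟩
    rw [← hx]; field_simp; simp
  · left
    exact ⟨(x.num : ZMod ℓ) / ((x.den : ℤ) : ZMod ℓ), x.num, x.den, h, by exact_mod_cast hx,
      by field_simp⟩

/-- A square root of a reducible number is reducible. -/
theorem red_of_sq {x : ℚ} {b : ZMod ℓ} (h : Red ℓ (x ^ 2) b) : ∃ c, Red ℓ x c ∧ c ^ 2 = b := by
  rcases red_total (ℓ := ℓ) x with ⟨c, hc⟩ | ⟨h0, hi⟩
  · exact ⟨c, hc, (hc.pow 2).unique h⟩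
  · exfalso
    have := (hi.pow 2).mul h
    rw [← mul_pow, inv_mul_cancel₀ h0] at this
    have := this.unique (by simpa using Red.one)
    simp at this

end Red

section PRed
variable {ℓ : ℕ} [hℓ : Fact ℓ.Prime] {a : ℤ}

/-- Reduction of points modulo `ℓ`. -/
def PRed (ℓ : ℕ) [Fact ℓ.Prime] {a : ℤ} (P : (EC (a : ℚ)).Point)
    (Pb : (EC (a : ZMod ℓ)).Point) : Prop :=
  (P = 0 ∧ Pb = 0) ∨ (∃ x y, IsPt P x y ∧ x ≠ 0 ∧ Red ℓ x⁻¹ 0 ∧ Pb = 0) ∨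
    (∃ x y xb yb, IsPt P x y ∧ IsPt Pb xb yb ∧ Red ℓ x xb ∧ Red ℓ y yb)

theorem PRed.neg {P : (EC (a : ℚ)).Point} {Pb : (EC (a : ZMod ℓ)).Point} (h : PRed ℓ P Pb) :
    PRed ℓ (-P) (-Pb) := by
  rcases h with ⟨rfl, rfl⟩ | ⟨x, y, h1, h2, h3, rfl⟩ | ⟨x, y, xb, yb, h1, h2, h3, h4⟩
  · exact Or.inl ⟨by simp, by simp⟩
  · exact Or.inr (Or.inl ⟨x, -y, h1.neg, h2, h3, by simp⟩)
  · exact Or.inr (Or.inr ⟨x, -y, xb, -yb, h1.neg, h2.neg, h3, h4.neg⟩)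

theorem PRed.affine {P : (EC (a : ℚ)).Point} {Pb : (EC (a : ZMod ℓ)).Point} (h : PRed ℓ P Pb)
    {xb yb : ZMod ℓ} (hb : IsPt Pb xb yb) : ∃ x y, IsPt P x y ∧ Red ℓ x xb ∧ Red ℓ y yb := by
  rcases h with ⟨rfl, rfl⟩ | ⟨x, y, h1, h2, h3, rfl⟩ | ⟨x, y, xb, yb, h1, h2, h3, h4⟩
  · exact absurd rfl hb.ne_zero
  · exact absurd rfl hb.ne_zero
  · obtain ⟨rfl, rfl⟩ := hb.unique h2
    exact ⟨x, y, h1, h3, h4⟩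

theorem red_pole {x : ℚ} (h0 : x ≠ 0) (h : Red ℓ x⁻¹ 0) {b : ZMod ℓ} (h' : Red ℓ x b) : False := by
  have := h.mul h'
  rw [inv_mul_cancel₀ h0, zero_mul] at this
  exact one_ne_zero (Red.one.unique this)

/-- A point with integral coordinate is not a pole. -/
theorem PRed.of_red {P : (EC (a : ℚ)).Point} {Pb : (EC (a : ZMod ℓ)).Point} (h : PRed ℓ P Pb)
    {x y : ℚ} (hP : IsPt P x y) {xb : ZMod ℓ} (hx : Red ℓ x xb) :
    ∃ yb, IsPt Pb xb yb ∧ Red ℓ y yb := by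
  rcases h with ⟨rfl, rfl⟩ | ⟨x, y, h1, h2, h3, rfl⟩ | ⟨x, y, xb, yb, h1, h2, h3, h4⟩
  · exact absurd rfl hP.ne_zero
  · obtain ⟨rfl, rfl⟩ := hP.unique h1
    exact (red_pole h2 h3 hx).elim
  · obtain ⟨rfl, rfl⟩ := hP.unique h1
    obtain rfl := hx.unique h3
    exact ⟨_, h2, h4⟩

theorem PRed.add (h2a : ((2 * a : ℤ) : ZMod ℓ) ≠ 0) {P G : (EC (a : ℚ)).Point}
    {Pb Gb : (EC (a : ZMod ℓ)).Point} (h : PRed ℓ P Pb) (hG : PRed ℓ G Gb) (hGb : Gb ≠ 0) :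
    PRed ℓ (P + G) (Pb + Gb) := by
  have h2 : (2 : ZMod ℓ) ≠ 0 := by rintro h; apply h2a; push_cast; rw [h]; ring
  have ha : (a : ZMod ℓ) ≠ 0 := by rintro h; apply h2a; push_cast; rw [h]; ring
  have haQ : (a : ℚ) ≠ 0 := by
    have : a ≠ 0 := by rintro rfl; simp at ha
    exact_mod_cast this
  have ra : Red ℓ (a : ℚ) (a : ZMod ℓ) := Red.int a
  obtain ⟨gxb, gyb, hgb⟩ := (pt_cases Gb).resolve_left hGb
  obtain ⟨gx, gy, hg, rgx, rgy⟩ := hG.affine hgb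
  have eg := hg.eqn
  have egb := hgb.eqn
  rcases h with ⟨rfl, rfl⟩ | ⟨x, y, hp, hx0, hx, rfl⟩ | ⟨x, y, xb, yb, hp, hpb, rx, ry⟩
  · simpa using hG
  · -- pole
    have ep := hp.eqn
    have hne : x ≠ gx := by
      rintro rfl
      exact red_pole hx0 hx rgx
    have hu : Red ℓ (1 + a * (x⁻¹) ^ 2) 1 := by
      simpa using Red.one.add (ra.mul (hx.pow 2))
    have hm2 : Red ℓ ((y / x ^ 2) ^ 2) 0 := by
      have := hx.mul hu
      rw [zero_mul] at this
      convert this using 1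
      field_simp
      linear_combination ep
    obtain ⟨c, hm, hc⟩ := red_of_sq hm2
    obtain rfl : c = 0 := by simpa using hc
    set s := x⁻¹ with hs
    set m := y / x ^ 2 with hmd
    have hd : Red ℓ (1 - gx * s) 1 := by simpa using Red.one.sub (rgx.mul hx)
    have hd0 : 1 - gx * s ≠ 0 := hd.ne_zero one_ne_zero
    have hxg : x - gx ≠ 0 := sub_ne_zero.2 hne
    set A := -3 * gx ^ 2 + gx ^ 3 * s - a - a * gx * s with hA
    have rA : ∃ c, Red ℓ A c := ⟨_, (((((Red.ofNat 3).neg.mul (rgx.pow 2)).add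
      ((rgx.pow 3).mul hx)).sub ra).sub ((ra.mul rgx).mul hx))⟩
    obtain ⟨Ab, rA⟩ := rA
    set x3 := ((gx + a * s) * (1 + gx * s) - 2 * gy * m) / (1 - gx * s) ^ 2 with hx3
    set y3 := (m * A + 2 * gy * (1 + a * s ^ 2) - gy * s * (s * A + 2 * gy * m)) /
      (1 - gx * s) ^ 3 - gy with hy3
    have rx3 : Red ℓ x3 gxb := by
      have := (((rgx.add (ra.mul hx)).mul (Red.one.add (rgx.mul hx))).sub
        (((Red.ofNat 2).mul rgy).mul hm)).div (hd.pow 2) (by simp)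
      simpa using this
    have ry3 : Red ℓ y3 gyb := by
      have := ((((hm.mul rA).add (((Red.ofNat 2).mul rgy).mul hu)).sub
        ((rgy.mul hx).mul ((hx.mul rA).add (((Red.ofNat 2).mul rgy).mul hm)))).div
          (hd.pow 3) (by simp)).sub rgy
      have e : (0 * Ab + 2 * gyb * 1 - gyb * 0 * (0 * Ab + 2 * gyb * 0)) / 1 ^ 3 - gyb = gyb := by
        simp; ring
      rw [e] at this
      exact this
    have h3 : IsPt (P + G) x3 y3 := by
      have hsx : 1 - gx * s = (x - gx) / x := by rw [hs]; field_simp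
      refine hp.add_chord hg hne (l := (y - gy) / (x - gx)) (by field_simp) ?_ ?_
      · rw [hx3, hsx, hs, hmd]
        field_simp
        linear_combination -ep - eg
      · have e1 : (y - gy) / (x - gx) * (x - x3) - y = (y - gy) / (x - gx) * (gx - x3) - gy := by
          field_simp
          ring
        rw [e1, hy3, hx3, hsx, hA, hs, hmd]
        field_simp
        linear_combination (-2 * gy) * ep
    rw [zero_add]
    exact Or.inr (Or.inr ⟨_, _, _, _, h3, hgb, rx3, ry3⟩)
  · have ep := hp.eqn
    have epb := hpb.eqn
    by_cases hne : xb = gxb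
    · subst hne
      by_cases hyy : yb = -gyb
      · -- opposite
        have hsum : Pb + Gb = 0 := hpb.add_neg (by rw [hyy, neg_neg]; exact hgb)
        rw [hsum]
        by_cases hPG : P + G = 0
        · exact Or.inl ⟨hPG, rfl⟩
        have hl : ∃ l x3 y3, IsPt (P + G) x3 y3 ∧ x3 = l ^ 2 - x - gx ∧ l ≠ 0 ∧ Red ℓ l⁻¹ 0 := by
          have hnum : gyb = 0 → Red ℓ (x ^ 2 + x * gx + gx ^ 2 + a) (xb ^ 2 + xb * xb + xb ^ 2 + a) ∧
              xb ^ 2 + xb * xb + xb ^ 2 + a ≠ 0 := by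
            intro h0
            refine ⟨(((rx.pow 2).add (rx.mul rgx)).add (rgx.pow 2)).add ra, ?_⟩
            intro h3
            rw [h0] at egb
            have : xb * (xb ^ 2 + a) = 0 := by linear_combination -egb
            rcases mul_eq_zero.1 this with h | h
            · rw [h] at h3; apply ha; linear_combination h3
            · apply h2a; push_cast; linear_combination 3 * h - h3
          by_cases hxx : x = gx
          · subst hxx
            have : (y - gy) * (y + gy) = 0 := by linear_combination ep - eg
            have hyg : y = gy := by
              rcases mul_eq_zero.1 this with h | h
              · exact sub_eq_zero.1 h
              · exfalso
                apply hPG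
                refine hp.add_neg ?_
                rw [show -y = gy by linear_combination -h]
                exact hg
            subst hyg
            have hy0 : gyb = 0 := by
              have := ry.unique rgy
              have : 2 * gyb = 0 := by linear_combination hyy - this
              exact (mul_eq_zero.1 this).resolve_left h2
            have hPG' : P = G := hp.eq hg
            subst hPG'
            obtain ⟨n1, n2⟩ := hnum hy0
            have hy : y ≠ 0 := by
              rintro rfl
              apply hPG
              exact hp.add_neg (by simpa using hp)
            have hA0 := n1.ne_zero n2
            have hA0' : 3 * x ^ 2 + a ≠ 0 := by intro h; apply hA0; linear_combination h
            refine ⟨(3 * x ^ 2 + a) / (2 * y), _, _, hp.add_self two_ne_zero hy (by field_simp)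
              rfl rfl, rfl, by positivity, ?_⟩
            have := ((Red.ofNat 2).mul rgy).div n1 n2
            rw [hy0] at this
            rw [show x ^ 2 + x * x + x ^ 2 + a = 3 * x ^ 2 + a by ring] at this
            simpa using this
          · have hxg : x - gx ≠ 0 := sub_ne_zero.2 hxx
            have hid : (y - gy) * (y + gy) = (x - gx) * (x ^ 2 + x * gx + gx ^ 2 + a) := by
              linear_combination ep - eg
            refine ⟨(y - gy) / (x - gx), _, _, hp.add_chord hg hxx (by field_simp) rfl rfl, rfl, ?_⟩
            by_cases h0 : gyb = 0
            · obtain ⟨n1, n2⟩ := hnum h0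
              have hA0 := n1.ne_zero n2
              have hyy0 : (y - gy) * (y + gy) ≠ 0 := by rw [hid]; exact mul_ne_zero hxg hA0
              have hy1 := left_ne_zero_of_mul hyy0
              have hy2 := right_ne_zero_of_mul hyy0
              refine ⟨div_ne_zero hy1 hxg, ?_⟩
              have := (ry.add rgy).div n1 n2
              rw [hyy, h0] at this
              have e : ((y - gy) / (x - gx))⁻¹ = (y + gy) / (x ^ 2 + x * gx + gx ^ 2 + a) := by
                rw [inv_div, div_eq_div_iff hy1 hA0]
                linear_combination -hid
              rw [e]
              simpa using this
            · have hb : yb - gyb ≠ 0 := by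
                intro h
                apply h0
                have : 2 * gyb = 0 := by linear_combination -h + hyy
                exact (mul_eq_zero.1 this).resolve_left h2
              have r := ry.sub rgy
              refine ⟨div_ne_zero (r.ne_zero hb) hxg, ?_⟩
              rw [inv_div]
              simpa using (rx.sub rgx).div r hb
        obtain ⟨l, x3, y3, h3, e3, hl0, rl⟩ := hl
        have rd : Red ℓ (1 - (x + gx) * (l⁻¹) ^ 2) 1 := by
          simpa using Red.one.sub ((rx.add rgx).mul (rl.pow 2))
        have hd0 := rd.ne_zero one_ne_zero
        have e : x3 = l ^ 2 * (1 - (x + gx) * (l⁻¹) ^ 2) := by rw [e3]; field_simp; ring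
        refine Or.inr (Or.inl ⟨x3, y3, h3, ?_, ?_, rfl⟩)
        · rw [e]; positivity
        · have := (rl.pow 2).div rd one_ne_zero
          rw [e, mul_inv, ← div_eq_mul_inv, ← inv_pow]
          simpa using this
      · -- tangent
        have hyb : yb = gyb := by
          have : (yb - gyb) * (yb + gyb) = 0 := by linear_combination epb - egb
          rcases mul_eq_zero.1 this with h | h
          · exact sub_eq_zero.1 h
          · exact absurd (by linear_combination h) hyy
        subst hyb
        have hPGb : Pb = Gb := hpb.eq hgb
        subst hPGb
        have hb0 : yb + yb ≠ 0 := by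
          intro h; apply hyy; linear_combination h
        have hyb0 : yb ≠ 0 := by rintro rfl; simp at hb0
        have rl := ((((rx.pow 2).add (rx.mul rgx)).add (rgx.pow 2)).add ra).div (ry.add rgy) hb0
        have hs0 := (ry.add rgy).ne_zero hb0
        set l := (x ^ 2 + x * gx + gx ^ 2 + a) / (y + gy) with hl
        set lb := (xb ^ 2 + xb * xb + xb ^ 2 + a) / (yb + yb) with hlb
        have h3b := hpb.add_self h2 hyb0 (l := lb)
          (by rw [hlb, div_mul_eq_mul_div, div_eq_iff hb0]; ring) rfl rfl
        have h3 : IsPt (P + G) (l ^ 2 - x - gx) (l * (x - (l ^ 2 - x - gx)) - y) := by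
          by_cases hxx : x = gx
          · subst hxx
            have : (y - gy) * (y + gy) = 0 := by linear_combination ep - eg
            have hyg : y = gy := by
              rcases mul_eq_zero.1 this with h | h
              · exact sub_eq_zero.1 h
              · exact absurd h hs0
            subst hyg
            have hPG' : P = G := hp.eq hg
            subst hPG'
            have hy0 : y ≠ 0 := by rintro rfl; simp at hs0
            exact hp.add_self two_ne_zero hy0 (by rw [hl]; field_simp; ring) rfl rfl
          · refine hp.add_chord hg hxx ?_ rfl rfl
            rw [hl]
            field_simp
            linear_combination -ep + eg
        exact Or.inr (Or.inr ⟨_, _, _, _, h3, h3b, ((rl.pow 2).sub rx).sub rgx,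
          (rl.mul (rx.sub (((rl.pow 2).sub rx).sub rgx))).sub ry⟩)
    · -- chord
      have hb : xb - gxb ≠ 0 := sub_ne_zero.2 hne
      have hxx : x ≠ gx := by
        rintro rfl
        exact hne (rx.unique rgx)
      have rl := (ry.sub rgy).div (rx.sub rgx) hb
      have hq := (rx.sub rgx).ne_zero hb
      exact Or.inr (Or.inr ⟨_, _, _, _, hp.add_chord hg hxx (by field_simp) rfl rfl,
        hpb.add_chord hgb hne (by field_simp) rfl rfl, ((rl.pow 2).sub rx).sub rgx,
          (rl.mul (rx.sub (((rl.pow 2).sub rx).sub rgx))).sub ry⟩)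

end PRed

section Rel2
variable {ℓ : ℕ} [hℓ : Fact ℓ.Prime] {a : ℤ}

theorem PRed.zero : PRed ℓ (0 : (EC (a : ℚ)).Point) (0 : (EC (a : ZMod ℓ)).Point) :=
  Or.inl ⟨rfl, rfl⟩

theorem PRed.nsmul (h2a : ((2 * a : ℤ) : ZMod ℓ) ≠ 0) {G : (EC (a : ℚ)).Point}
    {Gb : (EC (a : ZMod ℓ)).Point} (hG : PRed ℓ G Gb) (hGb : Gb ≠ 0) (n : ℕ) :
    PRed ℓ (n • G) (n • Gb) := by
  induction n with
  | zero => simpa using PRed.zero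
  | succ n ih => rw [succ_nsmul, succ_nsmul]; exact ih.add h2a hG hGb

theorem PRed.zsmul (h2a : ((2 * a : ℤ) : ZMod ℓ) ≠ 0) {G : (EC (a : ℚ)).Point}
    {Gb : (EC (a : ZMod ℓ)).Point} (hG : PRed ℓ G Gb) (hGb : Gb ≠ 0) (n : ℤ) :
    PRed ℓ (n • G) (n • Gb) := by
  obtain ⟨k, rfl | rfl⟩ := n.eq_nat_or_neg
  · simpa using hG.nsmul h2a hGb k
  · simpa using (hG.nsmul h2a hGb k).neg

theorem PRed.mk' (h2a : ((2 * a : ℤ) : ZMod ℓ) ≠ 0) {P : (EC (a : ℚ)).Point} {x y : ℚ}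
    (hP : IsPt P x y) {xb yb : ZMod ℓ} (hx : Red ℓ x xb) (hy : Red ℓ y yb) :
    ∃ Pb, IsPt Pb xb yb ∧ PRed ℓ P Pb := by
  have h2 : (2 : ZMod ℓ) ≠ 0 := by rintro h; apply h2a; push_cast; rw [h]; ring
  have ha : (a : ZMod ℓ) ≠ 0 := by rintro h; apply h2a; push_cast; rw [h]; ring
  have e : yb ^ 2 = xb ^ 3 + a * xb := by
    have h1 := hy.pow 2
    rw [hP.eqn] at h1
    exact h1.unique ((hx.pow 3).add ((Red.int a).mul hx))
  obtain ⟨Pb, hb⟩ := isPt_mk ha h2 e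
  exact ⟨Pb, hb, Or.inr (Or.inr ⟨_, _, _, _, hP, hb, hx, hy⟩)⟩

/-- Points with the same `x`-coordinate. -/
theorem eq_or_neg_of_x {F : Type} [Field F] {a : F} {P Q : (EC a).Point} {x y y' : F}
    (hP : IsPt P x y) (hQ : IsPt Q x y') : P = Q ∨ P = -Q := by
  have h1 := hP.eqn
  have h2 := hQ.eqn
  have : (y - y') * (y + y') = 0 := by linear_combination h1 - h2
  rcases mul_eq_zero.1 this with h | h
  · left; obtain rfl := sub_eq_zero.1 h; exact hP.eq hQ
  · right; obtain rfl : y = -y' := by linear_combination h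
    exact hP.eq hQ.neg

end Rel2

theorem five_nr3 {x y : ℤ} (h : (5 : ℤ) ∣ x ^ 2 - 3 * y ^ 4) : (5 : ℤ) ∣ y := by
  have h' := (ZMod.intCast_zmod_eq_zero_iff_dvd _ 5).2 h
  push_cast at h'
  apply (ZMod.intCast_zmod_eq_zero_iff_dvd y 5).1
  have key : ∀ a b : ZMod 5, a ^ 2 - 3 * b ^ 4 = 0 → b = 0 := by decide
  exact key _ _ h'

theorem five_nr2 {x y : ℤ} (h : (5 : ℤ) ∣ x ^ 2 - 2 * y ^ 4) : (5 : ℤ) ∣ y := by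
  have h' := (ZMod.intCast_zmod_eq_zero_iff_dvd _ 5).2 h
  push_cast at h'
  apply (ZMod.intCast_zmod_eq_zero_iff_dvd y 5).1
  have key : ∀ a b : ZMod 5, a ^ 2 - 2 * b ^ 4 = 0 → b = 0 := by decide
  exact key _ _ h'

theorem int_prime_two : Prime (2 : ℤ) := Int.prime_two
theorem int_prime_five : Prime (5 : ℤ) := by exact_mod_cast natPrime_int (p := 5) (by norm_num)

theorem cop_contra {p a b : ℤ} (hp : Prime p) (h : IsCoprime a b) (ha : p ∣ a) (hb : p ∣ b) :
    False := hp.not_isUnit (h.isUnit_of_dvd' ha hb)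

theorem cop_dvd {p s t : ℤ} {i : ℕ} (hp : Prime p) (h : IsCoprime s t) (hd : p ^ i ∣ s * t) :
    p ^ i ∣ s ∨ p ^ i ∣ t := by
  by_cases hs : p ∣ s
  · left
    have h1 : ¬ p ∣ t := fun ht => cop_contra hp h hs ht
    have h2 : IsCoprime (p ^ i) t := ((Prime.coprime_iff_not_dvd hp).2 h1).pow_left
    exact h2.dvd_of_dvd_mul_right hd
  · right
    have h2 : IsCoprime (p ^ i) s := ((Prime.coprime_iff_not_dvd hp).2 hs).pow_left
    exact h2.dvd_of_dvd_mul_left hd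

theorem odd_of_cop {g h : ℤ} (hc : IsCoprime g h) (hh : (2 : ℤ) ∣ h) : ¬ (2 : ℤ) ∣ g :=
  fun hg => cop_contra int_prime_two hc hg hh

/-- basic facts on `w^2 = u^4 + 8 m^2 d^4`. -/
theorem desc_basic {m u d w : ℤ} (hm : m = 1 ∨ m = 5) (hc : IsCoprime u d)
    (h : w ^ 2 = u ^ 4 + 8 * m ^ 2 * d ^ 4) :
    ¬ (2 : ℤ) ∣ u ∧ IsCoprime u w ∧ (m = 5 → ¬ (5 : ℤ) ∣ u) := by
  have hu : ¬ (2 : ℤ) ∣ u := by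
    rintro ⟨a, rfl⟩
    have h1 : (2 : ℤ) ∣ w := int_prime_two.dvd_of_dvd_pow (n := 2)
      ⟨8 * a ^ 4 + 4 * m ^ 2 * d ^ 4, by rw [h]; ring⟩
    obtain ⟨b, rfl⟩ := h1
    have h2 : b ^ 2 = 2 * (2 * a ^ 4 + m ^ 2 * d ^ 4) := by
      have : (4 : ℤ) * b ^ 2 = 4 * (2 * (2 * a ^ 4 + m ^ 2 * d ^ 4)) := by linear_combination h
      linarith
    obtain ⟨b', rfl⟩ := int_prime_two.dvd_of_dvd_pow (n := 2) ⟨_, h2⟩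
    have h3 : m ^ 2 * d ^ 4 = 2 * (b' ^ 2 - a ^ 4) := by linarith
    have h4 : (2 : ℤ) ∣ d ^ 4 := by
      rcases hm with rfl | rfl
      · exact ⟨b' ^ 2 - a ^ 4, by linarith⟩
      · exact ⟨b' ^ 2 - a ^ 4 - 12 * d ^ 4, by linarith⟩
    exact cop_contra int_prime_two hc ⟨a, rfl⟩ (int_prime_two.dvd_of_dvd_pow h4)
  have h5 : m = 5 → ¬ (5 : ℤ) ∣ u := by
    rintro rfl ⟨a, rfl⟩
    obtain ⟨b, rfl⟩ := int_prime_five.dvd_of_dvd_pow (n := 2)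
      (show (5 : ℤ) ∣ w ^ 2 from ⟨125 * a ^ 4 + 40 * d ^ 4, by rw [h]; ring⟩)
    have : (5 : ℤ) ∣ b ^ 2 - 3 * d ^ 4 := ⟨5 * a ^ 4 + d ^ 4, by linarith⟩
    exact cop_contra int_prime_five hc ⟨a, rfl⟩ (five_nr3 this)
  refine ⟨hu, int_coprime_of_primes ?_ (Or.inl (by rintro rfl; simp at hu)), h5⟩
  intro p hp h1 h2
  have h3 : p ∣ 8 * m ^ 2 * d ^ 4 := by
    have : 8 * m ^ 2 * d ^ 4 = w ^ 2 - u ^ 4 := by linarith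
    rw [this]
    exact dvd_sub (dvd_pow h2 two_ne_zero) (dvd_pow h1 four_ne_zero)
  rcases hp.dvd_or_dvd h3 with h3 | h3
  · rcases hp.dvd_or_dvd h3 with h3 | h3
    · have : p ∣ 2 := hp.dvd_of_dvd_pow (n := 3) (by norm_num; exact h3)
      have h2 := (int_prime_two.dvd_prime_iff_associated hp).2
        ((Prime.dvd_prime_iff_associated hp int_prime_two).1 this).symm
      exact hu (h2.trans h1)
    · have := hp.dvd_of_dvd_pow h3
      rcases hm with rfl | rfl
      · exact hp.not_isUnit (isUnit_of_dvd_one this)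
      · have h2 := (int_prime_five.dvd_prime_iff_associated hp).2
          ((Prime.dvd_prime_iff_associated hp int_prime_five).1 this).symm
        exact h5 rfl (h2.trans h1)
  · exact cop_contra hp hc h1 (hp.dvd_of_dvd_pow h3)

/-- Splitting of `s t = 2 m^2 d^4`. -/
theorem split2m {m s t d : ℤ} (a : ℕ) (hm : m = 1 ∨ m = 5) (hs : 0 < s) (ht : 0 < t) (hd : 0 < d)
    (hc : IsCoprime s t) (h : s * t = 2 ^ a * m ^ 2 * d ^ 4) :
    ∃ e f, 0 < e ∧ 0 < f ∧ d = e * f ∧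
      ((s = 2 ^ a * m ^ 2 * e ^ 4 ∧ t = f ^ 4) ∨ (s = e ^ 4 ∧ t = 2 ^ a * m ^ 2 * f ^ 4) ∨
      (m = 5 ∧ s = 2 ^ a * e ^ 4 ∧ t = m ^ 2 * f ^ 4) ∨
      (m = 5 ∧ s = m ^ 2 * e ^ 4 ∧ t = 2 ^ a * f ^ 4)) := by
  have key : ∀ (A B s' t' : ℤ), 0 < A → 0 < B → s = A * s' → t = B * t' →
      A * B = 2 ^ a * m ^ 2 → ∃ e f, 0 < e ∧ 0 < f ∧ d = e * f ∧ s = A * e ^ 4 ∧ t = B * f ^ 4 := by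
    intro A B s' t' hA hB h1 h2 h3
    have hs' : 0 < s' := by rw [h1] at hs; exact (mul_pos_iff_of_pos_left hA).1 hs
    have ht' : 0 < t' := by rw [h2] at ht; exact (mul_pos_iff_of_pos_left hB).1 ht
    have h4 : s' * t' = d ^ 4 := by
      have : (A * B) * (s' * t') = (A * B) * d ^ 4 := by
        rw [h3, ← h, h1, h2, ← h3]; ring
      exact mul_left_cancel₀ (mul_pos hA hB).ne' this
    have hc' : IsCoprime s' t' := by
      rw [h1, h2] at hc
      exact hc.of_mul_left_right.of_mul_right_right
    obtain ⟨e, f, he, hf, h5, h6, h7⟩ := int_pow_split four_ne_zero hs' ht' hd hc' h4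
    exact ⟨e, f, he, hf, h7, by rw [h1, h5], by rw [h2, h6]⟩
  have h2 : (2 : ℤ) ^ a ∣ s ∨ (2 : ℤ) ^ a ∣ t :=
    cop_dvd int_prime_two hc ⟨m ^ 2 * d ^ 4, by rw [h]; ring⟩
  have hp : (0 : ℤ) < 2 ^ a := by positivity
  rcases hm with rfl | rfl
  · rcases h2 with ⟨s', h2⟩ | ⟨t', h2⟩
    · obtain ⟨e, f, he, hf, h5, h6, h7⟩ := key (2 ^ a) 1 s' t hp one_pos h2 (by ring) (by ring)
      exact ⟨e, f, he, hf, h5, Or.inl ⟨by rw [h6]; ring, by rw [h7]; ring⟩⟩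
    · obtain ⟨e, f, he, hf, h5, h6, h7⟩ := key 1 (2 ^ a) s t' one_pos hp (by ring) h2 (by ring)
      exact ⟨e, f, he, hf, h5, Or.inr (Or.inl ⟨by rw [h6]; ring, by rw [h7]; ring⟩)⟩
  · have h5 : (5 : ℤ) ^ 2 ∣ s ∨ (5 : ℤ) ^ 2 ∣ t :=
      cop_dvd int_prime_five hc ⟨2 ^ a * d ^ 4, by rw [h]; ring⟩
    have h25 : IsCoprime ((2 : ℤ) ^ a) (5 ^ 2) := by
      apply IsCoprime.pow
      exact ⟨-2, 1, by norm_num⟩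
    rcases h2 with h2 | h2 <;> rcases h5 with h5 | h5
    · obtain ⟨s', h6⟩ := h25.mul_dvd h2 h5
      obtain ⟨e, f, he, hf, h5, h6, h7⟩ := key (2 ^ a * 5 ^ 2) 1 s' t (by positivity) one_pos h6
        (by ring) (by ring)
      exact ⟨e, f, he, hf, h5, Or.inl ⟨by rw [h6], by rw [h7]; ring⟩⟩
    · obtain ⟨s', h2⟩ := h2
      obtain ⟨t', h5⟩ := h5
      obtain ⟨e, f, he, hf, h5, h6, h7⟩ := key (2 ^ a) (5 ^ 2) s' t' hp (by norm_num) h2 h5 (by ring)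
      exact ⟨e, f, he, hf, h5, Or.inr (Or.inr (Or.inl ⟨rfl, h6, h7⟩))⟩
    · obtain ⟨s', h2⟩ := h2
      obtain ⟨t', h5⟩ := h5
      obtain ⟨e, f, he, hf, h5, h6, h7⟩ := key (5 ^ 2) (2 ^ a) t' s' (by norm_num) hp h5 h2 (by ring)
      exact ⟨e, f, he, hf, h5, Or.inr (Or.inr (Or.inr ⟨rfl, h6, h7⟩))⟩
    · obtain ⟨s', h6⟩ := h25.mul_dvd h2 h5
      obtain ⟨e, f, he, hf, h5, h6, h7⟩ := key 1 (2 ^ a * 5 ^ 2) s s' one_pos (by positivity)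
        (by ring) h6 (by ring)
      exact ⟨e, f, he, hf, h5, Or.inr (Or.inl ⟨by rw [h6]; ring, by rw [h7]⟩)⟩

/-- Descent step for `w^2 = u^4 + 8 m^2 d^4`. -/
theorem desc_step {m u d w : ℤ} (hm : m = 1 ∨ m = 5) (hd : 0 < d) (hc : IsCoprime u d)
    (h : w ^ 2 = u ^ 4 + 8 * m ^ 2 * d ^ 4) :
    (∃ g h f : ℤ, 0 < g ∧ 0 < f ∧ 0 < h ∧ f ^ 2 = h ^ 4 + 8 * m ^ 2 * g ^ 4 ∧
      u ^ 2 = (h ^ 4 - 8 * m ^ 2 * g ^ 4) ^ 2 ∧ d = 2 * g * h * f) ∨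
    (∃ g h e f : ℤ, IsCoprime g h ∧ 2 ∣ h ∧ 0 < e ∧ 0 < f ∧ e ^ 2 = g ^ 2 + 2 * g * h - h ^ 2 ∧
      m * f ^ 2 = g ^ 2 + h ^ 2 ∧ u ^ 2 = (g ^ 2 - h ^ 2 - 2 * g * h) ^ 2 ∧ d = e * f) := by
  wlog hw : 0 ≤ w generalizing w
  · exact this (w := -w) (by rw [← h]; ring) (by linarith)
  obtain ⟨hu, huw, hu5⟩ := desc_basic hm hc h
  have hm0 : 0 < m := by rcases hm with rfl | rfl <;> norm_num
  have hd4 : 0 < 8 * m ^ 2 * d ^ 4 := by positivity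
  have hu0 : u ≠ 0 := by rintro rfl; simp at hu
  have hu2 : 0 < u ^ 2 := by positivity
  have hlt : u ^ 2 < w := by
    by_contra hcon
    push Not at hcon
    nlinarith
  have hou : u % 2 = 1 := by omega
  have how : w % 2 = 1 := by
    by_contra hcon
    obtain ⟨b, rfl⟩ : (2 : ℤ) ∣ w := by omega
    apply hu
    apply int_prime_two.dvd_of_dvd_pow (n := 4)
    exact ⟨2 * b ^ 2 - 4 * m ^ 2 * d ^ 4, by linarith⟩
  have hou2 : u ^ 2 % 2 = 1 := by rw [pow_two, Int.mul_emod, hou]; norm_num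
  obtain ⟨s, hs⟩ : (2 : ℤ) ∣ w - u ^ 2 := by omega
  have ht : w + u ^ 2 = 2 * (s + u ^ 2) := by linarith
  set t := s + u ^ 2 with htd
  have hst : s * t = 2 ^ 1 * m ^ 2 * d ^ 4 := by
    have : 4 * (s * t) = 4 * (2 ^ 1 * m ^ 2 * d ^ 4) := by
      rw [show 4 * (s * t) = (2 * s) * (2 * t) by ring, ← hs, ← ht]
      linear_combination h
    linarith
  have hs0 : 0 < s := by linarith
  have ht0 : 0 < t := by linarith
  have hcst : IsCoprime s t := by
    refine int_coprime_of_primes ?_ (Or.inl hs0.ne')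
    intro p hp h1 h2
    refine cop_contra hp huw (hp.dvd_of_dvd_pow (n := 2) ?_) ?_
    · have : u ^ 2 = t - s := by rw [htd]; ring
      rw [this]; exact dvd_sub h2 h1
    · have : w = t + s := by linarith
      rw [this]; exact dvd_add h2 h1
  have hkey : u ^ 2 = t - s := by rw [htd]; ring
  obtain ⟨e, f, he, hf, hdef, hcase⟩ := split2m 1 hm hs0 ht0 hd hcst hst
  rcases hcase with ⟨hse, htf⟩ | ⟨hse, htf⟩ | ⟨rfl, hse, htf⟩ | ⟨rfl, hse, htf⟩
  · left
    have e1 : u ^ 2 = f ^ 4 - 2 * m ^ 2 * e ^ 4 := by rw [hkey, hse, htf]; ring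
    have hfodd : f % 2 = 1 := by
      by_contra hcon
      obtain ⟨b, rfl⟩ : (2 : ℤ) ∣ f := by omega
      apply hu
      apply int_prime_two.dvd_of_dvd_pow (n := 2)
      exact ⟨8 * b ^ 4 - m ^ 2 * e ^ 4, by rw [e1]; ring⟩
    have heven : (2 : ℤ) ∣ e := by
      by_contra hcon
      have h8 : ∀ x : ℤ, x % 2 = 1 → x ^ 2 % 8 = 1 := by
        intro x hx
        obtain ⟨y, rfl⟩ : ∃ y, x = 2 * y + 1 := ⟨x / 2, by omega⟩
        have : (2 : ℤ) ∣ y * (y + 1) := by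
          rcases Int.even_or_odd' y with ⟨z, rfl | rfl⟩
          · exact ⟨z * (2 * z + 1), by ring⟩
          · exact ⟨(2 * z + 1) * (z + 1), by ring⟩
        obtain ⟨z, hz⟩ := this
        have : (2 * y + 1) ^ 2 = 8 * z + 1 := by linear_combination 4 * hz
        omega
      have h1 := h8 u hou
      have h2 := h8 (f ^ 2) (by have := h8 f hfodd; omega)
      have h3 := h8 (e ^ 2) (by have := h8 e (by omega); omega)
      have : u ^ 2 = (f ^ 2) ^ 2 - 2 * m ^ 2 * (e ^ 2) ^ 2 := by rw [e1]; ring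
      rcases hm with rfl | rfl <;> omega
    obtain ⟨e', rfl⟩ := heven
    have hfu : u ^ 2 < (f ^ 2) ^ 2 := by
      have : 0 < 2 * m ^ 2 * (2 * e') ^ 4 := by positivity
      nlinarith
    have habs := abs_lt_of_sq_lt_sq hfu (by positivity)
    have hfo2 : f ^ 2 % 2 = 1 := by rw [pow_two, Int.mul_emod, hfodd]; norm_num
    obtain ⟨s1, hs1⟩ : (2 : ℤ) ∣ f ^ 2 - u := by omega
    have ht1 : f ^ 2 + u = 2 * (s1 + u) := by linarith
    have hst1 : s1 * (s1 + u) = 2 ^ 3 * m ^ 2 * e' ^ 4 := by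
      have : 4 * (s1 * (s1 + u)) = 4 * (2 ^ 3 * m ^ 2 * e' ^ 4) := by
        rw [show 4 * (s1 * (s1 + u)) = (2 * s1) * (2 * (s1 + u)) by ring, ← hs1, ← ht1]
        linear_combination -e1
      linarith
    rw [abs_lt] at habs
    have hs10 : 0 < s1 := by linarith [habs.2]
    have ht10 : 0 < s1 + u := by linarith [habs.1]
    have hcfu : IsCoprime u f := by
      refine int_coprime_of_primes ?_ (Or.inr hf.ne')
      intro p hp h1 h2
      exact cop_contra hp hc h1 (by rw [hdef]; exact h2.mul_left _)
    have hc1 : IsCoprime s1 (s1 + u) := by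
      refine int_coprime_of_primes ?_ (Or.inl hs10.ne')
      intro p hp h1 h2
      have h3 : p ∣ u := by simpa using dvd_sub h2 h1
      refine cop_contra hp hcfu h3 (hp.dvd_of_dvd_pow (n := 2) ?_)
      have : f ^ 2 = s1 + (s1 + u) := by linarith
      rw [this]; exact dvd_add h1 h2
    obtain ⟨x, y, hx, hy, hxy, hcs⟩ := split2m 3 hm hs10 ht10 (by linarith) hc1 hst1
    rcases hcs with ⟨h1, h2⟩ | ⟨h1, h2⟩ | ⟨rfl, h1, h2⟩ | ⟨rfl, h1, h2⟩
    · refine ⟨x, y, f, hx, hf, hy, ?_, ?_, ?_⟩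
      · linear_combination hs1 + h1 + h2
      · have : u = y ^ 4 - 8 * m ^ 2 * x ^ 4 := by linear_combination h2 - h1
        rw [this]
      · rw [hdef, hxy]; ring
    · refine ⟨y, x, f, hy, hf, hx, ?_, ?_, ?_⟩
      · linear_combination hs1 + h1 + h2
      · have : u = -(x ^ 4 - 8 * m ^ 2 * y ^ 4) := by linear_combination h2 - h1
        rw [this]; ring
      · rw [hdef, hxy]; ring
    · exfalso
      have h5 : (5 : ℤ) ∣ x := five_nr3 (x := f) ⟨5 * y ^ 4 + x ^ 4, by linear_combination hs1 + h1 + h2⟩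
      refine cop_contra int_prime_five hc1 ?_ ⟨5 * y ^ 4, by rw [h2]; ring⟩
      rw [h1]; exact (dvd_pow h5 four_ne_zero).mul_left _
    · exfalso
      have h5 : (5 : ℤ) ∣ y := five_nr3 (x := f) ⟨5 * x ^ 4 + y ^ 4, by linear_combination hs1 + h1 + h2⟩
      refine cop_contra int_prime_five hc1 ⟨5 * x ^ 4, by rw [h1]; ring⟩ ?_
      rw [h2]; exact (dvd_pow h5 four_ne_zero).mul_left _
  · right
    have e1 : u ^ 2 + e ^ 4 = 2 * (m * f ^ 2) ^ 2 := by rw [hkey, hse, htf]; ring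
    have heo : e % 2 = 1 := by
      by_contra hcon
      obtain ⟨b, rfl⟩ : (2 : ℤ) ∣ e := by omega
      apply hu
      apply int_prime_two.dvd_of_dvd_pow (n := 2)
      exact ⟨m ^ 2 * f ^ 4 - 8 * b ^ 4, by linarith⟩
    have heo2 : e ^ 2 % 2 = 1 := by rw [pow_two, Int.mul_emod, heo]; norm_num
    have hcue : IsCoprime u e := by
      rw [hdef] at hc; exact hc.of_mul_right_left
    -- choose the sign
    obtain ⟨v, A, B, hv, hA, hB⟩ : ∃ v A B : ℤ, (v = u ∨ v = -u) ∧ e ^ 2 + v = 2 * (2 * A + 1) ∧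
        e ^ 2 - v = 4 * B := by
      obtain ⟨A, hA⟩ : (2 : ℤ) ∣ e ^ 2 + u := by omega
      obtain ⟨B, hB⟩ : (2 : ℤ) ∣ e ^ 2 - u := by omega
      have hpar : (A + B) % 2 = 1 := by omega
      by_cases hA2 : A % 2 = 1
      · exact ⟨u, A / 2, B / 2, Or.inl rfl, by omega, by omega⟩
      · exact ⟨-u, B / 2, A / 2, Or.inr rfl, by omega, by omega⟩
    have hv2 : v ^ 2 = u ^ 2 := by rcases hv with rfl | rfl <;> ring
    have hpy : PythagoreanTriple (2 * A + 1) (2 * B) (m * f ^ 2) := by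
      unfold PythagoreanTriple
      have h4 : 4 * ((2 * A + 1) * (2 * A + 1) + 2 * B * (2 * B)) = 4 * (m * f ^ 2 * (m * f ^ 2)) := by
        have : 4 * ((2 * A + 1) * (2 * A + 1) + 2 * B * (2 * B)) =
          (2 * (2 * A + 1)) ^ 2 + (4 * B) ^ 2 := by ring
        rw [this, ← hA, ← hB]
        linear_combination 2 * hv2 + 2 * e1
      linarith
    have hcv : IsCoprime v e := by
      rcases hv with rfl | rfl
      · exact hcue
      · exact hcue.neg_left
    have hgcd : Int.gcd (2 * A + 1) (2 * B) = 1 := by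
      rw [← Int.isCoprime_iff_gcd_eq_one]
      refine int_coprime_of_primes ?_ (Or.inl (by omega))
      intro p hp h1 h2
      refine cop_contra hp hcv ?_ (hp.dvd_of_dvd_pow (n := 2) ?_)
      · have : v = (2 * A + 1) - 2 * B := by linarith
        rw [this]; exact dvd_sub h1 h2
      · have : e ^ 2 = (2 * A + 1) + 2 * B := by linarith
        rw [this]; exact dvd_add h1 h2
    obtain ⟨g, k, hx, hy, hz, hgk, hpar, -⟩ := hpy.coprime_classification' hgcd (by omega)
      (by positivity)
    have he2 : e ^ 2 = g ^ 2 + 2 * g * k - k ^ 2 := by linarith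
    have hk : (2 : ℤ) ∣ k := by
      rcases hpar with ⟨hg, hk⟩ | ⟨hg, hk⟩
      · exfalso
        obtain ⟨a, rfl⟩ : (2 : ℤ) ∣ g := by omega
        obtain ⟨b, rfl⟩ : ∃ b, k = 2 * b + 1 := ⟨k / 2, by omega⟩
        obtain ⟨c, rfl⟩ : ∃ c, e = 2 * c + 1 := ⟨e / 2, by omega⟩
        have : 4 * (c ^ 2 + c) + 1 = 4 * (a ^ 2 + a * (2 * b + 1) - b ^ 2 - b) - 1 := by
          linear_combination he2
        omega
      · omega
    refine ⟨g, k, e, f, Int.isCoprime_iff_gcd_eq_one.2 hgk, hk, he, hf, he2, hz, ?_, hdef⟩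
    rw [← hv2]
    have : v = g ^ 2 - k ^ 2 - 2 * g * k := by linarith
    rw [this]
  · exfalso
    have : (5 : ℤ) ∣ e := five_nr3 (x := u) ⟨5 * f ^ 4 - e ^ 4, by rw [hkey, hse, htf]; ring⟩
    apply hu5 rfl
    apply int_prime_five.dvd_of_dvd_pow (n := 2)
    rw [hkey, hse, htf]
    exact dvd_sub ⟨5 * f ^ 4, by ring⟩ ((dvd_pow this four_ne_zero).mul_left _)
  · exfalso
    have : (5 : ℤ) ∣ f := five_nr2 (x := u) ⟨-5 * e ^ 4, by rw [hkey, hse, htf]; ring⟩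
    apply hu5 rfl
    apply int_prime_five.dvd_of_dvd_pow (n := 2)
    rw [hkey, hse, htf]
    exact dvd_sub ((dvd_pow this four_ne_zero).mul_left _) ⟨5 * e ^ 4, by ring⟩

section MW
variable {a : ℤ}

/-- duplication of a point with square `x`-coordinate. -/
theorem dup_sq {m : ℤ} (ha : a = 8 * m ^ 2) {P : (EC (a : ℚ)).Point} {h g f : ℚ} (hg : g ≠ 0)
    (hh : h ≠ 0) (hf : f ≠ 0) (hP : IsPt P (h ^ 2 / g ^ 2) (h * f / g ^ 3))
    (hfe : f ^ 2 = h ^ 4 + 8 * m ^ 2 * g ^ 4) :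
    IsPt (P + P) ((h ^ 4 - 8 * m ^ 2 * g ^ 4) ^ 2 / (2 * g * h * f) ^ 2)
      ((h ^ 4 - 8 * m ^ 2 * g ^ 4) * (f ^ 4 + 32 * m ^ 2 * h ^ 4 * g ^ 4) / (2 * g * h * f) ^ 3) := by
  have e : f ^ 2 - 8 * m ^ 2 * g ^ 4 = h ^ 4 := by rw [hfe]; ring
  have e' : (8 : ℚ) * m ^ 2 * g ^ 4 = f ^ 2 - h ^ 4 := by rw [hfe]; ring
  refine hP.add_self two_ne_zero (by positivity) (l := (3 * h ^ 4 + 8 * m ^ 2 * g ^ 4) /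
    (2 * g * h * f)) ?_ ?_ ?_
  · rw [ha]; push_cast; field_simp
  · rw [e']
    field_simp
    ring
  · rw [show (32 : ℚ) * m ^ 2 * h ^ 4 * g ^ 4 = 4 * h ^ 4 * (8 * m ^ 2 * g ^ 4) by ring, e']
    field_simp
    ring

/-- The induction hypothesis. -/
def MWhyp (a : ℤ) (G : (EC (a : ℚ)).Point) (N : ℕ) : Prop :=
  ∀ u d : ℤ, 0 < d → d < N → u ≠ 0 → ∀ (P : (EC (a : ℚ)).Point) (y : ℚ),
    IsPt P ((u : ℚ) ^ 2 / (d : ℚ) ^ 2) y → ∃ n : ℤ, P = n • G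

theorem MW_gen {m : ℤ} (hm : m = 1 ∨ m = 5) (ha : a = 8 * m ^ 2) (G : (EC (a : ℚ)).Point)
    (hii : ∀ N : ℕ, MWhyp a G N → ∀ g h e f : ℤ, IsCoprime g h → 2 ∣ h → 0 < e → 0 < f →
      e ^ 2 = g ^ 2 + 2 * g * h - h ^ 2 → m * f ^ 2 = g ^ 2 + h ^ 2 → e * f ≤ N →
      ∀ (P : (EC (a : ℚ)).Point) (y : ℚ),
        IsPt P (((g : ℚ) ^ 2 - h ^ 2 - 2 * g * h) ^ 2 / (e * f : ℚ) ^ 2) y → ∃ n : ℤ, P = n • G)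
    (N : ℕ) : MWhyp a G N := by
  have hm0 : 0 < m := by rcases hm with rfl | rfl <;> norm_num
  have hmQ : (0 : ℚ) < m := by exact_mod_cast hm0
  induction N with
  | zero => intro u d h1 h2; simp at h2; omega
  | succ N ih =>
    intro u d hd hdN hu P y hP
    -- make coprime
    wlog hc : IsCoprime u d generalizing u d
    · obtain ⟨c, u', d', hc0, hcop, hu', hd'⟩ : ∃ c u' d' : ℤ, 0 < c ∧ IsCoprime u' d' ∧
          u = c * u' ∧ d = c * d' := by
        have hg : 0 < Int.gcd u d := Int.gcd_pos_of_ne_zero_left _ hu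
        refine ⟨Int.gcd u d, u / Int.gcd u d, d / Int.gcd u d, by exact_mod_cast hg, ?_, ?_, ?_⟩
        · rw [Int.isCoprime_iff_gcd_eq_one]; exact Int.gcd_ediv_gcd_ediv_gcd hg
        · rw [Int.mul_ediv_cancel' (Int.gcd_dvd_left _ _)]
        · rw [Int.mul_ediv_cancel' (Int.gcd_dvd_right _ _)]
      have hd0 : 0 < d' := by rw [hd'] at hd; exact (mul_pos_iff_of_pos_left hc0).1 hd
      refine this u' d' hd0 ?_ ?_ ?_ hcop
      · have : d' ≤ d := by rw [hd']; nlinarith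
        exact this.trans_lt hdN
      · rintro rfl; simp at hu'; exact hu hu'
      · convert hP using 1
        rw [hu', hd']
        have : (c : ℚ) ≠ 0 := by exact_mod_cast hc0.ne'
        have : (d' : ℚ) ≠ 0 := by exact_mod_cast hd0.ne'
        push_cast
        field_simp
    have huQ : (u : ℚ) ≠ 0 := by exact_mod_cast hu
    have hdQ : (d : ℚ) ≠ 0 := by exact_mod_cast hd.ne'
    have heq := hP.eqn
    obtain ⟨w, hw⟩ : ∃ w : ℤ, w ^ 2 = u ^ 4 + 8 * m ^ 2 * d ^ 4 := by
      have : IsSquare (((u ^ 4 + 8 * m ^ 2 * d ^ 4 : ℤ)) : ℚ) := by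
        refine ⟨y * d ^ 3 / u, ?_⟩
        rw [ha] at heq
        push_cast at heq ⊢
        field_simp at heq ⊢
        linear_combination -heq
      obtain ⟨w, hw⟩ := Rat.isSquare_intCast_iff.1 this
      exact ⟨w, by rw [hw]; ring⟩
    rcases desc_step hm hd hc hw with ⟨g, h, f, hg, hf, hh, h1, h2, h3⟩ |
        ⟨g, h, e, f, h1, h2, h3, h4, h5, h6, h7, h8⟩
    · have hgQ : (g : ℚ) ≠ 0 := by exact_mod_cast hg.ne'
      have hhQ : (h : ℚ) ≠ 0 := by exact_mod_cast hh.ne'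
      have hfQ : (f : ℚ) ≠ 0 := by exact_mod_cast hf.ne'
      have h1Q : (f : ℚ) ^ 2 = h ^ 4 + 8 * m ^ 2 * g ^ 4 := by exact_mod_cast h1
      have h2Q : (u : ℚ) ^ 2 = (h ^ 4 - 8 * m ^ 2 * g ^ 4) ^ 2 := by exact_mod_cast h2
      have h3Q : (d : ℚ) = 2 * g * h * f := by exact_mod_cast h3
      have haQ : (a : ℚ) = 8 * m ^ 2 := by rw [ha]; push_cast; ring
      obtain ⟨Q, hQ⟩ := isPt_mk (a := (a : ℚ)) (by rw [haQ]; positivity) two_ne_zero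
        (x := (h : ℚ) ^ 2 / g ^ 2) (y := (h : ℚ) * f / g ^ 3) (by
          rw [haQ]; field_simp; linear_combination h1Q)
      have hgN : g < N := by
        have : 0 < g * (h * f - 1) + g * h * f := by
          have : 1 ≤ h * f := by nlinarith
          have : 0 ≤ g * (h * f - 1) := mul_nonneg hg.le (by linarith)
          positivity
        have : g < d := by rw [h3]; linarith
        push_cast at hdN
        omega
      obtain ⟨n, hn⟩ := ih h g hg hgN hh.ne' Q _ hQ
      have hdup := dup_sq ha hgQ hhQ hfQ hQ h1Q
      rw [← h2Q, ← h3Q] at hdup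
      rcases eq_or_neg_of_x hP hdup with h | h
      · exact ⟨n + n, by rw [h, hn, add_zsmul]⟩
      · exact ⟨-(n + n), by rw [h, hn, neg_zsmul, add_zsmul]⟩
    · refine hii N ih g h e f h1 h2 h3 h4 h5 h6 (by push_cast at hdN; rw [← h8]; omega) P y ?_
      have h7Q : (u : ℚ) ^ 2 = ((g : ℚ) ^ 2 - h ^ 2 - 2 * g * h) ^ 2 := by exact_mod_cast h7
      have h8Q : (d : ℚ) = e * f := by exact_mod_cast h8
      rw [← h7Q, ← h8Q]
      exact hP

/-! ### The curve `y^2 = x^3 + 8x` -/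

theorem pt1_eqn {g h v : ℚ} (hh : h ≠ 0)
    (hv : v ^ 2 = (g ^ 2 + 2 * g * h - h ^ 2) * (g ^ 2 + h ^ 2)) :
    ((4 * g ^ 3 + 6 * g ^ 2 * h + 2 * h ^ 3 + v * (4 * g + 2 * h)) / h ^ 3) ^ 2 =
      (2 * (v + g ^ 2 + g * h) / h ^ 2) ^ 3 + ((8 : ℤ) : ℚ) * (2 * (v + g ^ 2 + g * h) / h ^ 2) := by
  push_cast
  field_simp
  linear_combination ((4 * g + 2 * h) ^ 2 / 4 - 6 * (g ^ 2 + g * h) - 2 * v) * 4 * hv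

/-- The point attached to `(g,h,v)`. -/
def Pt1 (P : (EC (((8 : ℤ)) : ℚ)).Point) (g h v : ℚ) : Prop :=
  IsPt P (2 * (v + g ^ 2 + g * h) / h ^ 2)
    ((4 * g ^ 3 + 6 * g ^ 2 * h + 2 * h ^ 3 + v * (4 * g + 2 * h)) / h ^ 3)

theorem pt1_add {g h v : ℚ} (hh : h ≠ 0) (hv0 : v ≠ 0)
    {Q Q' G : (EC (((8 : ℤ)) : ℚ)).Point}
    (hQ : Pt1 Q g h v) (hQ' : Pt1 Q' g h (-v)) (hG : IsPt G 1 (-3)) : Q + Q' = G := by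
  refine IsPt.eq (IsPt.add_chord hQ hQ' ?_ (l := (2 * g + h) / h) ?_ ?_ ?_) hG
  · intro h1
    field_simp at h1
    apply hv0
    linarith
  · field_simp; ring
  · field_simp; ring
  · field_simp; ring

theorem pt1_sub {g h v : ℚ} (hh : h ≠ 0) (hv0 : v ≠ 0)
    (hv : v ^ 2 = (g ^ 2 + 2 * g * h - h ^ 2) * (g ^ 2 + h ^ 2))
    {Q Q' : (EC (((8 : ℤ)) : ℚ)).Point}
    (hQ : Pt1 Q g h v) (hQ' : Pt1 Q' g h (-v)) :
    ∃ y, IsPt (Q + -Q') ((g ^ 2 - h ^ 2 - 2 * g * h) ^ 2 / v ^ 2) y := by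
  refine ⟨_, IsPt.add_chord hQ hQ'.neg ?_ (l := (2 * g ^ 3 + 3 * g ^ 2 * h + h ^ 3) / (v * h))
    ?_ ?_ rfl⟩
  · intro h1
    field_simp at h1
    apply hv0
    linarith
  · field_simp; ring
  · field_simp
    linear_combination 4 * (g ^ 2 + g * h) * hv

/-- The `x`-coordinate is a square. -/
theorem pt1_sq {g h e f : ℤ} (hc : IsCoprime g h) (h2 : (2 : ℤ) ∣ h) (hh : h ≠ 0)
    (he : e ^ 2 = g ^ 2 + 2 * g * h - h ^ 2) (hf : f ^ 2 = g ^ 2 + h ^ 2) :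
    ∃ k : ℤ, k ≠ 0 ∧ e * f + g ^ 2 + g * h = 2 * k ^ 2 := by
  have hg := odd_of_cop hc h2
  obtain ⟨h', rfl⟩ := h2
  have ho : ∀ x : ℤ, ¬ (2 : ℤ) ∣ x ^ 2 → x % 2 = 1 := by
    intro x hx
    by_contra h
    exact hx (dvd_pow (by omega) two_ne_zero)
  have hg2 : ¬ (2 : ℤ) ∣ g ^ 2 := fun h => hg (int_prime_two.dvd_of_dvd_pow h)
  have heo : e % 2 = 1 := by
    apply ho
    have : g ^ 2 = e ^ 2 - 2 * (2 * (g * h') - 2 * h' ^ 2) := by rw [he]; ring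
    omega
  have hfo : f % 2 = 1 := by
    apply ho
    have : g ^ 2 = f ^ 2 - 2 * (2 * h' ^ 2) := by rw [hf]; ring
    omega
  have hef : (e * f) % 2 = 1 := by rw [Int.mul_emod, heo, hfo]; norm_num
  have hg2' : g ^ 2 % 2 = 1 := by omega
  have hgh : g * (2 * h') = 2 * (g * h') := by ring
  obtain ⟨c, hcd⟩ : (2 : ℤ) ∣ e * f + g ^ 2 + g * (2 * h') := by omega
  obtain ⟨c', hcd'⟩ : (2 : ℤ) ∣ -(e * f) + g ^ 2 + g * (2 * h') := by omega
  have hprod : c * c' = (h' * (g - 2 * h')) ^ 2 := by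
    have : (2 * c) * (2 * c') = 4 * (h' * (g - 2 * h')) ^ 2 := by
      rw [← hcd, ← hcd']
      linear_combination (-f ^ 2) * he - (g ^ 2 + 2 * g * (2 * h') - (2 * h') ^ 2) * hf
    linarith
  have hsum : c + c' = g * (g + 2 * h') := by linarith
  have hg2h : g - 2 * h' ≠ 0 := by intro h; apply hg; exact ⟨h', by linarith⟩
  have hh' : h' ≠ 0 := by rintro rfl; simp at hh
  have hm0 : h' * (g - 2 * h') ≠ 0 := mul_ne_zero hh' hg2h
  have hpos : 0 < c * c' := by rw [hprod]; positivity
  have hspos : 0 < c + c' := by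
    rw [hsum]
    have h1 : 0 ≤ e ^ 2 := sq_nonneg e
    have h2 : 0 < h' ^ 2 := by positivity
    nlinarith [sq_nonneg g]
  have hc0 : 0 < c := by
    by_contra hcon
    push Not at hcon
    rcases hcon.lt_or_eq with h | h
    · have : c' < 0 := by nlinarith
      linarith
    · rw [h] at hpos; simp at hpos
  obtain ⟨k, hk⟩ := int_sq_or (r := 1) hprod hm0 hc0 (by
    intro p hp h1 h2
    exfalso
    have hp' := natPrime_int hp
    have h3 : (p : ℤ) ∣ h' * (g - 2 * h') := hp'.dvd_of_dvd_pow (n := 2) (hprod ▸ h1.mul_right _)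
    have h4 : (p : ℤ) ∣ g * (g + 2 * h') := hsum ▸ dvd_add h1 h2
    have hch : IsCoprime g h' := hc.of_mul_right_right
    have hp2 : ¬ (p : ℤ) ∣ 2 := by
      intro h
      have := (Prime.dvd_prime_iff_associated hp' int_prime_two).1 h
      have : (2 : ℤ) ∣ g * (g + 2 * h') := this.symm.dvd.trans h4
      have h6 : g * (g + 2 * h') = g ^ 2 + 2 * (g * h') := by ring
      omega
    have hph : ¬ (p : ℤ) ∣ h' → ¬ (p : ℤ) ∣ 2 * h' := by
      intro h h'
      rcases hp'.dvd_or_dvd h' with h1 | h1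
      · exact hp2 h1
      · exact h h1
    rcases hp'.dvd_or_dvd h3 with h5 | h5
    · rcases hp'.dvd_or_dvd h4 with h6 | h6
      · exact cop_contra hp' hch h6 h5
      · refine cop_contra hp' hch ?_ h5
        have := dvd_sub h6 (h5.mul_left 2)
        simpa using this
    · rcases hp'.dvd_or_dvd h4 with h6 | h6
      · have h7 := dvd_sub h6 h5
        rw [show g - (g - 2 * h') = 2 * h' by ring] at h7
        exact cop_contra hp' hc h6 h7
      · have h7 := dvd_add h6 h5
        rw [show g + 2 * h' + (g - 2 * h') = 2 * g by ring] at h7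
        rcases hp'.dvd_or_dvd h7 with h8 | h8
        · exact hp2 h8
        · have h9 := dvd_sub h8 h5
          rw [show g - (g - 2 * h') = 2 * h' by ring] at h9
          exact cop_contra hp' hc h8 h9)
  have hk' : c = k ^ 2 := by rcases hk with h | h <;> simpa using h
  exact ⟨k, by rintro rfl; simp at hk'; omega, by rw [hcd, hk']⟩

/-- Points attached to pairs are multiples of `G` (given the descent hypothesis). -/
theorem pt1_mul {G : (EC (((8 : ℤ)) : ℚ)).Point} {N : ℕ} (ih : MWhyp 8 G N) {g h e f : ℤ}
    (hc : IsCoprime g h) (h2 : (2 : ℤ) ∣ h) (hh : h ≠ 0)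
    (he : e ^ 2 = g ^ 2 + 2 * g * h - h ^ 2) (hf : f ^ 2 = g ^ 2 + h ^ 2) (hN : |h| ≤ N)
    {Q : (EC (((8 : ℤ)) : ℚ)).Point} (hQ : Pt1 Q g h (e * f)) : ∃ n : ℤ, Q = n • G := by
  obtain ⟨k, hk, hkk⟩ := pt1_sq hc h2 hh he hf
  obtain ⟨h', rfl⟩ := h2
  have hh' : h' ≠ 0 := by rintro rfl; simp at hh
  have hhQ : (h' : ℚ) ≠ 0 := by exact_mod_cast hh'
  have hkkQ : (e * f + g ^ 2 + g * (2 * h') : ℚ) = 2 * k ^ 2 := by exact_mod_cast hkk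
  have hab : 0 < |h'| := abs_pos.2 hh'
  refine ih k |h'| hab ?_ hk Q ((4 * g ^ 3 + 6 * g ^ 2 * (2 * h' : ℤ) + 2 * (2 * h' : ℤ) ^ 3 +
    e * f * (4 * g + 2 * (2 * h' : ℤ))) / (2 * h' : ℤ) ^ 3) ?_
  · rw [abs_mul] at hN
    simp at hN
    omega
  · have : (2 * (e * f + g ^ 2 + g * (2 * h' : ℤ)) / (2 * h' : ℤ) ^ 2 : ℚ) = k ^ 2 / (|h'| : ℤ) ^ 2 := by
      push_cast
      rw [hkkQ, sq_abs]
      field_simp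
    rw [← this]
    exact hQ

theorem MW1 {G : (EC (((8 : ℤ)) : ℚ)).Point} (hG : IsPt G 1 (-3)) (N : ℕ) : MWhyp 8 G N := by
  refine MW_gen (m := 1) (Or.inl rfl) (by norm_num) G ?_ N
  clear N
  intro N ih g h e f hc h2 he0 hf0 he hf hN P y hP
  rw [one_mul] at hf
  have hefQ : (e * f : ℚ) ≠ 0 := by
    have := mul_pos he0 hf0
    exact_mod_cast this.ne'
  by_cases hh : h = 0
  · subst hh
    have hg : (g : ℚ) ^ 2 = 1 := by
      have : IsUnit g := isCoprime_zero_right.1 hc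
      rcases Int.isUnit_iff.1 this with rfl | rfl <;> norm_num
    have e1 : (e * f : ℚ) ^ 2 = 1 := by
      have h1 : (e : ℚ) ^ 2 = 1 := by
        have : (e : ℚ) ^ 2 = (g : ℚ) ^ 2 := by exact_mod_cast (by linarith : e ^ 2 = g ^ 2)
        rw [this, hg]
      have h2 : (f : ℚ) ^ 2 = 1 := by
        have : (f : ℚ) ^ 2 = (g : ℚ) ^ 2 := by exact_mod_cast (by linarith : f ^ 2 = g ^ 2)
        rw [this, hg]
      rw [mul_pow, h1, h2]; norm_num
    have : (((g : ℚ) ^ 2 - (0 : ℤ) ^ 2 - 2 * g * (0 : ℤ)) ^ 2 / (e * f : ℚ) ^ 2) = 1 := by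
      rw [e1, hg]; norm_num
    rw [this] at hP
    rcases eq_or_neg_of_x hP hG with h | h
    · exact ⟨1, by simpa using h⟩
    · exact ⟨-1, by simpa using h⟩
  have hhQ : (h : ℚ) ≠ 0 := by exact_mod_cast hh
  have heQ : (e : ℚ) ^ 2 = g ^ 2 + 2 * g * h - h ^ 2 := by exact_mod_cast he
  have hfQ : (f : ℚ) ^ 2 = g ^ 2 + h ^ 2 := by exact_mod_cast hf
  have hv : (e * f : ℚ) ^ 2 = (g ^ 2 + 2 * g * h - h ^ 2) * (g ^ 2 + h ^ 2) := by
    rw [mul_pow, heQ, hfQ]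
  have hv' : (-(e * f) : ℚ) ^ 2 = (g ^ 2 + 2 * g * h - h ^ 2) * (g ^ 2 + h ^ 2) := by
    rw [← hv]; ring
  obtain ⟨Q, hQ⟩ := isPt_mk (a := ((8 : ℤ) : ℚ)) (by norm_num) two_ne_zero (pt1_eqn hhQ hv)
  obtain ⟨Q', hQ'⟩ := isPt_mk (a := ((8 : ℤ) : ℚ)) (by norm_num) two_ne_zero (pt1_eqn hhQ hv')
  have hhN : |h| ≤ N := by
    have h1 : |h| < f := abs_lt_of_sq_lt_sq (by rw [hf]; nlinarith [sq_nonneg h, (show 0 < g ^ 2 by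
      have : g ≠ 0 := by rintro rfl; exact odd_of_cop hc h2 (dvd_zero _)
      positivity)]) hf0.le
    have : f ≤ e * f := by nlinarith
    linarith
  obtain ⟨n, hn⟩ := pt1_mul ih hc h2 hh he hf hhN hQ
  have hadd := pt1_add hhQ hefQ hQ hQ' hG
  obtain ⟨y', hy'⟩ := pt1_sub hhQ hefQ hv hQ hQ'
  have hQ'' : Q' = G - Q := by rw [← hadd]; abel
  rcases eq_or_neg_of_x hP hy' with h | h
  · exact ⟨n + n - 1, by rw [h, hQ'', hn, sub_zsmul, add_zsmul, one_zsmul]; abel⟩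
  · exact ⟨-(n + n - 1), by rw [h, hQ'', hn, neg_zsmul, sub_zsmul, add_zsmul, one_zsmul]; abel⟩

/-- Main consequence for pairs. -/
theorem pair1 {G : (EC (((8 : ℤ)) : ℚ)).Point} (hG : IsPt G 1 (-3)) {g h e f : ℤ}
    (hc : IsCoprime g h) (h2 : (2 : ℤ) ∣ h) (hh : h ≠ 0) (he0 : e ≠ 0) (hf0 : f ≠ 0)
    (he : e ^ 2 = g ^ 2 + 2 * g * h - h ^ 2) (hf : f ^ 2 = g ^ 2 + h ^ 2) :
    ∃ n : ℤ, Pt1 (n • G) g h (e * f) ∧ Pt1 ((1 - n) • G) g h (-(e * f)) := by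
  have hhQ : (h : ℚ) ≠ 0 := by exact_mod_cast hh
  have heQ : (e : ℚ) ^ 2 = g ^ 2 + 2 * g * h - h ^ 2 := by exact_mod_cast he
  have hfQ : (f : ℚ) ^ 2 = g ^ 2 + h ^ 2 := by exact_mod_cast hf
  have hefQ : (e * f : ℚ) ≠ 0 := by
    have := mul_ne_zero he0 hf0
    exact_mod_cast this
  have hv : (e * f : ℚ) ^ 2 = (g ^ 2 + 2 * g * h - h ^ 2) * (g ^ 2 + h ^ 2) := by
    rw [mul_pow, heQ, hfQ]
  have hv' : (-(e * f) : ℚ) ^ 2 = (g ^ 2 + 2 * g * h - h ^ 2) * (g ^ 2 + h ^ 2) := by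
    rw [← hv]; ring
  obtain ⟨Q, hQ⟩ := isPt_mk (a := ((8 : ℤ) : ℚ)) (by norm_num) two_ne_zero (pt1_eqn hhQ hv)
  obtain ⟨Q', hQ'⟩ := isPt_mk (a := ((8 : ℤ) : ℚ)) (by norm_num) two_ne_zero (pt1_eqn hhQ hv')
  obtain ⟨n, hn⟩ := pt1_mul (MW1 hG h.natAbs) hc h2 hh he hf (by simp) hQ
  have hadd := pt1_add hhQ hefQ hQ hQ' hG
  have hQ'' : Q' = (1 - n) • G := by rw [sub_zsmul, one_zsmul, ← hn, ← hadd]; abel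
  refine ⟨n, ?_, ?_⟩
  · rw [← hn]; exact hQ
  · rw [← hQ'']; exact hQ'

end MW

/-! ### The curve `y^2 = x^3 + 200x` -/

/-- The point attached to `(g,h,v)` on the second curve. -/
def Pt5 (P : (EC (((200 : ℤ)) : ℚ)).Point) (g h v : ℚ) : Prop :=
  IsPt P (10 * (5 * v + (3 * g ^ 2 + 5 * g * h - 2 * h ^ 2)) / (h - 2 * g) ^ 2)
    ((v * (500 * g - 150 * (h - 2 * g)) + (100 * g * (3 * g ^ 2 + 5 * g * h - 2 * h ^ 2) -
      490 * g * (h - 2 * g) ^ 2 - 30 * (3 * g ^ 2 + 5 * g * h - 2 * h ^ 2) * (h - 2 * g) -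
      210 * (h - 2 * g) ^ 3)) / (h - 2 * g) ^ 3)

theorem pt5_exists {g h v : ℚ} (hh : h - 2 * g ≠ 0)
    (hv : 5 * v ^ 2 = (g ^ 2 + 2 * g * h - h ^ 2) * (g ^ 2 + h ^ 2)) :
    ∃ P, Pt5 P g h v := by
  obtain ⟨D, rfl⟩ : ∃ D, h = 2 * g + D := ⟨h - 2 * g, by ring⟩
  have e : 2 * g + D - 2 * g = D := by ring
  rw [e] at hh
  refine isPt_mk (by norm_num) two_ne_zero ?_
  push_cast
  simp only [e]
  field_simp
  linear_combination (((500 * g - 150 * D) ^ 2 - 75000 *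
    (3 * g ^ 2 + 5 * g * (2 * g + D) - 2 * (2 * g + D) ^ 2)) / 5 - 25000 * v) * hv

theorem pt5_add {g h v : ℚ} (hh : h - 2 * g ≠ 0) (hv0 : v ≠ 0)
    {Q Q' G : (EC (((200 : ℤ)) : ℚ)).Point}
    (hQ : Pt5 Q g h v) (hQ' : Pt5 Q' g h (-v)) (hG : IsPt G 49 357) : Q + Q' = G := by
  obtain ⟨D, rfl⟩ : ∃ D, h = 2 * g + D := ⟨h - 2 * g, by ring⟩
  have e : 2 * g + D - 2 * g = D := by ring
  rw [e] at hh
  unfold Pt5 at hQ hQ'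
  rw [e] at hQ hQ'
  refine IsPt.eq (IsPt.add_chord hQ hQ' ?_ (l := (10 * g - 3 * D) / D) ?_ ?_ ?_) hG
  · intro h1
    field_simp at h1
    apply hv0
    linarith
  · field_simp; ring
  · field_simp; ring
  · field_simp; ring

theorem pt5_sub {g h v : ℚ} (hh : h - 2 * g ≠ 0) (hv0 : v ≠ 0)
    (hv : 5 * v ^ 2 = (g ^ 2 + 2 * g * h - h ^ 2) * (g ^ 2 + h ^ 2))
    {Q Q' : (EC (((200 : ℤ)) : ℚ)).Point}
    (hQ : Pt5 Q g h v) (hQ' : Pt5 Q' g h (-v)) :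
    ∃ y, IsPt (Q + -Q') ((g ^ 2 - h ^ 2 - 2 * g * h) ^ 2 / v ^ 2) y := by
  obtain ⟨D, hD⟩ : ∃ D, h = 2 * g + D := ⟨h - 2 * g, by ring⟩
  have e : h - 2 * g = D := by rw [hD]; ring
  rw [e] at hh
  unfold Pt5 at hQ hQ'
  rw [e] at hQ hQ'
  subst hD
  refine ⟨_, IsPt.add_chord hQ hQ'.neg ?_ (l := (100 * g * (3 * g ^ 2 + 5 * g * (2 * g + D) -
      2 * (2 * g + D) ^ 2) -
      490 * g * D ^ 2 - 30 * (3 * g ^ 2 + 5 * g * (2 * g + D) - 2 * (2 * g + D) ^ 2) * D -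
      210 * D ^ 3) / (50 * (v * D)))
    ?_ ?_ rfl⟩
  · intro h1
    field_simp at h1
    apply hv0
    linarith
  · field_simp; ring
  · field_simp
    linear_combination 10000 * (3 * g ^ 2 + 5 * g * (2 * g + D) - 2 * (2 * g + D) ^ 2) * hv

theorem dvd_two_contra {p : ℕ} (hp : p.Prime) {x : ℤ} (hx : x % 2 = 1) (h : (p : ℤ) ∣ x)
    (h2 : (p : ℤ) ∣ 2) : False := by
  have := (Prime.dvd_prime_iff_associated (natPrime_int hp) int_prime_two).1 h2
  have : (2 : ℤ) ∣ x := this.symm.dvd.trans h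
  omega

theorem prime_eq_five {p : ℕ} (hp : p.Prime) (h : (p : ℤ) ∣ 5) : p = 5 := by
  have : p ∣ 5 := by exact_mod_cast h
  exact (Nat.prime_dvd_prime_iff_eq hp (by norm_num)).1 this

/-- structure of the pairs -/
theorem pt5_div {g h e f : ℤ} (h2 : (2 : ℤ) ∣ h)
    (he : e ^ 2 = g ^ 2 + 2 * g * h - h ^ 2) (hf : 5 * f ^ 2 = g ^ 2 + h ^ 2) :
    ∃ D, h - 2 * g = 10 * D := by
  have h2' : (2 : ℤ) ∣ h - 2 * g := dvd_sub h2 ⟨g, rfl⟩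
  have h5 : (5 : ℤ) ∣ h - 2 * g := by
    have hz1 : (e : ZMod 5) ^ 2 = g ^ 2 + 2 * g * h - h ^ 2 := by
      exact_mod_cast congrArg (Int.cast : ℤ → ZMod 5) he
    have hz2 : (0 : ZMod 5) = g ^ 2 + h ^ 2 := by
      have := congrArg (Int.cast : ℤ → ZMod 5) hf
      push_cast at this
      rw [← this, show (5 : ZMod 5) = 0 from rfl]; ring
    have key : ∀ e g h : ZMod 5, e ^ 2 = g ^ 2 + 2 * g * h - h ^ 2 → 0 = g ^ 2 + h ^ 2 →
        h - 2 * g = 0 := by decide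
    have := key _ _ _ hz1 hz2
    apply (ZMod.intCast_zmod_eq_zero_iff_dvd _ 5).1
    push_cast
    exact this
  have : (2 * 5 : ℤ) ∣ h - 2 * g := IsCoprime.mul_dvd ⟨-2, 1, by norm_num⟩ h2' h5
  obtain ⟨D, hD⟩ := this
  exact ⟨D, by rw [hD]; ring⟩

theorem pt5_sq {g h e f : ℤ} (hc : IsCoprime g h) (h2 : (2 : ℤ) ∣ h) (hh : h - 2 * g ≠ 0)
    (he : e ^ 2 = g ^ 2 + 2 * g * h - h ^ 2) (hf : 5 * f ^ 2 = g ^ 2 + h ^ 2) :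
    ∃ k : ℤ, k ≠ 0 ∧ (5 * (e * f) + (3 * g ^ 2 + 5 * g * h - 2 * h ^ 2) = 10 * k ^ 2 ∨
      5 * (e * f) + (3 * g ^ 2 + 5 * g * h - 2 * h ^ 2) = 50 * k ^ 2) := by
  obtain ⟨D, hD⟩ := pt5_div h2 he hf
  have hg := odd_of_cop hc h2
  have hh2 : h = 2 * g + 10 * D := by linarith
  subst hh2
  have hD0 : D ≠ 0 := by rintro rfl; simp at hh
  have ho : ∀ x : ℤ, ¬ (2 : ℤ) ∣ x ^ 2 → x % 2 = 1 := by
    intro x hx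
    by_contra h
    exact hx (dvd_pow (by omega) two_ne_zero)
  have hg2 : ¬ (2 : ℤ) ∣ g ^ 2 := fun h => hg (int_prime_two.dvd_of_dvd_pow h)
  have heo : e % 2 = 1 := by
    apply ho
    have : g ^ 2 = e ^ 2 - 2 * (2 * g * (g + 5 * D) - 2 * (g + 5 * D) ^ 2) := by rw [he]; ring
    omega
  have hfo : f % 2 = 1 := by
    apply ho
    have : g ^ 2 = f ^ 2 + 2 * (2 * f ^ 2 - 2 * (g + 5 * D) ^ 2) := by linear_combination -hf
    omega
  have hef : (e * f) % 2 = 1 := by rw [Int.mul_emod, heo, hfo]; norm_num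
  have hg2' : g ^ 2 % 2 = 1 := by omega
  have hF : 3 * g ^ 2 + 5 * g * (2 * g + 10 * D) - 2 * (2 * g + 10 * D) ^ 2 =
      5 * ((g - 10 * D) * (g + 4 * D)) := by ring
  have hFo : ((g - 10 * D) * (g + 4 * D)) % 2 = 1 := by
    have : (g - 10 * D) * (g + 4 * D) = g ^ 2 + 2 * (-3 * g * D - 20 * D ^ 2) := by ring
    omega
  rw [hF]
  obtain ⟨c, hcd⟩ : (2 : ℤ) ∣ e * f + (g - 10 * D) * (g + 4 * D) := by omega
  obtain ⟨c', hcd'⟩ : (2 : ℤ) ∣ -(e * f) + (g - 10 * D) * (g + 4 * D) := by omega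
  have hprod : c * c' = (D * (7 * g + 30 * D)) ^ 2 := by
    have : (2 * c) * (2 * c') = 4 * (D * (7 * g + 30 * D)) ^ 2 := by
      rw [← hcd, ← hcd']
      have h5 : 5 * ((e * f + (g - 10 * D) * (g + 4 * D)) * (-(e * f) + (g - 10 * D) * (g + 4 * D)))
          = 5 * (4 * (D * (7 * g + 30 * D)) ^ 2) := by
        linear_combination (-5 * f ^ 2) * he - (g ^ 2 + 2 * g * (2 * g + 10 * D) -
          (2 * g + 10 * D) ^ 2) * hf
      linarith
    linarith
  have hsum : c + c' = (g - 10 * D) * (g + 4 * D) := by linarith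
  have hm0 : D * (7 * g + 30 * D) ≠ 0 := by
    refine mul_ne_zero hD0 ?_
    intro h
    apply hg
    exact ⟨-15 * D - 3 * g, by linarith⟩
  have hpos : 0 < c * c' := by rw [hprod]; positivity
  have hspos : 0 < c + c' := by
    rw [hsum]
    have h1 : 0 ≤ e ^ 2 := sq_nonneg e
    have h2 : 0 < D ^ 2 := by positivity
    nlinarith [sq_nonneg g, sq_nonneg (g + 3 * D)]
  have hc0 : 0 < c := by
    by_contra hcon
    push Not at hcon
    rcases hcon.lt_or_eq with h | h
    · have : c' < 0 := by nlinarith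
      linarith
    · rw [h] at hpos; simp at hpos
  obtain ⟨k, hk⟩ := int_sq_or (r := 5) hprod hm0 hc0 (by
    intro p hp h1 h2
    have hp' := natPrime_int hp
    have h3 : (p : ℤ) ∣ D * (7 * g + 30 * D) := hp'.dvd_of_dvd_pow (n := 2) (hprod ▸ h1.mul_right _)
    have h4 : (p : ℤ) ∣ (g - 10 * D) * (g + 4 * D) := hsum ▸ dvd_add h1 h2
    have hcD : ∀ n : ℕ, n.Prime → (n : ℤ) ∣ g → (n : ℤ) ∣ D → False := by
      intro n hn ha hb
      exact cop_contra (natPrime_int hn) hc ha (dvd_add (ha.mul_left _) (hb.mul_left _))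
    have hp2 : ¬ (p : ℤ) ∣ 2 := fun h => dvd_two_contra hp hFo h4 h
    by_contra hne
    have hp5 : ¬ (p : ℤ) ∣ 5 := fun h => hne (prime_eq_five hp h)
    have hp10 : ∀ x, (p : ℤ) ∣ 100 * x → (p : ℤ) ∣ x := by
      intro x hx
      rcases hp'.dvd_or_dvd hx with h | h
      · rw [show (100 : ℤ) = 2 * (2 * (5 * 5)) by norm_num] at h
        rcases hp'.dvd_or_dvd h with h | h
        · exact absurd h hp2
        rcases hp'.dvd_or_dvd h with h | h
        · exact absurd h hp2
        rcases hp'.dvd_or_dvd h with h | h <;> exact absurd h hp5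
      · exact h
    rcases hp'.dvd_or_dvd h3 with h5 | h5
    · refine hcD p hp ?_ h5
      rcases hp'.dvd_or_dvd h4 with h6 | h6
      · have := dvd_add h6 (h5.mul_left 10)
        simpa using this
      · have := dvd_sub h6 (h5.mul_left 4)
        simpa using this
    · rcases hp'.dvd_or_dvd h4 with h6 | h6
      · refine hcD p hp (hp10 _ ?_) (hp10 _ ?_)
        · have := dvd_add (h5.mul_left 10) (h6.mul_left 30)
          rwa [show 10 * (7 * g + 30 * D) + 30 * (g - 10 * D) = 100 * g by ring] at this
        · have := dvd_sub h5 (h6.mul_left 7)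
          rwa [show 7 * g + 30 * D - 7 * (g - 10 * D) = 100 * D by ring] at this
      · refine hcD p hp (hp10 _ ?_) (hp10 _ ?_)
        · have := dvd_sub (h6.mul_left 1500) (h5.mul_left 200)
          rwa [show 1500 * (g + 4 * D) - 200 * (7 * g + 30 * D) = 100 * g by ring] at this
        · have := dvd_sub (h5.mul_left 50) (h6.mul_left 350)
          rwa [show 50 * (7 * g + 30 * D) - 350 * (g + 4 * D) = 100 * D by ring] at this)
  refine ⟨k, ?_, ?_⟩
  · rintro rfl
    simp at hk
    omega
  · refine hk.imp (fun h => ?_) (fun h => ?_)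
    · rw [← h]; linarith
    · push_cast at h
      linarith

/-- No point has `x`-coordinate `5 ξ^2`. -/
theorem no_five {P : (EC (((200 : ℤ)) : ℚ)).Point} {ξ y : ℚ} (hξ : ξ ≠ 0)
    (hP : IsPt P (5 * ξ ^ 2) y) : False := by
  have h := hP.eqn
  push_cast at h
  -- (y/(5ξ))^2 = 5 (ξ^4 + 8)
  have h1 : (y / (5 * ξ)) ^ 2 = 5 * (ξ ^ 4 + 8) := by
    field_simp
    linear_combination h
  have hn : (ξ.num : ℚ) = ξ * ξ.den := (Rat.mul_den_eq_num ξ).symm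
  have hd0 : (ξ.den : ℚ) ≠ 0 := by exact_mod_cast ξ.den_ne_zero
  have hsq : IsSquare (((5 * (ξ.num ^ 4 + 8 * (ξ.den : ℤ) ^ 4) : ℤ)) : ℚ) := by
    refine ⟨y / (5 * ξ) * ξ.den ^ 2, ?_⟩
    push_cast
    rw [hn]
    linear_combination (-(ξ.den : ℚ) ^ 4) * h1
  obtain ⟨r, hr⟩ := Rat.isSquare_intCast_iff.1 hsq
  obtain ⟨s, rfl⟩ : (5 : ℤ) ∣ r := int_prime_five.dvd_of_dvd_pow (n := 2) ⟨_, by rw [pow_two, ← hr]⟩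
  have h2 : ξ.num ^ 4 + 8 * (ξ.den : ℤ) ^ 4 = 5 * s ^ 2 := by linarith
  have hd5 : (5 : ℤ) ∣ ξ.den := by
    have : (5 : ℤ) ∣ (ξ.num ^ 2) ^ 2 - 2 * (ξ.den : ℤ) ^ 4 := ⟨s ^ 2 - 2 * (ξ.den : ℤ) ^ 4, by linarith⟩
    exact five_nr2 this
  have hn5 : (5 : ℤ) ∣ ξ.num := by
    apply int_prime_five.dvd_of_dvd_pow (n := 4)
    have : ξ.num ^ 4 = 5 * s ^ 2 - 8 * (ξ.den : ℤ) ^ 4 := by linarith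
    rw [this]
    exact dvd_sub ⟨_, rfl⟩ ((dvd_pow hd5 four_ne_zero).mul_left _)
  have hred := ξ.reduced
  have h3 : 5 ∣ ξ.num.natAbs := by exact_mod_cast Int.natCast_dvd.1 (by exact_mod_cast hn5)
  have h4 : 5 ∣ ξ.den := by exact_mod_cast hd5
  have := Nat.dvd_gcd h3 h4
  rw [hred] at this
  norm_num at this

theorem pt5_mul {G : (EC (((200 : ℤ)) : ℚ)).Point} {N : ℕ} (ih : MWhyp 200 G N) {g h e f : ℤ}
    (hc : IsCoprime g h) (h2 : (2 : ℤ) ∣ h) (hh : h - 2 * g ≠ 0)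
    (he : e ^ 2 = g ^ 2 + 2 * g * h - h ^ 2) (hf : 5 * f ^ 2 = g ^ 2 + h ^ 2)
    (hN : |h - 2 * g| ≤ 5 * N)
    {Q : (EC (((200 : ℤ)) : ℚ)).Point} (hQ : Pt5 Q g h (e * f)) : ∃ n : ℤ, Q = n • G := by
  obtain ⟨k, hk, hkk⟩ := pt5_sq hc h2 hh he hf
  obtain ⟨D, hD⟩ := pt5_div h2 he hf
  have hD0 : D ≠ 0 := by rintro rfl; simp at hD; exact hh (by linarith)
  have hDQ : (D : ℚ) ≠ 0 := by exact_mod_cast hD0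
  have hhD : (h : ℚ) - 2 * g = 10 * D := by exact_mod_cast hD
  have hkQ : (k : ℚ) ≠ 0 := by exact_mod_cast hk
  have hab : 0 < |D| := abs_pos.2 hD0
  unfold Pt5 at hQ
  rcases hkk with hkk | hkk
  · have hkkQ : (5 * (e * f) + (3 * g ^ 2 + 5 * g * h - 2 * h ^ 2) : ℚ) = 10 * k ^ 2 := by
      exact_mod_cast hkk
    have : (10 * (5 * (e * f) + (3 * g ^ 2 + 5 * g * h - 2 * h ^ 2)) / (h - 2 * g) ^ 2 : ℚ) =
          k ^ 2 / (|D| : ℤ) ^ 2 := by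
      push_cast
      rw [hkkQ, sq_abs, hhD]
      field_simp
    rw [this] at hQ
    refine ih k |D| hab ?_ hk Q _ hQ
    rw [hD, abs_mul] at hN
    norm_num at hN
    omega
  · exfalso
    have hkkQ : (5 * (e * f) + (3 * g ^ 2 + 5 * g * h - 2 * h ^ 2) : ℚ) = 50 * k ^ 2 := by
      exact_mod_cast hkk
    rw [hkkQ] at hQ
    have : (10 * (50 * k ^ 2) / (h - 2 * g) ^ 2 : ℚ) = 5 * (k / D) ^ 2 := by
      rw [hhD]; field_simp; norm_num
    rw [this] at hQ
    exact no_five (div_ne_zero hkQ hDQ) hQ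

theorem MW5 {G : (EC (((200 : ℤ)) : ℚ)).Point} (hG : IsPt G 49 357) (N : ℕ) : MWhyp 200 G N := by
  refine MW_gen (m := 5) (Or.inr rfl) (by norm_num) G ?_ N
  clear N
  intro N ih g h e f hc h2 he0 hf0 he hf hN P y hP
  have hefQ : (e * f : ℚ) ≠ 0 := by
    have := mul_pos he0 hf0
    exact_mod_cast this.ne'
  by_cases hh : h - 2 * g = 0
  · obtain rfl : h = 2 * g := by linarith
    have hgu : IsUnit g := by
      have : IsCoprime g g := hc.of_mul_right_right
      exact isCoprime_self.1 this
    have hg : (g : ℚ) ^ 2 = 1 := by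
      rcases Int.isUnit_iff.1 hgu with rfl | rfl <;> norm_num
    have e1 : (e * f : ℚ) ^ 2 = 1 := by
      have h1 : (e : ℚ) ^ 2 = 1 := by
        have : (e : ℚ) ^ 2 = (g : ℚ) ^ 2 := by exact_mod_cast (by linarith : e ^ 2 = g ^ 2)
        rw [this, hg]
      have h2 : (f : ℚ) ^ 2 = 1 := by
        have : (f : ℚ) ^ 2 = (g : ℚ) ^ 2 := by exact_mod_cast (by linarith : f ^ 2 = g ^ 2)
        rw [this, hg]
      rw [mul_pow, h1, h2]; norm_num
    have : (((g : ℚ) ^ 2 - (2 * g : ℤ) ^ 2 - 2 * g * (2 * g : ℤ)) ^ 2 / (e * f : ℚ) ^ 2) = 49 := by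
      rw [e1]; push_cast
      rw [show ((g : ℚ) ^ 2 - (2 * g) ^ 2 - 2 * g * (2 * g)) = -7 * g ^ 2 by ring, hg]; norm_num
    rw [this] at hP
    rcases eq_or_neg_of_x hP hG with h | h
    · exact ⟨1, by simpa using h⟩
    · exact ⟨-1, by simpa using h⟩
  have hhQ : (h : ℚ) - 2 * g ≠ 0 := by exact_mod_cast hh
  have heQ : (e : ℚ) ^ 2 = g ^ 2 + 2 * g * h - h ^ 2 := by exact_mod_cast he
  have hfQ : 5 * (f : ℚ) ^ 2 = g ^ 2 + h ^ 2 := by exact_mod_cast hf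
  have hv : 5 * (e * f : ℚ) ^ 2 = (g ^ 2 + 2 * g * h - h ^ 2) * (g ^ 2 + h ^ 2) := by
    rw [← heQ, ← hfQ]; ring
  have hv' : 5 * (-(e * f) : ℚ) ^ 2 = (g ^ 2 + 2 * g * h - h ^ 2) * (g ^ 2 + h ^ 2) := by
    rw [← hv]; ring
  obtain ⟨Q, hQ⟩ := pt5_exists hhQ hv
  obtain ⟨Q', hQ'⟩ := pt5_exists hhQ hv'
  have hhN : |h - 2 * g| ≤ 5 * N := by
    have h1 : |h - 2 * g| ≤ 5 * f := abs_le_of_sq_le_sq (by nlinarith [sq_nonneg (2 * h + g)])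
      (by linarith)
    have : f ≤ e * f := by nlinarith
    linarith
  obtain ⟨n, hn⟩ := pt5_mul ih hc h2 hh he hf hhN hQ
  have hadd := pt5_add hhQ hefQ hQ hQ' hG
  obtain ⟨y', hy'⟩ := pt5_sub hhQ hefQ hv hQ hQ'
  have hQ'' : Q' = G - Q := by rw [← hadd]; abel
  rcases eq_or_neg_of_x hP hy' with h | h
  · exact ⟨n + n - 1, by rw [h, hQ'', hn, sub_zsmul, add_zsmul, one_zsmul]; abel⟩
  · exact ⟨-(n + n - 1), by rw [h, hQ'', hn, neg_zsmul, sub_zsmul, add_zsmul, one_zsmul]; abel⟩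

/-- Main consequence for pairs. -/
theorem pair5 {G : (EC (((200 : ℤ)) : ℚ)).Point} (hG : IsPt G 49 357) {g h e f : ℤ}
    (hc : IsCoprime g h) (h2 : (2 : ℤ) ∣ h) (hh : h - 2 * g ≠ 0) (he0 : e ≠ 0) (hf0 : f ≠ 0)
    (he : e ^ 2 = g ^ 2 + 2 * g * h - h ^ 2) (hf : 5 * f ^ 2 = g ^ 2 + h ^ 2) :
    ∃ n : ℤ, Pt5 (n • G) g h (e * f) ∧ Pt5 ((1 - n) • G) g h (-(e * f)) := by
  have hhQ : (h : ℚ) - 2 * g ≠ 0 := by exact_mod_cast hh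
  have heQ : (e : ℚ) ^ 2 = g ^ 2 + 2 * g * h - h ^ 2 := by exact_mod_cast he
  have hfQ : 5 * (f : ℚ) ^ 2 = g ^ 2 + h ^ 2 := by exact_mod_cast hf
  have hefQ : (e * f : ℚ) ≠ 0 := by
    have := mul_ne_zero he0 hf0
    exact_mod_cast this
  have hv : 5 * (e * f : ℚ) ^ 2 = (g ^ 2 + 2 * g * h - h ^ 2) * (g ^ 2 + h ^ 2) := by
    rw [← heQ, ← hfQ]; ring
  have hv' : 5 * (-(e * f) : ℚ) ^ 2 = (g ^ 2 + 2 * g * h - h ^ 2) * (g ^ 2 + h ^ 2) := by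
    rw [← hv]; ring
  obtain ⟨Q, hQ⟩ := pt5_exists hhQ hv
  obtain ⟨Q', hQ'⟩ := pt5_exists hhQ hv'
  obtain ⟨n, hn⟩ := pt5_mul (MW5 hG (h - 2 * g).natAbs) hc h2 hh he hf
    (by rw [Int.natCast_natAbs]; have := abs_nonneg (h - 2 * g); linarith) hQ
  have hadd := pt5_add hhQ hefQ hQ hQ' hG
  have hQ'' : Q' = (1 - n) • G := by rw [sub_zsmul, one_zsmul, ← hn, ← hadd]; abel
  refine ⟨n, ?_, ?_⟩
  · rw [← hn]; exact hQ
  · rw [← hQ'']; exact hQ'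

/-! ### Arithmetic tools on the reduced curves -/

section ZArith
variable {ℓ : ℕ} [hℓ : Fact ℓ.Prime] {a : ℤ}

theorem zmod_eq_of {x y : ℤ} (h : (x - y) % ℓ = 0) : (x : ZMod ℓ) = y := by
  rw [← sub_eq_zero, ← Int.cast_sub]
  exact (ZMod.intCast_zmod_eq_zero_iff_dvd _ ℓ).2 (Int.dvd_of_emod_eq_zero h)

theorem zmod_ne_of {x y : ℤ} (h : (x - y) % ℓ ≠ 0) : (x : ZMod ℓ) ≠ y := by
  intro hh
  rw [← sub_eq_zero, ← Int.cast_sub] at hh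
  exact h (Int.emod_eq_zero_of_dvd ((ZMod.intCast_zmod_eq_zero_iff_dvd _ ℓ).1 hh))

theorem zdbl {G : (EC (a : ZMod ℓ)).Point} {i k : ℤ} {x y : ℤ} (hP : IsPt (i • G) (x : ZMod ℓ) y)
    (l x₃ y₃ : ℤ) (hk : k = i + i)
    (h : (2 * y - 0) % ℓ ≠ 0 ∧ (l * (2 * y) - (3 * x ^ 2 + a)) % ℓ = 0 ∧
      (x₃ - (l ^ 2 - x - x)) % ℓ = 0 ∧ (y₃ - (l * (x - x₃) - y)) % ℓ = 0) :
    IsPt (k • G) (x₃ : ZMod ℓ) y₃ := by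
  obtain ⟨h1, h2, h3, h4⟩ := h
  have e1 := zmod_ne_of (ℓ := ℓ) h1
  have e2 := zmod_eq_of (ℓ := ℓ) h2
  have e3 := zmod_eq_of (ℓ := ℓ) h3
  have e4 := zmod_eq_of (ℓ := ℓ) h4
  push_cast at e1 e2 e3 e4
  rw [hk, add_zsmul]
  exact hP.add_self (fun h => e1 (by rw [h]; ring)) (fun h => e1 (by rw [h]; ring)) e2 e3 e4

theorem zadd {G : (EC (a : ZMod ℓ)).Point} {i j k : ℤ} {x y x' y' : ℤ}
    (hP : IsPt (i • G) (x : ZMod ℓ) y) (hQ : IsPt (j • G) (x' : ZMod ℓ) y')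
    (l x₃ y₃ : ℤ) (hk : k = i + j)
    (h : (x - x') % ℓ ≠ 0 ∧ (l * (x - x') - (y - y')) % ℓ = 0 ∧
      (x₃ - (l ^ 2 - x - x')) % ℓ = 0 ∧ (y₃ - (l * (x - x₃) - y)) % ℓ = 0) :
    IsPt (k • G) (x₃ : ZMod ℓ) y₃ := by
  obtain ⟨h1, h2, h3, h4⟩ := h
  have e1 := zmod_ne_of (ℓ := ℓ) h1
  have e2 := zmod_eq_of (ℓ := ℓ) h2
  have e3 := zmod_eq_of (ℓ := ℓ) h3
  have e4 := zmod_eq_of (ℓ := ℓ) h4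
  push_cast at e1 e2 e3 e4
  rw [hk, add_zsmul]
  exact hP.add_chord hQ e1 e2 e3 e4

theorem zzero {G : (EC (a : ZMod ℓ)).Point} {i j k : ℤ} {x y x' y' : ℤ}
    (hP : IsPt (i • G) (x : ZMod ℓ) y) (hQ : IsPt (j • G) (x' : ZMod ℓ) y') (hk : k = i + j)
    (h : (x - x') % ℓ = 0 ∧ (y' - (-y)) % ℓ = 0) : k • G = 0 := by
  obtain ⟨h1, h2⟩ := h
  have e1 := zmod_eq_of (ℓ := ℓ) h1
  have e2 := zmod_eq_of (ℓ := ℓ) h2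
  push_cast at e2
  rw [hk, add_zsmul]
  rw [e2, ← e1] at hQ
  exact hP.add_neg hQ

theorem zmod_smul {G : (EC (a : ZMod ℓ)).Point} {k n : ℤ} (hk : k • G = 0) :
    n • G = (n % k) • G := by
  conv_lhs => rw [← Int.mul_ediv_add_emod n k]
  rw [add_zsmul, mul_comm, mul_zsmul, hk, zsmul_zero, zero_add]

theorem znonsq {x : ℤ} (h : jacobiSym x ℓ = -1) : ¬ ∃ c : ZMod ℓ, c ^ 2 = x := by
  rintro ⟨c, hc⟩
  exact ZMod.nonsquare_of_jacobiSym_eq_neg_one h ⟨c, by rw [← hc, pow_two]⟩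

/-- reduction of the generator -/
theorem gen_red (h2a : (2 * a - 0) % ℓ ≠ 0) {G : (EC (a : ℚ)).Point} {x y : ℤ}
    (hG : IsPt G (x : ℚ) y) : ∃ Gb : (EC (a : ZMod ℓ)).Point, IsPt ((1 : ℤ) • Gb) (x : ZMod ℓ) y ∧
      ∀ n : ℤ, PRed ℓ (n • G) (n • Gb) := by
  have e := zmod_ne_of (ℓ := ℓ) h2a
  rw [Int.cast_zero] at e
  obtain ⟨Gb, h1, h2⟩ := PRed.mk' (ℓ := ℓ) e hG (Red.int x) (Red.int y)
  exact ⟨Gb, by rwa [one_zsmul], fun n => h2.zsmul e h1.ne_zero n⟩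

end ZArith

/-- The binary form attached to `z = p/q`. -/
def fv {R : Type} [CommRing R] (κ p q : R) : R := (q ^ 2 - p ^ 2) ^ 3 + κ * (p * q) ^ 3

theorem fv_red {ℓ : ℕ} [Fact ℓ.Prime] {k p q : ℚ} {kb pb qb : ZMod ℓ} (hk : Red ℓ k kb)
    (hp : Red ℓ p pb) (hq : Red ℓ q qb) : Red ℓ (fv k p q) (fv kb pb qb) :=
  (((hq.pow 2).sub (hp.pow 2)).pow 3).add (hk.mul ((hp.mul hq).pow 3))

/-- Structure of doubles. -/
theorem dbl_struct {a m : ℤ} (hm : 0 < m) (ha : a = 8 * m ^ 2) {R R' : (EC (a : ℚ)).Point}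
    (hR : R = R' + R') (hS : R + R ≠ 0) :
    ∃ u d w : ℤ, IsCoprime u d ∧ u ≠ 0 ∧ d ≠ 0 ∧ w ≠ 0 ∧ w ^ 2 = u ^ 4 + 8 * m ^ 2 * d ^ 4 ∧
      IsPt R ((u : ℚ) ^ 2 / d ^ 2) (u * w / d ^ 3) := by
  have ha0 : (0 : ℚ) < a := by rw [ha]; positivity
  rcases pt_cases R' with h | ⟨x, y, hxy⟩
  · exfalso; apply hS; rw [hR, h]; simp
  have hy : y ≠ 0 := by
    rintro rfl
    apply hS
    rw [hR, hxy.add_neg (Q := R') (by simpa using hxy)]; simp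
  have he := hxy.eqn
  obtain ⟨Y, hR2⟩ : ∃ Y, IsPt R (((x ^ 2 - a) / (2 * y)) ^ 2) Y := by
    rw [hR]
    refine ⟨_, hxy.add_self two_ne_zero hy (l := (3 * x ^ 2 + a) / (2 * y)) ?_ ?_ rfl⟩
    · field_simp
    · field_simp
      linear_combination (8 * x) * he
  set ξ := (x ^ 2 - (a : ℚ)) / (2 * y) with hξdef
  have hY := hR2.eqn
  have hξ : ξ ≠ 0 := by
    intro h0
    apply hS
    rw [h0] at hY hR2
    have : Y = 0 := by
      have : Y ^ 2 = 0 := by rw [hY]; ring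
      exact pow_eq_zero_iff two_ne_zero |>.1 this
    subst this
    exact hR2.add_neg (by simpa using hR2)
  clear_value ξ
  have hn : (ξ.num : ℚ) = ξ * ξ.den := (Rat.mul_den_eq_num ξ).symm
  have hd0 : (ξ.den : ℚ) ≠ 0 := by exact_mod_cast ξ.den_ne_zero
  have hsq : IsSquare (((ξ.num ^ 4 + 8 * m ^ 2 * (ξ.den : ℤ) ^ 4 : ℤ)) : ℚ) := by
    refine ⟨Y * ξ.den ^ 2 / ξ, ?_⟩
    push_cast
    rw [hn]
    rw [ha] at hY
    push_cast at hY
    field_simp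
    linear_combination -hY
  obtain ⟨w, hw⟩ := Rat.isSquare_intCast_iff.1 hsq
  have hnum : ξ.num ≠ 0 := Rat.num_ne_zero.2 hξ
  have hden : ((ξ.den : ℤ)) ≠ 0 := by exact_mod_cast ξ.den_ne_zero
  have hw0 : w ≠ 0 := by
    rintro rfl
    have : 0 < ξ.num ^ 4 + 8 * m ^ 2 * (ξ.den : ℤ) ^ 4 := by positivity
    rw [hw] at this
    simp at this
  have hwQ : (w : ℚ) ^ 2 = ξ.num ^ 4 + 8 * m ^ 2 * (ξ.den : ℚ) ^ 4 := by
    have := congrArg (Int.cast : ℤ → ℚ) hw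
    push_cast at this
    rw [this]; ring
  have hx : ((ξ.num : ℚ)) ^ 2 / ((ξ.den : ℤ) : ℚ) ^ 2 = ξ ^ 2 := by
    push_cast; rw [hn]; field_simp
  have hcop : IsCoprime ξ.num (ξ.den : ℤ) := Int.isCoprime_iff_nat_coprime.2 (by simpa using ξ.reduced)
  have hYY : (Y - ξ.num * w / ((ξ.den : ℤ) : ℚ) ^ 3) * (Y + ξ.num * w / ((ξ.den : ℤ) : ℚ) ^ 3) = 0 := by
    have : (ξ.num * w / ((ξ.den : ℤ) : ℚ) ^ 3) ^ 2 = Y ^ 2 := by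
      rw [hY, div_pow, mul_pow, hwQ, ha, hn]
      push_cast
      field_simp
    linear_combination -this
  rcases mul_eq_zero.1 hYY with h | h
  · refine ⟨ξ.num, ξ.den, w, hcop, hnum, hden, hw0, by rw [pow_two, ← hw], ?_⟩
    rw [hx, ← sub_eq_zero.1 h]; exact hR2
  · refine ⟨ξ.num, ξ.den, -w, hcop, hnum, hden, neg_ne_zero.2 hw0, by rw [neg_sq, pow_two, ← hw], ?_⟩
    have : (ξ.num : ℚ) * ((-w : ℤ) : ℚ) / ((ξ.den : ℤ) : ℚ) ^ 3 = Y := by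
      push_cast; push_cast at h; linear_combination -h
    rw [hx, this]; exact hR2

/-! ### Cohn's argument on `y^2 = x^3 + 8x` -/

theorem odd_smul {A : Type} [AddCommGroup A] {S : A} (h : S + S = 0) {i : ℤ} (hi : i % 2 = 1) :
    i • S = S := by
  have : i = 2 * (i / 2) + 1 := by omega
  rw [this, add_zsmul, one_zsmul, mul_comm, mul_zsmul, two_zsmul, h, zsmul_zero, zero_add]

theorem cohn1_loc {ℓ : ℕ} [Fact ℓ.Prime] {u d w : ℤ} (hu : u ≠ 0) (hd : d ≠ 0) (hw0 : w ≠ 0)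
    (hw : w ^ 2 = u ^ 4 + 8 * 1 ^ 2 * d ^ 4) (hN : (ℓ : ℤ) ∣ w ^ 4 + 32 * u ^ 4 * d ^ 4)
    (h2 : (2 * d * u * w : ZMod ℓ) ≠ 0) {R : (EC (((8 : ℤ)) : ℚ)).Point}
    (hR : IsPt R ((u : ℚ) ^ 2 / d ^ 2) (u * w / d ^ 3)) {i : ℤ} (hi : i % 2 = 1) :
    ∃ ρ : ZMod ℓ, ρ ^ 2 = -2 ∧ 4 * u ^ 2 * d ^ 2 * ρ = w ^ 2 ∧
      ∃ x y, IsPt (i • (R + R)) x y ∧ Red ℓ x (2 * ρ) ∧ Red ℓ y 0 := by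
  have h2' : (2 : ZMod ℓ) ≠ 0 := fun h => h2 (by rw [h]; ring)
  have hd' : (d : ZMod ℓ) ≠ 0 := fun h => h2 (by rw [h]; ring)
  have hu' : (u : ZMod ℓ) ≠ 0 := fun h => h2 (by rw [h]; ring)
  have hw' : (w : ZMod ℓ) ≠ 0 := fun h => h2 (by rw [h]; ring)
  have huQ : (u : ℚ) ≠ 0 := by exact_mod_cast hu
  have hdQ : (d : ℚ) ≠ 0 := by exact_mod_cast hd
  have hwQ : (w : ℚ) ≠ 0 := by exact_mod_cast hw0
  have e := (ZMod.intCast_zmod_eq_zero_iff_dvd _ ℓ).2 hN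
  push_cast at e
  have ew : (w : ZMod ℓ) ^ 2 = u ^ 4 + 8 * d ^ 4 := by
    have := congrArg (Int.cast : ℤ → ZMod ℓ) hw
    push_cast at this
    rw [this]; try ring
  have h4 : (4 : ZMod ℓ) ≠ 0 := by
    rw [show (4 : ZMod ℓ) = 2 * 2 by norm_num]; exact mul_ne_zero h2' h2'
  have h2a : (((2 * 8 : ℤ)) : ZMod ℓ) ≠ 0 := by
    push_cast
    norm_num
    rw [show (16 : ZMod ℓ) = 4 * 4 by norm_num]; exact mul_ne_zero h4 h4
  have hS := dup_sq (a := 8) (m := 1) (by norm_num) hdQ huQ hwQ hR (by exact_mod_cast hw)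
  have hden : Red ℓ (2 * d * u * w) (2 * d * u * w : ZMod ℓ) := by
    simpa using Red.int (ℓ := ℓ) (2 * d * u * w)
  have hx1 : Red ℓ (u ^ 4 - 8 * ((1 : ℤ) : ℚ) ^ 2 * d ^ 4) (u ^ 4 - 8 * d ^ 4 : ZMod ℓ) := by
    have := Red.int (ℓ := ℓ) (u ^ 4 - 8 * d ^ 4)
    push_cast at this
    simpa using this
  have hy1 : Red ℓ (w ^ 4 + 32 * ((1 : ℤ) : ℚ) ^ 2 * u ^ 4 * d ^ 4) (0 : ZMod ℓ) := by
    have := Red.int (ℓ := ℓ) (w ^ 4 + 32 * u ^ 4 * d ^ 4)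
    push_cast at this
    rw [e] at this
    simpa using this
  have hX := (hx1.pow 2).div (hden.pow 2) (pow_ne_zero 2 h2)
  have hY := (hx1.mul hy1).div (hden.pow 3) (pow_ne_zero 3 h2)
  obtain ⟨Sb, hSb, hSr⟩ := PRed.mk' (ℓ := ℓ) h2a hS hX hY
  have hSb2 : Sb + Sb = 0 := hSb.add_neg (by simpa using hSb)
  have hi' := hSr.zsmul h2a hSb.ne_zero i
  rw [odd_smul hSb2 hi] at hi'
  obtain ⟨x, y, h5, h6, h7⟩ := hi'.affine hSb
  refine ⟨w ^ 2 / (4 * u ^ 2 * d ^ 2), ?_, ?_, x, y, h5, ?_, ?_⟩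
  · field_simp
    linear_combination e
  · field_simp
  · convert h6 using 1
    field_simp
    linear_combination 4 * e + 4 * (u ^ 4 + 8 * d ^ 4 + w ^ 2) * ew
  · convert h7 using 1
    ring

/-- The function attached to the first curve. -/
def F1 {R : Type} [CommRing R] (κ x y : R) : R := fv κ (2 * (x - 1)) (y - x - 2)

theorem F1_red {ℓ : ℕ} [Fact ℓ.Prime] {k : ℤ} {x y : ℚ} {xb yb : ZMod ℓ}
    (hx : Red ℓ x xb) (hy : Red ℓ y yb) : Red ℓ (F1 (k : ℚ) x y) (F1 (k : ZMod ℓ) xb yb) :=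
  fv_red (Red.int k) ((Red.ofNat 2).mul (hx.sub Red.one)) ((hy.sub hx).sub (Red.ofNat 2))

theorem cohn1_sq {ℓ : ℕ} [Fact ℓ.Prime] {u d w : ℤ} (hu : u ≠ 0) (hd : d ≠ 0) (hw0 : w ≠ 0)
    (hw : w ^ 2 = u ^ 4 + 8 * 1 ^ 2 * d ^ 4) (hN : (ℓ : ℤ) ∣ w ^ 4 + 32 * u ^ 4 * d ^ 4)
    (h2 : (2 * d * u * w : ZMod ℓ) ≠ 0) (h3 : (3 : ZMod ℓ) ≠ 0) {R : (EC (((8 : ℤ)) : ℚ)).Point}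
    (hR : IsPt R ((u : ℚ) ^ 2 / d ^ 2) (u * w / d ^ 3)) {i : ℤ} (hi : i % 2 = 1)
    {σ κ : ℤ} (hσ : σ = 1 ∧ κ = 16 ∨ σ = -1 ∧ κ = 4)
    (hsq : ∀ x y, IsPt (i • (R + R)) x y → ∃ s, F1 (κ : ℚ) x y = s ^ 2) :
    ∃ c : ZMod ℓ,
      c ^ 2 = ((3 * σ * w ^ 2 - 20 * u ^ 2 * d ^ 2 : ℤ) : ZMod ℓ) := by
  obtain ⟨ρ, h1, h4, x, y, h5, h6, h7⟩ := cohn1_loc hu hd hw0 hw hN h2 hR hi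
  obtain ⟨s, hs⟩ := hsq x y h5
  have h8 := F1_red (k := κ) h6 h7
  rw [hs] at h8
  obtain ⟨c, _, hc⟩ := red_of_sq h8
  have h2' : (2 : ZMod ℓ) ≠ 0 := fun h => h2 (by rw [h]; ring)
  have hρ : ρ ≠ 0 := by
    rintro rfl
    apply h2'
    linear_combination h1
  have h5ρ : 5 - ρ ≠ 0 := by
    intro h
    have : (3 : ZMod ℓ) ^ 3 = 0 := by linear_combination h1 + (5 + ρ) * h
    exact h3 (pow_eq_zero_iff three_ne_zero |>.1 this)
  have h16 : (16 : ZMod ℓ) ≠ 0 := by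
    rw [show (16 : ZMod ℓ) = 2 ^ 4 by norm_num]; exact pow_ne_zero _ h2'
  rcases hσ with ⟨rfl, rfl⟩ | ⟨rfl, rfl⟩
  · refine ⟨c / (16 * ρ * (5 - ρ)) * (2 * u * d), ?_⟩
    have : F1 (((16 : ℤ)) : ZMod ℓ) (2 * ρ) 0 = (3 * ρ - 5) * (16 * ρ * (5 - ρ)) ^ 2 := by
      unfold F1 fv
      push_cast
      have h3' : ρ ^ 3 = -2 * ρ := by linear_combination ρ * h1
      have h4' : ρ ^ 4 = 4 := by linear_combination (ρ ^ 2 - 2) * h1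
      have h5' : ρ ^ 5 = 4 * ρ := by linear_combination ρ * h4'
      have h6' : ρ ^ 6 = -8 := by linear_combination ρ ^ 2 * h4' + 4 * h1
      ring_nf
      rw [h3', h4', h5', h6', h1]
      ring
    rw [this] at hc
    rw [mul_pow, div_pow, hc, mul_div_assoc, div_self (pow_ne_zero 2 (mul_ne_zero (mul_ne_zero h16 hρ) h5ρ))]
    push_cast
    linear_combination 3 * h4
  · refine ⟨c / (16 * (5 - ρ)) * (2 * u * d), ?_⟩
    have : F1 (((4 : ℤ)) : ZMod ℓ) (2 * ρ) 0 = (-3 * ρ - 5) * (16 * (5 - ρ)) ^ 2 := by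
      unfold F1 fv
      push_cast
      have h3' : ρ ^ 3 = -2 * ρ := by linear_combination ρ * h1
      have h4' : ρ ^ 4 = 4 := by linear_combination (ρ ^ 2 - 2) * h1
      have h5' : ρ ^ 5 = 4 * ρ := by linear_combination ρ * h4'
      have h6' : ρ ^ 6 = -8 := by linear_combination ρ ^ 2 * h4' + 4 * h1
      ring_nf
      rw [h3', h4', h5', h6', h1]
      ring
    rw [this] at hc
    rw [mul_pow, div_pow, hc, mul_div_assoc, div_self (pow_ne_zero 2 (mul_ne_zero h16 h5ρ))]
    push_cast
    linear_combination (-3) * h4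

open scoped NumberTheorySymbols

theorem int_dvd_two_contra {p : ℤ} (hp : Prime p) {x : ℤ} (hx : x % 2 = 1) (h : p ∣ x)
    (h2 : p ∣ 2) : False := by
  have := (Prime.dvd_prime_iff_associated hp int_prime_two).1 h2
  have : (2 : ℤ) ∣ x := this.symm.dvd.trans h
  omega

theorem jac_neg_one {N : ℕ} (h : N % 4 = 1) : J(-1 | N) = 1 := by
  rw [jacobiSym.at_neg_one (Nat.odd_iff.2 (by omega)), ZMod.χ₄_nat_one_mod_four h]

theorem jac_natAbs {N : ℕ} (h : N % 4 = 1) (M : ℤ) : J(M | N) = J((M.natAbs : ℤ) | N) := by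
  rcases Int.natAbs_eq M with h1 | h1
  · conv_lhs => rw [h1]
  · conv_lhs => rw [h1, ← neg_one_mul, jacobiSym.mul_left, jac_neg_one h, one_mul]

/-- reciprocity for `M ≡ 1 mod 4` and `q ≡ 3 mod 4` with sign. -/
theorem jac_recip_abs {q : ℕ} (hq : q % 4 = 3) {M : ℤ} (hM : M % 4 = 1) :
    J((q : ℤ) | M.natAbs) = J(M | q) := by
  have hqo : Odd q := Nat.odd_iff.2 (by omega)
  rcases Int.natAbs_eq M with h1 | h1
  · have h2 : M.natAbs % 4 = 1 := by omega
    rw [jacobiSym.quadratic_reciprocity_one_mod_four' hqo h2, ← h1]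
  · have h2 : M.natAbs % 4 = 3 := by omega
    rw [jacobiSym.quadratic_reciprocity_three_mod_four hq h2]
    conv_rhs => rw [h1, ← neg_one_mul, jacobiSym.mul_left, jacobiSym.at_neg_one hqo,
      ZMod.χ₄_nat_three_mod_four hq]
    ring

theorem sq_mod_of_odd {w : ℤ} (h : w % 2 = 1) : w ^ 2 % 8 = 1 := by
  have : w % 8 = 1 ∨ w % 8 = 3 ∨ w % 8 = 5 ∨ w % 8 = 7 := by omega
  rcases this with h | h | h | h <;> simp [pow_two, Int.mul_emod, h]

theorem odd_u {m u d w : ℤ} (hm : m % 2 = 1) (hc : IsCoprime u d) (hw : w ^ 2 = u ^ 4 + 8 * m ^ 2 * d ^ 4) : u % 2 = 1 := by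
  by_contra h
  obtain ⟨v, rfl⟩ : (2 : ℤ) ∣ u := by omega
  have hd : d % 2 = 1 := by
    by_contra h
    have h2 : (2 : ℤ) ∣ d := by omega
    exact cop_contra int_prime_two hc ⟨v, rfl⟩ h2
  have h2 : (2 : ℤ) ∣ w := int_prime_two.dvd_of_dvd_pow (n := 2) ⟨8 * v ^ 4 + 4 * m ^ 2 * d ^ 4, by rw [hw]; ring⟩
  obtain ⟨x, rfl⟩ := h2
  have h3 : x ^ 2 = 2 * (2 * v ^ 4 + m ^ 2 * d ^ 4) := by linarith
  have h2 : (2 : ℤ) ∣ x := int_prime_two.dvd_of_dvd_pow (n := 2) ⟨_, h3⟩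
  obtain ⟨y, rfl⟩ := h2
  have h4 : (m * d ^ 2) ^ 2 = 2 * (y ^ 2 - v ^ 4) := by linarith
  have h5 : (m * d ^ 2) ^ 2 % 8 = 1 := by
    apply sq_mod_of_odd
    rw [Int.mul_emod, hm]
    have := sq_mod_of_odd hd
    omega
  omega

theorem cohn1_facts {u d w : ℤ} (hc : IsCoprime u d) (hw : w ^ 2 = u ^ 4 + 8 * 1 ^ 2 * d ^ 4)
    (h3 : (3 : ℤ) ∣ d) {N : ℕ} (hN : (N : ℤ) = w ^ 4 + 32 * u ^ 4 * d ^ 4) :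
    w % 2 = 1 ∧ N % 4 = 1 ∧ N % 3 = 1 ∧
      ∀ p : ℤ, Prime p → p ∣ w → p ∣ u ^ 2 * d ^ 2 → False := by
  have hu2 := odd_u (by norm_num) hc hw
  have hw2 : w % 2 = 1 := by
    by_contra h
    obtain ⟨v, rfl⟩ : (2 : ℤ) ∣ w := by omega
    have : (2 : ℤ) ∣ u := int_prime_two.dvd_of_dvd_pow (n := 4) ⟨2 * v ^ 2 - 4 * d ^ 4, by linarith⟩
    omega
  have hw8 := sq_mod_of_odd hw2
  have hu3 : u % 3 = 1 ∨ u % 3 = 2 := by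
    by_contra h
    have : (3 : ℤ) ∣ u := by omega
    exact cop_contra Int.prime_three hc this h3
  have hN4 : N % 4 = 1 := by
    have h1 : w ^ 4 = (w ^ 2) ^ 2 := by ring
    have h2 : (w ^ 2) ^ 2 % 8 = 1 := sq_mod_of_odd (by omega)
    have h4 : (N : ℤ) % 4 = 1 := by
      rw [hN, h1, show 32 * u ^ 4 * d ^ 4 = 4 * (8 * u ^ 4 * d ^ 4) by ring]
      omega
    omega
  have hN3 : N % 3 = 1 := by
    obtain ⟨e, rfl⟩ := h3
    have h1 : (N : ℤ) = (u ^ 4) ^ 2 + 3 * (e ^ 4 * (864 * u ^ 4 + 432 * u ^ 4 + (648 * 216) * e ^ 4)) := by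
      rw [hN, show w ^ 4 = (w ^ 2) ^ 2 by ring, hw]; ring
    have h2 : (u ^ 4) ^ 2 % 3 = 1 := by
      rcases hu3 with h | h <;> simp [pow_succ, Int.mul_emod, h]
    have : (N : ℤ) % 3 = 1 := by rw [h1]; omega
    omega
  have hcw : ∀ p : ℤ, Prime p → p ∣ w → p ∣ u ^ 2 * d ^ 2 → False := by
    intro p hp h1 h4
    have hp2 : ¬ p ∣ 2 := fun h => int_dvd_two_contra hp hw2 h1 h
    have e1 : u ^ 4 = w * w - 8 * d ^ 4 := by rw [← pow_two, hw]; ring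
    rcases hp.dvd_or_dvd h4 with h5 | h5
    · have h6 := hp.dvd_of_dvd_pow h5
      have h7 : p ∣ 2 * 2 * 2 * d ^ 4 := by
        have : 2 * 2 * 2 * d ^ 4 = w * w - u * u ^ 3 := by linear_combination -hw
        rw [this]; exact dvd_sub (h1.mul_right _) (h6.mul_right _)
      rcases hp.dvd_or_dvd h7 with h8 | h8
      · rcases hp.dvd_or_dvd h8 with h8 | h8
        · rcases hp.dvd_or_dvd h8 with h8 | h8 <;> exact hp2 h8
        · exact hp2 h8
      · exact cop_contra hp hc h6 (hp.dvd_of_dvd_pow h8)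
    · have h6 := hp.dvd_of_dvd_pow h5
      have h7 : p ∣ u ^ 4 := by
        rw [e1]; exact dvd_sub (h1.mul_right _) ((dvd_pow h6 four_ne_zero).mul_left _)
      exact cop_contra hp hc (hp.dvd_of_dvd_pow h7) h6
  exact ⟨hw2, hN4, hN3, hcw⟩

theorem cohn1_jac {u d w β σ : ℤ} (hc : IsCoprime u d) (hw : w ^ 2 = u ^ 4 + 8 * 1 ^ 2 * d ^ 4)
    (h3 : (3 : ℤ) ∣ d) (hβ : 3 * β = u ^ 2 * d ^ 2) (hσ : σ = 1 ∨ σ = -1) {N : ℕ}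
    (hN : (N : ℤ) = w ^ 4 + 32 * u ^ 4 * d ^ 4) :
    J(3 * σ * w ^ 2 - 20 * u ^ 2 * d ^ 2 | N) = J(w ^ 2 - σ * 20 * β | 43) := by
  obtain ⟨hw2, hN4, hN3, hcw'⟩ := cohn1_facts hc hw h3 hN
  have hw8 := sq_mod_of_odd hw2
  have hcw : ∀ p : ℤ, Prime p → p ∣ w → p ∣ β → False := fun p hp h1 h2 =>
    hcw' p hp h1 (hβ ▸ h2.mul_left 3)
  have hσ2 : σ ^ 2 = 1 := by rcases hσ with rfl | rfl <;> norm_num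
  set M := w ^ 2 - σ * 20 * β with hM
  have hM4 : M % 4 = 1 := by
    rw [hM, show w ^ 2 - σ * 20 * β = w ^ 2 - 4 * (σ * 5 * β) by ring]; omega
  have e1 : 3 * σ * w ^ 2 - 20 * u ^ 2 * d ^ 2 = 3 * σ * M := by
    rw [hM]; linear_combination 20 * hβ + 60 * β * hσ2
  have hJσ : J(σ | N) = 1 := by
    rcases hσ with rfl | rfl
    · exact jacobiSym.one_left N
    · exact jac_neg_one hN4
  have hJ3 : J(3 | N) = 1 := by
    have := jacobiSym.quadratic_reciprocity_one_mod_four' (a := 3) (b := N) (by decide) hN4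
    rw [show ((3 : ℕ) : ℤ) = 3 from rfl] at this
    rw [this, jacobiSym.mod_left]
    have : ((N : ℤ)) % ((3 : ℕ) : ℤ) = 1 := by omega
    rw [this, jacobiSym.one_left]
  rw [e1, jacobiSym.mul_left, jacobiSym.mul_left, hJσ, hJ3, one_mul, one_mul, jac_natAbs hN4]
  have hodd : Odd M.natAbs := by rw [Nat.odd_iff]; omega
  rw [jacobiSym.quadratic_reciprocity_one_mod_four' hodd hN4]
  have e2 : J((N : ℤ) | M.natAbs) = J(43 * (4 * β) ^ 2 | M.natAbs) := by
    apply jacobiSym.mod_left'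
    apply Int.ModEq.symm
    rw [Int.modEq_iff_dvd]
    rw [Int.natAbs_dvd]
    refine ⟨w ^ 2 + σ * 20 * β, ?_⟩
    rw [hN, hM]
    linear_combination (-32 * u ^ 2 * d ^ 2 - 96 * β) * hβ + 400 * β ^ 2 * hσ2
  have hgcd : Int.gcd (4 * β) M.natAbs = 1 := by
    rw [← Int.isCoprime_iff_gcd_eq_one]
    apply int_coprime_of_primes
    swap
    · right; omega
    intro p hp' h1 h2
    rw [Int.dvd_natAbs] at h2
    have hp2 : ¬ p ∣ 2 := fun h => int_dvd_two_contra hp' (by omega) h2 h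
    rcases hp'.dvd_or_dvd h1 with h3 | h3
    · rw [show (4 : ℤ) = 2 * 2 by norm_num] at h3
      rcases hp'.dvd_or_dvd h3 with h3 | h3 <;> exact hp2 h3
    · refine hcw p hp' ?_ h3
      apply hp'.dvd_of_dvd_pow (n := 2)
      have : w ^ 2 = M + σ * 20 * β := by rw [hM]; ring
      rw [this]
      exact dvd_add h2 (h3.mul_left _)
  rw [e2, jacobiSym.mul_left, jacobiSym.sq_one' hgcd, mul_one]
  exact jac_recip_abs (q := 43) (by norm_num) hM4

instance fact3 : Fact (Nat.Prime 3) := ⟨by norm_num⟩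
instance fact43 : Fact (Nat.Prime 43) := ⟨by norm_num⟩

theorem cohn1 {G : (EC (((8 : ℤ)) : ℚ)).Point} (hG : IsPt G 1 (-3)) {n r r' i : ℤ}
    (hr : r = r' + r') (hn : n = (r + r) * i) (hi : i % 2 = 1) (hn0 : n • G ≠ 0)
    {σ κ : ℤ} (hσ : σ = 1 ∧ κ = 16 ∨ σ = -1 ∧ κ = 4)
    (hsq : ∀ x y, IsPt (n • G) x y → ∃ s, F1 (κ : ℚ) x y = s ^ 2)
    {xb yb cb : ZMod 43} (hb : ∀ Gb : (EC (((8 : ℤ)) : ZMod 43)).Point,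
      IsPt ((1 : ℤ) • Gb) ((1 : ℤ) : ZMod 43) ((-3 : ℤ) : ZMod 43) → IsPt (r • Gb) xb yb)
    (hcb : cb ≠ 0) (hcb2 : 3 * (xb ^ 2 + 8) - (σ : ZMod 43) * 20 * xb = cb ^ 2) : False := by
  have hS : n • G = i • (r • G + r • G) := by rw [hn, mul_comm, mul_zsmul, add_zsmul]
  rw [hS] at hn0 hsq
  have hG' : IsPt G ((1 : ℤ) : ℚ) ((-3 : ℤ) : ℚ) := by simpa using hG
  obtain ⟨u, d, w, hc, hu, hd, hw0, hw, hR⟩ := dbl_struct (m := 1) (by norm_num) (by norm_num)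
    (R := r • G) (R' := r' • G) (by rw [hr, add_zsmul]) (fun h => hn0 (by rw [h, zsmul_zero]))
  have hdQ : (d : ℚ) ≠ 0 := by exact_mod_cast hd
  have huQ : (u : ℚ) ≠ 0 := by exact_mod_cast hu
  -- divisibility by 3
  have h3 : (3 : ℤ) ∣ d := by
    obtain ⟨Gb, h1, h2⟩ := gen_red (ℓ := 3) (by norm_num) hG'
    have h4 : (2 : ℤ) • Gb = 0 := zzero h1 h1 (by norm_num) (by norm_num)
    have h5 : r • Gb = 0 := by
      rw [hr, ← two_mul, mul_comm, mul_zsmul, h4, zsmul_zero]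
    have h6 := h2 r
    rw [h5] at h6
    by_contra hcon
    have hd3 : (d : ZMod 3) ≠ 0 := fun h => hcon ((ZMod.intCast_zmod_eq_zero_iff_dvd _ 3).1 h)
    obtain ⟨_, h7, _⟩ := h6.of_red hR (((Red.int u).pow 2).div ((Red.int d).pow 2) (pow_ne_zero 2 hd3))
    exact h7.ne_zero rfl
  obtain ⟨β, hβ⟩ : ∃ β, 3 * β = u ^ 2 * d ^ 2 := by
    obtain ⟨e, rfl⟩ := h3
    exact ⟨3 * u ^ 2 * e ^ 2, by ring⟩
  obtain ⟨N, hN⟩ : ∃ N : ℕ, (N : ℤ) = w ^ 4 + 32 * u ^ 4 * d ^ 4 :=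
    ⟨(w ^ 4 + 32 * u ^ 4 * d ^ 4).toNat, Int.toNat_of_nonneg (by positivity)⟩
  obtain ⟨hw2, hN4, hN3, hcw⟩ := cohn1_facts hc hw h3 hN
  have hσ' : σ = 1 ∨ σ = -1 := hσ.imp And.left And.left
  have hJ : J(w ^ 2 - σ * 20 * β | 43) ≠ -1 := by
    rw [← cohn1_jac hc hw h3 hβ hσ' hN]
    intro hJ
    obtain ⟨p, hp, hpN, hpJ⟩ := jacobiSym.eq_neg_one_at_prime_divisor_of_eq_neg_one hJ
    haveI : Fact p.Prime := ⟨hp⟩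
    have hp' := natPrime_int hp
    have hpN' : (p : ℤ) ∣ w ^ 4 + 32 * u ^ 4 * d ^ 4 := by rw [← hN]; exact_mod_cast hpN
    have hp2 : ¬ (p : ℤ) ∣ 2 := fun h => dvd_two_contra (x := N) hp (by omega) (by exact_mod_cast hpN) h
    have hpw : ¬ (p : ℤ) ∣ w := by
      intro h
      refine hcw p hp' h ?_
      apply hp'.dvd_of_dvd_pow (n := 2)
      have h1 : (p : ℤ) ∣ 2 ^ 5 * (u ^ 2 * d ^ 2) ^ 2 := by
        have : 2 ^ 5 * (u ^ 2 * d ^ 2) ^ 2 = w ^ 4 + 32 * u ^ 4 * d ^ 4 - w ^ 4 := by ring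
        rw [this]; exact dvd_sub hpN' (dvd_pow h four_ne_zero)
      rcases hp'.dvd_or_dvd h1 with h2 | h2
      · exact absurd (hp'.dvd_of_dvd_pow h2) hp2
      · exact h2
    have hpu : ¬ (p : ℤ) ∣ u * d := by
      intro h
      apply hpw
      apply hp'.dvd_of_dvd_pow (n := 4)
      have : w ^ 4 = w ^ 4 + 32 * u ^ 4 * d ^ 4 - u * d * (32 * u ^ 3 * d ^ 3) := by ring
      rw [this]; exact dvd_sub hpN' (h.mul_right _)
    have hp3 : (3 : ZMod p) ≠ 0 := by
      intro h
      have h1 : ((3 : ℤ) : ZMod p) = 0 := by exact_mod_cast h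
      have h2 : p ∣ 3 := by exact_mod_cast (ZMod.intCast_zmod_eq_zero_iff_dvd _ p).1 h1
      have h3 : p = 3 := (Nat.prime_dvd_prime_iff_eq hp (by norm_num)).1 h2
      rw [h3] at hpN
      omega
    have h2 : (2 * d * u * w : ZMod p) ≠ 0 := by
      intro h
      have h1 : ((2 * (u * d) * w : ℤ) : ZMod p) = 0 := by push_cast; rw [← h]; ring
      have h2 := (ZMod.intCast_zmod_eq_zero_iff_dvd _ p).1 h1
      rcases hp'.dvd_or_dvd h2 with h3 | h3
      · rcases hp'.dvd_or_dvd h3 with h3 | h3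
        · exact hp2 h3
        · exact hpu h3
      · exact hpw h3
    exact znonsq hpJ (cohn1_sq hu hd hw0 hw hpN' h2 hp3 hR hi hσ hsq)
  -- reduction modulo 43
  obtain ⟨Gb, h1, h2⟩ := gen_red (ℓ := 43) (by norm_num) hG'
  have h4 := hb Gb h1
  obtain ⟨x, y, h5, h6, h7⟩ := (h2 r).affine h4
  obtain ⟨rfl, rfl⟩ := h5.unique hR
  have hd43 : (d : ZMod 43) ≠ 0 := by
    intro h
    have h8 := h6.mul ((Red.int (ℓ := 43) d).pow 2)
    rw [h, div_mul_cancel₀ _ (pow_ne_zero 2 hdQ)] at h8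
    have h9 := h8.unique ((Red.int (ℓ := 43) u).pow 2)
    have h10 : (u : ZMod 43) = 0 := by
      refine pow_eq_zero_iff two_ne_zero |>.1 (h9.symm.trans ?_)
      ring
    exact cop_contra (natPrime_int (by norm_num : Nat.Prime 43)) hc
      ((ZMod.intCast_zmod_eq_zero_iff_dvd _ 43).1 h10) ((ZMod.intCast_zmod_eq_zero_iff_dvd _ 43).1 h)
  have hxb : xb * (d : ZMod 43) ^ 2 = u ^ 2 := by
    have h8 := h6.mul ((Red.int (ℓ := 43) d).pow 2)
    rw [div_mul_cancel₀ _ (pow_ne_zero 2 hdQ)] at h8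
    exact h8.unique ((Red.int (ℓ := 43) u).pow 2)
  have hwz : (w : ZMod 43) ^ 2 = u ^ 4 + 8 * d ^ 4 := by
    have := congrArg (Int.cast : ℤ → ZMod 43) hw
    push_cast at this
    rw [this]
  have hβz : 3 * (β : ZMod 43) = u ^ 2 * d ^ 2 := by exact_mod_cast congrArg (Int.cast : ℤ → ZMod 43) hβ
  have hkey : ((3 * (w ^ 2 - σ * 20 * β) : ℤ) : ZMod 43) = (d ^ 2 * cb) ^ 2 := by
    push_cast
    rw [mul_pow, ← hcb2]
    linear_combination 3 * hwz - 20 * σ * hβz - (3 * (xb * d ^ 2 + u ^ 2) - 20 * σ * d ^ 2) * hxb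
  have hne : ((3 * (w ^ 2 - σ * 20 * β) : ℤ) : ZMod 43) ≠ 0 := by
    rw [hkey]
    exact pow_ne_zero 2 (mul_ne_zero (pow_ne_zero 2 hd43) hcb)
  have hleg : J(3 * (w ^ 2 - σ * 20 * β) | 43) = 1 := by
    rw [← jacobiSym.legendreSym.to_jacobiSym]
    exact (legendreSym.eq_one_iff 43 hne).2 ⟨d ^ 2 * cb, by rw [hkey, pow_two]⟩
  rw [jacobiSym.mul_left] at hleg
  have h3n : J(3 | 43) = -1 := by norm_num
  rw [h3n] at hleg
  apply hJ
  linarith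

open scoped NumberTheorySymbols

instance fact11 : Fact (Nat.Prime 11) := ⟨by norm_num⟩
instance fact19 : Fact (Nat.Prime 19) := ⟨by norm_num⟩
instance fact61 : Fact (Nat.Prime 61) := ⟨by norm_num⟩
instance fact113 : Fact (Nat.Prime 113) := ⟨by norm_num⟩
instance fact577 : Fact (Nat.Prime 577) := ⟨by norm_num⟩
instance fact1217 : Fact (Nat.Prime 1217) := ⟨by norm_num⟩
instance fact1459 : Fact (Nat.Prime 1459) := ⟨by norm_num⟩

theorem sv_use {ℓ : ℕ} [Fact ℓ.Prime] {G : (EC (((8 : ℤ)) : ℚ)).Point}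
    {Gb : (EC (((8 : ℤ)) : ZMod ℓ)).Point} {n k r x y κ : ℤ} (v : ℤ)
    (hred : PRed ℓ (n • G) (n • Gb)) (hz : k • Gb = 0) (h : n % k = r)
    (hr : IsPt (r • Gb) (x : ZMod ℓ) y)
    (hsq : ∀ x y, IsPt (n • G) x y → ∃ s, F1 (κ : ℚ) x y = s ^ 2)
    (hv : (F1 κ x y - v) % ℓ = 0) (hJ : J(v | ℓ) = -1) : False := by
  rw [zmod_smul hz (n := n), h] at hred
  obtain ⟨X, Y, h1, h2, h3⟩ := hred.affine hr
  obtain ⟨s, hs⟩ := hsq X Y h1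
  have h4 := F1_red (k := κ) h2 h3
  rw [hs] at h4
  obtain ⟨c, _, hc⟩ := red_of_sq h4
  refine znonsq hJ ⟨c, hc.trans ?_⟩
  rw [← zmod_eq_of hv]
  simp [F1, fv]

theorem sv1459 {G : (EC (((8 : ℤ)) : ℚ)).Point} (hG : IsPt G ((1 : ℤ) : ℚ) ((-3 : ℤ) : ℚ)) {n : ℤ}
    (hn : n % 2 = 0) (hsq : ∀ x y, IsPt (n • G) x y → ∃ s, F1 (((16 : ℤ)) : ℚ) x y = s ^ 2) :
    n % 10 = 0 := by
  obtain ⟨Gb, h1, hred⟩ := gen_red (ℓ := 1459) (by norm_num) hG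
  have h2 := zdbl (k := 2) h1 1214 204 132 (by norm_num) (by norm_num)
  have h4 := zdbl (k := 4) h2 694 1217 84 (by norm_num) (by norm_num)
  have h8 := zdbl (k := 8) h4 1289 204 1327 (by norm_num) (by norm_num)
  have h6 := zadd (k := 6) h4 h2 1289 1217 1375 (by norm_num) (by norm_num)
  have hz : (10 : ℤ) • Gb = 0 := zzero h8 h2 (by norm_num) (by norm_num)
  by_contra hcon
  have h : n % 10 = 2 ∨ n % 10 = 4 ∨ n % 10 = 6 ∨ n % 10 = 8 := by omega
  rcases h with h | h | h | h
  · exact sv_use (262) (hred _) hz h h2 hsq (by norm_num [F1, fv]) (by norm_num)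
  · exact sv_use (266) (hred _) hz h h4 hsq (by norm_num [F1, fv]) (by norm_num)
  · exact sv_use (498) (hred _) hz h h6 hsq (by norm_num [F1, fv]) (by norm_num)
  · exact sv_use (314) (hred _) hz h h8 hsq (by norm_num [F1, fv]) (by norm_num)

theorem sv1217 {G : (EC (((8 : ℤ)) : ℚ)).Point} (hG : IsPt G ((1 : ℤ) : ℚ) ((-3 : ℤ) : ℚ)) {n : ℤ}
    (hn : n % 10 = 0) (hsq : ∀ x y, IsPt (n • G) x y → ∃ s, F1 (((16 : ℤ)) : ℚ) x y = s ^ 2) :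
    n % 20 = 0 := by
  obtain ⟨Gb, h1, hred⟩ := gen_red (ℓ := 1217) (by norm_num) hG
  have h2 := zdbl (k := 2) h1 201 238 1046 (by norm_num) (by norm_num)
  have h4 := zdbl (k := 4) h2 1140 585 116 (by norm_num) (by norm_num)
  have h8 := zdbl (k := 8) h4 297 632 529 (by norm_num) (by norm_num)
  have h10 := zadd (k := 10) h8 h2 1157 296 0 (by norm_num) (by norm_num)
  have hz : (20 : ℤ) • Gb = 0 := zzero h10 h10 (by norm_num) (by norm_num)
  by_contra hcon
  have h : n % 20 = 10 := by omega
  exact sv_use (795) (hred _) hz h h10 hsq (by norm_num [F1, fv]) (by norm_num)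

theorem sv113 {G : (EC (((8 : ℤ)) : ℚ)).Point} (hG : IsPt G ((1 : ℤ) : ℚ) ((-3 : ℤ) : ℚ)) {n : ℤ}
    (hn : n % 2 = 0) (hsq : ∀ x y, IsPt (n • G) x y → ∃ s, F1 (((4 : ℤ)) : ℚ) x y = s ^ 2) :
    n % 4 = 0 := by
  obtain ⟨Gb, h1, hred⟩ := gen_red (ℓ := 113) (by norm_num) hG
  have h2 := zdbl (k := 2) h1 17 61 0 (by norm_num) (by norm_num)
  have hz : (4 : ℤ) • Gb = 0 := zzero h2 h2 (by norm_num) (by norm_num)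
  by_contra hcon
  have h : n % 4 = 2 := by omega
  exact sv_use (78) (hred _) hz h h2 hsq (by norm_num [F1, fv]) (by norm_num)

theorem sv11 {G : (EC (((8 : ℤ)) : ℚ)).Point} (hG : IsPt G ((1 : ℤ) : ℚ) ((-3 : ℤ) : ℚ)) {n : ℤ}
     (hsq : ∀ x y, IsPt (n • G) x y → ∃ s, F1 (((4 : ℤ)) : ℚ) x y = s ^ 2) :
    n % 6 ≠ 2 := by
  obtain ⟨Gb, h1, hred⟩ := gen_red (ℓ := 11) (by norm_num) hG
  have h2 := zdbl (k := 2) h1 0 9 3 (by norm_num) (by norm_num)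
  have h4 := zdbl (k := 4) h2 7 9 8 (by norm_num) (by norm_num)
  have hz : (6 : ℤ) • Gb = 0 := zzero h4 h2 (by norm_num) (by norm_num)
  intro h
  exact sv_use (10) (hred _) hz h h2 hsq (by norm_num [F1, fv]) (by norm_num)

theorem sv577 {G : (EC (((8 : ℤ)) : ℚ)).Point} (hG : IsPt G ((1 : ℤ) : ℚ) ((-3 : ℤ) : ℚ)) {n : ℤ}
     (hsq : ∀ x y, IsPt (n • G) x y → ∃ s, F1 (((4 : ℤ)) : ℚ) x y = s ^ 2) :
    n % 6 ≠ 4 := by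
  obtain ⟨Gb, h1, hred⟩ := gen_red (ℓ := 577) (by norm_num) hG
  have h2 := zdbl (k := 2) h1 479 370 391 (by norm_num) (by norm_num)
  have h4 := zdbl (k := 4) h2 416 370 186 (by norm_num) (by norm_num)
  have hz : (6 : ℤ) • Gb = 0 := zzero h4 h2 (by norm_num) (by norm_num)
  intro h
  exact sv_use (266) (hred _) hz h h4 hsq (by norm_num [F1, fv]) (by norm_num)

theorem sv19 {G : (EC (((8 : ℤ)) : ℚ)).Point} (hG : IsPt G ((1 : ℤ) : ℚ) ((-3 : ℤ) : ℚ)) {n : ℤ}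
    (hn : n % 2 = 0) (hsq : ∀ x y, IsPt (n • G) x y → ∃ s, F1 (((4 : ℤ)) : ℚ) x y = s ^ 2) :
    n % 10 = 0 ∨ n % 10 = 4 := by
  obtain ⟨Gb, h1, hred⟩ := gen_red (ℓ := 19) (by norm_num) hG
  have h2 := zdbl (k := 2) h1 14 4 18 (by norm_num) (by norm_num)
  have h4 := zdbl (k := 4) h2 10 16 14 (by norm_num) (by norm_num)
  have h8 := zdbl (k := 8) h4 6 4 1 (by norm_num) (by norm_num)
  have h6 := zadd (k := 6) h4 h2 6 16 5 (by norm_num) (by norm_num)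
  have hz : (10 : ℤ) • Gb = 0 := zzero h8 h2 (by norm_num) (by norm_num)
  by_contra hcon
  have h : n % 10 = 2 ∨ n % 10 = 6 ∨ n % 10 = 8 := by omega
  rcases h with h | h | h
  · exact sv_use (3) (hred _) hz h h2 hsq (by norm_num [F1, fv]) (by norm_num)
  · exact sv_use (2) (hred _) hz h h6 hsq (by norm_num [F1, fv]) (by norm_num)
  · exact sv_use (14) (hred _) hz h h8 hsq (by norm_num [F1, fv]) (by norm_num)

theorem sv61 {G : (EC (((8 : ℤ)) : ℚ)).Point} (hG : IsPt G ((1 : ℤ) : ℚ) ((-3 : ℤ) : ℚ)) {n : ℤ}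
     (hsq : ∀ x y, IsPt (n • G) x y → ∃ s, F1 (((4 : ℤ)) : ℚ) x y = s ^ 2) :
    n % 5 ≠ 2 := by
  obtain ⟨Gb, h1, hred⟩ := gen_red (ℓ := 61) (by norm_num) hG
  have h2 := zdbl (k := 2) h1 49 20 48 (by norm_num) (by norm_num)
  have h3 := zadd (k := 3) h2 h1 38 20 13 (by norm_num) (by norm_num)
  have hz : (5 : ℤ) • Gb = 0 := zzero h3 h2 (by norm_num) (by norm_num)
  intro h
  exact sv_use (28) (hred _) hz h h2 hsq (by norm_num [F1, fv]) (by norm_num)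

open scoped NumberTheorySymbols

theorem tab43 (Gb : (EC (((8 : ℤ)) : ZMod 43)).Point)
    (h1 : IsPt ((1 : ℤ) • Gb) ((1 : ℤ) : ZMod 43) ((-3 : ℤ) : ZMod 43)) : (22 : ℤ) • Gb = 0 ∧
    IsPt ((2 : ℤ) • Gb) ((36 : ℤ) : ZMod 43) ((17 : ℤ) : ZMod 43) ∧
    IsPt ((4 : ℤ) • Gb) ((25 : ℤ) : ZMod 43) ((42 : ℤ) : ZMod 43) ∧
    IsPt ((6 : ℤ) • Gb) ((6 : ℤ) : ZMod 43) ((36 : ℤ) : ZMod 43) ∧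
    IsPt ((8 : ℤ) • Gb) ((24 : ℤ) : ZMod 43) ((27 : ℤ) : ZMod 43) ∧
    IsPt ((10 : ℤ) • Gb) ((4 : ℤ) : ZMod 43) ((28 : ℤ) : ZMod 43) ∧
    IsPt ((12 : ℤ) • Gb) ((4 : ℤ) : ZMod 43) ((15 : ℤ) : ZMod 43) ∧
    IsPt ((14 : ℤ) • Gb) ((24 : ℤ) : ZMod 43) ((16 : ℤ) : ZMod 43) ∧
    IsPt ((16 : ℤ) • Gb) ((6 : ℤ) : ZMod 43) ((7 : ℤ) : ZMod 43) ∧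
    IsPt ((18 : ℤ) • Gb) ((25 : ℤ) : ZMod 43) ((1 : ℤ) : ZMod 43) ∧
    IsPt ((20 : ℤ) • Gb) ((36 : ℤ) : ZMod 43) ((26 : ℤ) : ZMod 43) := by
  have h2 := zdbl (k := 2) h1 34 36 17 (by norm_num) (by norm_num)
  have h4 := zdbl (k := 4) h2 21 25 42 (by norm_num) (by norm_num)
  have h6 := zadd (k := 6) h4 h2 29 6 36 (by norm_num) (by norm_num)
  have h8 := zadd (k := 8) h6 h2 18 24 27 (by norm_num) (by norm_num)
  have h10 := zadd (k := 10) h8 h2 35 4 28 (by norm_num) (by norm_num)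
  have h12 := zadd (k := 12) h10 h2 1 4 15 (by norm_num) (by norm_num)
  have h14 := zadd (k := 14) h12 h2 35 24 16 (by norm_num) (by norm_num)
  have h16 := zadd (k := 16) h14 h2 18 6 7 (by norm_num) (by norm_num)
  have h18 := zadd (k := 18) h16 h2 29 25 1 (by norm_num) (by norm_num)
  have h20 := zadd (k := 20) h18 h2 21 36 26 (by norm_num) (by norm_num)
  have hz : (22 : ℤ) • Gb = 0 := zzero h20 h2 (by norm_num) (by norm_num)
  exact ⟨hz, h2, h4, h6, h8, h10, h12, h14, h16, h18, h20⟩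

theorem smul_res43 {r ρ : ℤ} {Gb : (EC (((8 : ℤ)) : ZMod 43)).Point} (hz : (22 : ℤ) • Gb = 0)
    (h : r % 22 = ρ) : r • Gb = ρ • Gb := by
  rw [zmod_smul hz, h]

theorem cohn1_16 {G : (EC (((8 : ℤ)) : ℚ)).Point} (hG : IsPt G 1 (-3)) {n r r' i : ℤ}
    (hr : r = r' + r') (hn : n = (r + r) * i) (hi : i % 2 = 1) (hn0 : n • G ≠ 0)
    (hsq : ∀ x y, IsPt (n • G) x y → ∃ s, F1 (((16 : ℤ)) : ℚ) x y = s ^ 2) :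
    ¬ (r % 22 = 2 ∨ r % 22 = 4 ∨ r % 22 = 8 ∨ r % 22 = 10 ∨ r % 22 = 12 ∨ r % 22 = 14 ∨ r % 22 = 18 ∨ r % 22 = 20) := by
  intro h
  rcases h with h | h | h | h | h | h | h | h
  · refine cohn1 hG hr hn hi hn0 (σ := 1) (by norm_num) hsq (cb := 15) (xb := ((36 : ℤ) : ZMod 43))
      (yb := ((17 : ℤ) : ZMod 43)) (fun Gb h1 => ?_) (by decide) (by decide)
    obtain ⟨hz, hh⟩ := tab43 Gb h1
    rw [smul_res43 hz h]
    exact hh.1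
  · refine cohn1 hG hr hn hi hn0 (σ := 1) (by norm_num) hsq (cb := 18) (xb := ((25 : ℤ) : ZMod 43))
      (yb := ((42 : ℤ) : ZMod 43)) (fun Gb h1 => ?_) (by decide) (by decide)
    obtain ⟨hz, hh⟩ := tab43 Gb h1
    rw [smul_res43 hz h]
    exact hh.2.1
  · refine cohn1 hG hr hn hi hn0 (σ := 1) (by norm_num) hsq (cb := 5) (xb := ((24 : ℤ) : ZMod 43))
      (yb := ((27 : ℤ) : ZMod 43)) (fun Gb h1 => ?_) (by decide) (by decide)
    obtain ⟨hz, hh⟩ := tab43 Gb h1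
    rw [smul_res43 hz h]
    exact hh.2.2.2.1
  · refine cohn1 hG hr hn hi hn0 (σ := 1) (by norm_num) hsq (cb := 11) (xb := ((4 : ℤ) : ZMod 43))
      (yb := ((28 : ℤ) : ZMod 43)) (fun Gb h1 => ?_) (by decide) (by decide)
    obtain ⟨hz, hh⟩ := tab43 Gb h1
    rw [smul_res43 hz h]
    exact hh.2.2.2.2.1
  · refine cohn1 hG hr hn hi hn0 (σ := 1) (by norm_num) hsq (cb := 11) (xb := ((4 : ℤ) : ZMod 43))
      (yb := ((15 : ℤ) : ZMod 43)) (fun Gb h1 => ?_) (by decide) (by decide)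
    obtain ⟨hz, hh⟩ := tab43 Gb h1
    rw [smul_res43 hz h]
    exact hh.2.2.2.2.2.1
  · refine cohn1 hG hr hn hi hn0 (σ := 1) (by norm_num) hsq (cb := 5) (xb := ((24 : ℤ) : ZMod 43))
      (yb := ((16 : ℤ) : ZMod 43)) (fun Gb h1 => ?_) (by decide) (by decide)
    obtain ⟨hz, hh⟩ := tab43 Gb h1
    rw [smul_res43 hz h]
    exact hh.2.2.2.2.2.2.1
  · refine cohn1 hG hr hn hi hn0 (σ := 1) (by norm_num) hsq (cb := 18) (xb := ((25 : ℤ) : ZMod 43))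
      (yb := ((1 : ℤ) : ZMod 43)) (fun Gb h1 => ?_) (by decide) (by decide)
    obtain ⟨hz, hh⟩ := tab43 Gb h1
    rw [smul_res43 hz h]
    exact hh.2.2.2.2.2.2.2.2.1
  · refine cohn1 hG hr hn hi hn0 (σ := 1) (by norm_num) hsq (cb := 15) (xb := ((36 : ℤ) : ZMod 43))
      (yb := ((26 : ℤ) : ZMod 43)) (fun Gb h1 => ?_) (by decide) (by decide)
    obtain ⟨hz, hh⟩ := tab43 Gb h1
    rw [smul_res43 hz h]
    exact hh.2.2.2.2.2.2.2.2.2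

theorem cohn1_4 {G : (EC (((8 : ℤ)) : ℚ)).Point} (hG : IsPt G 1 (-3)) {n r r' i : ℤ}
    (hr : r = r' + r') (hn : n = (r + r) * i) (hi : i % 2 = 1) (hn0 : n • G ≠ 0)
    (hsq : ∀ x y, IsPt (n • G) x y → ∃ s, F1 (((4 : ℤ)) : ℚ) x y = s ^ 2) :
    ¬ (r % 22 = 2 ∨ r % 22 = 10 ∨ r % 22 = 12 ∨ r % 22 = 20) := by
  intro h
  rcases h with h | h | h | h
  · refine cohn1 hG hr hn hi hn0 (σ := -1) (by norm_num) hsq (cb := 17) (xb := ((36 : ℤ) : ZMod 43))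
      (yb := ((17 : ℤ) : ZMod 43)) (fun Gb h1 => ?_) (by decide) (by decide)
    obtain ⟨hz, hh⟩ := tab43 Gb h1
    rw [smul_res43 hz h]
    exact hh.1
  · refine cohn1 hG hr hn hi hn0 (σ := -1) (by norm_num) hsq (cb := 18) (xb := ((4 : ℤ) : ZMod 43))
      (yb := ((28 : ℤ) : ZMod 43)) (fun Gb h1 => ?_) (by decide) (by decide)
    obtain ⟨hz, hh⟩ := tab43 Gb h1
    rw [smul_res43 hz h]
    exact hh.2.2.2.2.1
  · refine cohn1 hG hr hn hi hn0 (σ := -1) (by norm_num) hsq (cb := 18) (xb := ((4 : ℤ) : ZMod 43))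
      (yb := ((15 : ℤ) : ZMod 43)) (fun Gb h1 => ?_) (by decide) (by decide)
    obtain ⟨hz, hh⟩ := tab43 Gb h1
    rw [smul_res43 hz h]
    exact hh.2.2.2.2.2.1
  · refine cohn1 hG hr hn hi hn0 (σ := -1) (by norm_num) hsq (cb := 17) (xb := ((36 : ℤ) : ZMod 43))
      (yb := ((26 : ℤ) : ZMod 43)) (fun Gb h1 => ?_) (by decide) (by decide)
    obtain ⟨hz, hh⟩ := tab43 Gb h1
    rw [smul_res43 hz h]
    exact hh.2.2.2.2.2.2.2.2.2


theorem two_pow_split {n : ℤ} (hn : n ≠ 0) : ∃ k : ℕ, ∃ j : ℤ, n = 2 ^ k * j ∧ j % 2 = 1 := by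
  obtain ⟨j, h1, h2⟩ := (Int.finiteMultiplicity_iff.2 ⟨by norm_num, hn⟩ :
    FiniteMultiplicity (2 : ℤ) n).exists_eq_pow_mul_and_not_dvd
  exact ⟨_, j, h1, by omega⟩

theorem two_pow_11 (k : ℕ) : (2 : ℤ) ^ k % 11 ≠ 0 := by
  intro h
  have h1 := Int.Prime.dvd_pow' (by norm_num : Nat.Prime 11) (Int.dvd_of_emod_eq_zero h)
  norm_num at h1

theorem odd_dvd_of {n j q : ℤ} {k : ℕ} (h : n = 2 ^ k * j) (hq : q % 2 = 1) (hd : q ∣ n) : q ∣ j := by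
  have h2 : IsCoprime q (2 ^ k) := by
    apply IsCoprime.pow_right
    exact ⟨1, -(q / 2), by omega⟩
  exact h2.dvd_of_dvd_mul_left (h ▸ hd)

/-- `n = 4 r₀ j` with `r₀` a power of two, `j` odd. -/
theorem four_split {n : ℤ} (hn : n ≠ 0) (h4 : n % 4 = 0) :
    ∃ k : ℕ, ∃ r j : ℤ, r = 2 ^ k ∧ n = 4 * r * j ∧ j % 2 = 1 ∧
      ∀ q : ℤ, q % 2 = 1 → q ∣ n → q ∣ j := by
  obtain ⟨k, j, h1, h2⟩ := two_pow_split hn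
  obtain _ | _ | k := k
  · omega
  · omega
  · exact ⟨k, 2 ^ k, j, rfl, by rw [h1]; ring, h2, fun q hq hd => odd_dvd_of h1 hq hd⟩

theorem end1_16 {G : (EC (((8 : ℤ)) : ℚ)).Point} (hG : IsPt G 1 (-3)) {n : ℤ} (hn : n % 2 = 0)
    (hn0 : n • G ≠ 0)
    (hsq : ∀ x y, IsPt (n • G) x y → ∃ s, F1 (((16 : ℤ)) : ℚ) x y = s ^ 2) : False := by
  have hG' : IsPt G ((1 : ℤ) : ℚ) ((-3 : ℤ) : ℚ) := by simpa using hG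
  have h20 := sv1217 hG' (sv1459 hG' hn hsq) hsq
  have hne : n ≠ 0 := by rintro rfl; simp at hn0
  obtain ⟨k, r, j, hk, h1, h2, h3⟩ := four_split hne (by omega)
  have hr := two_pow_11 k
  rw [← hk] at hr
  obtain ⟨j', rfl⟩ := h3 5 (by norm_num) (by omega)
  have a1 := cohn1_16 hG (n := n) (r := 2 * r) (r' := r) (i := 5 * j') (by ring) (by rw [h1]; ring)
    (by omega) hn0 hsq
  have a2 := cohn1_16 hG (n := n) (r := 10 * r) (r' := 5 * r) (i := j') (by ring)
    (by rw [h1]; ring) (by omega) hn0 hsq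
  omega

theorem end1_4 {G : (EC (((8 : ℤ)) : ℚ)).Point} (hG : IsPt G 1 (-3)) {n : ℤ} (hn : n % 2 = 0)
    (hn0 : n • G ≠ 0)
    (hsq : ∀ x y, IsPt (n • G) x y → ∃ s, F1 (((4 : ℤ)) : ℚ) x y = s ^ 2)
    (hsq' : ∀ x y, IsPt ((1 - n) • G) x y → ∃ s, F1 (((4 : ℤ)) : ℚ) x y = s ^ 2) : False := by
  have hG' : IsPt G ((1 : ℤ) : ℚ) ((-3 : ℤ) : ℚ) := by simpa using hG
  have b1 := sv113 hG' hn hsq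
  have b2 := sv11 hG' hsq
  have b3 := sv577 hG' hsq
  have b4 := sv19 hG' hn hsq
  have b5 := sv61 hG' hsq'
  have hne : n ≠ 0 := by rintro rfl; simp at hn0
  obtain ⟨k, r, j, hk, h1, h2, h3⟩ := four_split hne (by omega)
  have hr := two_pow_11 k
  rw [← hk] at hr
  obtain ⟨j', rfl⟩ := h3 15 (by norm_num) (by omega)
  have a1 := cohn1_4 hG (n := n) (r := 2 * r) (r' := r) (i := 15 * j') (by ring) (by rw [h1]; ring)
    (by omega) hn0 hsq
  have a2 := cohn1_4 hG (n := n) (r := 6 * r) (r' := 3 * r) (i := 5 * j') (by ring)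
    (by rw [h1]; ring) (by omega) hn0 hsq
  have a3 := cohn1_4 hG (n := n) (r := 30 * r) (r' := 15 * r) (i := j') (by ring)
    (by rw [h1]; ring) (by omega) hn0 hsq
  clear b1 b2 b3 b4 b5 h1 h2 h3 hsq hsq' hk
  have hr' : r % 11 = 1 ∨ r % 11 = 2 ∨ r % 11 = 3 ∨ r % 11 = 4 ∨ r % 11 = 5 ∨ r % 11 = 6 ∨ r % 11 = 7 ∨ r % 11 = 8 ∨ r % 11 = 9 ∨ r % 11 = 10 := by omega
  rcases hr' with hr' | hr' | hr' | hr' | hr' | hr' | hr' | hr' | hr' | hr' <;> omega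

theorem pt1_F1 {P : (EC (((8 : ℤ)) : ℚ)).Point} {g h v t κ : ℚ} (hh : h ≠ 0) (hP : Pt1 P g h v)
    (ht : fv κ h g = t ^ 2) : ∀ x y, IsPt P x y → ∃ s, F1 κ x y = s ^ 2 := by
  intro x y hxy
  obtain ⟨rfl, rfl⟩ := hxy.unique hP
  refine ⟨t * (2 * (2 * v + 2 * g ^ 2 + 2 * g * h - h ^ 2) / h ^ 3) ^ 3, ?_⟩
  rw [mul_pow, ← ht]
  unfold F1 fv
  field_simp
  ring

theorem case4_e1 {g h e f t κ : ℤ} (hκ : κ = 16 ∨ κ = 4)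
    (hc : IsCoprime g h) (h2 : (2 : ℤ) ∣ h) (hh : h ≠ 0) (he0 : e ≠ 0) (hf0 : f ≠ 0)
    (he : e ^ 2 = g ^ 2 + 2 * g * h - h ^ 2) (hf : f ^ 2 = g ^ 2 + h ^ 2)
    (ht : fv κ h g = t ^ 2) : False := by
  obtain ⟨G, hG⟩ := isPt_mk (a := ((8 : ℤ) : ℚ)) (x := 1) (y := -3) (by norm_num) two_ne_zero
    (by norm_num)
  obtain ⟨n, hn1, hn2⟩ := pair1 hG hc h2 hh he0 hf0 he hf
  have hhQ : (h : ℚ) ≠ 0 := by exact_mod_cast hh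
  have htQ : fv (κ : ℚ) h g = t ^ 2 := by
    unfold fv at ht ⊢
    exact_mod_cast ht
  have s1 := pt1_F1 hhQ hn1 htQ
  have s2 := pt1_F1 hhQ hn2 htQ
  have z1 := IsPt.ne_zero hn1
  have z2 := IsPt.ne_zero hn2
  rcases hκ with rfl | rfl
  · rcases Int.emod_two_eq_zero_or_one n with h | h
    · exact end1_16 hG h z1 s1
    · exact end1_16 hG (by omega) z2 s2
  · rcases Int.emod_two_eq_zero_or_one n with h | h
    · exact end1_4 hG h z1 s1 s2
    · exact end1_4 hG (n := 1 - n) (by omega) z2 s2 (by rw [sub_sub_cancel]; exact s1)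

open scoped NumberTheorySymbols

/-! ### Cohn's argument on `y^2 = x^3 + 200x` -/

/-- The function attached to the second curve. -/
def F5 {R : Type} [CommRing R] (κ x y : R) : R :=
  5 * fv κ (2 * (y + 3 * x + 210) + 10 * (x - 49)) (y + 3 * x + 210)

theorem F5_red {ℓ : ℕ} [Fact ℓ.Prime] {k : ℤ} {x y : ℚ} {xb yb : ZMod ℓ}
    (hx : Red ℓ x xb) (hy : Red ℓ y yb) : Red ℓ (F5 (k : ℚ) x y) (F5 (k : ZMod ℓ) xb yb) := by
  have hq := (hy.add ((Red.ofNat 3).mul hx)).add (Red.ofNat (ℓ := ℓ) 210)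
  exact (Red.ofNat 5).mul (fv_red (Red.int k)
    (((Red.ofNat 2).mul hq).add ((Red.ofNat 10).mul (hx.sub (Red.ofNat 49)))) hq)

theorem pt5_F5 {P : (EC (((200 : ℤ)) : ℚ)).Point} {g h v t κ : ℚ} (hh : h - 2 * g ≠ 0)
    (hP : Pt5 P g h v) (ht : fv κ h g = 5 * t ^ 2) :
    ∀ x y, IsPt P x y → ∃ s, F5 κ x y = s ^ 2 := by
  intro x y hxy
  obtain ⟨hx, hy⟩ := hxy.unique hP
  set D := h - 2 * g with hD
  set N := 3 * g ^ 2 + 5 * g * h - 2 * h ^ 2 with hN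
  have e1 : y + 3 * x + 210 = g * (10 * (50 * v + 10 * N - 49 * D ^ 2) / D ^ 3) := by
    rw [hx, hy]; field_simp; ring
  have e2 : 2 * (y + 3 * x + 210) + 10 * (x - 49) =
      h * (10 * (50 * v + 10 * N - 49 * D ^ 2) / D ^ 3) := by
    rw [e1, hx, show h = D + 2 * g by rw [hD]; ring]; field_simp; ring
  refine ⟨5 * t * (10 * (50 * v + 10 * N - 49 * D ^ 2) / D ^ 3) ^ 3, ?_⟩
  unfold F5
  rw [e2, e1]
  unfold fv at ht ⊢
  linear_combination 5 * (10 * (50 * v + 10 * N - 49 * D ^ 2) / D ^ 3) ^ 6 * ht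

theorem cohn5_sq {ℓ : ℕ} [Fact ℓ.Prime] {u d w : ℤ} (hu : u ≠ 0) (hd : d ≠ 0) (hw0 : w ≠ 0)
    (hw : w ^ 2 = u ^ 4 + 8 * 5 ^ 2 * d ^ 4) (hN : (ℓ : ℤ) ∣ u ^ 4 - 200 * d ^ 4)
    (h2 : (2 * d * u * w : ZMod ℓ) ≠ 0) (h5 : (5 : ZMod ℓ) ≠ 0) (h7 : (7 : ZMod ℓ) ≠ 0)
    {R : (EC (((200 : ℤ)) : ℚ)).Point}
    (hR : IsPt R ((u : ℚ) ^ 2 / d ^ 2) (u * w / d ^ 3)) {i : ℤ} (hi : i % 2 = 1)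
    (hsq : ∀ x y, IsPt (i • (R + R)) x y → ∃ s, F5 (((4 : ℤ)) : ℚ) x y = s ^ 2) :
    ∃ c : ZMod ℓ, c ^ 2 = ((505 : ℤ) : ZMod ℓ) := by
  have h2' : (2 : ZMod ℓ) ≠ 0 := fun h => h2 (by rw [h]; ring)
  have huQ : (u : ℚ) ≠ 0 := by exact_mod_cast hu
  have hdQ : (d : ℚ) ≠ 0 := by exact_mod_cast hd
  have hwQ : (w : ℚ) ≠ 0 := by exact_mod_cast hw0
  have e := (ZMod.intCast_zmod_eq_zero_iff_dvd _ ℓ).2 hN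
  push_cast at e
  have h2a : (((2 * 200 : ℤ)) : ZMod ℓ) ≠ 0 := by
    push_cast
    rw [show (400 : ZMod ℓ) = 2 ^ 4 * 5 ^ 2 by norm_num]
    exact mul_ne_zero (pow_ne_zero _ h2') (pow_ne_zero _ h5)
  have hS := dup_sq (a := 200) (m := 5) (by norm_num) hdQ huQ hwQ hR (by exact_mod_cast hw)
  have hden : Red ℓ (2 * d * u * w) (2 * d * u * w : ZMod ℓ) := by
    simpa using Red.int (ℓ := ℓ) (2 * d * u * w)
  have hx1 : Red ℓ (u ^ 4 - 8 * ((5 : ℤ) : ℚ) ^ 2 * d ^ 4) (0 : ZMod ℓ) := by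
    have := Red.int (ℓ := ℓ) (u ^ 4 - 200 * d ^ 4)
    push_cast at this
    rw [e] at this
    convert this using 1
    push_cast; ring
  have hy1 : Red ℓ (w ^ 4 + 32 * ((5 : ℤ) : ℚ) ^ 2 * u ^ 4 * d ^ 4)
      ((w ^ 4 + 32 * 5 ^ 2 * u ^ 4 * d ^ 4 : ℤ) : ZMod ℓ) := by
    have := Red.int (ℓ := ℓ) (w ^ 4 + 32 * 5 ^ 2 * u ^ 4 * d ^ 4)
    convert this using 1
    push_cast; ring
  have hX := (hx1.pow 2).div (hden.pow 2) (pow_ne_zero 2 h2)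
  have hY := (hx1.mul hy1).div (hden.pow 3) (pow_ne_zero 3 h2)
  have z1 : ((0 : ZMod ℓ) ^ 2 / (2 * d * u * w) ^ 2) = 0 := by simp
  rw [z1] at hX
  rw [zero_mul, zero_div] at hY
  obtain ⟨Sb, hSb, hSr⟩ := PRed.mk' (ℓ := ℓ) h2a hS hX hY
  have hSb2 : Sb + Sb = 0 := hSb.add_neg (by simpa using hSb)
  have hi' := hSr.zsmul h2a hSb.ne_zero i
  rw [odd_smul hSb2 hi] at hi'
  obtain ⟨x, y, h5', h6, h7'⟩ := hi'.affine hSb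
  obtain ⟨s, hs⟩ := hsq x y h5'
  have h8 := F5_red (k := 4) h6 h7'
  rw [hs] at h8
  obtain ⟨c, _, hc⟩ := red_of_sq h8
  refine ⟨c / (2 * (2 * 5 * 7) ^ 3), ?_⟩
  rw [div_pow, hc, div_eq_iff (by
    exact pow_ne_zero _ (mul_ne_zero h2' (pow_ne_zero _ (mul_ne_zero (mul_ne_zero h2' h5) h7))))]
  unfold F5 fv
  push_cast
  ring

theorem five_u {u d w : ℤ} (hc : IsCoprime u d) (hw : w ^ 2 = u ^ 4 + 8 * 5 ^ 2 * d ^ 4) :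
    ¬ (5 : ℤ) ∣ u := by
  rintro ⟨v, rfl⟩
  obtain ⟨x, rfl⟩ : (5 : ℤ) ∣ w := int_prime_five.dvd_of_dvd_pow (n := 2)
    ⟨125 * v ^ 4 + 40 * d ^ 4, by rw [hw]; ring⟩
  have h1 : x ^ 2 = 25 * v ^ 4 + 8 * d ^ 4 := by linarith
  have hd : ¬ (5 : ℤ) ∣ d := fun h => cop_contra int_prime_five hc ⟨v, rfl⟩ h
  have h2 : x ^ 2 % 5 = (25 * v ^ 4 + 8 * d ^ 4) % 5 := by rw [h1]
  have hd4 : d ^ 4 % 5 = 1 := by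
    have : d % 5 = 1 ∨ d % 5 = 2 ∨ d % 5 = 3 ∨ d % 5 = 4 := by omega
    rcases this with h | h | h | h <;> simp [pow_succ, Int.mul_emod, h]
  have hx : x ^ 2 % 5 = 0 ∨ x ^ 2 % 5 = 1 ∨ x ^ 2 % 5 = 4 := by
    have : x % 5 = 0 ∨ x % 5 = 1 ∨ x % 5 = 2 ∨ x % 5 = 3 ∨ x % 5 = 4 := by omega
    rcases this with h | h | h | h | h <;> simp [pow_succ, Int.mul_emod, h]
  omega

theorem jac_recip_one {q : ℕ} (hq : q % 4 = 1) {M : ℤ} (hM : M % 2 = 1) :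
    J((q : ℤ) | M.natAbs) = J(M | q) := by
  rw [jac_natAbs hq M]
  exact jacobiSym.quadratic_reciprocity_one_mod_four hq (Nat.odd_iff.2 (by omega))

instance fact7 : Fact (Nat.Prime 7) := ⟨by norm_num⟩
instance fact17 : Fact (Nat.Prime 17) := ⟨by norm_num⟩
instance fact101 : Fact (Nat.Prime 101) := ⟨by norm_num⟩

theorem cohn5 {G : (EC (((200 : ℤ)) : ℚ)).Point} (hG : IsPt G ((49 : ℤ) : ℚ) ((357 : ℤ) : ℚ))
    {n r r' i : ℤ} (hr : r = r' + r') (hn : n = (r + r) * i) (hi : i % 2 = 1) (hn0 : n • G ≠ 0)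
    (hsq : ∀ x y, IsPt (n • G) x y → ∃ s, F5 (((4 : ℤ)) : ℚ) x y = s ^ 2)
    {xb : ℤ} (hb : ∀ Gb : (EC (((200 : ℤ)) : ZMod 101)).Point,
      IsPt ((1 : ℤ) • Gb) ((49 : ℤ) : ZMod 101) ((357 : ℤ) : ZMod 101) →
        ∃ yb, IsPt (r • Gb) (xb : ZMod 101) yb)
    (hJ : J(xb ^ 2 - 200 | 101) = -1) : False := by
  have hS : n • G = i • (r • G + r • G) := by rw [hn, mul_comm, mul_zsmul, add_zsmul]
  rw [hS] at hn0 hsq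
  obtain ⟨u, d, w, hc, hu, hd, hw0, hw, hR⟩ := dbl_struct (m := 5) (by norm_num) (by norm_num)
    (R := r • G) (R' := r' • G) (by rw [hr, add_zsmul]) (fun h => hn0 (by rw [h, zsmul_zero]))
  have hdQ : (d : ℚ) ≠ 0 := by exact_mod_cast hd
  have huQ : (u : ℚ) ≠ 0 := by exact_mod_cast hu
  have h7 : (7 : ℤ) ∣ d := by
    obtain ⟨Gb, h1, h2⟩ := gen_red (ℓ := 7) (by norm_num) hG
    have h4 : (2 : ℤ) • Gb = 0 := zzero h1 h1 (by norm_num) (by norm_num)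
    have h5 : r • Gb = 0 := by
      rw [hr, ← two_mul, mul_comm, mul_zsmul, h4, zsmul_zero]
    have h6 := h2 r
    rw [h5] at h6
    by_contra hcon
    have hd3 : (d : ZMod 7) ≠ 0 := fun h => hcon ((ZMod.intCast_zmod_eq_zero_iff_dvd _ 7).1 h)
    obtain ⟨_, h7, _⟩ := h6.of_red hR (((Red.int u).pow 2).div ((Red.int d).pow 2) (pow_ne_zero 2 hd3))
    exact h7.ne_zero rfl
  have hu2 := odd_u (m := 5) (by norm_num) hc hw
  have hu5 := five_u hc hw
  set N := u ^ 4 - 200 * d ^ 4 with hNdef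
  have hN2 : N % 2 = 1 := by
    have := sq_mod_of_odd hu2
    have h3 := sq_mod_of_odd (w := u ^ 2) (by omega)
    rw [hNdef, show u ^ 4 - 200 * d ^ 4 = (u ^ 2) ^ 2 - 2 * (100 * d ^ 4) by ring]
    omega
  have hN5 : J(N | 5) = 1 := by
    have : N = u ^ 4 + 5 * (-40 * d ^ 4) := by rw [hNdef]; ring
    rw [jacobiSym.mod_left, this]
    have hd4 : u ^ 4 % 5 = 1 := by
      have : u % 5 = 1 ∨ u % 5 = 2 ∨ u % 5 = 3 ∨ u % 5 = 4 := by omega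
      rcases this with h | h | h | h <;> simp [pow_succ, Int.mul_emod, h]
    have : (u ^ 4 + 5 * (-40 * d ^ 4)) % ((5 : ℕ) : ℤ) = 1 := by push_cast; omega
    rw [this, jacobiSym.one_left]
  -- reduction modulo 101
  have hN101 : J(N | 101) = -1 := by
    obtain ⟨Gb, h1, h2⟩ := gen_red (ℓ := 101) (by norm_num) hG
    obtain ⟨yb, h4⟩ := hb Gb h1
    obtain ⟨x, y, h5, h6, h7⟩ := (h2 r).affine h4
    obtain ⟨rfl, rfl⟩ := h5.unique hR
    have h8 := h6.mul ((Red.int (ℓ := 101) d).pow 2)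
    rw [div_mul_cancel₀ _ (pow_ne_zero 2 hdQ)] at h8
    have h9 := h8.unique ((Red.int (ℓ := 101) u).pow 2)
    have hd43 : ¬ (101 : ℤ) ∣ d := by
      intro h
      have h' := (ZMod.intCast_zmod_eq_zero_iff_dvd _ 101).2 h
      rw [h'] at h9
      have h10 : (u : ZMod 101) = 0 := by
        refine pow_eq_zero_iff two_ne_zero |>.1 (h9.symm.trans ?_)
        ring
      exact cop_contra (natPrime_int (by norm_num : Nat.Prime 101)) hc
        ((ZMod.intCast_zmod_eq_zero_iff_dvd _ 101).1 h10) h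
    have e1 : J(N | 101) = J((xb ^ 2 - 200) * (d ^ 2) ^ 2 | 101) := by
      apply jacobiSym.mod_left'
      rw [← sub_zero N, ← sub_zero ((xb ^ 2 - 200) * (d ^ 2) ^ 2)]
      apply (ZMod.intCast_eq_intCast_iff' _ _ 101).1
      rw [hNdef]
      push_cast
      linear_combination (-(u : ZMod 101) ^ 2 - xb * d ^ 2) * h9
    have hg : Int.gcd (d ^ 2) ((101 : ℕ) : ℤ) = 1 := by
      rw [← Int.isCoprime_iff_gcd_eq_one]
      apply IsCoprime.pow_left
      exact ((Prime.coprime_iff_not_dvd (natPrime_int (by norm_num : Nat.Prime 101))).2 hd43).symm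
    rw [e1, jacobiSym.mul_left, jacobiSym.sq_one' hg, hJ]; rfl
  have hJN : J(505 | N.natAbs) = -1 := by
    have a1 := jac_recip_one (q := 5) (by norm_num) hN2
    have a2 := jac_recip_one (q := 101) (by norm_num) hN2
    rw [show (505 : ℤ) = ((5 : ℕ) : ℤ) * ((101 : ℕ) : ℤ) by norm_num, jacobiSym.mul_left, a1, a2, hN5,
      hN101]; rfl
  obtain ⟨p, hp, hpN, hpJ⟩ := jacobiSym.eq_neg_one_at_prime_divisor_of_eq_neg_one hJN
  haveI : Fact p.Prime := ⟨hp⟩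
  have hpN' : (p : ℤ) ∣ N := Int.natCast_dvd.2 hpN
  have hpI := natPrime_int hp
  have hpd : ¬ (p : ℤ) ∣ d := by
    intro h
    have : (p : ℤ) ∣ u ^ 4 := by
      have : u ^ 4 = N + d * (200 * d ^ 3) := by rw [hNdef]; ring
      rw [this]; exact dvd_add hpN' (h.mul_right _)
    exact cop_contra hpI hc (hpI.dvd_of_dvd_pow this) h
  have hp2 : ¬ (p : ℤ) ∣ 2 := fun h => int_dvd_two_contra hpI hN2 hpN' h
  have hp5 : ¬ (p : ℤ) ∣ 5 := by
    intro h
    have := (Prime.dvd_prime_iff_associated hpI int_prime_five).1 h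
    have h5N : (5 : ℤ) ∣ N := this.symm.dvd.trans hpN'
    apply hu5
    apply int_prime_five.dvd_of_dvd_pow (n := 4)
    have : u ^ 4 = N + 5 * (40 * d ^ 4) := by rw [hNdef]; ring
    rw [this]; exact dvd_add h5N (Dvd.intro _ rfl)
  have hp7 : ¬ (p : ℤ) ∣ 7 := fun h => hpd (h.trans h7)
  have hpu : ¬ (p : ℤ) ∣ u := by
    intro h
    have : (p : ℤ) ∣ 2 * 2 * 2 * 5 * 5 * d ^ 4 := by
      have : 2 * 2 * 2 * 5 * 5 * d ^ 4 = u * u ^ 3 - N := by rw [hNdef]; ring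
      rw [this]; exact dvd_sub (h.mul_right _) hpN'
    simp only [hpI.dvd_mul, hp2, hp5, false_or, or_false] at this
    exact hpd (hpI.dvd_of_dvd_pow this)
  have hpw : ¬ (p : ℤ) ∣ w := by
    intro h
    have : (p : ℤ) ∣ 2 * 2 * 2 * 2 * 5 * 5 * d ^ 4 := by
      have : 2 * 2 * 2 * 2 * 5 * 5 * d ^ 4 = w * w - N := by rw [hNdef]; linear_combination -hw
      rw [this]; exact dvd_sub (h.mul_right _) hpN'
    simp only [hpI.dvd_mul, hp2, hp5, false_or, or_false] at this
    exact hpd (hpI.dvd_of_dvd_pow this)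
  have key : ∀ x : ℤ, ¬ (p : ℤ) ∣ x → (x : ZMod p) ≠ 0 := fun x hx h =>
    hx ((ZMod.intCast_zmod_eq_zero_iff_dvd _ p).1 h)
  have k2 := key 2 hp2
  have k5 := key 5 hp5
  have k7 := key 7 hp7
  push_cast at k2 k5 k7
  exact znonsq hpJ (cohn5_sq hu hd hw0 hw hpN' (mul_ne_zero (mul_ne_zero (mul_ne_zero k2 (key d hpd))
    (key u hpu)) (key w hpw)) k5 k7 hR hi hsq)

open scoped NumberTheorySymbols

instance fact179 : Fact (Nat.Prime 179) := ⟨by norm_num⟩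
instance fact1297 : Fact (Nat.Prime 1297) := ⟨by norm_num⟩
instance fact4391 : Fact (Nat.Prime 4391) := ⟨by norm_num⟩

theorem sv5_use {ℓ : ℕ} [Fact ℓ.Prime] {G : (EC (((200 : ℤ)) : ℚ)).Point}
    {Gb : (EC (((200 : ℤ)) : ZMod ℓ)).Point} {n k r x y κ : ℤ} (v : ℤ)
    (hred : PRed ℓ (n • G) (n • Gb)) (hz : k • Gb = 0) (h : n % k = r)
    (hr : IsPt (r • Gb) (x : ZMod ℓ) y)
    (hsq : ∀ x y, IsPt (n • G) x y → ∃ s, F5 (κ : ℚ) x y = s ^ 2)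
    (hv : (F5 κ x y - v) % ℓ = 0) (hJ : J(v | ℓ) = -1) : False := by
  rw [zmod_smul hz (n := n), h] at hred
  obtain ⟨X, Y, h1, h2, h3⟩ := hred.affine hr
  obtain ⟨s, hs⟩ := hsq X Y h1
  have h4 := F5_red (k := κ) h2 h3
  rw [hs] at h4
  obtain ⟨c, _, hc⟩ := red_of_sq h4
  refine znonsq hJ ⟨c, hc.trans ?_⟩
  rw [← zmod_eq_of hv]
  simp [F5, fv]

theorem sv179 {G : (EC (((200 : ℤ)) : ℚ)).Point} (hG : IsPt G ((49 : ℤ) : ℚ) ((357 : ℤ) : ℚ)) {n : ℤ}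
    (hn : n % 2 = 0) (hsq : ∀ x y, IsPt (n • G) x y → ∃ s, F5 (((4 : ℤ)) : ℚ) x y = s ^ 2) :
    n % 6 = 0 := by
  obtain ⟨Gb, h1, hred⟩ := gen_red (ℓ := 179) (by norm_num) hG
  have h2 := zdbl (k := 2) h1 147 31 141 (by norm_num) (by norm_num)
  have h4 := zdbl (k := 4) h2 56 31 38 (by norm_num) (by norm_num)
  have hz : (6 : ℤ) • Gb = 0 := zzero h4 h2 (by norm_num) (by norm_num)
  by_contra hcon
  have h : n % 6 = 2 ∨ n % 6 = 4 := by omega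
  rcases h with h | h
  · exact sv5_use (28) (hred _) hz h h2 hsq (by norm_num [F5, fv]) (by norm_num)
  · exact sv5_use (10) (hred _) hz h h4 hsq (by norm_num [F5, fv]) (by norm_num)

theorem sv1297 {G : (EC (((200 : ℤ)) : ℚ)).Point} (hG : IsPt G ((49 : ℤ) : ℚ) ((357 : ℤ) : ℚ)) {n : ℤ}
    (hn : n % 6 = 0) (hsq : ∀ x y, IsPt (n • G) x y → ∃ s, F5 (((4 : ℤ)) : ℚ) x y = s ^ 2) :
    n % 18 = 0 ∨ n % 18 = 12 := by
  obtain ⟨Gb, h1, hred⟩ := gen_red (ℓ := 1297) (by norm_num) hG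
  have h2 := zdbl (k := 2) h1 1113 36 1142 (by norm_num) (by norm_num)
  have h4 := zdbl (k := 4) h2 924 278 928 (by norm_num) (by norm_num)
  have h6 := zadd (k := 6) h4 h2 385 53 95 (by norm_num) (by norm_num)
  have h12 := zdbl (k := 12) h6 926 53 1202 (by norm_num) (by norm_num)
  have hz : (18 : ℤ) • Gb = 0 := zzero h12 h6 (by norm_num) (by norm_num)
  by_contra hcon
  have h : n % 18 = 6 := by omega
  rcases h with h
  · exact sv5_use (109) (hred _) hz h h6 hsq (by norm_num [F5, fv]) (by norm_num)

theorem sv4391 {G : (EC (((200 : ℤ)) : ℚ)).Point} (hG : IsPt G ((49 : ℤ) : ℚ) ((357 : ℤ) : ℚ)) {n : ℤ}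
    (hn : n % 6 = 0) (hsq : ∀ x y, IsPt (n • G) x y → ∃ s, F5 (((4 : ℤ)) : ℚ) x y = s ^ 2) :
    n % 36 = 0 ∨ n % 36 = 24 := by
  obtain ⟨Gb, h1, hred⟩ := gen_red (ℓ := 4391) (by norm_num) hG
  have h2 := zdbl (k := 2) h1 816 2717 491 (by norm_num) (by norm_num)
  have h4 := zdbl (k := 4) h2 897 13 1165 (by norm_num) (by norm_num)
  have h6 := zadd (k := 6) h4 h2 3660 320 3702 (by norm_num) (by norm_num)
  have h12 := zdbl (k := 12) h6 1128 2745 882 (by norm_num) (by norm_num)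
  have h18 := zadd (k := 18) h12 h6 533 0 0 (by norm_num) (by norm_num)
  have h30 := zadd (k := 30) h18 h12 533 320 689 (by norm_num) (by norm_num)
  have hz : (36 : ℤ) • Gb = 0 := zzero h18 h18 (by norm_num) (by norm_num)
  by_contra hcon
  have h : n % 36 = 6 ∨ n % 36 = 12 ∨ n % 36 = 18 ∨ n % 36 = 30 := by omega
  rcases h with h | h | h | h
  · exact sv5_use (638) (hred _) hz h h6 hsq (by norm_num [F5, fv]) (by norm_num)
  · exact sv5_use (4280) (hred _) hz h h12 hsq (by norm_num [F5, fv]) (by norm_num)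
  · exact sv5_use (3841) (hred _) hz h h18 hsq (by norm_num [F5, fv]) (by norm_num)
  · exact sv5_use (101) (hred _) hz h h30 hsq (by norm_num [F5, fv]) (by norm_num)

theorem pt_smul_neg {Gb : (EC (((200 : ℤ)) : ZMod 101)).Point} (hz : (61 : ℤ) • Gb = 0) {r ρ : ℤ}
    (h : r % 61 = ρ ∨ r % 61 = 61 - ρ) {x : ZMod 101} {y : ZMod 101} (hp : IsPt (ρ • Gb) x y) :
    ∃ yb, IsPt (r • Gb) x yb := by
  rcases h with h | h
  · exact ⟨y, by rwa [zmod_smul hz, h]⟩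
  · refine ⟨-y, ?_⟩
    rw [zmod_smul hz, h, sub_zsmul, hz, zero_add]
    exact hp.neg

theorem tab101 (Gb : (EC (((200 : ℤ)) : ZMod 101)).Point)
    (h1 : IsPt ((1 : ℤ) • Gb) ((49 : ℤ) : ZMod 101) ((357 : ℤ) : ZMod 101)) (r : ℤ) :
    ((r % 61 = 2 ∨ r % 61 = 61 - 2) → ∃ yb, IsPt (r • Gb) ((9 : ℤ) : ZMod 101) yb) ∧
    ((r % 61 = 4 ∨ r % 61 = 61 - 4) → ∃ yb, IsPt (r • Gb) ((96 : ℤ) : ZMod 101) yb) ∧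
    ((r % 61 = 5 ∨ r % 61 = 61 - 5) → ∃ yb, IsPt (r • Gb) ((81 : ℤ) : ZMod 101) yb) ∧
    ((r % 61 = 6 ∨ r % 61 = 61 - 6) → ∃ yb, IsPt (r • Gb) ((20 : ℤ) : ZMod 101) yb) ∧
    ((r % 61 = 8 ∨ r % 61 = 61 - 8) → ∃ yb, IsPt (r • Gb) ((97 : ℤ) : ZMod 101) yb) ∧
    ((r % 61 = 9 ∨ r % 61 = 61 - 9) → ∃ yb, IsPt (r • Gb) ((19 : ℤ) : ZMod 101) yb) ∧
    ((r % 61 = 13 ∨ r % 61 = 61 - 13) → ∃ yb, IsPt (r • Gb) ((23 : ℤ) : ZMod 101) yb) ∧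
    ((r % 61 = 14 ∨ r % 61 = 61 - 14) → ∃ yb, IsPt (r • Gb) ((65 : ℤ) : ZMod 101) yb) ∧
    ((r % 61 = 15 ∨ r % 61 = 61 - 15) → ∃ yb, IsPt (r • Gb) ((17 : ℤ) : ZMod 101) yb) ∧
    ((r % 61 = 17 ∨ r % 61 = 61 - 17) → ∃ yb, IsPt (r • Gb) ((5 : ℤ) : ZMod 101) yb) ∧
    ((r % 61 = 18 ∨ r % 61 = 61 - 18) → ∃ yb, IsPt (r • Gb) ((84 : ℤ) : ZMod 101) yb) ∧
    ((r % 61 = 20 ∨ r % 61 = 61 - 20) → ∃ yb, IsPt (r • Gb) ((100 : ℤ) : ZMod 101) yb) ∧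
    ((r % 61 = 21 ∨ r % 61 = 61 - 21) → ∃ yb, IsPt (r • Gb) ((78 : ℤ) : ZMod 101) yb) ∧
    ((r % 61 = 22 ∨ r % 61 = 61 - 22) → ∃ yb, IsPt (r • Gb) ((92 : ℤ) : ZMod 101) yb) ∧
    ((r % 61 = 23 ∨ r % 61 = 61 - 23) → ∃ yb, IsPt (r • Gb) ((82 : ℤ) : ZMod 101) yb) ∧
    ((r % 61 = 24 ∨ r % 61 = 61 - 24) → ∃ yb, IsPt (r • Gb) ((1 : ℤ) : ZMod 101) yb) ∧
    ((r % 61 = 27 ∨ r % 61 = 61 - 27) → ∃ yb, IsPt (r • Gb) ((4 : ℤ) : ZMod 101) yb) ∧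
    ((r % 61 = 29 ∨ r % 61 = 61 - 29) → ∃ yb, IsPt (r • Gb) ((36 : ℤ) : ZMod 101) yb) := by
  have h2 := zdbl (k := 2) h1 62 9 2 (by norm_num) (by norm_num)
  have h3 := zadd (k := 3) h2 h1 72 76 22 (by norm_num) (by norm_num)
  have h4 := zadd (k := 4) h3 h1 25 96 84 (by norm_num) (by norm_num)
  have h5 := zadd (k := 5) h4 h1 78 81 76 (by norm_num) (by norm_num)
  have h6 := zadd (k := 6) h5 h1 7 20 48 (by norm_num) (by norm_num)
  have h7 := zadd (k := 7) h6 h1 42 79 100 (by norm_num) (by norm_num)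
  have h8 := zadd (k := 8) h7 h1 15 97 34 (by norm_num) (by norm_num)
  have h9 := zadd (k := 9) h8 h1 8 19 85 (by norm_num) (by norm_num)
  have h10 := zadd (k := 10) h9 h1 36 16 23 (by norm_num) (by norm_num)
  have h11 := zadd (k := 11) h10 h1 4 52 35 (by norm_num) (by norm_num)
  have h12 := zadd (k := 12) h11 h1 61 85 73 (by norm_num) (by norm_num)
  have h13 := zadd (k := 13) h12 h1 37 23 100 (by norm_num) (by norm_num)
  have h14 := zadd (k := 14) h13 h1 6 65 52 (by norm_num) (by norm_num)
  have h15 := zadd (k := 15) h14 h1 63 17 43 (by norm_num) (by norm_num)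
  have h16 := zadd (k := 16) h15 h1 54 22 91 (by norm_num) (by norm_num)
  have h17 := zadd (k := 17) h16 h1 51 5 69 (by norm_num) (by norm_num)
  have h18 := zadd (k := 18) h17 h1 80 84 75 (by norm_num) (by norm_num)
  have h19 := zadd (k := 19) h18 h1 41 33 97 (by norm_num) (by norm_num)
  have h20 := zadd (k := 20) h19 h1 92 100 1 (by norm_num) (by norm_num)
  have h21 := zadd (k := 21) h20 h1 96 78 91 (by norm_num) (by norm_num)
  have h22 := zadd (k := 22) h21 h1 57 92 20 (by norm_num) (by norm_num)
  have h23 := zadd (k := 23) h22 h1 18 82 59 (by norm_num) (by norm_num)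
  have h24 := zadd (k := 24) h23 h1 43 1 91 (by norm_num) (by norm_num)
  have h25 := zadd (k := 25) h24 h1 35 64 27 (by norm_num) (by norm_num)
  have h26 := zadd (k := 26) h25 h1 79 68 61 (by norm_num) (by norm_num)
  have h27 := zadd (k := 27) h26 h1 11 4 37 (by norm_num) (by norm_num)
  have h28 := zadd (k := 28) h27 h1 52 25 83 (by norm_num) (by norm_num)
  have h29 := zadd (k := 29) h28 h1 3 36 86 (by norm_num) (by norm_num)
  have h30 := zadd (k := 30) h29 h1 83 37 33 (by norm_num) (by norm_num)
  have h31 := zadd (k := 31) h30 h1 27 37 68 (by norm_num) (by norm_num)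
  have hz : (61 : ℤ) • Gb = 0 := zzero h31 h30 (by norm_num) (by norm_num)
  exact ⟨fun h => pt_smul_neg hz h h2, fun h => pt_smul_neg hz h h4, fun h => pt_smul_neg hz h h5, fun h => pt_smul_neg hz h h6, fun h => pt_smul_neg hz h h8, fun h => pt_smul_neg hz h h9, fun h => pt_smul_neg hz h h13, fun h => pt_smul_neg hz h h14, fun h => pt_smul_neg hz h h15, fun h => pt_smul_neg hz h h17, fun h => pt_smul_neg hz h h18, fun h => pt_smul_neg hz h h20, fun h => pt_smul_neg hz h h21, fun h => pt_smul_neg hz h h22, fun h => pt_smul_neg hz h h23, fun h => pt_smul_neg hz h h24, fun h => pt_smul_neg hz h h27, fun h => pt_smul_neg hz h h29⟩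

theorem cohn5_101 {G : (EC (((200 : ℤ)) : ℚ)).Point} (hG : IsPt G ((49 : ℤ) : ℚ) ((357 : ℤ) : ℚ))
    {n r r' i : ℤ} (hr : r = r' + r') (hn : n = (r + r) * i) (hi : i % 2 = 1) (hn0 : n • G ≠ 0)
    (hsq : ∀ x y, IsPt (n • G) x y → ∃ s, F5 (((4 : ℤ)) : ℚ) x y = s ^ 2) (ρ : ℤ)
    (hρ : ρ ∈ ([2, 4, 5, 6, 8, 9, 13, 14, 15, 17, 18, 20, 21, 22, 23, 24, 27, 29] : List ℤ)) :
    ¬ (r % 61 = ρ ∨ r % 61 = 61 - ρ) := by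
  intro h
  simp only [List.mem_cons, List.not_mem_nil, or_false] at hρ
  rcases hρ with rfl | rfl | rfl | rfl | rfl | rfl | rfl | rfl | rfl | rfl | rfl | rfl | rfl | rfl | rfl | rfl | rfl | rfl
  · exact cohn5 hG hr hn hi hn0 hsq (fun Gb h1 => (tab101 Gb h1 r).1 h) (by norm_num)
  · exact cohn5 hG hr hn hi hn0 hsq (fun Gb h1 => (tab101 Gb h1 r).2.1 h) (by norm_num)
  · exact cohn5 hG hr hn hi hn0 hsq (fun Gb h1 => (tab101 Gb h1 r).2.2.1 h) (by norm_num)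
  · exact cohn5 hG hr hn hi hn0 hsq (fun Gb h1 => (tab101 Gb h1 r).2.2.2.1 h) (by norm_num)
  · exact cohn5 hG hr hn hi hn0 hsq (fun Gb h1 => (tab101 Gb h1 r).2.2.2.2.1 h) (by norm_num)
  · exact cohn5 hG hr hn hi hn0 hsq (fun Gb h1 => (tab101 Gb h1 r).2.2.2.2.2.1 h) (by norm_num)
  · exact cohn5 hG hr hn hi hn0 hsq (fun Gb h1 => (tab101 Gb h1 r).2.2.2.2.2.2.1 h) (by norm_num)
  · exact cohn5 hG hr hn hi hn0 hsq (fun Gb h1 => (tab101 Gb h1 r).2.2.2.2.2.2.2.1 h) (by norm_num)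
  · exact cohn5 hG hr hn hi hn0 hsq (fun Gb h1 => (tab101 Gb h1 r).2.2.2.2.2.2.2.2.1 h) (by norm_num)
  · exact cohn5 hG hr hn hi hn0 hsq (fun Gb h1 => (tab101 Gb h1 r).2.2.2.2.2.2.2.2.2.1 h) (by norm_num)
  · exact cohn5 hG hr hn hi hn0 hsq (fun Gb h1 => (tab101 Gb h1 r).2.2.2.2.2.2.2.2.2.2.1 h) (by norm_num)
  · exact cohn5 hG hr hn hi hn0 hsq (fun Gb h1 => (tab101 Gb h1 r).2.2.2.2.2.2.2.2.2.2.2.1 h) (by norm_num)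
  · exact cohn5 hG hr hn hi hn0 hsq (fun Gb h1 => (tab101 Gb h1 r).2.2.2.2.2.2.2.2.2.2.2.2.1 h) (by norm_num)
  · exact cohn5 hG hr hn hi hn0 hsq (fun Gb h1 => (tab101 Gb h1 r).2.2.2.2.2.2.2.2.2.2.2.2.2.1 h) (by norm_num)
  · exact cohn5 hG hr hn hi hn0 hsq (fun Gb h1 => (tab101 Gb h1 r).2.2.2.2.2.2.2.2.2.2.2.2.2.2.1 h) (by norm_num)
  · exact cohn5 hG hr hn hi hn0 hsq (fun Gb h1 => (tab101 Gb h1 r).2.2.2.2.2.2.2.2.2.2.2.2.2.2.2.1 h) (by norm_num)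
  · exact cohn5 hG hr hn hi hn0 hsq (fun Gb h1 => (tab101 Gb h1 r).2.2.2.2.2.2.2.2.2.2.2.2.2.2.2.2.1 h) (by norm_num)
  · exact cohn5 hG hr hn hi hn0 hsq (fun Gb h1 => (tab101 Gb h1 r).2.2.2.2.2.2.2.2.2.2.2.2.2.2.2.2.2 h) (by norm_num)

theorem two_pow_61 (k : ℕ) : (2 : ℤ) ^ k % 61 ≠ 0 := by
  intro h
  have h1 := Int.Prime.dvd_pow' (by norm_num : Nat.Prime 61) (Int.dvd_of_emod_eq_zero h)
  norm_num at h1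

theorem good61 : ∀ x ∈ Finset.Icc (1 : ℤ) 60,
    (∃ ρ ∈ ([2, 4, 5, 6, 8, 9, 13, 14, 15, 17, 18, 20, 21, 22, 23, 24, 27, 29] : List ℤ),
      (2 * x % 61 = ρ ∨ 2 * x % 61 = 61 - ρ) ∨ (6 * x % 61 = ρ ∨ 6 * x % 61 = 61 - ρ) ∨
      (18 * x % 61 = ρ ∨ 18 * x % 61 = 61 - ρ)) := by
  decide

theorem end5_4 {G : (EC (((200 : ℤ)) : ℚ)).Point} (hG : IsPt G ((49 : ℤ) : ℚ) ((357 : ℤ) : ℚ)) {n : ℤ} (hn : n % 2 = 0)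
    (hn0 : n • G ≠ 0)
    (hsq : ∀ x y, IsPt (n • G) x y → ∃ s, F5 (((4 : ℤ)) : ℚ) x y = s ^ 2) : False := by
  have b1 := sv179 hG hn hsq
  have b2 := sv1297 hG b1 hsq
  have b3 := sv4391 hG b1 hsq
  have hne : n ≠ 0 := by rintro rfl; simp at hn0
  obtain ⟨k, r, j, hk, h1, h2, h3⟩ := four_split hne (by omega)
  have hr := two_pow_61 k
  rw [← hk] at hr
  obtain ⟨j', rfl⟩ := h3 9 (by norm_num) (by omega)
  obtain ⟨ρ, hρ, h⟩ := good61 (r % 61) (by rw [Finset.mem_Icc]; omega)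
  have e : ∀ m : ℤ, m * (r % 61) % 61 = m * r % 61 := fun m => by simp [Int.mul_emod]
  simp only [e] at h
  rcases h with h | h | h
  · exact cohn5_101 hG (n := n) (r := 2 * r) (r' := r) (i := 9 * j') (by ring) (by rw [h1]; ring)
      (by omega) hn0 hsq ρ hρ h
  · exact cohn5_101 hG (n := n) (r := 6 * r) (r' := 3 * r) (i := 3 * j') (by ring)
      (by rw [h1]; ring) (by omega) hn0 hsq ρ hρ h
  · exact cohn5_101 hG (n := n) (r := 18 * r) (r' := 9 * r) (i := j') (by ring)
      (by rw [h1]; ring) (by omega) hn0 hsq ρ hρ h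

theorem pt5_17 {P : (EC (((200 : ℤ)) : ℚ)).Point} {g h v : ℤ}
    (hP : Pt5 P g h v) (h0 : PRed 17 P (0 : (EC (((200 : ℤ)) : ZMod 17)).Point)) :
    (17 : ℤ) ∣ h - 2 * g := by
  by_contra hcon
  have hd : (((h - 2 * g : ℤ)) : ZMod 17) ≠ 0 := fun h => hcon ((ZMod.intCast_zmod_eq_zero_iff_dvd _ 17).1 h)
  have e1 := (Red.int (ℓ := 17) (10 * (5 * v + (3 * g ^ 2 + 5 * g * h - 2 * h ^ 2)))).div
    ((Red.int (h - 2 * g)).pow 2) (pow_ne_zero 2 hd)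
  obtain ⟨_, h7, _⟩ := h0.of_red hP (by convert e1 using 1; push_cast; ring)
  exact h7.ne_zero rfl

theorem end5_17 {g h t : ℤ} (hc : IsCoprime g h) (h17 : (17 : ℤ) ∣ h - 2 * g)
    (ht : fv 16 h g = 5 * t ^ 2) : False := by
  have e1 : (h : ZMod 17) = 2 * g := by
    have := (ZMod.intCast_zmod_eq_zero_iff_dvd _ 17).2 h17
    push_cast at this
    linear_combination this
  have hg : (g : ZMod 17) ≠ 0 := by
    intro h0
    have h0' := (ZMod.intCast_zmod_eq_zero_iff_dvd _ 17).1 h0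
    refine cop_contra (natPrime_int (by norm_num : Nat.Prime 17)) hc h0' ?_
    have : h = (h - 2 * g) + g * 2 := by ring
    rw [this]
    exact dvd_add h17 (h0'.mul_right 2)
  have e2 : (101 : ZMod 17) * g ^ 6 = 5 * t ^ 2 := by
    have := congrArg (Int.cast : ℤ → ZMod 17) ht
    unfold fv at this
    push_cast at this
    rw [← this, e1]; ring
  refine znonsq (ℓ := 17) (x := 505) (by norm_num) ⟨5 * t / g ^ 3, ?_⟩
  rw [div_pow, div_eq_iff (pow_ne_zero 2 (pow_ne_zero 3 hg))]
  push_cast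
  linear_combination -5 * e2

theorem case4_e5 {g h e f t κ : ℤ} (hκ : κ = 16 ∨ κ = 4)
    (hc : IsCoprime g h) (h2 : (2 : ℤ) ∣ h) (he0 : e ≠ 0) (hf0 : f ≠ 0)
    (he : e ^ 2 = g ^ 2 + 2 * g * h - h ^ 2) (hf : 5 * f ^ 2 = g ^ 2 + h ^ 2)
    (ht : fv κ h g = 5 * t ^ 2) : κ = 4 ∧ h = 2 * g := by
  obtain ⟨G, hG⟩ := isPt_mk (a := ((200 : ℤ) : ℚ)) (x := 49) (y := 357) (by norm_num) two_ne_zero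
    (by norm_num)
  have hG' : IsPt G ((49 : ℤ) : ℚ) ((357 : ℤ) : ℚ) := by simpa using hG
  by_cases hh : h - 2 * g = 0
  · refine ⟨?_, by omega⟩
    rcases hκ with rfl | rfl
    · exact absurd (end5_17 hc (by rw [hh]; exact dvd_zero _) ht) id
    · rfl
  exfalso
  obtain ⟨n, hn1, hn2⟩ := pair5 hG hc h2 hh he0 hf0 he hf
  have hhQ : (h : ℚ) - 2 * g ≠ 0 := by exact_mod_cast hh
  have htQ : fv (κ : ℚ) h g = 5 * t ^ 2 := by
    unfold fv at ht ⊢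
    exact_mod_cast ht
  rcases hκ with rfl | rfl
  · obtain ⟨Gb, h1, hred⟩ := gen_red (ℓ := 17) (by norm_num) hG'
    have hz : (2 : ℤ) • Gb = 0 := zzero h1 h1 (by norm_num) (by norm_num)
    rcases Int.emod_two_eq_zero_or_one n with h | h
    · have h3 := hred n
      rw [zmod_smul hz, h, zero_zsmul] at h3
      exact end5_17 hc (pt5_17 (v := e * f) (by exact_mod_cast hn1) h3) ht
    · have h3 := hred (1 - n)
      rw [zmod_smul hz, show (1 - n) % 2 = 0 by omega, zero_zsmul] at h3
      exact end5_17 hc (pt5_17 (v := -(e * f)) (by exact_mod_cast hn2) h3) ht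
  · rcases Int.emod_two_eq_zero_or_one n with h | h
    · exact end5_4 hG' h (IsPt.ne_zero hn1) (pt5_F5 hhQ hn1 htQ)
    · exact end5_4 hG' (n := 1 - n) (by omega) (IsPt.ne_zero hn2) (pt5_F5 hhQ hn2 htQ)

/-! ### Square products: the case `D₁ D₂` -/

theorem pdvd_of_comb {p x y z a b : ℤ} (h1 : p ∣ x) (h2 : p ∣ y) (h : z = x * a + y * b) : p ∣ z :=
  h ▸ dvd_add (h1.mul_right _) (h2.mul_right _)

theorem cop_AB {p q : ℤ} (hc : IsCoprime p q) : IsCoprime (q ^ 2 - p ^ 2) (p * q) := by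
  have h1 : IsCoprime (q ^ 2 - p ^ 2) p := by
    have : q ^ 2 - p ^ 2 = q ^ 2 + (-p) * p := by ring
    rw [this]
    exact (IsCoprime.pow_left hc.symm).add_mul_right_left _
  have h2 : IsCoprime (q ^ 2 - p ^ 2) q := by
    have : q ^ 2 - p ^ 2 = -p ^ 2 + q * q := by ring
    rw [this]
    exact (IsCoprime.pow_left hc).neg_left.add_mul_right_left _
  exact h1.mul_right h2

theorem int_sq_pm {a b m : ℤ} (h : a * b = m ^ 2) (hm : m ≠ 0)
    (hc : ∀ p : ℤ, Prime p → p ∣ a → p ∣ b → False) :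
    ∃ k : ℤ, k ≠ 0 ∧ (a = k ^ 2 ∨ a = -k ^ 2) := by
  have ha : a ≠ 0 := by rintro rfl; simp at h; exact hm (by simpa using h.symm)
  obtain ⟨k, hk⟩ := Int.sq_of_isCoprime (int_coprime_of_primes hc (Or.inl ha)) h
  refine ⟨k, ?_, hk⟩
  rintro rfl
  simp at hk
  exact ha hk

theorem int_sq_pos {a b m : ℤ} (h : a * b = m ^ 2) (hm : m ≠ 0) (ha : 0 < a)
    (hc : ∀ p : ℤ, Prime p → p ∣ a → p ∣ b → False) :
    ∃ k : ℤ, k ≠ 0 ∧ a = k ^ 2 := by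
  obtain ⟨k, hk, h1 | h1⟩ := int_sq_pm h hm hc
  · exact ⟨k, hk, h1⟩
  · nlinarith [sq_nonneg k]

/-- cancel a nonzero square factor -/
theorem sq_cancel {a x m : ℤ} (ha : a ≠ 0) (h : a ^ 2 * x = m ^ 2) : ∃ k, x = k ^ 2 := by
  obtain ⟨k, rfl⟩ : a ∣ m := (Int.pow_dvd_pow_iff two_ne_zero).1 ⟨x, h.symm⟩
  exact ⟨k, mul_left_cancel₀ (pow_ne_zero 2 ha) (by rw [h]; ring)⟩

theorem case4_pos {κ p q m : ℤ} (hκ : κ = 16 ∨ κ = 4) (hc : IsCoprime p q) (hp0 : p ≠ 0)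
    (hodd : (q ^ 2 - p ^ 2) % 2 = 1) (hm : m ≠ 0)
    (hU : 0 < q ^ 2 - p ^ 2 + 2 * (p * q))
    (h : (q ^ 2 - p ^ 2 + 2 * (p * q)) * ((p ^ 2 + q ^ 2) * fv κ p q) = m ^ 2) :
    κ = 4 ∧ p = 2 * q := by
  have hAB := cop_AB hc
  set A := q ^ 2 - p ^ 2 with hA
  set B := p * q with hB
  have hV2 : (p ^ 2 + q ^ 2) * (p ^ 2 + q ^ 2) = A ^ 2 + 4 * B ^ 2 := by rw [hA, hB]; ring
  have hW : fv κ p q = A ^ 3 + κ * B ^ 3 := rfl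
  have hVpos : 0 < p ^ 2 + q ^ 2 := by positivity
  set V := p ^ 2 + q ^ 2 with hVdef
  have hV1 : V % 2 = 1 := by
    rw [hVdef]; rw [hA] at hodd; omega
  have hU1 : (A + 2 * B) % 2 = 1 := by omega
  obtain ⟨r, hr0, hr⟩ := int_sq_pos h hm hU (by
    intro l hl h1 h2
    have hl2 : ¬ l ∣ 2 := fun h => int_dvd_two_contra hl hU1 h1 h
    have key : l ∣ B → False := fun hb => cop_contra hl hAB
      (pdvd_of_comb h1 hb (a := 1) (b := -2) (by ring)) hb
    rcases hl.dvd_or_dvd h2 with h3 | h3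
    · have h4 : l ∣ 2 * 2 * 2 * (B * B) :=
        pdvd_of_comb h1 h3 (a := 2 * B - A) (b := V) (by linear_combination -hV2)
      simp only [hl.dvd_mul, hl2, or_self, false_or] at h4
      exact key h4
    · rw [hW] at h3
      rcases hκ with rfl | rfl
      · have h4 : l ∣ 2 * 2 * 2 * (B * B * B) :=
          pdvd_of_comb h1 h3 (a := -(A ^ 2 - 2 * A * B + 4 * B ^ 2)) (b := 1) (by ring)
        simp only [hl.dvd_mul, hl2, or_self, false_or] at h4
        exact key h4
      · have h4 : l ∣ 2 * 2 * (B * B * B) :=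
          pdvd_of_comb h1 h3 (a := (A ^ 2 - 2 * A * B + 4 * B ^ 2)) (b := -1) (by ring)
        simp only [hl.dvd_mul, hl2, or_self, false_or] at h4
        exact key h4)
  rw [hr] at h
  obtain ⟨m', hm'⟩ := sq_cancel hr0 h
  have hm0 : m' ≠ 0 := by
    rintro rfl
    rw [hm'] at h
    simp at h
    exact hm (by simpa using h.symm)
  have hodd' : r % 2 = 1 := by
    by_contra hcon
    obtain ⟨r', rfl⟩ : (2 : ℤ) ∣ r := by omega
    rw [hr, show (2 * r') ^ 2 = 2 * (2 * r' ^ 2) by ring] at hU1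
    omega
  have hr8 := sq_mod_of_odd hodd'
  have hp2 : (2 : ℤ) ∣ p := by
    by_contra hcon
    have hp1 : p % 2 = 1 := by omega
    have hq1 : q % 2 = 0 := by
      by_contra h3
      have h3 := sq_mod_of_odd (w := q) (by omega)
      have h4 := sq_mod_of_odd hp1
      omega
    have h4 := sq_mod_of_odd hp1
    obtain ⟨q', rfl⟩ : (2 : ℤ) ∣ q := by omega
    have : r ^ 2 = 4 * (q' ^ 2 + p * q') - p ^ 2 := by rw [← hr, hA, hB]; ring
    omega
  obtain ⟨f, hf⟩ := int_sq_or hm' hm0 hVpos (r := 5) (by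
    intro l hl h1 h2
    have hlI := natPrime_int hl
    have hl2 : ¬ (l : ℤ) ∣ 2 := fun h => int_dvd_two_contra hlI hV1 h1 h
    have key : (l : ℤ) ∣ B → False := fun hb => by
      have : (l : ℤ) ∣ A ^ 2 := pdvd_of_comb h1 hb (a := V) (b := -4 * B) (by linear_combination -hV2)
      exact cop_contra hlI hAB (hlI.dvd_of_dvd_pow this) hb
    rw [hW] at h2
    have h5 : (l : ℤ) ∣ 5 := by
      rcases hκ with rfl | rfl
      · have h3 : (l : ℤ) ∣ 2 * 2 * (B * B) * (4 * B - A) :=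
          pdvd_of_comb h1 h2 (a := -V * A) (b := 1) (by linear_combination A * hV2)
        simp only [hlI.dvd_mul, hl2, or_self, false_or] at h3
        rcases h3 with h3 | h3
        · exact (key h3).elim
        have h4 : (l : ℤ) ∣ 2 * 2 * 5 * (B * B) :=
          pdvd_of_comb h1 h3 (a := V) (b := 4 * B + A) (by linear_combination -hV2)
        simp only [hlI.dvd_mul, hl2, or_self, false_or] at h4
        exact h4.resolve_right key
      · have h3 : (l : ℤ) ∣ 2 * 2 * (B * B) * (B - A) :=
          pdvd_of_comb h1 h2 (a := -V * A) (b := 1) (by linear_combination A * hV2)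
        simp only [hlI.dvd_mul, hl2, or_self, false_or] at h3
        rcases h3 with h3 | h3
        · exact (key h3).elim
        have h4 : (l : ℤ) ∣ 5 * (B * B) :=
          pdvd_of_comb h1 h3 (a := V) (b := B + A) (by linear_combination -hV2)
        simp only [hlI.dvd_mul, hl2, or_self, false_or] at h4
        exact h4.resolve_right key
    exact (Nat.prime_dvd_prime_iff_eq hl (by norm_num)).1 (by exact_mod_cast h5))
  have hf0 : f ≠ 0 := by
    rintro rfl
    simp at hf
    omega
  have he : r ^ 2 = q ^ 2 + 2 * q * p - p ^ 2 := by rw [← hr, hA, hB]; ring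
  rcases hf with hf | hf
  · exfalso
    rw [hf] at hm'
    obtain ⟨t, ht⟩ := sq_cancel hf0 hm'
    exact case4_e1 hκ hc.symm hp2 hp0 hr0 hf0 he (by rw [← hf, hVdef]; ring) ht
  · push_cast at hf
    rw [hf] at hm'
    obtain ⟨t, ht⟩ := sq_cancel (a := 5 * f) (x := 5 * fv κ p q) (m := 5 * m') (by omega)
      (by rw [mul_pow, mul_pow, ← hm']; ring)
    obtain ⟨t', rfl⟩ : (5 : ℤ) ∣ t := int_prime_five.dvd_of_dvd_pow (n := 2) ⟨_, ht.symm⟩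
    exact case4_e5 hκ hc.symm hp2 hr0 hf0 he (by rw [← hf, hVdef]; ring) (t := t')
      (by linarith [ht, mul_pow 5 t' 2])

theorem case4_odd {κ p q m : ℤ} (hκ : κ = 16 ∨ κ = 4) (hc : IsCoprime p q) (hp0 : p ≠ 0) (hq0 : q ≠ 0)
    (hodd : (q ^ 2 - p ^ 2) % 2 = 1) (hm : m ≠ 0)
    (h : (q ^ 2 - p ^ 2 + 2 * (p * q)) * ((p ^ 2 + q ^ 2) * fv κ p q) = m ^ 2) :
    κ = 4 ∧ (p = 2 * q ∨ q = -2 * p) := by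
  have hU0 : q ^ 2 - p ^ 2 + 2 * (p * q) ≠ 0 := by
    intro h0
    rw [h0] at h
    exact hm (by simpa using h.symm)
  rcases lt_or_gt_of_ne hU0 with hU | hU
  · have := case4_pos (p := q) (q := -p) (m := m) hκ hc.symm.neg_right hq0 (by
      rw [show (-p) ^ 2 - q ^ 2 = -(q ^ 2 - p ^ 2) by ring]; omega) hm (by linarith)
      (by rw [← h]; unfold fv; ring)
    exact ⟨this.1, Or.inr (by linarith [this.2])⟩
  · have := case4_pos hκ hc hp0 hodd hm hU h
    exact ⟨this.1, Or.inl this.2⟩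

theorem case4 {p q m : ℤ} (hc : IsCoprime p q) (hp0 : p ≠ 0) (hq0 : q ≠ 0) (hA0 : q ^ 2 - p ^ 2 ≠ 0)
    (hm : m ≠ 0)
    (h : (q ^ 2 - p ^ 2 + 2 * (p * q)) * ((p ^ 2 + q ^ 2) * ((q ^ 2 - p ^ 2) ^ 3 + 16 * (p * q) ^ 3)) = m ^ 2) :
    q = -3 * p ∨ p = 3 * q := by
  rcases Int.emod_two_eq_zero_or_one (q ^ 2 - p ^ 2) with h2 | h2
  · have hp1 : p % 2 = 1 ∧ q % 2 = 1 := by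
      have a1 : p % 2 = 1 ∨ (2 : ℤ) ∣ p := by omega
      have a2 : q % 2 = 1 ∨ (2 : ℤ) ∣ q := by omega
      rcases a1 with a1 | ⟨p', rfl⟩ <;> rcases a2 with a2 | ⟨q', rfl⟩
      · exact ⟨a1, a2⟩
      · have := sq_mod_of_odd a1
        rw [show (2 * q') ^ 2 = 2 * (2 * q' ^ 2) by ring] at h2
        omega
      · have := sq_mod_of_odd a2
        rw [show (2 * p') ^ 2 = 2 * (2 * p' ^ 2) by ring] at h2
        omega
      · exact (cop_contra int_prime_two hc ⟨_, rfl⟩ ⟨_, rfl⟩).elim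
    obtain ⟨x, hx⟩ : ∃ x, q - p = 2 * x := ⟨(q - p) / 2, by omega⟩
    obtain ⟨y, hy⟩ : ∃ y, q + p = 2 * y := ⟨(q + p) / 2, by omega⟩
    obtain rfl : q = y + x := by linarith
    obtain rfl : p = y - x := by linarith
    have hxy : (y ^ 2 - x ^ 2) % 2 = 1 := by
      have e : y ^ 2 - x ^ 2 = (y - x) * (y + x) := by ring
      rw [e, Int.mul_emod, hp1.1, hp1.2]; rfl
    have hcxy : IsCoprime x y := by
      apply int_coprime_of_primes
      · intro l hl h1 h2
        exact cop_contra hl hc (dvd_sub h2 h1) (dvd_add h2 h1)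
      · by_contra! h3
        exact hp0 (by rw [h3.1, h3.2]; rfl)
    have hx0 : x ≠ 0 := by rintro rfl; apply hA0; ring
    have hy0 : y ≠ 0 := by rintro rfl; apply hA0; ring
    obtain ⟨t, ht⟩ := sq_cancel (a := 8) (x := (y ^ 2 - x ^ 2 + 2 * (x * y)) * ((x ^ 2 + y ^ 2) * fv 4 x y))
      (m := m) (by norm_num) (by rw [← h]; unfold fv; ring)
    have ht0 : t ≠ 0 := by
      rintro rfl
      apply hm
      have : m ^ 2 = 64 * ((y ^ 2 - x ^ 2 + 2 * (x * y)) * ((x ^ 2 + y ^ 2) * fv 4 x y)) := by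
        rw [← h]; unfold fv; ring
      rw [ht] at this
      simpa using this
    rcases (case4_odd (Or.inr rfl) hcxy hx0 hy0 hxy ht0 ht).2 with h3 | h3
    · left; linarith
    · right; linarith
  · have := (case4_odd (κ := 16) (Or.inl rfl) hc hp0 hq0 h2 hm h).1
    omega

/-! ### The case `D₁` -/

theorem four_step {w M N : ℤ} (hw : w % 2 = 1) (hN : N ≠ 0) (hc : IsCoprime M N)
    (h : w ^ 2 + N ^ 4 = M ^ 4) :
    ∃ i j : ℤ, j % 2 = 1 ∧ i ≠ 0 ∧ IsCoprime i j ∧ j ^ 4 + 4 * i ^ 4 = M ^ 2 ∧ N ^ 2 = 4 * i ^ 2 * j ^ 2 := by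
  have hM : M ≠ 0 := by
    rintro rfl
    have : 0 < N ^ 4 := by positivity
    nlinarith [sq_nonneg w]
  have hcw : IsCoprime w (N ^ 2) := by
    apply int_coprime_of_primes
    · intro l hl h1 h2
      have h3 := hl.dvd_of_dvd_pow h2
      have h4 : l ∣ M ^ 4 := pdvd_of_comb h1 h3 (a := w) (b := N ^ 3) (by rw [← h]; ring)
      exact cop_contra hl hc (hl.dvd_of_dvd_pow h4) h3
    · right; positivity
  obtain ⟨e, f, h1, h2, h3, h4, h5, h6⟩ := PythagoreanTriple.coprime_classification'
    (x := w) (y := N ^ 2) (z := M ^ 2) (by unfold PythagoreanTriple; linear_combination h)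
    (Int.isCoprime_iff_gcd_eq_one.1 hcw) hw (by positivity)
  have hef : IsCoprime e f := Int.isCoprime_iff_gcd_eq_one.2 h4
  have hN2 : 0 < N ^ 2 := by positivity
  have he : 0 < e := by
    rcases h6.lt_or_eq with h | h
    · exact h
    · rw [← h] at h2; simp at h2; exact (hN h2).elim
  have hf : 0 < f := by
    by_contra hcon
    nlinarith
  have h2N : (2 : ℤ) ∣ N := int_prime_two.dvd_of_dvd_pow (n := 2) ⟨e * f, by rw [h2]; ring⟩
  obtain ⟨n, rfl⟩ := h2N
  have hn : n ≠ 0 := by rintro rfl; exact hN rfl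
  have hn' : 0 < |n| := abs_pos.2 hn
  have main : ∀ e f : ℤ, 0 < e → 0 < f → IsCoprime e f → e % 2 = 0 → f % 2 = 1 →
      (2 * n) ^ 2 = 2 * e * f → M ^ 2 = e ^ 2 + f ^ 2 → ∃ i j : ℤ, j % 2 = 1 ∧ i ≠ 0 ∧ IsCoprime i j ∧ j ^ 4 + 4 * i ^ 4 = M ^ 2 ∧ (2 * n) ^ 2 = 4 * i ^ 2 * j ^ 2 := by
    intro e f he hf hef he2 hf2 h2 h3
    obtain ⟨g, rfl⟩ : (2 : ℤ) ∣ e := by omega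
    have hg : IsCoprime g f := hef.of_mul_left_right
    obtain ⟨i, j, hi, hj, hi', hj', hij⟩ := int_pow_split (k := 2) two_ne_zero (by omega) hf hn' hg
      (by rw [sq_abs]; linarith)
    refine ⟨i, j, ?_, hi.ne', ?_, ?_, ?_⟩
    · by_contra hcon
      obtain ⟨t, rfl⟩ : (2 : ℤ) ∣ j := by omega
      rw [show (2 * t) ^ 2 = 2 * (2 * t ^ 2) by ring] at hj'
      omega
    · rw [hi', hj'] at hg
      exact (IsCoprime.pow_iff (by norm_num) (by norm_num)).1 hg
    · rw [h3, hi', hj']; ring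
    · rw [h2, hi', hj']; ring
  rcases h5 with h5 | h5
  · exact main e f he hf hef h5.1 h5.2 h2 h3
  · exact main f e hf he hef.symm h5.2 h5.1 (by rw [h2]; ring) (by rw [h3]; ring)

theorem no_j4_4i4 (n : ℕ) : ∀ {i j q : ℤ}, i.natAbs = n → j % 2 = 1 → i ≠ 0 → IsCoprime i j →
    j ^ 4 + 4 * i ^ 4 = q ^ 2 → False := by
  induction n using Nat.strong_induction_on with
  | _ n ih =>
    intro i j q hn hj hi hc h
    have hq0 : q ≠ 0 := by
      rintro rfl
      have : 0 < i ^ 4 := by positivity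
      have : 0 ≤ j ^ 4 := by positivity
      linarith
    have hj0 : j ≠ 0 := by rintro rfl; omega
    have hcj : IsCoprime (j ^ 2) (2 * i ^ 2) := by
      apply IsCoprime.mul_right
      · apply IsCoprime.pow_left
        apply int_coprime_of_primes
        · intro l hl h1 h2
          exact int_dvd_two_contra hl hj h1 h2
        · right; norm_num
      · exact hc.symm.pow
    obtain ⟨m, k, h1, h2, h3, h4, h5, h6⟩ := PythagoreanTriple.coprime_classification'
      (x := j ^ 2) (y := 2 * i ^ 2) (z := |q|) (by unfold PythagoreanTriple; rw [abs_mul_abs_self]; linear_combination h)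
      (Int.isCoprime_iff_gcd_eq_one.1 hcj) (by have := sq_mod_of_odd hj; omega) (by positivity)
    have hmk : i ^ 2 = m * k := by linarith
    have hi2 : 0 < i ^ 2 := by positivity
    have hm : 0 < m := by
      rcases h6.lt_or_eq with h | h
      · exact h
      · rw [← h] at hmk; simp at hmk; exact (hi hmk).elim
    have hk : 0 < k := by
      by_contra hcon
      nlinarith
    obtain ⟨M, N, hM, hN, hM', hN', hMN⟩ := int_pow_split (k := 2) two_ne_zero hm hk (abs_pos.2 hi)
      (Int.isCoprime_iff_gcd_eq_one.2 h4) (by rw [sq_abs]; linarith)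
    have hMNc : IsCoprime M N := by
      have := Int.isCoprime_iff_gcd_eq_one.2 h4
      rw [hM', hN'] at this
      exact (IsCoprime.pow_iff (by norm_num) (by norm_num)).1 this
    obtain ⟨i', j', a1, a2, a3, a4, a5⟩ := four_step (w := j) (M := M) (N := N) hj hN.ne' hMNc
      (by rw [h1, hM', hN']; ring)
    refine ih i'.natAbs ?_ rfl a1 a2 a3 a4
    rw [← hn]
    have hj'0 : j' ≠ 0 := by rintro rfl; omega
    have hj2 : 1 ≤ j' ^ 2 := by have : 0 < j' ^ 2 := by positivity
                                omega
    have hM2 : 1 ≤ M ^ 2 := by nlinarith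
    have hi'2 : 0 < i' ^ 2 := by positivity
    apply Int.natAbs_lt_iff_sq_lt.2
    have e1 : i ^ 2 = M ^ 2 * N ^ 2 := by rw [hmk, hM', hN']
    rw [e1, a5]
    nlinarith [mul_pos hi'2 (show 0 < j' ^ 2 by linarith), mul_nonneg hi'2.le (show 0 ≤ j' ^ 2 - 1 by linarith),
      mul_nonneg (show (0:ℤ) ≤ M ^ 2 - 1 by linarith) (show 0 ≤ 4 * i' ^ 2 * j' ^ 2 by positivity)]

theorem no_diff_four {w p q : ℤ} (hw : w % 2 = 1) (hp : p ≠ 0) (hc : IsCoprime p q)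
    (h : w ^ 2 + p ^ 4 = q ^ 4) : False := by
  obtain ⟨i, j, a1, a2, a3, a4, a5⟩ := four_step hw hp hc.symm h
  exact no_j4_4i4 _ rfl a1 a2 a3 a4

/-- The transformation used when `p`, `q` are both odd. -/
theorem both_odd {p q : ℤ} (hc : IsCoprime p q) (hp0 : p ≠ 0) (hA0 : q ^ 2 - p ^ 2 ≠ 0)
    (h2 : (q ^ 2 - p ^ 2) % 2 = 0) : ∃ x y : ℤ, p = y - x ∧ q = y + x ∧ IsCoprime x y ∧ x ≠ 0 ∧ y ≠ 0 ∧
      (y ^ 2 - x ^ 2) % 2 = 1 := by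
  have hp1 : p % 2 = 1 ∧ q % 2 = 1 := by
    have a1 : p % 2 = 1 ∨ (2 : ℤ) ∣ p := by omega
    have a2 : q % 2 = 1 ∨ (2 : ℤ) ∣ q := by omega
    rcases a1 with a1 | ⟨p', rfl⟩ <;> rcases a2 with a2 | ⟨q', rfl⟩
    · exact ⟨a1, a2⟩
    · have := sq_mod_of_odd a1
      rw [show (2 * q') ^ 2 = 2 * (2 * q' ^ 2) by ring] at h2
      omega
    · have := sq_mod_of_odd a2
      rw [show (2 * p') ^ 2 = 2 * (2 * p' ^ 2) by ring] at h2
      omega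
    · exact (cop_contra int_prime_two hc ⟨_, rfl⟩ ⟨_, rfl⟩).elim
  obtain ⟨x, hx⟩ : ∃ x, q - p = 2 * x := ⟨(q - p) / 2, by omega⟩
  obtain ⟨y, hy⟩ : ∃ y, q + p = 2 * y := ⟨(q + p) / 2, by omega⟩
  obtain rfl : q = y + x := by linarith
  obtain rfl : p = y - x := by linarith
  refine ⟨x, y, rfl, rfl, ?_, ?_, ?_, ?_⟩
  · apply int_coprime_of_primes
    · intro l hl h1 h2
      exact cop_contra hl hc (dvd_sub h2 h1) (dvd_add h2 h1)
    · by_contra! h3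
      exact hp0 (by rw [h3.1, h3.2]; rfl)
  · rintro rfl; apply hA0; ring
  · rintro rfl; apply hA0; ring
  · have e : y ^ 2 - x ^ 2 = (y - x) * (y + x) := by ring
    rw [e, Int.mul_emod, hp1.1, hp1.2]; rfl

/-- coprimality facts for `U`, `V` (opposite parity) -/
theorem uv_facts {p q : ℤ} (hc : IsCoprime p q) (hodd : (q ^ 2 - p ^ 2) % 2 = 1) {l : ℤ} (hl : Prime l) :
    (l ∣ q ^ 2 - p ^ 2 → l ∣ p * q → False) ∧
    (l ∣ q ^ 2 - p ^ 2 + 2 * (p * q) → ¬ l ∣ 2) ∧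
    (l ∣ p ^ 2 + q ^ 2 → ¬ l ∣ 2) ∧
    (l ∣ q ^ 2 - p ^ 2 + 2 * (p * q) → l ∣ p * q → False) ∧
    (l ∣ p ^ 2 + q ^ 2 → l ∣ p * q → False) ∧
    (l ∣ q ^ 2 - p ^ 2 + 2 * (p * q) → l ∣ q ^ 2 - p ^ 2 → False) ∧
    (l ∣ p ^ 2 + q ^ 2 → l ∣ q ^ 2 - p ^ 2 → False) ∧
    (l ∣ q ^ 2 - p ^ 2 + 2 * (p * q) → l ∣ p ^ 2 + q ^ 2 → False) := by
  have hAB := cop_AB hc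
  have hV2 : (p ^ 2 + q ^ 2) * (p ^ 2 + q ^ 2) = (q ^ 2 - p ^ 2) ^ 2 + 4 * (p * q) ^ 2 := by ring
  have hV1 : (p ^ 2 + q ^ 2) % 2 = 1 := by omega
  have hU1 : (q ^ 2 - p ^ 2 + 2 * (p * q)) % 2 = 1 := by omega
  set A := q ^ 2 - p ^ 2
  set B := p * q
  set V := p ^ 2 + q ^ 2
  have f1 : l ∣ A → l ∣ B → False := fun h1 h2 => cop_contra hl hAB h1 h2
  have f2 : l ∣ A + 2 * B → ¬ l ∣ 2 := fun h1 h => int_dvd_two_contra hl hU1 h1 h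
  have f3 : l ∣ V → ¬ l ∣ 2 := fun h1 h => int_dvd_two_contra hl hV1 h1 h
  have f4 : l ∣ A + 2 * B → l ∣ B → False := fun h1 h2 =>
    f1 (pdvd_of_comb h1 h2 (a := 1) (b := -2) (by ring)) h2
  have f5 : l ∣ V → l ∣ B → False := fun h1 h2 => by
    have : l ∣ A ^ 2 := pdvd_of_comb h1 h2 (a := V) (b := -4 * B) (by linear_combination -hV2)
    exact f1 (hl.dvd_of_dvd_pow this) h2
  refine ⟨f1, f2, f3, f4, f5, ?_, ?_, ?_⟩
  · intro h1 h2
    have h3 : l ∣ 2 * B := pdvd_of_comb h1 h2 (a := 1) (b := -1) (by ring)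
    exact f4 h1 ((hl.dvd_or_dvd h3).resolve_left (f2 h1))
  · intro h1 h2
    have h4 : l ∣ 2 * 2 * (B * B) :=
      pdvd_of_comb h1 h2 (a := V) (b := -A) (by linear_combination -hV2)
    simp only [hl.dvd_mul, f3 h1, or_self, false_or] at h4
    exact f5 h1 h4
  · intro h1 h3
    have h4 : l ∣ 2 * 2 * 2 * (B * B) :=
      pdvd_of_comb h1 h3 (a := 2 * B - A) (b := V) (by linear_combination -hV2)
    simp only [hl.dvd_mul, f2 h1, or_self, false_or] at h4
    exact f4 h1 h4

theorem case1 {p q m : ℤ} (hc : IsCoprime p q) (hp0 : p ≠ 0) (hq0 : q ≠ 0) (hA0 : q ^ 2 - p ^ 2 ≠ 0)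
    (hm : m ≠ 0)
    (h : (q ^ 2 - p ^ 2) * ((q ^ 2 - p ^ 2 + 2 * (p * q)) * (p ^ 2 + q ^ 2)) = m ^ 2) : False := by
  rcases Int.emod_two_eq_zero_or_one (q ^ 2 - p ^ 2) with h2 | h2
  · obtain ⟨x, y, rfl, rfl, hcxy, hx0, hy0, hxy⟩ := both_odd hc hp0 hA0 h2
    obtain ⟨n, hn⟩ := sq_cancel (a := 4)
      (x := (x * y) * ((y ^ 2 - x ^ 2 + 2 * (x * y)) * (x ^ 2 + y ^ 2)))
      (m := m) (by norm_num) (by rw [← h]; ring)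
    have hn0 : n ≠ 0 := by
      rintro rfl
      apply hm
      have : m ^ 2 = 16 * ((x * y) * ((y ^ 2 - x ^ 2 + 2 * (x * y)) * (x ^ 2 + y ^ 2))) := by
        rw [← h]; ring
      rw [hn] at this
      simpa using this
    obtain ⟨s, hs0, hs⟩ := int_sq_pos (a := x ^ 2 + y ^ 2) (b := (x * y) * (y ^ 2 - x ^ 2 + 2 * (x * y)))
      (m := n) (by rw [← hn]; ring) hn0 (by positivity) (by
        intro l hl h1 h3
        obtain ⟨f1, f2, f3, f4, f5, f6, f7, f8⟩ := uv_facts hcxy hxy hl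
        rcases hl.dvd_or_dvd h3 with h4 | h4
        · exact f5 h1 h4
        · exact f8 h4 h1)
    obtain ⟨b, hb0, hb⟩ := int_sq_pm (a := x * y) (b := (y ^ 2 - x ^ 2 + 2 * (x * y)) * (x ^ 2 + y ^ 2))
      (m := n) (by rw [← hn]) hn0 (by
        intro l hl h1 h3
        obtain ⟨f1, f2, f3, f4, f5, f6, f7, f8⟩ := uv_facts hcxy hxy hl
        rcases hl.dvd_or_dvd h3 with h4 | h4
        · exact f4 h4 h1
        · exact f5 h4 h1)
    have hab : |x| * |y| = |b| ^ 2 := by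
      rw [← abs_mul, sq_abs]
      rcases hb with hb | hb
      · rw [hb, abs_of_nonneg (sq_nonneg b)]
      · rw [hb, abs_neg, abs_of_nonneg (sq_nonneg b)]
    obtain ⟨X, Y, hX, hY, hX', hY', -⟩ := int_pow_split (k := 2) two_ne_zero (abs_pos.2 hx0) (abs_pos.2 hy0)
      (abs_pos.2 hb0) ((IsCoprime.abs_abs_iff _ _).2 hcxy) hab
    refine not_fermat_42 hX.ne' hY.ne' (c := s) ?_
    rw [← hs, ← sq_abs x, ← sq_abs y, hX', hY']; ring
  · obtain ⟨s, hs0, hs⟩ := int_sq_pos (a := p ^ 2 + q ^ 2) (b := (q ^ 2 - p ^ 2) * (q ^ 2 - p ^ 2 + 2 * (p * q)))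
      (m := m) (by rw [← h]; ring) hm (by positivity) (by
        intro l hl h1 h3
        obtain ⟨f1, f2, f3, f4, f5, f6, f7, f8⟩ := uv_facts hc h2 hl
        rcases hl.dvd_or_dvd h3 with h4 | h4
        · exact f7 h1 h4
        · exact f8 h4 h1)
    obtain ⟨a, ha0, ha⟩ := int_sq_pm (a := q ^ 2 - p ^ 2) (b := (q ^ 2 - p ^ 2 + 2 * (p * q)) * (p ^ 2 + q ^ 2))
      (m := m) (by rw [← h]) hm (by
        intro l hl h1 h3
        obtain ⟨f1, f2, f3, f4, f5, f6, f7, f8⟩ := uv_facts hc h2 hl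
        rcases hl.dvd_or_dvd h3 with h4 | h4
        · exact f6 h4 h1
        · exact f7 h4 h1)
    have hodd : (a * s) % 2 = 1 := by
      have : ((a * s) ^ 2) % 2 = 1 := by
        rw [mul_pow, ← hs]
        rcases ha with ha | ha
        · rw [← ha, Int.mul_emod, h2, show (p ^ 2 + q ^ 2) % 2 = 1 by omega]; rfl
        · rw [show a ^ 2 = -(q ^ 2 - p ^ 2) by linarith, Int.mul_emod,
            show (-(q ^ 2 - p ^ 2)) % 2 = 1 by omega, show (p ^ 2 + q ^ 2) % 2 = 1 by omega]; rfl
      by_contra hcon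
      obtain ⟨t, ht⟩ : (2 : ℤ) ∣ a * s := by omega
      rw [ht, show (2 * t) ^ 2 = 2 * (2 * t ^ 2) by ring] at this
      omega
    rcases ha with ha | ha
    · exact no_diff_four hodd hp0 hc (by rw [mul_pow, ← hs, ← ha]; ring)
    · exact no_diff_four hodd hq0 hc.symm (by rw [mul_pow, ← hs, show a ^ 2 = -(q ^ 2 - p ^ 2) by linarith]; ring)

/-! ### The case `D₃`: descent for `X⁴ + X² Y² - Y⁴ = Z²` -/

theorem cop_of_pow {a b : ℤ} {m n : ℕ} (hm : 0 < m) (hn : 0 < n) (h : IsCoprime (a ^ m) (b ^ n)) : IsCoprime a b :=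
  (IsCoprime.pow_iff hm hn).1 h

theorem five_split {α β y : ℤ} (hα : 0 < α) (hβ : 0 < β) (hy : y ≠ 0) (hc : IsCoprime α β)
    (h : α * β = 5 * y ^ 4) :
    ∃ a b : ℤ, 0 < a ∧ 0 < b ∧ |y| = a * b ∧ IsCoprime a b ∧ α + β = a ^ 4 + 5 * b ^ 4 := by
  have main : ∀ α β : ℤ, 0 < α → 0 < β → IsCoprime α β → α * β = 5 * y ^ 4 → 5 ∣ β →
      ∃ a b : ℤ, 0 < a ∧ 0 < b ∧ |y| = a * b ∧ IsCoprime a b ∧ α + β = a ^ 4 + 5 * b ^ 4 := by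
    rintro α β hα hβ hc h ⟨β', rfl⟩
    have hc' : IsCoprime α β' := hc.of_mul_right_right
    obtain ⟨a, b, ha, hb, ha', hb', hab⟩ := int_pow_split (k := 4) four_ne_zero hα (by omega) (abs_pos.2 hy)
      hc' (by rw [show |y| ^ 4 = y ^ 4 from Even.pow_abs (by decide) y]; linarith)
    refine ⟨a, b, ha, hb, hab, ?_, by rw [ha', hb']⟩
    rw [ha', hb'] at hc'
    exact cop_of_pow (by norm_num) (by norm_num) hc'
  rcases int_prime_five.dvd_or_dvd (a := α) (b := β) ⟨_, h⟩ with h5 | h5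
  · obtain ⟨a, b, h1, h2, h3, h4, h6⟩ := main β α hβ hα hc.symm (by rw [mul_comm]; exact h) h5
    exact ⟨a, b, h1, h2, h3, h4, by rw [add_comm]; exact h6⟩
  · exact main α β hα hβ hc h h5

theorem odd_pow_of {a : ℤ} {n : ℕ} (hn : n ≠ 0) (h : (a ^ n) % 2 = 1) : a % 2 = 1 := by
  by_contra hcon
  have h2 : (2 : ℤ) ∣ a := by omega
  have : (2 : ℤ) ∣ a ^ n := dvd_pow h2 hn
  omega

theorem odd_of_mul {a b : ℤ} (h : (a * b) % 2 = 1) : a % 2 = 1 ∧ b % 2 = 1 := by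
  constructor
  · by_contra hcon
    have : (2 : ℤ) ∣ a * b := Dvd.dvd.mul_right (by omega) b
    omega
  · by_contra hcon
    have : (2 : ℤ) ∣ a * b := Dvd.dvd.mul_left (by omega) a
    omega

theorem odd_mul {a b : ℤ} (ha : a % 2 = 1) (hb : b % 2 = 1) : (a * b) % 2 = 1 := by
  rw [Int.mul_emod, ha, hb]; rfl

/-- two nested Pythagorean triples -/
theorem nested {b e x : ℤ} (hb : b % 2 = 1) (hc : IsCoprime b e) (hx : x ≠ 0)
    (h : (b ^ 2) ^ 2 + (2 * e) ^ 2 = x ^ 2) :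
    ∃ σ δ : ℤ, b = σ * δ ∧ IsCoprime σ δ ∧ b ^ 2 + 4 * e = σ ^ 4 + σ ^ 2 * δ ^ 2 - δ ^ 4 ∧
      (σ ^ 2 = δ ^ 2 → e = 0) := by
  have hb0 : b ≠ 0 := by rintro rfl; omega
  have hc2 : IsCoprime b 2 := by
    apply int_coprime_of_primes
    · intro l hl h1 h2
      exact int_dvd_two_contra hl hb h1 h2
    · right; norm_num
  have hc3 : IsCoprime (b ^ 2) (2 * e) := (hc2.mul_right hc).pow_left
  obtain ⟨k, l, h1, h2, h3, h4, h5, h6⟩ := PythagoreanTriple.coprime_classification'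
      (x := b ^ 2) (y := 2 * e) (z := |x|) (by unfold PythagoreanTriple; rw [abs_mul_abs_self]; linear_combination h)
      (Int.isCoprime_iff_gcd_eq_one.1 hc3) (by have := sq_mod_of_odd hb; omega) (by positivity)
  have hkl := Int.isCoprime_iff_gcd_eq_one.2 h4
  have hk : 0 < k := by
    rcases h6.lt_or_eq with h | h
    · exact h
    · rw [← h] at h1
      have : 0 < b ^ 2 := by positivity
      nlinarith [sq_nonneg l]
  have hbl : IsCoprime b l := by
    apply int_coprime_of_primes
    · intro r hr a1 a2
      have : r ∣ k ^ 2 := pdvd_of_comb a1 a2 (a := b) (b := l) (by linarith)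
      exact cop_contra hr hkl (hr.dvd_of_dvd_pow this) a2
    · exact Or.inl hb0
  obtain ⟨c, d, g1, g2, g3, g4, g5, g6⟩ := PythagoreanTriple.coprime_classification'
      (x := b) (y := l) (z := k) (by unfold PythagoreanTriple; linarith)
      (Int.isCoprime_iff_gcd_eq_one.1 hbl) hb hk
  have hcd := Int.isCoprime_iff_gcd_eq_one.2 g4
  refine ⟨c + d, c - d, by rw [g1]; ring, ?_, ?_, ?_⟩
  · apply int_coprime_of_primes
    · intro r hr a1 a2
      have hr2 : ¬ r ∣ 2 := fun hr2 => int_dvd_two_contra hr (x := c + d) (by omega) a1 hr2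
      have a3 : r ∣ 2 * c := pdvd_of_comb a1 a2 (a := 1) (b := 1) (by ring)
      have a4 : r ∣ 2 * d := pdvd_of_comb a1 a2 (a := 1) (b := -1) (by ring)
      exact cop_contra hr hcd ((hr.dvd_or_dvd a3).resolve_left hr2) ((hr.dvd_or_dvd a4).resolve_left hr2)
    · left; intro h0; omega
  · have : e = k * l := by linarith
    rw [this, g3, g2, g1]; ring
  · intro hs
    have : l = 0 := by rw [g2]; linarith [hs, show (c + d) ^ 2 - (c - d) ^ 2 = 2 * (2 * c * d) by ring]
    have h7 : e = k * l := by linarith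
    rw [h7, this, mul_zero]

set_option maxHeartbeats 1000000 in
theorem quartic_descent (n : ℕ) : ∀ {X Y Z : ℤ}, Y.natAbs = n → X ≠ 0 → Y ≠ 0 → IsCoprime X Y →
    X ^ 4 + X ^ 2 * Y ^ 2 - Y ^ 4 = Z ^ 2 → X ^ 2 = 1 ∧ Y ^ 2 = 1 := by
  induction n using Nat.strong_induction_on with
  | _ n ih =>
    intro X Y Z hn hX hY hc h
    rcases Int.emod_two_eq_zero_or_one Y with hY2 | hY2
    · exfalso
      obtain ⟨y, rfl⟩ : (2 : ℤ) ∣ Y := by omega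
      have hX2 : X % 2 = 1 := by
        by_contra hcon
        exact cop_contra int_prime_two hc (by omega) ⟨_, rfl⟩
      have hy : y ≠ 0 := by rintro rfl; exact hY rfl
      have hX8 := sq_mod_of_odd hX2
      have hZ2 : Z % 2 = 1 := by
        apply odd_pow_of two_ne_zero
        rw [← h]
        have := sq_mod_of_odd (w := X ^ 2) (by omega)
        rw [show X ^ 4 + X ^ 2 * (2 * y) ^ 2 - (2 * y) ^ 4 = (X ^ 2) ^ 2 + 2 * (2 * X ^ 2 * y ^ 2 - 8 * y ^ 4) by ring]
        omega
      obtain ⟨α, hα⟩ : ∃ α, X ^ 2 + 2 * y ^ 2 - Z = 2 * α := ⟨(X ^ 2 + 2 * y ^ 2 - Z) / 2, by omega⟩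
      obtain ⟨β, hβ⟩ : ∃ β, X ^ 2 + 2 * y ^ 2 + Z = 2 * β := ⟨(X ^ 2 + 2 * y ^ 2 + Z) / 2, by omega⟩
      have hP : α + β = X ^ 2 + 2 * y ^ 2 := by linarith
      have hαβ : α * β = 5 * y ^ 4 := by
        have : (2 * α) * (2 * β) = 20 * y ^ 4 := by rw [← hα, ← hβ]; linear_combination h
        linarith
      have hpos : 0 < α * β := by rw [hαβ]; positivity
      have hsum : 0 < α + β := by rw [hP]; positivity
      have hα0 : 0 < α := by
        by_contra hcon
        nlinarith
      have hβ0 : 0 < β := by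
        by_contra hcon
        nlinarith
      have hcαβ : IsCoprime α β := by
        apply int_coprime_of_primes
        · intro l hl h1 h2
          have h3 : l ∣ X ^ 2 + 2 * y ^ 2 := hP ▸ dvd_add h1 h2
          have hly : l ∣ y := by
            by_contra hly
            have h4 : l * l ∣ 5 * y ^ 4 := hαβ ▸ mul_dvd_mul h1 h2
            have h5 : l ∣ 5 := by
              have : l ∣ 5 * y ^ 4 := (Dvd.intro _ rfl).trans h4
              exact (hl.dvd_or_dvd this).resolve_right fun h => hly (hl.dvd_of_dvd_pow h)
            have h6 : Associated l 5 := hl.associated_of_dvd int_prime_five h5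
            have h7 : l * 5 ∣ 5 * y ^ 4 := (mul_dvd_mul_left l h6.symm.dvd).trans h4
            rw [mul_comm] at h7
            exact hly (hl.dvd_of_dvd_pow ((mul_dvd_mul_iff_left (by norm_num)).1 h7))
          have : l ∣ X ^ 2 := pdvd_of_comb h3 hly (a := 1) (b := -2 * y) (by ring)
          exact cop_contra hl hc (hl.dvd_of_dvd_pow this) (hly.mul_left 2)
        · exact Or.inl hα0.ne'
      obtain ⟨a, b, ha, hb, hab, hcab, hs⟩ := five_split hα0 hβ0 hy hcαβ hαβ
      have hyab : y ^ 2 = a ^ 2 * b ^ 2 := by rw [← sq_abs, hab]; ring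
      have hXab : (a ^ 2 - b ^ 2) ^ 2 + (2 * b ^ 2) ^ 2 = X ^ 2 := by
        linear_combination hP - hs + 2 * hyab
      have hodd : (a ^ 2 - b ^ 2) % 2 = 1 := by
        apply odd_pow_of two_ne_zero
        have : (a ^ 2 - b ^ 2) ^ 2 = X ^ 2 - 2 * (2 * (b ^ 2) ^ 2) := by linear_combination hXab
        rw [this]; omega
      have hcc : IsCoprime (a ^ 2 - b ^ 2) (2 * b ^ 2) := by
        apply int_coprime_of_primes
        · intro l hl h1 h2
          have hl2 : ¬ l ∣ 2 := fun h => int_dvd_two_contra hl hodd h1 h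
          have hlb : l ∣ b := hl.dvd_of_dvd_pow ((hl.dvd_or_dvd h2).resolve_left hl2)
          have : l ∣ a ^ 2 := pdvd_of_comb h1 hlb (a := 1) (b := b) (by ring)
          exact cop_contra hl hcab (hl.dvd_of_dvd_pow this) hlb
        · right; positivity
      obtain ⟨k, l, h1, h2, h3, h4, h5, h6⟩ := PythagoreanTriple.coprime_classification'
        (x := a ^ 2 - b ^ 2) (y := 2 * b ^ 2) (z := |X|)
        (by unfold PythagoreanTriple; rw [abs_mul_abs_self]; linear_combination hXab)
        (Int.isCoprime_iff_gcd_eq_one.1 hcc) hodd (by positivity)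
      have hkl := Int.isCoprime_iff_gcd_eq_one.2 h4
      have hb2 : b ^ 2 = k * l := by linarith
      have hbpos : 0 < b ^ 2 := by positivity
      have hk : 0 < k := by
        rcases h6.lt_or_eq with h | h
        · exact h
        · rw [← h] at hb2; omega
      have hl : 0 < l := by
        by_contra hcon
        nlinarith
      obtain ⟨c, d, hc0, hd0, hc', hd', hcd⟩ := int_pow_split (k := 2) two_ne_zero hk hl hb hkl hb2.symm
      have hccd : IsCoprime c d := by
        rw [hc', hd'] at hkl
        exact cop_of_pow (by norm_num) (by norm_num) hkl
      have := ih d.natAbs (by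
        have e1 : |2 * y| = 2 * (a * (c * d)) := by rw [abs_mul, hab, hcd]; rfl
        have e2 : d < |2 * y| := by
          rw [e1]
          have e3 : d ≤ c * d := le_mul_of_one_le_left hd0.le (by omega)
          have e4 : c * d ≤ a * (c * d) := le_mul_of_one_le_left (by omega) (by omega)
          omega
        rw [← hn]
        zify
        rwa [abs_of_pos hd0]) (X := c) (Y := d) (Z := a) rfl hc0.ne' hd0.ne' hccd (by
          have : a ^ 2 = b ^ 2 + k ^ 2 - l ^ 2 := by linarith
          rw [this, hb2, hc', hd']; ring)
      rw [h1, hc', hd', this.1, this.2] at hodd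
      omega
    · have hY8 := sq_mod_of_odd hY2
      have hX2 : X % 2 = 1 := by
        by_contra hcon
        obtain ⟨x, rfl⟩ : (2 : ℤ) ∣ X := by omega
        have h1 := sq_mod_of_odd (w := Y ^ 2) (by omega)
        have e : Z ^ 2 = 4 * (4 * x ^ 4 + x ^ 2 * Y ^ 2) - (Y ^ 2) ^ 2 := by rw [← h]; ring
        rcases Int.emod_two_eq_zero_or_one Z with h3 | h3
        · obtain ⟨z, rfl⟩ : (2 : ℤ) ∣ Z := by omega
          rw [show (2 * z) ^ 2 = 4 * z ^ 2 by ring] at e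
          omega
        · have := sq_mod_of_odd h3
          omega
      have hX8 := sq_mod_of_odd hX2
      have hodd2 : ∀ s : ℤ, (2 * X ^ 2 + Y ^ 2 + 2 * s) % 2 = 1 := fun s => by omega
      set α := 2 * X ^ 2 + Y ^ 2 - 2 * Z with hα
      set β := 2 * X ^ 2 + Y ^ 2 + 2 * Z with hβ
      have hα2 : α % 2 = 1 := by rw [hα]; omega
      have hαβ : α * β = 5 * Y ^ 4 := by rw [hα, hβ]; linear_combination 4 * h
      have hP : α + β = 2 * (2 * X ^ 2 + Y ^ 2) := by rw [hα, hβ]; ring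
      have hpos : 0 < α * β := by rw [hαβ]; positivity
      have hsum : 0 < α + β := by rw [hP]; positivity
      have hα0 : 0 < α := by
        by_contra hcon
        nlinarith
      have hβ0 : 0 < β := by
        by_contra hcon
        nlinarith
      have hcαβ : IsCoprime α β := by
        apply int_coprime_of_primes
        · intro l hl h1 h2
          have hl2 : ¬ l ∣ 2 := fun h => int_dvd_two_contra hl hα2 h1 h
          have h3 : l ∣ 2 * (2 * X ^ 2 + Y ^ 2) := hP ▸ dvd_add h1 h2
          have h3 := (hl.dvd_or_dvd h3).resolve_left hl2
          have hly : l ∣ Y := by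
            by_contra hly
            have h4 : l * l ∣ 5 * Y ^ 4 := hαβ ▸ mul_dvd_mul h1 h2
            have h5 : l ∣ 5 := by
              have : l ∣ 5 * Y ^ 4 := (Dvd.intro _ rfl).trans h4
              exact (hl.dvd_or_dvd this).resolve_right fun h => hly (hl.dvd_of_dvd_pow h)
            have h6 : Associated l 5 := hl.associated_of_dvd int_prime_five h5
            have h7 : l * 5 ∣ 5 * Y ^ 4 := (mul_dvd_mul_left l h6.symm.dvd).trans h4
            rw [mul_comm] at h7
            exact hly (hl.dvd_of_dvd_pow ((mul_dvd_mul_iff_left (by norm_num)).1 h7))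
          have : l ∣ 2 * X ^ 2 := pdvd_of_comb h3 hly (a := 1) (b := -Y) (by ring)
          exact cop_contra hl hc (hl.dvd_of_dvd_pow ((hl.dvd_or_dvd this).resolve_left hl2)) hly
        · exact Or.inl hα0.ne'
      obtain ⟨a, b, ha, hb, hab, hcab, hs⟩ := five_split hα0 hβ0 hY hcαβ hαβ
      have hYab : Y ^ 2 = a ^ 2 * b ^ 2 := by rw [← sq_abs, hab]; ring
      have hab2 : a % 2 = 1 ∧ b % 2 = 1 := by
        apply odd_of_mul
        rw [← hab]
        rcases abs_choice Y with h1 | h1 <;> rw [h1] <;> omega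
      have ha8 := sq_mod_of_odd hab2.1
      have hb8 := sq_mod_of_odd hab2.2
      obtain ⟨e, he⟩ : ∃ e, a ^ 2 - b ^ 2 = 4 * e := ⟨(a ^ 2 - b ^ 2) / 4, by omega⟩
      have hXab : (b ^ 2) ^ 2 + (2 * e) ^ 2 = X ^ 2 := by
        have : 4 * ((b ^ 2) ^ 2 + (2 * e) ^ 2) = 4 * X ^ 2 := by
          linear_combination hP - hs + 2 * hYab - (a ^ 2 - b ^ 2 + 4 * e) * he
        linarith
      have hbe : IsCoprime b e := by
        apply int_coprime_of_primes
        · intro l hl h1 h2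
          have : l ∣ a ^ 2 := pdvd_of_comb h1 h2 (a := b) (b := 4) (by linarith)
          exact cop_contra hl hcab (hl.dvd_of_dvd_pow this) h1
        · left; omega
      obtain ⟨σ, δ, hbσ, hcσ, hq, -⟩ := nested hab2.2 hbe hX hXab
      have hσ0 : σ ≠ 0 := by rintro rfl; simp at hbσ; omega
      have hδ0 : δ ≠ 0 := by rintro rfl; simp at hbσ; omega
      have hq' : σ ^ 4 + σ ^ 2 * δ ^ 2 - δ ^ 4 = a ^ 2 := by rw [← hq]; linarith
      have hfin : σ ^ 2 = 1 ∧ δ ^ 2 = 1 := by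
        have hσ2 : 1 ≤ σ ^ 2 := by
          have : 0 < σ ^ 2 := by positivity
          omega
        have hδ2 : 1 ≤ δ ^ 2 := by
          have : 0 < δ ^ 2 := by positivity
          omega
        have ha2 : 1 ≤ a ^ 2 := by nlinarith
        have hYY : Y ^ 2 = a ^ 2 * σ ^ 2 * δ ^ 2 := by rw [hYab, hbσ]; ring
        by_cases hlt : δ ^ 2 < Y ^ 2
        · exact ih δ.natAbs (by rw [← hn]; exact Int.natAbs_lt_iff_sq_lt.2 hlt) rfl hσ0 hδ0 hcσ hq'
        · have h1 : a ^ 2 * σ ^ 2 ≤ 1 := by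
            by_contra hcon
            have : 2 ≤ a ^ 2 * σ ^ 2 := by omega
            nlinarith
          have h2 : σ ^ 2 = 1 := by nlinarith
          have h3 : a ^ 2 = 1 := by nlinarith
          refine ⟨h2, ?_⟩
          have h4 : σ ^ 4 = 1 := by rw [show σ ^ 4 = (σ ^ 2) ^ 2 by ring, h2]; rfl
          rw [h2, h3, h4] at hq'
          have : δ ^ 2 * (δ ^ 2 - 1) = 0 := by linear_combination -hq'
          rcases mul_eq_zero.1 this with h5 | h5
          · omega
          · omega
      have hb2 : b ^ 2 = 1 := by rw [hbσ, mul_pow, hfin.1, hfin.2]; rfl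
      have ha2 : a ^ 2 = 1 := by
        rw [← hq', show σ ^ 4 = (σ ^ 2) ^ 2 by ring, show δ ^ 4 = (δ ^ 2) ^ 2 by ring, hfin.1, hfin.2]; rfl
      have he0 : e = 0 := by omega
      refine ⟨?_, by rw [hYab, ha2, hb2]; rfl⟩
      rw [← hXab, hb2, he0]; rfl

theorem case3 {A B m : ℤ} (hc : IsCoprime A B) (hA0 : A ≠ 0) (hB0 : B ≠ 0) (hAB : A + B ≠ 0)
    (h : A ^ 4 + 4 * A ^ 2 * B ^ 2 + 8 * A * B ^ 3 + 4 * B ^ 4 = m ^ 2) : False := by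
  have hm : m ≠ 0 := by
    rintro rfl
    have : 0 < A ^ 4 := by positivity
    nlinarith [sq_nonneg (B * (A + B))]
  rcases Int.emod_two_eq_zero_or_one A with hA2 | hA2
  · obtain ⟨a, rfl⟩ : (2 : ℤ) ∣ A := by omega
    have ha0 : a ≠ 0 := by rintro rfl; exact hA0 rfl
    have hB2 : B % 2 = 1 := by
      by_contra hcon
      exact cop_contra int_prime_two hc ⟨_, rfl⟩ (by omega)
    have hcaB : IsCoprime a B := hc.of_mul_left_right
    obtain ⟨n, hn⟩ := sq_cancel (a := 2) (x := (B * (2 * a + B)) ^ 2 + (2 * a ^ 2) ^ 2) (m := m)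
      (by norm_num) (by rw [← h]; ring)
    have hn0 : n ≠ 0 := by
      rintro rfl
      have : 0 < (2 * a ^ 2) ^ 2 := by positivity
      nlinarith [sq_nonneg (B * (2 * a + B))]
    have hodd : (B * (2 * a + B)) % 2 = 1 := odd_mul hB2 (by omega)
    have hcc : IsCoprime (B * (2 * a + B)) (2 * a ^ 2) := by
      apply int_coprime_of_primes
      · intro l hl h1 h2
        have hl2 : ¬ l ∣ 2 := fun h => int_dvd_two_contra hl hodd h1 h
        have hla : l ∣ a := hl.dvd_of_dvd_pow ((hl.dvd_or_dvd h2).resolve_left hl2)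
        have : l ∣ B ^ 2 := pdvd_of_comb h1 hla (a := 1) (b := -2 * B) (by ring)
        exact cop_contra hl hcaB hla (hl.dvd_of_dvd_pow this)
      · right; positivity
    obtain ⟨k, l, h1, h2, h3, h4, h5, h6⟩ := PythagoreanTriple.coprime_classification'
      (x := B * (2 * a + B)) (y := 2 * a ^ 2) (z := |n|)
      (by unfold PythagoreanTriple; rw [abs_mul_abs_self]; linear_combination hn)
      (Int.isCoprime_iff_gcd_eq_one.1 hcc) hodd (by positivity)
    have hkl := Int.isCoprime_iff_gcd_eq_one.2 h4
    have hb2 : a ^ 2 = k * l := by linarith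
    have hbpos : 0 < a ^ 2 := by positivity
    have hk : 0 < k := by
      rcases h6.lt_or_eq with h | h
      · exact h
      · rw [← h] at hb2; omega
    have hl : 0 < l := by
      by_contra hcon
      nlinarith
    obtain ⟨c, d, hc0, hd0, hc', hd', hcd⟩ := int_pow_split (k := 2) two_ne_zero hk hl (abs_pos.2 ha0) hkl
      (by rw [sq_abs, hb2])
    have hccd : IsCoprime c d := by
      rw [hc', hd'] at hkl
      exact cop_of_pow (by norm_num) (by norm_num) hkl
    have := quartic_descent _ (X := c) (Y := d) (Z := B + a) rfl hc0.ne' hd0.ne' hccd (by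
      have e : (B + a) ^ 2 = a ^ 2 + (k ^ 2 - l ^ 2) := by rw [← h1]; ring
      rw [e, hb2, hc', hd']; ring)
    rw [h1, hc', hd', this.1, this.2] at hodd
    omega
  · have hcc : IsCoprime A (B * (A + B)) := by
      apply hc.mul_right
      have := hc.add_mul_left_right 1
      rwa [mul_one, add_comm] at this
    obtain ⟨σ, δ, h1, h2, h3, h4⟩ := nested (x := m) hA2 hcc hm (by rw [← h]; ring)
    have hσ0 : σ ≠ 0 := by rintro rfl; simp at h1; omega
    have hδ0 : δ ≠ 0 := by rintro rfl; simp at h1; omega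
    have := quartic_descent _ (X := σ) (Y := δ) (Z := A + 2 * B) rfl hσ0 hδ0 h2 (by rw [← h3]; ring)
    exact mul_ne_zero hB0 hAB (h4 (by rw [this.1, this.2]))

/-! ### Eisenstein integers and Euler's lemma -/

theorem eisenstein_ring : ∃ (R : Type) (_ : CommRing R) (_ : IsDomain R) (_ : IsPrincipalIdealRing R)
    (_ : CharZero R) (η : R), η ^ 2 + η + 1 = 0 ∧ (∀ x : R, ∃ p q : ℤ, x = p + q * η) ∧
      ∀ u : Rˣ, (u : R) = 1 ∨ (u : R) = -1 ∨ (u : R) = η ∨ (u : R) = -η ∨ (u : R) = η ^ 2 ∨ (u : R) = -η ^ 2 := by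
  obtain ⟨K, _, _, hcyc⟩ : ∃ (K : Type) (_ : Field K) (_ : CharZero K), IsCyclotomicExtension {3} ℚ K := by
    refine ⟨CyclotomicField 3 ℚ, inferInstance, inferInstance, ?_⟩
    have h : @IsCyclotomicExtension {3} ℚ (CyclotomicField 3 ℚ) _ _ (CyclotomicField.algebra 3 ℚ) := inferInstance
    rw [Subsingleton.elim (CyclotomicField.algebra 3 ℚ) DivisionRing.toRatAlgebra] at h
    exact h
  have hζ := IsCyclotomicExtension.zeta_spec 3 ℚ K
  have : NumberField K := IsCyclotomicExtension.numberField {3} ℚ _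
  have hpid : IsPrincipalIdealRing (NumberField.RingOfIntegers K) := IsCyclotomicExtension.Rat.three_pid K
  have h1 := IsCyclotomicExtension.Rat.Three.eta_sq hζ
  rw [IsCyclotomicExtension.Rat.Three.coe_eta hζ] at h1
  refine ⟨NumberField.RingOfIntegers K, inferInstance, inferInstance, hpid, inferInstance, hζ.toInteger, ?_, ?_, ?_⟩
  · rw [h1]; ring
  · intro x
    have hm : x ∈ Algebra.adjoin ℤ ({hζ.toInteger} : Set (NumberField.RingOfIntegers K)) := by
      have := hζ.integralPowerBasis.adjoin_gen_eq_top
      rw [hζ.integralPowerBasis_gen] at this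
      rw [this]; trivial
    induction hm using Algebra.adjoin_induction with
    | mem x hx =>
      rw [Set.mem_singleton_iff] at hx
      exact ⟨0, 1, by rw [hx]; push_cast; ring⟩
    | algebraMap r => exact ⟨r, 0, by simp⟩
    | add x y _ _ hx hy =>
      obtain ⟨a, b, rfl⟩ := hx
      obtain ⟨c, d, rfl⟩ := hy
      exact ⟨a + c, b + d, by push_cast; ring⟩
    | mul x y _ _ hx hy =>
      obtain ⟨a, b, rfl⟩ := hx
      obtain ⟨c, d, rfl⟩ := hy
      exact ⟨a * c - b * d, a * d + b * c - b * d, by push_cast; linear_combination (b * d) * h1⟩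
  · intro u
    have := IsCyclotomicExtension.Rat.Three.Units.mem hζ u
    simp only [List.mem_cons, List.not_mem_nil, or_false] at this
    rcases this with h | h | h | h | h | h
    · left; rw [h]; rfl
    · right; left; rw [h]; rfl
    · right; right; left; rw [h]; rfl
    · right; right; right; left; rw [h]; rfl
    · right; right; right; right; left; rw [h]; rfl
    · right; right; right; right; right; rw [h]; rfl

theorem euler_lemma {a b s : ℤ} (hs : s % 2 = 1) (hc : IsCoprime a b) (h : b ^ 2 + 3 * a ^ 2 = s ^ 3) :
    ∃ m n : ℤ, b = m * (m ^ 2 - 9 * n ^ 2) ∧ a = 3 * n * (m ^ 2 - n ^ 2) := by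
  obtain ⟨R, _, _, _, _, η, hη, hrep, hunit⟩ := eisenstein_ring
  -- linear independence
  have hli : ∀ p q : ℤ, (p : R) + q * η = 0 → p = 0 ∧ q = 0 := by
    intro p q h0
    have e : ((p ^ 2 - p * q + q ^ 2 : ℤ) : R) = 0 := by
      push_cast
      linear_combination (p - q - q * η) * h0 + q ^ 2 * hη
    have e : p ^ 2 - p * q + q ^ 2 = 0 := by exact_mod_cast e
    have hq : q = 0 := by
      have : q ^ 2 = 0 := by nlinarith [sq_nonneg (2 * p - q), sq_nonneg q]
      exact pow_eq_zero_iff two_ne_zero |>.1 this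
    subst hq
    simp at e
    exact ⟨e, rfl⟩
  have hmul : ((b : R) + a * (2 * η + 1)) * (b - a * (2 * η + 1)) = (s : R) ^ 3 := by
    have : ((b ^ 2 + 3 * a ^ 2 : ℤ) : R) = ((s ^ 3 : ℤ) : R) := by rw [h]
    push_cast at this
    linear_combination this - 4 * a ^ 2 * hη
  have h3b : IsCoprime (2 * b) (s ^ 3) := by
    apply int_coprime_of_primes
    · intro l hl h1 h2
      have hls := hl.dvd_of_dvd_pow h2
      have hl2 : ¬ l ∣ 2 := fun h => int_dvd_two_contra hl hs hls h
      have hlb := (hl.dvd_or_dvd h1).resolve_left hl2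
      have hla : ¬ l ∣ a := fun h => cop_contra hl hc h hlb
      have h3 : l ∣ 3 * a ^ 2 := pdvd_of_comb h2 hlb (a := 1) (b := -b) (by rw [← h]; ring)
      have h3 : l ∣ 3 := (hl.dvd_or_dvd h3).resolve_right fun h => hla (hl.dvd_of_dvd_pow h)
      have h4 : Associated l 3 := hl.associated_of_dvd Int.prime_three h3
      have h5 : (3 : ℤ) ∣ s := h4.symm.dvd.trans hls
      have h6 : (3 : ℤ) ∣ b := h4.symm.dvd.trans hlb
      obtain ⟨s', rfl⟩ := h5
      obtain ⟨b', rfl⟩ := h6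
      have h7 : (3 : ℤ) ∣ a ^ 2 := ⟨3 * s' ^ 3 - b' ^ 2, by linarith [h, mul_pow 3 s' 3, mul_pow 3 b' 2]⟩
      exact cop_contra Int.prime_three hc (Int.prime_three.dvd_of_dvd_pow h7) ⟨_, rfl⟩
    · right
      apply pow_ne_zero; rintro rfl; omega
  have hcop : IsCoprime ((b : R) + a * (2 * η + 1)) (b - a * (2 * η + 1)) := by
    obtain ⟨u, v, huv⟩ := h3b
    have huv' : (((u * (2 * b) + v * s ^ 3 : ℤ)) : R) = 1 := by rw [huv]; simp
    push_cast at huv'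
    refine ⟨u + v * (b - a * (2 * η + 1)), u, ?_⟩
    linear_combination huv' + v * hmul
  obtain ⟨d, u, hd⟩ := exists_associated_pow_of_mul_eq_pow' hcop hmul
  obtain ⟨x, y, rfl⟩ := hrep d
  -- choose the representative in ℤ[√-3]
  obtain ⟨m, n, hmn⟩ : ∃ m n : ℤ, ((x : R) + y * η) ^ 3 = (m + n * (2 * η + 1)) ^ 3 := by
    have h3 : η ^ 3 = 1 := by linear_combination (η - 1) * hη
    have : (2 : ℤ) ∣ y ∨ (2 : ℤ) ∣ x - y ∨ (2 : ℤ) ∣ x := by omega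
    rcases this with ⟨n, rfl⟩ | ⟨n, hn⟩ | ⟨n, rfl⟩
    · exact ⟨x - n, n, by push_cast; ring⟩
    · obtain rfl : x = y + 2 * n := by linarith
      refine ⟨-y - n, n, ?_⟩
      have : ((-y - n : ℤ) : R) + n * (2 * η + 1) = η * (((y + 2 * n : ℤ) : R) + y * η) := by
        push_cast
        linear_combination (-y : R) * hη
      rw [this, mul_pow, h3, one_mul]
    · refine ⟨y - n, -n, ?_⟩
      have : ((y - n : ℤ) : R) + ((-n : ℤ) : R) * (2 * η + 1) = η ^ 2 * (((2 * n : ℤ) : R) + y * η) := by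
        push_cast
        linear_combination (-2 * n : R) * hη - y * h3
      rw [this, mul_pow, ← pow_mul, pow_mul', h3]; ring
  rw [hmn] at hd
  set M := m * (m ^ 2 - 9 * n ^ 2) with hM
  set N := 3 * n * (m ^ 2 - n ^ 2) with hN
  have hMN : ((m : R) + n * (2 * η + 1)) ^ 3 = M + N * (2 * η + 1) := by
    rw [hM, hN]; push_cast
    linear_combination (8 * n ^ 3 * η + 4 * n ^ 3 + 12 * m * n ^ 2) * hη
  rw [hMN] at hd
  have hbad : ∀ ε : ℤ, ε = 1 ∨ ε = -1 → (2 * b = ε * (-M - 3 * N) ∧ 2 * a = ε * (M - N)) ∨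
      (2 * b = ε * (-M + 3 * N) ∧ 2 * a = ε * (-M - N)) → False := by
    intro ε hε hh
    have e1 : M ^ 2 + 3 * N ^ 2 = s ^ 3 := by
      have e0 : (2 * b) ^ 2 + 3 * (2 * a) ^ 2 = 4 * s ^ 3 := by rw [← h]; ring
      rcases hε with rfl | rfl <;> rcases hh with ⟨h1, h2⟩ | ⟨h1, h2⟩ <;> rw [h1, h2] at e0 <;> linarith
    have e2 : (M + N) % 2 = 0 := by
      rcases hε with rfl | rfl <;> rcases hh with ⟨h1, h2⟩ | ⟨h1, h2⟩ <;> omega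
    have e3 : s ^ 3 = (M + N) * (M - N) + 2 * (2 * N ^ 2) := by rw [← e1]; ring
    obtain ⟨t, ht⟩ : (2 : ℤ) ∣ M + N := by omega
    rw [ht] at e3
    have : (2 : ℤ) ∣ s := int_prime_two.dvd_of_dvd_pow (n := 3) ⟨t * (M - N) + 2 * N ^ 2, by rw [e3]; ring⟩
    omega
  rcases hunit u with h1 | h1 | h1 | h1 | h1 | h1 <;> rw [h1] at hd
  · obtain ⟨c1, c2⟩ := hli (M + N - b - a) (2 * N - 2 * a) (by push_cast; linear_combination hd)
    exact ⟨m, n, by omega, by omega⟩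
  · obtain ⟨c1, c2⟩ := hli (M + N + b + a) (2 * N + 2 * a) (by push_cast; linear_combination -hd)
    refine ⟨-m, -n, ?_, ?_⟩
    · have : b = -M := by omega
      rw [this, hM]; ring
    · have : a = -N := by omega
      rw [this, hN]; ring
  · obtain ⟨c1, c2⟩ := hli (-2 * N - b - a) (M - N - 2 * a) (by
      push_cast; linear_combination hd - 2 * N * hη)
    exact (hbad 1 (Or.inl rfl) (Or.inl ⟨by omega, by omega⟩)).elim
  · obtain ⟨c1, c2⟩ := hli (2 * N - b - a) (-M + N - 2 * a) (by
      push_cast; linear_combination hd + 2 * N * hη)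
    exact (hbad (-1) (Or.inr rfl) (Or.inl ⟨by omega, by omega⟩)).elim
  · obtain ⟨c1, c2⟩ := hli (N - M - b - a) (-M - N - 2 * a) (by
      push_cast; linear_combination hd - (2 * N * η - N + M) * hη)
    exact (hbad 1 (Or.inl rfl) (Or.inr ⟨by omega, by omega⟩)).elim
  · obtain ⟨c1, c2⟩ := hli (-N + M - b - a) (M + N - 2 * a) (by
      push_cast; linear_combination hd + (2 * N * η - N + M) * hη)
    exact (hbad (-1) (Or.inr rfl) (Or.inr ⟨by omega, by omega⟩)).elim

/-! ### The case `D₂`: the equation `X³ + Y³ = 4 Z³` -/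

theorem cube_split {a b c : ℤ} (hc : IsCoprime a b) (h : a * b = c ^ 3) : ∃ x y, a = x ^ 3 ∧ b = y ^ 3 := by
  obtain ⟨x, hx⟩ := Int.eq_pow_of_mul_eq_pow_odd_left hc (by decide) h
  obtain ⟨y, hy⟩ := Int.eq_pow_of_mul_eq_pow_odd_right hc (by decide) h
  exact ⟨x, y, hx, hy⟩

theorem zmod9_cubes : ∀ x y z : ZMod 9, x ^ 3 + y ^ 3 = 4 * z ^ 3 →
    z ^ 3 = 0 ∧ ((x + y) ^ 3 = 0) := by decide

theorem mod9_cubes {x y z : ℤ} (h : x ^ 3 + y ^ 3 = 4 * z ^ 3) : (3 : ℤ) ∣ z ∧ (3 : ℤ) ∣ x + y := by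
  have h1 : (x : ZMod 9) ^ 3 + (y : ZMod 9) ^ 3 = 4 * (z : ZMod 9) ^ 3 := by exact_mod_cast congrArg (Int.cast (R := ZMod 9)) h
  obtain ⟨h2, h3⟩ := zmod9_cubes _ _ _ h1
  have h2 : ((z ^ 3 : ℤ) : ZMod 9) = 0 := by exact_mod_cast h2
  have h3 : (((x + y) ^ 3 : ℤ) : ZMod 9) = 0 := by exact_mod_cast h3
  have h4 := (ZMod.intCast_zmod_eq_zero_iff_dvd _ 9).1 h2
  have h5 := (ZMod.intCast_zmod_eq_zero_iff_dvd _ 9).1 h3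
  have e : (3 : ℤ) ∣ ((9 : ℕ) : ℤ) := by norm_num
  exact ⟨Int.prime_three.dvd_of_dvd_pow (e.trans h4), Int.prime_three.dvd_of_dvd_pow (e.trans h5)⟩

theorem cop_two_of_odd {a : ℤ} (h : a % 2 = 1) : IsCoprime a 2 := by
  apply int_coprime_of_primes
  · intro l hl h1 h2
    exact int_dvd_two_contra hl h h1 h2
  · right; norm_num

theorem cubic_descent (n : ℕ) : ∀ {X Y Z : ℤ}, Z.natAbs = n → Z ≠ 0 → IsCoprime X Y →
    X ^ 3 + Y ^ 3 = 4 * Z ^ 3 → False := by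
  induction n using Nat.strong_induction_on with
  | _ n ih =>
    intro X Y Z hn hZ hc h
    obtain ⟨⟨Z', rfl⟩, h3⟩ := mod9_cubes h
    have hZ' : Z' ≠ 0 := by rintro rfl; exact hZ rfl
    have hXY : X % 2 = 1 ∧ Y % 2 = 1 := by
      have a1 : X % 2 = 1 ∨ (2 : ℤ) ∣ X := by omega
      have a2 : Y % 2 = 1 ∨ (2 : ℤ) ∣ Y := by omega
      have e4 : (2 : ℤ) ∣ 4 * (3 * Z') ^ 3 := ⟨2 * (3 * Z') ^ 3, by ring⟩
      rcases a1 with a1 | a1 <;> rcases a2 with a2 | a2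
      · exact ⟨a1, a2⟩
      · have : (2 : ℤ) ∣ X ^ 3 := by
          rw [show X ^ 3 = 4 * (3 * Z') ^ 3 - Y ^ 3 by rw [← h]; ring]
          exact dvd_sub e4 (dvd_pow a2 three_ne_zero)
        have := int_prime_two.dvd_of_dvd_pow this
        omega
      · have : (2 : ℤ) ∣ Y ^ 3 := by
          rw [show Y ^ 3 = 4 * (3 * Z') ^ 3 - X ^ 3 by rw [← h]; ring]
          exact dvd_sub e4 (dvd_pow a1 three_ne_zero)
        have := int_prime_two.dvd_of_dvd_pow this
        omega
      · exact (cop_contra int_prime_two hc a1 a2).elim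
    obtain ⟨a, ha⟩ : ∃ a, X + Y = 6 * a := ⟨(X + Y) / 6, by omega⟩
    obtain ⟨b, hb⟩ : ∃ b, X - Y = 2 * b := ⟨(X - Y) / 2, by omega⟩
    obtain rfl : X = 3 * a + b := by omega
    obtain rfl : Y = 3 * a - b := by omega
    have h1 : a * (b ^ 2 + 3 * a ^ 2) = 6 * Z' ^ 3 := by
      have : 18 * (a * (b ^ 2 + 3 * a ^ 2)) = 18 * (6 * Z' ^ 3) := by linear_combination h
      linarith
    have hab : IsCoprime (3 * a) b := by
      apply int_coprime_of_primes
      · intro l hl h1 h2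
        exact cop_contra hl hc (dvd_add h1 h2) (dvd_sub h1 h2)
      · by_contra! h0
        rw [h0.1, h0.2] at hXY
        omega
    have hab' : IsCoprime a b := hab.of_mul_left_right
    have h3b : IsCoprime 3 b := hab.of_mul_left_left
    have hS2 : (b ^ 2 + 3 * a ^ 2) % 2 = 1 := by
      have e : b ^ 2 + 3 * a ^ 2 = (a + b) * (a + b) + 2 * (a ^ 2 - a * b) := by ring
      have : ((a + b) * (a + b)) % 2 = 1 := odd_mul (by omega) (by omega)
      omega
    have hS3 : IsCoprime 3 (b ^ 2 + 3 * a ^ 2) := (h3b.pow_right (n := 2)).add_mul_left_right _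
    have hSa : IsCoprime a (b ^ 2 + 3 * a ^ 2) := by
      have := (hab'.pow_right (n := 2)).add_mul_left_right (3 * a)
      rwa [show b ^ 2 + a * (3 * a) = b ^ 2 + 3 * a ^ 2 by ring] at this
    have h6 : (6 : ℤ) ∣ a := by
      have hc6 : IsCoprime 6 (b ^ 2 + 3 * a ^ 2) := by
        rw [show (6 : ℤ) = 2 * 3 by norm_num]
        exact (cop_two_of_odd hS2).symm.mul_left hS3
      exact hc6.dvd_of_dvd_mul_right ⟨_, h1⟩
    obtain ⟨a', rfl⟩ := h6
    have h2 : a' * (b ^ 2 + 3 * (6 * a') ^ 2) = Z' ^ 3 := by linarith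
    obtain ⟨c, s, hc', hs'⟩ := cube_split hSa.of_mul_left_right h2
    have hs2 : s % 2 = 1 := odd_pow_of three_ne_zero (by rw [← hs']; exact hS2)
    obtain ⟨m, n', hm, hn'⟩ := euler_lemma hs2 hab' hs'
    have e1 : n' * (m ^ 2 - n' ^ 2) = 2 * c ^ 3 := by
      rw [hc'] at hn'; linarith
    have hbodd : b % 2 = 1 := by omega
    have hm2 := odd_of_mul (a := m) (b := m ^ 2 - 9 * n' ^ 2) (by rw [← hm]; exact hbodd)
    have hm8 := sq_mod_of_odd hm2.1
    have hn2 : (2 : ℤ) ∣ n' := by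
      by_contra hcon
      have := sq_mod_of_odd (w := n') (by omega)
      omega
    have hmn : IsCoprime m n' := by
      apply int_coprime_of_primes
      · intro l hl g1 g2
        exact cop_contra hl hab' (by rw [hn']; exact (g2.mul_left 3).mul_right _) (by rw [hm]; exact g1.mul_right _)
      · left; rintro rfl; omega
    obtain ⟨k, rfl⟩ := hn2
    have e2 : k * ((m - 2 * k) * (m + 2 * k)) = c ^ 3 := by linarith
    have hkm : IsCoprime k m := hmn.symm.of_mul_left_right
    have c1 : IsCoprime k (m - 2 * k) := by
      have := hkm.add_mul_left_right (-2)
      rwa [show m + k * -2 = m - 2 * k by ring] at this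
    have c2 : IsCoprime k (m + 2 * k) := by
      have := hkm.add_mul_left_right 2
      rwa [show m + k * 2 = m + 2 * k by ring] at this
    have c3 : IsCoprime (m - 2 * k) (m + 2 * k) := by
      apply int_coprime_of_primes
      · intro l hl g1 g2
        have hl2 : ¬ l ∣ 2 := fun h => int_dvd_two_contra hl (x := m - 2 * k) (by omega) g1 h
        have g3 : l ∣ 2 * m := pdvd_of_comb g1 g2 (a := 1) (b := 1) (by ring)
        have g4 : l ∣ 2 * (2 * k) := pdvd_of_comb g1 g2 (a := -1) (b := 1) (by ring)
        exact cop_contra hl hmn ((hl.dvd_or_dvd g3).resolve_left hl2) ((hl.dvd_or_dvd g4).resolve_left hl2)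
      · left; omega
    obtain ⟨C, T, hC, hT⟩ := cube_split (c1.mul_right c2) e2
    obtain ⟨D, E, hD, hE⟩ := cube_split c3 hT
    have hC0 : C ≠ 0 := by
      rintro rfl
      apply hZ'
      have hk0 : k = 0 := by rw [hC]; rfl
      rw [hk0] at e2
      have hc0 : c ^ 3 = 0 := by rw [← e2]; ring
      rw [hc', hc0] at h2
      have : Z' ^ 3 = 0 := by rw [← h2]; ring
      exact pow_eq_zero_iff three_ne_zero |>.1 this
    have hCZ : C ∣ Z' := by
      rw [← Int.pow_dvd_pow_iff (n := 3) three_ne_zero, ← hC, ← h2, hc', ← e2]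
      exact (Dvd.intro _ rfl).mul_right _
    refine ih C.natAbs ?_ (X := E) (Y := -D) rfl hC0 ?_ ?_
    · have := Int.natAbs_le_of_dvd_ne_zero hCZ hZ'
      rw [← hn, Int.natAbs_mul]
      have : 0 < Z'.natAbs := Int.natAbs_pos.2 hZ'
      rw [show (3 : ℤ).natAbs = 3 from rfl]
      omega
    · rw [hD, hE] at c3
      exact (cop_of_pow (by norm_num) (by norm_num) c3).symm.neg_right
    · rw [show E ^ 3 + (-D) ^ 3 = E ^ 3 - D ^ 3 by ring, ← hE, ← hD, ← hC]; ring

theorem case2_odd {A B m : ℤ} (hc : IsCoprime A B) (hA2 : A % 2 = 1) (hB : B ≠ 0) (hm : m ≠ 0)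
    (h : A * (A ^ 3 + 16 * B ^ 3) = m ^ 2) : False := by
  obtain ⟨a, ha0, ha⟩ := int_sq_pm h hm (by
    intro l hl h1 h2
    have hl2 : ¬ l ∣ 2 := fun h => int_dvd_two_contra hl hA2 h1 h
    have h4 : l ∣ 2 * 2 * 2 * 2 * (B * B * B) :=
      pdvd_of_comb h1 h2 (a := -A ^ 2) (b := 1) (by ring)
    simp only [hl.dvd_mul, hl2, or_self, false_or] at h4
    exact cop_contra hl hc h1 h4)
  obtain ⟨β, t, hβ, hcβ, ht⟩ : ∃ β t : ℤ, β ≠ 0 ∧ IsCoprime a β ∧ t ^ 2 = a ^ 6 + 16 * β ^ 3 := by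
    rcases ha with rfl | rfl
    · obtain ⟨t, ht⟩ := sq_cancel ha0 h
      exact ⟨B, t, hB, cop_of_pow (m := 2) (n := 1) (by norm_num) (by norm_num) (by rw [pow_one]; exact hc), by rw [← ht]; ring⟩
    · obtain ⟨t, ht⟩ := sq_cancel (x := a ^ 6 + 16 * (-B) ^ 3) ha0 (by rw [← h]; ring)
      refine ⟨-B, t, neg_ne_zero.2 hB, ?_, ht.symm⟩
      exact (cop_of_pow (m := 2) (n := 1) (by norm_num) (by norm_num) (by rw [pow_one]; exact (IsCoprime.neg_left_iff _ _).1 hc)).neg_right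
  have ha2 : a % 2 = 1 := by
    apply odd_pow_of two_ne_zero
    rcases ha with ha | ha <;> omega
  have ha3 : (a ^ 3) % 2 = 1 := by
    have := odd_mul (odd_mul ha2 ha2) ha2
    rwa [show a ^ 3 = a * a * a by ring]
  have ht2 : t % 2 = 1 := by
    apply odd_pow_of two_ne_zero
    have := odd_mul ha3 ha3
    rw [ht, show a ^ 6 + 16 * β ^ 3 = a ^ 3 * a ^ 3 + 2 * (8 * β ^ 3) by ring]
    omega
  obtain ⟨X, hX⟩ : ∃ X, t - a ^ 3 = 2 * X := ⟨(t - a ^ 3) / 2, by omega⟩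
  have hY : t + a ^ 3 = 2 * (X + a ^ 3) := by linarith
  have hXY : X * (X + a ^ 3) = 4 * β ^ 3 := by
    have : (2 * X) * (2 * (X + a ^ 3)) = 16 * β ^ 3 := by rw [← hX, ← hY]; linear_combination ht
    linarith
  have hcX : IsCoprime X a := by
    apply int_coprime_of_primes
    · intro l hl h1 h2
      have hl2 : ¬ l ∣ 2 := fun h => int_dvd_two_contra hl ha2 h2 h
      have h4 : l ∣ 2 * 2 * (β * β * β) := by
        rw [show 2 * 2 * (β * β * β) = X * (X + a ^ 3) by rw [hXY]; ring]
        exact h1.mul_right _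
      simp only [hl.dvd_mul, hl2, or_self, false_or] at h4
      exact cop_contra hl hcβ h2 h4
    · right; exact ha0
  have hcXY : IsCoprime X (X + a ^ 3) := by
    have := (hcX.pow_right (n := 3)).add_mul_left_right 1
    rwa [mul_one, add_comm] at this
  rcases Int.emod_two_eq_zero_or_one X with h2 | h2
  · have h4 : (4 : ℤ) ∣ X := by
      have c4 : IsCoprime (4 : ℤ) (X + a ^ 3) := by
        rw [show (4 : ℤ) = 2 * 2 by norm_num]
        have := (cop_two_of_odd (a := X + a ^ 3) (by omega)).symm
        exact this.mul_left this
      exact c4.dvd_of_dvd_mul_right ⟨_, hXY⟩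
    obtain ⟨X', rfl⟩ := h4
    obtain ⟨u, v, hu, hv⟩ := cube_split (c := β) hcXY.of_mul_left_right (by linarith)
    have hu0 : u ≠ 0 := by
      rintro rfl
      have : X' = 0 := by rw [hu]; rfl
      rw [this] at hXY
      have : β ^ 3 = 0 := by linarith
      exact hβ (pow_eq_zero_iff three_ne_zero |>.1 this)
    refine cubic_descent _ (X := v) (Y := -a) (Z := u) rfl hu0 ?_ (by rw [← hu, ← hv]; ring)
    apply IsCoprime.neg_right
    have : IsCoprime (4 * X' + a ^ 3) a := by
      have := hcX.add_mul_left_left (a ^ 2)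
      rwa [show 4 * X' + a * a ^ 2 = 4 * X' + a ^ 3 by ring] at this
    rw [hv] at this
    exact cop_of_pow (m := 3) (n := 1) (by norm_num) (by norm_num) (by rw [pow_one]; exact this)
  · have h4 : (4 : ℤ) ∣ X + a ^ 3 := by
      have c4 : IsCoprime (4 : ℤ) X := by
        rw [show (4 : ℤ) = 2 * 2 by norm_num]
        have := (cop_two_of_odd h2).symm
        exact this.mul_left this
      exact c4.dvd_of_dvd_mul_left ⟨_, hXY⟩
    obtain ⟨Y', hY'⟩ := h4
    rw [hY'] at hcXY hXY
    obtain ⟨u, v, hu, hv⟩ := cube_split (c := β) hcXY.of_mul_right_right (by linarith)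
    have hv0 : v ≠ 0 := by
      rintro rfl
      have : Y' = 0 := by rw [hv]; rfl
      rw [this] at hXY
      have : β ^ 3 = 0 := by linarith
      exact hβ (pow_eq_zero_iff three_ne_zero |>.1 this)
    refine cubic_descent _ (X := u) (Y := a) (Z := v) rfl hv0 ?_ (by rw [← hu, ← hv]; exact hY')
    rw [hu] at hcX
    exact cop_of_pow (m := 3) (n := 1) (by norm_num) (by norm_num) (by rw [pow_one]; exact hcX)

theorem case2_even {A B m : ℤ} (hc : IsCoprime A B) (hA2 : A % 2 = 1) (hm : m ≠ 0)
    (h : B * (A ^ 3 + 4 * B ^ 3) = m ^ 2) : False := by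
  obtain ⟨b, hb0, hb⟩ := int_sq_pm h hm (by
    intro l hl h1 h2
    have h4 : l ∣ (A * A * A) :=
      pdvd_of_comb h1 h2 (a := -4 * B ^ 2) (b := 1) (by ring)
    simp only [hl.dvd_mul, or_self] at h4
    exact cop_contra hl hc h4 h1)
  obtain ⟨α, t, hα, hcα, ht⟩ : ∃ α t : ℤ, α % 2 = 1 ∧ IsCoprime α b ∧ t ^ 2 = 4 * b ^ 6 + α ^ 3 := by
    rcases hb with rfl | rfl
    · obtain ⟨t, ht⟩ := sq_cancel hb0 h
      exact ⟨A, t, hA2, cop_of_pow (m := 1) (n := 2) (by norm_num) (by norm_num) (by rw [pow_one]; exact hc), by rw [← ht]; ring⟩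
    · obtain ⟨t, ht⟩ := sq_cancel (x := 4 * b ^ 6 + (-A) ^ 3) hb0 (by rw [← h]; ring)
      refine ⟨-A, t, by omega, ?_, ht.symm⟩
      exact (cop_of_pow (m := 1) (n := 2) (by norm_num) (by norm_num) (by rw [pow_one]; exact (IsCoprime.neg_right_iff _ _).1 hc)).neg_left
  have hcc : IsCoprime (t - 2 * b ^ 3) (t + 2 * b ^ 3) := by
    apply int_coprime_of_primes
    · intro l hl h1 h2
      have hlα : l ∣ α := by
        apply hl.dvd_of_dvd_pow (n := 3)
        rw [show α ^ 3 = (t - 2 * b ^ 3) * (t + 2 * b ^ 3) by linear_combination -ht]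
        exact h1.mul_right _
      have hl2 : ¬ l ∣ 2 := fun h => int_dvd_two_contra hl hα hlα h
      have h4 : l ∣ 2 * 2 * (b * b * b) :=
        pdvd_of_comb h1 h2 (a := -1) (b := 1) (by ring)
      simp only [hl.dvd_mul, hl2, or_self, false_or] at h4
      exact cop_contra hl hcα hlα h4
    · by_contra! h0
      have : 4 * b ^ 3 = 0 := by linarith
      exact hb0 (pow_eq_zero_iff three_ne_zero |>.1 (by linarith : b ^ 3 = 0))
  obtain ⟨x, y, hx, hy⟩ := cube_split hcc (c := α) (by linear_combination ht)
  refine cubic_descent _ (X := y) (Y := -x) (Z := b) rfl hb0 ?_ ?_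
  · rw [hx, hy] at hcc
    exact (cop_of_pow (by norm_num) (by norm_num) hcc).symm.neg_right
  · rw [show y ^ 3 + (-x) ^ 3 = y ^ 3 - x ^ 3 by ring, ← hx, ← hy]; ring

theorem case2 {p q m : ℤ} (hc : IsCoprime p q) (hp0 : p ≠ 0) (hq0 : q ≠ 0) (hA0 : q ^ 2 - p ^ 2 ≠ 0)
    (hm : m ≠ 0)
    (h : (q ^ 2 - p ^ 2) * ((q ^ 2 - p ^ 2) ^ 3 + 16 * (p * q) ^ 3) = m ^ 2) : False := by
  rcases Int.emod_two_eq_zero_or_one (q ^ 2 - p ^ 2) with h2 | h2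
  · obtain ⟨x, y, rfl, rfl, hcxy, hx0, hy0, hxy⟩ := both_odd hc hp0 hA0 h2
    obtain ⟨n, hn⟩ := sq_cancel (a := 8)
      (x := (x * y) * ((y ^ 2 - x ^ 2) ^ 3 + 4 * (x * y) ^ 3))
      (m := m) (by norm_num) (by rw [← h]; ring)
    have hn0 : n ≠ 0 := by
      rintro rfl
      apply hm
      have : m ^ 2 = 64 * ((x * y) * ((y ^ 2 - x ^ 2) ^ 3 + 4 * (x * y) ^ 3)) := by
        rw [← h]; ring
      rw [hn] at this
      simpa using this
    exact case2_even (cop_AB hcxy) hxy hn0 hn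
  · exact case2_odd (cop_AB hc) h2 (mul_ne_zero hp0 hq0) hm h

/-! ### The cases involving `D₃`, and the final arithmetic statement -/

theorem block {a U V W D m : ℤ} (hD : 0 < D) (hm : m ≠ 0)
    (h1 : ∀ l : ℤ, Prime l → l ∣ U → l ∣ a → False)
    (h2 : ∀ l : ℤ, Prime l → l ∣ U → l ∣ V → False)
    (h3 : ∀ l : ℤ, Prime l → l ∣ U → l ∣ W → False)
    (h4 : ∀ l : ℤ, Prime l → l ∣ U → l ∣ D → False)
    (h5 : ∀ l : ℤ, Prime l → l ∣ D → l ∣ a → False)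
    (h6 : ∀ l : ℤ, Prime l → l ∣ D → l ∣ W → False)
    (h7 : ∀ u : ℤ, (U = u ^ 2 ∨ U = -u ^ 2) → ∀ l : ℤ, Prime l → l ∣ D → l ∣ V → False)
    (h : a * (U * V) * D = m ^ 2 ∨ a * W * D = m ^ 2 ∨ U * V * W * D = m ^ 2) : ∃ k : ℤ, D = k ^ 2 := by
  rcases h with h | h | h
  · obtain ⟨u, -, hu⟩ := int_sq_pm (a := U) (b := a * V * D) (by rw [← h]; ring) hm (by
      intro l hl g1 g2
      rcases hl.dvd_or_dvd g2 with g2 | g2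
      · rcases hl.dvd_or_dvd g2 with g2 | g2
        · exact h1 l hl g1 g2
        · exact h2 l hl g1 g2
      · exact h4 l hl g1 g2)
    obtain ⟨k, -, hk⟩ := int_sq_pos (a := D) (b := a * (U * V)) (by rw [← h]; ring) hm hD (by
      intro l hl g1 g2
      rcases hl.dvd_or_dvd g2 with g2 | g2
      · exact h5 l hl g1 g2
      · rcases hl.dvd_or_dvd g2 with g2 | g2
        · exact h4 l hl g2 g1
        · exact h7 u hu l hl g1 g2)
    exact ⟨k, hk⟩
  · obtain ⟨k, -, hk⟩ := int_sq_pos (a := D) (b := a * W) (by rw [← h]; ring) hm hD (by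
      intro l hl g1 g2
      rcases hl.dvd_or_dvd g2 with g2 | g2
      · exact h5 l hl g1 g2
      · exact h6 l hl g1 g2)
    exact ⟨k, hk⟩
  · obtain ⟨u, -, hu⟩ := int_sq_pm (a := U) (b := V * W * D) (by rw [← h]; ring) hm (by
      intro l hl g1 g2
      rcases hl.dvd_or_dvd g2 with g2 | g2
      · rcases hl.dvd_or_dvd g2 with g2 | g2
        · exact h2 l hl g1 g2
        · exact h3 l hl g1 g2
      · exact h4 l hl g1 g2)
    obtain ⟨k, -, hk⟩ := int_sq_pos (a := D) (b := U * V * W) (by rw [← h]; ring) hm hD (by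
      intro l hl g1 g2
      rcases hl.dvd_or_dvd g2 with g2 | g2
      · rcases hl.dvd_or_dvd g2 with g2 | g2
        · exact h4 l hl g2 g1
        · exact h7 u hu l hl g1 g2
      · exact h6 l hl g1 g2)
    exact ⟨k, hk⟩

theorem zmod5_U : ∀ p q : ZMod 5, q ^ 2 - p ^ 2 + 2 * (p * q) = 0 → p = 0 ∧ q = 0 := by decide

theorem zmod17_W : ∀ p q : ZMod 17, (q ^ 2 - p ^ 2 - p * q = 0 ∨ q ^ 2 - p ^ 2 - 4 * (p * q) = 0) → p = 0 ∧ q = 0 := by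
  decide

theorem zmod17_V : ∀ p q : ZMod 17, (p * q + 2 * (q ^ 2 - p ^ 2) = 0 ∨ p * q - 2 * (q ^ 2 - p ^ 2) = 0) →
    (∃ u, q ^ 2 - p ^ 2 + 2 * (p * q) = u ^ 2 ∨ q ^ 2 - p ^ 2 + 2 * (p * q) = - u ^ 2) → p = 0 ∧ q = 0 := by
  decide

theorem dvd_iff_zmod {n : ℕ} {x : ℤ} : (n : ℤ) ∣ x ↔ (x : ZMod n) = 0 := (ZMod.intCast_zmod_eq_zero_iff_dvd x n).symm

theorem five_not_U {p q : ℤ} (hc : IsCoprime p q) (h : (5 : ℤ) ∣ q ^ 2 - p ^ 2 + 2 * (p * q)) : False := by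
  have h1 := (dvd_iff_zmod (n := 5)).1 h
  push_cast at h1
  obtain ⟨h2, h3⟩ := zmod5_U _ _ h1
  exact cop_contra int_prime_five hc ((dvd_iff_zmod (n := 5)).2 h2) ((dvd_iff_zmod (n := 5)).2 h3)

theorem int_prime_17 : Prime (17 : ℤ) := by norm_num

theorem seventeen_W {p q : ℤ} (hc : IsCoprime p q)
    (h : (17 : ℤ) ∣ q ^ 2 - p ^ 2 - p * q ∨ (17 : ℤ) ∣ q ^ 2 - p ^ 2 - 4 * (p * q)) : False := by
  have h1 := zmod17_W p q (by
    rcases h with h | h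
    · left; have h1 := (dvd_iff_zmod (n := 17)).1 h; push_cast at h1; exact h1
    · right; have h1 := (dvd_iff_zmod (n := 17)).1 h; push_cast at h1; exact h1)
  exact cop_contra int_prime_17 hc ((dvd_iff_zmod (n := 17)).2 h1.1) ((dvd_iff_zmod (n := 17)).2 h1.2)

theorem seventeen_V {p q u : ℤ} (hc : IsCoprime p q)
    (h : (17 : ℤ) ∣ p * q + 2 * (q ^ 2 - p ^ 2) ∨ (17 : ℤ) ∣ p * q - 2 * (q ^ 2 - p ^ 2))
    (hu : q ^ 2 - p ^ 2 + 2 * (p * q) = u ^ 2 ∨ q ^ 2 - p ^ 2 + 2 * (p * q) = -u ^ 2) : False := by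
  have h1 := zmod17_V p q (by
    rcases h with h | h
    · left; have h1 := (dvd_iff_zmod (n := 17)).1 h; push_cast at h1; exact h1
    · right; have h1 := (dvd_iff_zmod (n := 17)).1 h; push_cast at h1; exact h1)
    ⟨u, by
      rcases hu with hu | hu
      · left; have := congrArg (Int.cast (R := ZMod 17)) hu; push_cast at this; exact this
      · right; have := congrArg (Int.cast (R := ZMod 17)) hu; push_cast at this; exact this⟩
  exact cop_contra int_prime_17 hc ((dvd_iff_zmod (n := 17)).2 h1.1) ((dvd_iff_zmod (n := 17)).2 h1.2)

theorem prime_to {l P : ℤ} (hl : Prime l) (hP : Prime P) (h : l ∣ P) {x : ℤ} (hx : l ∣ x) : P ∣ x :=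
  (hl.associated_of_dvd hP h).symm.dvd.trans hx

theorem blockO {p q m : ℤ} (hc : IsCoprime p q) (hodd : (q ^ 2 - p ^ 2) % 2 = 1) (hm : m ≠ 0)
    {A B U V W D : ℤ} (hA : A = q ^ 2 - p ^ 2) (hB : B = p * q) (hU : U = A + 2 * B) (hV : V = p ^ 2 + q ^ 2)
    (hW : W = A ^ 3 + 16 * B ^ 3) (hD : D = A ^ 4 + 4 * A ^ 2 * B ^ 2 + 8 * A * B ^ 3 + 4 * B ^ 4)
    (h : A * (U * V) * D = m ^ 2 ∨ A * W * D = m ^ 2 ∨ U * V * W * D = m ^ 2) : ∃ k : ℤ, D = k ^ 2 := by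
  have hV2 : V * V = A ^ 2 + 4 * B ^ 2 := by rw [hA, hB, hV]; ring
  have hA2 : A % 2 = 1 := by rw [hA]; exact hodd
  have hU2 : U % 2 = 1 := by omega
  have hD2 : D % 2 = 1 := by
    have := odd_mul (odd_mul hA2 hA2) (odd_mul hA2 hA2)
    rw [hD, show A ^ 4 + 4 * A ^ 2 * B ^ 2 + 8 * A * B ^ 3 + 4 * B ^ 4 = A * A * (A * A) +
      2 * (2 * A ^ 2 * B ^ 2 + 4 * A * B ^ 3 + 2 * B ^ 4) by ring]
    omega
  have hDpos : 0 < D := by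
    have : A ≠ 0 := by rintro rfl; omega
    have h4 : 0 < A ^ 4 := by positivity
    rw [hD]; nlinarith [sq_nonneg (B * (A + B))]
  have facts := fun (l : ℤ) (hl : Prime l) => uv_facts hc hodd hl
  rw [← hA, ← hB, ← hU, ← hV] at facts
  refine block hDpos hm (fun l hl => (facts l hl).2.2.2.2.2.1) (fun l hl => (facts l hl).2.2.2.2.2.2.2)
    ?_ ?_ ?_ ?_ ?_ h
  · intro l hl g1 g2
    obtain ⟨f1, f2, f3, f4, f5, f6, f7, f8⟩ := facts l hl
    have h4 : l ∣ 2 * 2 * 2 * (B * B * B) :=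
      pdvd_of_comb g1 g2 (a := -(A ^ 2 - 2 * A * B + 4 * B ^ 2)) (b := 1) (by rw [hU, hW]; ring)
    simp only [hl.dvd_mul, f2 g1, or_self, false_or] at h4
    exact f4 g1 h4
  · intro l hl g1 g2
    obtain ⟨f1, f2, f3, f4, f5, f6, f7, f8⟩ := facts l hl
    have h4 : l ∣ 2 * 2 * 5 * (B * B * B * B) :=
      pdvd_of_comb g1 g2 (a := -(A ^ 3 - 2 * A ^ 2 * B + 8 * A * B ^ 2 - 8 * B ^ 3)) (b := 1) (by rw [hU, hD]; ring)
    simp only [hl.dvd_mul, f2 g1, or_self, false_or] at h4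
    refine five_not_U hc ?_
    rw [← hA, ← hB, ← hU]
    exact prime_to hl int_prime_five (h4.resolve_right (f4 g1)) g1
  · intro l hl g1 g2
    have hl2 : ¬ l ∣ 2 := fun h => int_dvd_two_contra hl hA2 g2 h
    have h4 : l ∣ 2 * 2 * (B * B * B * B) :=
      pdvd_of_comb g1 g2 (a := 1) (b := -(A ^ 3 + 4 * A * B ^ 2 + 8 * B ^ 3)) (by rw [hD]; ring)
    simp only [hl.dvd_mul, hl2, or_self, false_or] at h4
    exact (facts l hl).1 g2 h4
  · intro l hl g1 g2
    have hl2 : ¬ l ∣ 2 := fun h => int_dvd_two_contra hl hD2 g1 h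
    have h4 : l ∣ 2 * 2 * (B * B) * ((A - B) * (A - B)) :=
      pdvd_of_comb g1 g2 (a := 1) (b := -A) (by rw [hD, hW]; ring)
    simp only [hl.dvd_mul, hl2, or_self, false_or] at h4
    have hnB : ¬ l ∣ B := fun hb => (facts l hl).1
      (hl.dvd_of_dvd_pow (n := 3) (pdvd_of_comb g2 hb (a := 1) (b := -16 * B ^ 2) (by rw [hW]; ring))) hb
    have h4 := h4.resolve_left hnB
    have h5 : l ∣ 17 * (B * B * B) := pdvd_of_comb g2 h4 (a := 1) (b := -(A ^ 2 + A * B + B ^ 2)) (by rw [hW]; ring)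
    simp only [hl.dvd_mul, hnB, or_self, or_false] at h5
    refine seventeen_W hc (Or.inl ?_)
    rw [← hA, ← hB]
    exact prime_to hl int_prime_17 h5 h4
  · intro u hu l hl g1 g2
    obtain ⟨f1, f2, f3, f4, f5, f6, f7, f8⟩ := facts l hl
    have h4 : l ∣ 2 * 2 * (B * B * B) * (B + 2 * A) :=
      pdvd_of_comb g1 g2 (a := 1) (b := -V * A ^ 2) (by rw [hD]; linear_combination A ^ 2 * hV2)
    simp only [hl.dvd_mul, f3 g2, or_self, false_or] at h4
    have h4 := h4.resolve_left (f5 g2)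
    have h5 : l ∣ 17 * (A * A) := pdvd_of_comb g2 h4 (a := V) (b := -4 * B + 8 * A) (by linear_combination -hV2)
    simp only [hl.dvd_mul, or_self] at h5
    have h5 := h5.resolve_right (f7 g2)
    refine seventeen_V hc (Or.inl ?_) (u := u) ?_
    · rw [← hA, ← hB]
      exact prime_to hl int_prime_17 h5 h4
    · rw [← hA, ← hB, ← hU]; exact hu

theorem blockS {p q m : ℤ} (hc : IsCoprime p q) (hodd : (q ^ 2 - p ^ 2) % 2 = 1) (hm : m ≠ 0)
    {A B U V W D : ℤ} (hA : A = q ^ 2 - p ^ 2) (hB : B = p * q) (hU : U = A + 2 * B) (hV : V = p ^ 2 + q ^ 2)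
    (hW : W = A ^ 3 + 4 * B ^ 3) (hD : D = A ^ 4 + 8 * A ^ 3 * B + 16 * A ^ 2 * B ^ 2 + 64 * B ^ 4)
    (h : B * (U * V) * D = m ^ 2 ∨ B * W * D = m ^ 2 ∨ U * V * W * D = m ^ 2) : ∃ k : ℤ, D = k ^ 2 := by
  have hV2 : V * V = A ^ 2 + 4 * B ^ 2 := by rw [hA, hB, hV]; ring
  have hA2 : A % 2 = 1 := by rw [hA]; exact hodd
  have hU2 : U % 2 = 1 := by omega
  have hD2 : D % 2 = 1 := by
    have := odd_mul (odd_mul hA2 hA2) (odd_mul hA2 hA2)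
    rw [hD, show A ^ 4 + 8 * A ^ 3 * B + 16 * A ^ 2 * B ^ 2 + 64 * B ^ 4 = A * A * (A * A) +
      2 * (4 * A ^ 3 * B + 8 * A ^ 2 * B ^ 2 + 32 * B ^ 4) by ring]
    omega
  have hDpos : 0 < D := by
    have hne : D ≠ 0 := by rintro h0; omega
    have : 0 ≤ D := by
      rw [hD, show A ^ 4 + 8 * A ^ 3 * B + 16 * A ^ 2 * B ^ 2 + 64 * B ^ 4 = (A * (A + 4 * B)) ^ 2 + (8 * B ^ 2) ^ 2 by ring]
      positivity
    omega
  have facts := fun (l : ℤ) (hl : Prime l) => uv_facts hc hodd hl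
  rw [← hA, ← hB, ← hU, ← hV] at facts
  refine block hDpos hm (fun l hl => (facts l hl).2.2.2.1) (fun l hl => (facts l hl).2.2.2.2.2.2.2)
    ?_ ?_ ?_ ?_ ?_ h
  · intro l hl g1 g2
    obtain ⟨f1, f2, f3, f4, f5, f6, f7, f8⟩ := facts l hl
    have h4 : l ∣ 2 * 2 * (B * B * B) :=
      pdvd_of_comb g1 g2 (a := (A ^ 2 - 2 * A * B + 4 * B ^ 2)) (b := -1) (by rw [hU, hW]; ring)
    simp only [hl.dvd_mul, f2 g1, or_self, false_or] at h4
    exact f4 g1 h4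
  · intro l hl g1 g2
    obtain ⟨f1, f2, f3, f4, f5, f6, f7, f8⟩ := facts l hl
    have h4 : l ∣ 2 * 2 * 2 * 2 * 5 * (B * B * B * B) :=
      pdvd_of_comb g1 g2 (a := -(A ^ 3 + 6 * A ^ 2 * B + 4 * A * B ^ 2 - 8 * B ^ 3)) (b := 1) (by rw [hU, hD]; ring)
    simp only [hl.dvd_mul, f2 g1, or_self, false_or] at h4
    refine five_not_U hc ?_
    rw [← hA, ← hB, ← hU]
    exact prime_to hl int_prime_five (h4.resolve_right (f4 g1)) g1
  · intro l hl g1 g2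
    have h4 : l ∣ (A * A * A * A) :=
      pdvd_of_comb g1 g2 (a := 1) (b := -(8 * A ^ 3 + 16 * A ^ 2 * B + 64 * B ^ 3)) (by rw [hD]; ring)
    simp only [hl.dvd_mul, or_self] at h4
    exact (facts l hl).1 h4 g2
  · intro l hl g1 g2
    have hl2 : ¬ l ∣ 2 := fun h => int_dvd_two_contra hl hD2 g1 h
    have h4 : l ∣ (A * A) * ((A - 4 * B) * (A - 4 * B)) :=
      pdvd_of_comb g1 g2 (a := 1) (b := -16 * B) (by rw [hD, hW]; ring)
    simp only [hl.dvd_mul, or_self] at h4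
    have hnB : ¬ l ∣ B := fun hb => (facts l hl).1
      (hl.dvd_of_dvd_pow (n := 3) (pdvd_of_comb g2 hb (a := 1) (b := -4 * B ^ 2) (by rw [hW]; ring))) hb
    have hnA : ¬ l ∣ A := fun ha => by
      have h5 : l ∣ 2 * 2 * (B * B * B) := pdvd_of_comb g2 ha (a := 1) (b := -A ^ 2) (by rw [hW]; ring)
      simp only [hl.dvd_mul, hl2, hnB, or_self] at h5
    have h4 := h4.resolve_left hnA
    have h5 : l ∣ 2 * 2 * 17 * (B * B * B) := pdvd_of_comb g2 h4 (a := 1) (b := -(A ^ 2 + 4 * A * B + 16 * B ^ 2)) (by rw [hW]; ring)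
    simp only [hl.dvd_mul, hnB, hl2, or_self, or_false, false_or] at h5
    refine seventeen_W hc (Or.inr ?_)
    rw [← hA, ← hB]
    exact prime_to hl int_prime_17 h5 h4
  · intro u hu l hl g1 g2
    obtain ⟨f1, f2, f3, f4, f5, f6, f7, f8⟩ := facts l hl
    have h4 : l ∣ 2 * 2 * 2 * 2 * (B * B * B) * (B - 2 * A) :=
      pdvd_of_comb g1 g2 (a := 1) (b := -V * (A ^ 2 + 8 * A * B + 12 * B ^ 2)) (by
        rw [hD]; linear_combination (A ^ 2 + 8 * A * B + 12 * B ^ 2) * hV2)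
    simp only [hl.dvd_mul, f3 g2, or_self, false_or] at h4
    have h4 := h4.resolve_left (f5 g2)
    have h5 : l ∣ 17 * (A * A) := pdvd_of_comb g2 h4 (a := V) (b := -4 * B - 8 * A) (by linear_combination -hV2)
    simp only [hl.dvd_mul, or_self] at h5
    have h5 := h5.resolve_right (f7 g2)
    refine seventeen_V hc (Or.inr ?_) (u := u) ?_
    · rw [← hA, ← hB]
      exact prime_to hl int_prime_17 h5 h4
    · rw [← hA, ← hB, ← hU]; exact hu

theorem case567 {p q m : ℤ} (hc : IsCoprime p q) (hp0 : p ≠ 0) (hq0 : q ≠ 0) (hA0 : q ^ 2 - p ^ 2 ≠ 0)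
    (hm : m ≠ 0) {A B U V W D : ℤ} (hA : A = q ^ 2 - p ^ 2) (hB : B = p * q) (hU : U = A + 2 * B) (hV : V = p ^ 2 + q ^ 2)
    (hW : W = A ^ 3 + 16 * B ^ 3) (hD : D = A ^ 4 + 4 * A ^ 2 * B ^ 2 + 8 * A * B ^ 3 + 4 * B ^ 4)
    (h : A * (U * V) * D = m ^ 2 ∨ A * W * D = m ^ 2 ∨ U * V * W * D = m ^ 2) : ∃ k : ℤ, D = k ^ 2 := by
  rcases Int.emod_two_eq_zero_or_one (q ^ 2 - p ^ 2) with h2 | h2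
  · obtain ⟨x, y, rfl, rfl, hcxy, hx0, hy0, hxy⟩ := both_odd hc hp0 hA0 h2
    set A' := y ^ 2 - x ^ 2 with hA'
    set B' := x * y with hB'
    set U' := A' + 2 * B' with hU'
    set V' := x ^ 2 + y ^ 2 with hV'
    set W' := A' ^ 3 + 4 * B' ^ 3 with hW'
    set D' := A' ^ 4 + 8 * A' ^ 3 * B' + 16 * A' ^ 2 * B' ^ 2 + 64 * B' ^ 4 with hD'
    have eA : A = 4 * B' := by rw [hA, hB']; ring
    have eB : B = A' := by rw [hB, hA']; ring
    have eU : U = 2 * U' := by rw [hU, eA, eB, hU']; ring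
    have eV : V = 2 * V' := by rw [hV, hV']; ring
    have eW : W = 16 * W' := by rw [hW, eA, eB, hW']; ring
    have eD : D = 4 * D' := by rw [hD, eA, eB, hD']; ring
    obtain ⟨n, hn0, hn⟩ : ∃ n, n ≠ 0 ∧ (B' * (U' * V') * D' = n ^ 2 ∨ B' * W' * D' = n ^ 2 ∨ U' * V' * W' * D' = n ^ 2) := by
      rcases h with h | h | h
      · have hx : 8^2 * (B' * (U' * V') * D') = m ^ 2 := by rw [← h, eA, eU, eV, eD]; ring
        obtain ⟨n, hn⟩ := sq_cancel (a := 8) (by norm_num) hx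
        refine ⟨n, ?_, Or.inl hn⟩
        rintro rfl
        rw [hn] at hx
        exact hm (pow_eq_zero_iff two_ne_zero |>.1 (by rw [← hx]; ring))
      · have hx : 16^2 * (B' * W' * D') = m ^ 2 := by rw [← h, eA, eW, eD]; ring
        obtain ⟨n, hn⟩ := sq_cancel (a := 16) (by norm_num) hx
        refine ⟨n, ?_, Or.inr (Or.inl hn)⟩
        rintro rfl
        rw [hn] at hx
        exact hm (pow_eq_zero_iff two_ne_zero |>.1 (by rw [← hx]; ring))
      · have hx : 16^2 * (U' * V' * W' * D') = m ^ 2 := by rw [← h, eU, eV, eW, eD]; ring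
        obtain ⟨n, hn⟩ := sq_cancel (a := 16) (by norm_num) hx
        refine ⟨n, ?_, Or.inr (Or.inr hn)⟩
        rintro rfl
        rw [hn] at hx
        exact hm (pow_eq_zero_iff two_ne_zero |>.1 (by rw [← hx]; ring))
    obtain ⟨k, hk⟩ := blockS hcxy hxy hn0 hA' hB' hU' hV' hW' hD' hn
    exact ⟨2 * k, by rw [eD, hk]; ring⟩
  · exact blockO hc h2 hm hA hB hU hV hW hD h

/-! ### The final arithmetic statement -/

theorem nonzero_facts {p q : ℤ} (hc : IsCoprime p q) (hp0 : p ≠ 0) (hA0 : q ^ 2 - p ^ 2 ≠ 0) :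
    q ^ 2 - p ^ 2 + p * q ≠ 0 ∧ q ^ 2 - p ^ 2 + 2 * (p * q) ≠ 0 ∧ p ^ 2 + q ^ 2 ≠ 0 ∧
    (q ^ 2 - p ^ 2) ^ 3 + 16 * (p * q) ^ 3 ≠ 0 ∧
    (q ^ 2 - p ^ 2) ^ 4 + 4 * (q ^ 2 - p ^ 2) ^ 2 * (p * q) ^ 2 + 8 * (q ^ 2 - p ^ 2) * (p * q) ^ 3
      + 4 * (p * q) ^ 4 ≠ 0 := by
  have hV : p ^ 2 + q ^ 2 ≠ 0 := by positivity
  have hD : (q ^ 2 - p ^ 2) ^ 4 + 4 * (q ^ 2 - p ^ 2) ^ 2 * (p * q) ^ 2 + 8 * (q ^ 2 - p ^ 2) * (p * q) ^ 3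
      + 4 * (p * q) ^ 4 ≠ 0 := by
    have h1 : 0 < (q ^ 2 - p ^ 2) ^ 4 := by positivity
    nlinarith [sq_nonneg (p * q * (q ^ 2 - p ^ 2 + p * q))]
  have hAB : IsCoprime (q ^ 2 - p ^ 2) (p * q) := cop_AB hc
  have key : ∀ {A B : ℤ}, IsCoprime A B → A = -B → B = 1 ∨ B = -1 := by
    intro A B h1 h2
    rw [h2] at h1
    have : IsUnit B := isCoprime_self.1 (IsCoprime.neg_left_iff _ _ |>.1 h1)
    exact Int.isUnit_iff.1 this
  rcases Int.emod_two_eq_zero_or_one (q ^ 2 - p ^ 2) with h2 | h2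
  · obtain ⟨x, y, rfl, rfl, hcxy, hx0, hy0, hxy⟩ := both_odd hc hp0 hA0 h2
    refine ⟨?_, ?_, hV, ?_, hD⟩
    · rw [show (y + x) ^ 2 - (y - x) ^ 2 + (y - x) * (y + x) = 2 * (2 * (x * y)) + (y ^ 2 - x ^ 2) by ring]
      omega
    · rw [show (y + x) ^ 2 - (y - x) ^ 2 + 2 * ((y - x) * (y + x)) = 2 * (2 * (x * y) + (y ^ 2 - x ^ 2)) by ring]
      omega
    · rw [show ((y + x) ^ 2 - (y - x) ^ 2) ^ 3 + 16 * ((y - x) * (y + x)) ^ 3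
        = 16 * (2 * (2 * (x * y) ^ 3) + (y ^ 2 - x ^ 2) * (y ^ 2 - x ^ 2) * (y ^ 2 - x ^ 2)) by ring]
      have := odd_mul (odd_mul hxy hxy) hxy
      omega
  · refine ⟨?_, ?_, hV, ?_, hD⟩
    · intro h
      have h3 : (p * q) % 2 = 1 := by omega
      have h4 : p % 2 = 1 := by
        rcases Int.emod_two_eq_zero_or_one p with h | h
        · rw [Int.mul_emod, h] at h3; simp at h3
        · exact h
      have h5 : q % 2 = 1 := by
        rcases Int.emod_two_eq_zero_or_one q with h | h
        · rw [Int.mul_emod, h] at h3; simp at h3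
        · exact h
      have h6 := odd_mul h4 h4
      have h7 := odd_mul h5 h5
      rw [pow_two, pow_two] at h2
      omega
    · omega
    · rw [show (q ^ 2 - p ^ 2) ^ 3 + 16 * (p * q) ^ 3
        = 2 * (8 * (p * q) ^ 3) + (q ^ 2 - p ^ 2) * (q ^ 2 - p ^ 2) * (q ^ 2 - p ^ 2) by ring]
      have := odd_mul (odd_mul h2 h2) h2
      omega

theorem int_final {p q : ℤ} (hc : IsCoprime p q) (hp0 : p ≠ 0) (hq0 : q ≠ 0) (hA0 : q ^ 2 - p ^ 2 ≠ 0)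
    (hex : ¬ (q = -3 * p ∨ p = 3 * q)) {A B U V W D : ℤ} (hA : A = q ^ 2 - p ^ 2) (hB : B = p * q)
    (hU : U = A + 2 * B) (hV : V = p ^ 2 + q ^ 2)
    (hW : W = A ^ 3 + 16 * B ^ 3) (hD : D = A ^ 4 + 4 * A ^ 2 * B ^ 2 + 8 * A * B ^ 3 + 4 * B ^ 4) :
    ¬ IsSquare (A * (U * V)) ∧ ¬ IsSquare (A * W) ∧ ¬ IsSquare D ∧ ¬ IsSquare (A * (U * V) * (A * W)) ∧
    ¬ IsSquare (A * (U * V) * D) ∧ ¬ IsSquare (A * W * D) ∧ ¬ IsSquare (A * (U * V) * (A * W) * D) := by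
  obtain ⟨n1, n2, n3, n4, n5⟩ := nonzero_facts hc hp0 hA0
  rw [← hA, ← hB] at n1 n2 n4 n5
  rw [← hU] at n2
  rw [← hV] at n3
  rw [← hW] at n4
  rw [← hD] at n5
  have hA1 : A ≠ 0 := by rw [hA]; exact hA0
  have hB1 : B ≠ 0 := by rw [hB]; exact mul_ne_zero hp0 hq0
  have hnz : ∀ {x m : ℤ}, x ≠ 0 → x = m * m → m ≠ 0 := by
    rintro x m hx h rfl
    exact hx (by simpa using h)
  have hDn : ¬ ∃ k, D = k ^ 2 := by
    rintro ⟨k, hk⟩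
    refine case3 (A := A) (B := B) ?_ hA1 hB1 n1 (hD ▸ hk)
    rw [hA, hB]; exact cop_AB hc
  have h567 : ∀ m, ¬ (A * (U * V) * D = m ^ 2 ∨ A * W * D = m ^ 2 ∨ U * V * W * D = m ^ 2) := by
    intro m h
    refine hDn (case567 hc hp0 hq0 hA0 ?_ hA hB hU hV hW hD h)
    rintro rfl
    simp [hA1, n2, n3, n4, n5] at h
  refine ⟨?_, ?_, ?_, ?_, ?_, ?_, ?_⟩
  · rintro ⟨m, hm⟩
    refine case1 hc hp0 hq0 hA0 (m := m) (hnz (by simp [hA1, n2, n3]) hm) ?_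
    rw [← hA, ← hB, ← hU, ← hV, hm]; ring
  · rintro ⟨m, hm⟩
    refine case2 hc hp0 hq0 hA0 (m := m) (hnz (by simp [hA1, n4]) hm) ?_
    rw [← hA, ← hB, ← hW, hm]; ring
  · rintro ⟨m, hm⟩
    exact hDn ⟨m, by rw [hm]; ring⟩
  · rintro ⟨m, hm⟩
    obtain ⟨k, hk⟩ := sq_cancel (a := A) (x := U * (V * W)) (m := m) hA1 (by rw [pow_two m, ← hm]; ring)
    refine hex (case4 hc hp0 hq0 hA0 (m := k) (hnz (x := U * (V * W)) (by simp [n2, n3, n4]) (by rw [hk]; ring)) ?_)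
    rw [← hA, ← hB, ← hW, ← hU, ← hV, hk]
  · rintro ⟨m, hm⟩
    exact h567 m (Or.inl (by rw [hm]; ring))
  · rintro ⟨m, hm⟩
    exact h567 m (Or.inr (Or.inl (by rw [hm]; ring)))
  · rintro ⟨m, hm⟩
    obtain ⟨k, hk⟩ := sq_cancel (a := A) (x := U * V * W * D) (m := m) hA1 (by rw [pow_two m, ← hm]; ring)
    exact h567 k (Or.inr (Or.inr hk))

/-- The arithmetic input: none of the seven discriminant products is a rational square. -/
theorem rat_final {z : ℚ} (h0 : z ≠ 0) (h1 : z ≠ 1) (h2 : z ≠ -1) (h3 : z ≠ 3) (h4 : z ≠ -1/3)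
    {a d₁ d₂ d₃ : ℚ} (ha : a = 1 - z ^ 2) (e1 : d₁ = a * ((a + 2 * z) * (1 + z ^ 2)))
    (e2 : d₂ = a * (a ^ 3 + 16 * z ^ 3))
    (e3 : d₃ = a ^ 4 + 4 * a ^ 2 * z ^ 2 + 8 * a * z ^ 3 + 4 * z ^ 4) :
    ¬ IsSquare d₁ ∧ ¬ IsSquare d₂ ∧ ¬ IsSquare d₃ ∧ ¬ IsSquare (d₁ * d₂) ∧
    ¬ IsSquare (d₁ * d₃) ∧ ¬ IsSquare (d₂ * d₃) ∧ ¬ IsSquare (d₁ * d₂ * d₃) := by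
  obtain ⟨p, q, hq0, hc, hz⟩ : ∃ p q : ℤ, q ≠ 0 ∧ IsCoprime p q ∧ z = p / q :=
    ⟨z.num, z.den, by exact_mod_cast z.den_ne_zero, by
      rw [Int.isCoprime_iff_gcd_eq_one]; exact z.reduced, by simp [Rat.num_div_den]⟩
  have hqQ : (q : ℚ) ≠ 0 := by exact_mod_cast hq0
  have hp : (p : ℚ) = z * q := by rw [hz]; field_simp
  have hp0 : p ≠ 0 := by
    rintro rfl
    apply h0; rw [hz]; simp
  have hA0 : q ^ 2 - p ^ 2 ≠ 0 := by
    intro h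
    have : (q : ℚ) ^ 2 - p ^ 2 = 0 := by exact_mod_cast h
    rw [hp, show (q : ℚ) ^ 2 - (z * q) ^ 2 = q ^ 2 * ((1 - z) * (1 + z)) by ring] at this
    rcases mul_eq_zero.1 this with h | h
    · exact pow_ne_zero 2 hqQ h
    · rcases mul_eq_zero.1 h with h | h
      · exact h1 (by linarith)
      · exact h2 (by linarith)
  have hex : ¬ (q = -3 * p ∨ p = 3 * q) := by
    rintro (h | h)
    · have : (q : ℚ) = -3 * p := by exact_mod_cast h
      apply h4
      rw [hp] at this
      apply mul_right_cancel₀ hqQ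
      linarith
    · have : (p : ℚ) = 3 * q := by exact_mod_cast h
      apply h3
      rw [hp] at this
      exact mul_right_cancel₀ hqQ this
  have key := int_final hc hp0 hq0 hA0 hex rfl rfl rfl rfl rfl rfl
  have tr : ∀ (x : ℤ) (d : ℚ) (n : ℕ), (x : ℚ) = (q ^ n) ^ 2 * d → ¬ IsSquare x → ¬ IsSquare d := by
    rintro x d n hx hn ⟨s, hs⟩
    apply hn
    rw [← Rat.isSquare_intCast_iff]
    exact ⟨q ^ n * s, by rw [hx, hs]; ring⟩
  obtain ⟨k1, k2, k3, k4, k5, k6, k7⟩ := key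
  refine ⟨tr _ _ 3 ?_ k1, tr _ _ 4 ?_ k2, tr _ _ 4 ?_ k3, tr _ _ 7 ?_ k4, tr _ _ 7 ?_ k5,
    tr _ _ 8 ?_ k6, tr _ _ 11 ?_ k7⟩ <;>
  · subst e1 e2 e3 ha
    push_cast
    rw [hp]
    ring

/-! ### Group theory: a description of `Igroup` -/

def cyc4 : Fin 12 → Fin 12 := ![1, 2, 3, 0, 5, 6, 7, 4, 9, 10, 11, 8]

def gα : Equiv.Perm (Fin 12) where
  toFun := ![1, 2, 3, 0, 4, 5, 6, 7, 8, 9, 10, 11]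
  invFun := ![3, 0, 1, 2, 4, 5, 6, 7, 8, 9, 10, 11]
  left_inv := by decide
  right_inv := by decide

def gβ : Equiv.Perm (Fin 12) where
  toFun := ![0, 1, 2, 3, 4, 5, 6, 7, 9, 10, 11, 8]
  invFun := ![0, 1, 2, 3, 4, 5, 6, 7, 11, 8, 9, 10]
  left_inv := by decide
  right_inv := by decide

def gs : Equiv.Perm (Fin 12) where
  toFun := ![8, 9, 10, 11, 4, 5, 6, 7, 0, 1, 2, 3]
  invFun := ![8, 9, 10, 11, 4, 5, 6, 7, 0, 1, 2, 3]
  left_inv := by decide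
  right_inv := by decide

def gw : Equiv.Perm (Fin 12) where
  toFun := ![0, 1, 2, 3, 6, 7, 4, 5, 8, 9, 10, 11]
  invFun := ![0, 1, 2, 3, 6, 7, 4, 5, 8, 9, 10, 11]
  left_inv := by decide
  right_inv := by decide

theorem gen1 : ([0, 3, 2, 1] : List (Fin 12)).formPerm = gα⁻¹ := by decide
theorem gen2 : ([8, 9, 10, 11] : List (Fin 12)).formPerm = gβ := by decide
theorem gen3 : ([0, 9, 3, 8, 2, 11, 1, 10] : List (Fin 12)).formPerm = gα ^ 2 * gβ * gs := by decide
theorem gen4 : ([0, 9] : List (Fin 12)).formPerm * ([1, 10] : List (Fin 12)).formPerm *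
       ([2, 11] : List (Fin 12)).formPerm * ([3, 8] : List (Fin 12)).formPerm *
       ([4, 6] : List (Fin 12)).formPerm * ([5, 7] : List (Fin 12)).formPerm = gα ^ 3 * gβ * gs * gw := by decide

theorem word_values : ∀ (a b : Fin 4) (k l : Fin 2),
    ((gα ^ (a : ℕ) * gβ ^ (b : ℕ) * gs ^ (k : ℕ) * gw ^ (l : ℕ)) 0 : Fin 12).val = (if k = 0 then a.val else 8 + b.val) ∧
    ((gα ^ (a : ℕ) * gβ ^ (b : ℕ) * gs ^ (k : ℕ) * gw ^ (l : ℕ)) 4 : Fin 12).val = (if l = 0 then 4 else 6) ∧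
    ((gα ^ (a : ℕ) * gβ ^ (b : ℕ) * gs ^ (k : ℕ) * gw ^ (l : ℕ)) 8 : Fin 12).val = (if k = 0 then 8 + b.val else a.val) := by
  decide

theorem gα_cyc : ∀ i, gα (cyc4 i) = cyc4 (gα i) := by decide
theorem gβ_cyc : ∀ i, gβ (cyc4 i) = cyc4 (gβ i) := by decide
theorem gs_cyc : ∀ i, gs (cyc4 i) = cyc4 (gs i) := by decide
theorem gw_cyc : ∀ i, gw (cyc4 i) = cyc4 (gw i) := by decide

/-- The subgroup of permutations commuting with `cyc4`. -/
def cycCent : Subgroup (Equiv.Perm (Fin 12)) where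
  carrier := {π | ∀ i, π (cyc4 i) = cyc4 (π i)}
  mul_mem' := by
    intro a b ha hb i
    rw [Equiv.Perm.mul_apply, hb i, ha (b i), Equiv.Perm.mul_apply]
  one_mem' := fun i => rfl
  inv_mem' := by
    intro a ha i
    rw [Equiv.Perm.inv_eq_iff_eq, ha (a⁻¹ i)]
    simp

theorem word_cyc (a b k l : ℕ) : gα ^ a * gβ ^ b * gs ^ k * gw ^ l ∈ cycCent :=
  mul_mem (mul_mem (mul_mem (pow_mem (show gα ∈ cycCent from gα_cyc) a) (pow_mem (show gβ ∈ cycCent from gβ_cyc) b)) (pow_mem (show gs ∈ cycCent from gs_cyc) k)) (pow_mem (show gw ∈ cycCent from gw_cyc) l)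

theorem cyc_reach : ∀ i, i ∈ ({0, 4, 8} : Finset (Fin 12)) ∨ (∃ j ∈ ({0, 4, 8} : Finset (Fin 12)),
    i = cyc4 j ∨ i = cyc4 (cyc4 j) ∨ i = cyc4 (cyc4 (cyc4 j))) := by decide

theorem cyc_ext {π θ : Equiv.Perm (Fin 12)} (h : π ∈ cycCent) (h' : θ ∈ cycCent)
    (h0 : π 0 = θ 0) (h4 : π 4 = θ 4) (h8 : π 8 = θ 8) : π = θ := by
  have hb : ∀ j ∈ ({0, 4, 8} : Finset (Fin 12)), π j = θ j := by
    intro j hj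
    simp only [Finset.mem_insert, Finset.mem_singleton] at hj
    rcases hj with rfl | rfl | rfl <;> assumption
  have e1 : ∀ i, π (cyc4 i) = cyc4 (π i) := h
  have e2 : ∀ i, θ (cyc4 i) = cyc4 (θ i) := h'
  ext i : 1
  rcases cyc_reach i with hi | ⟨j, hj, rfl | rfl | rfl⟩
  · exact hb i hi
  · rw [e1, e2, hb j hj]
  · rw [e1, e1, e2, e2, hb j hj]
  · rw [e1, e1, e1, e2, e2, e2, hb j hj]

theorem blocks : ∀ i : Fin 12, (4 ≤ i.val ∧ i.val < 8) → (i = 4 ∨ i = cyc4 4 ∨ i = cyc4 (cyc4 4) ∨ i = cyc4 (cyc4 (cyc4 4))) := by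
  decide

theorem cyc_block : ∀ i j : Fin 12, i.val / 4 = j.val / 4 →
    (j = i ∨ j = cyc4 i ∨ j = cyc4 (cyc4 i) ∨ j = cyc4 (cyc4 (cyc4 i))) := by
  decide

theorem cyc_div : ∀ i : Fin 12, (cyc4 i).val / 4 = i.val / 4 := by decide

theorem cent_block {π : Equiv.Perm (Fin 12)} (h : π ∈ cycCent) {i j : Fin 12} :
    (π i).val / 4 = (π j).val / 4 → i.val / 4 = j.val / 4 := by
  intro hij
  have e2 : ∀ i, π (cyc4 i) = cyc4 (π i) := h
  rcases cyc_block _ _ hij with h | h | h | h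
  · rw [π.injective h]
  · rw [← e2] at h; rw [π.injective h, cyc_div]
  · rw [← e2, ← e2] at h; rw [π.injective h, cyc_div, cyc_div]
  · rw [← e2, ← e2, ← e2] at h; rw [π.injective h, cyc_div, cyc_div, cyc_div]

theorem word_form {π : Equiv.Perm (Fin 12)} (h : π ∈ cycCent) (h4 : π 4 = 4 ∨ π 4 = 6) :
    ∃ (a b : Fin 4) (k l : Fin 2), π = gα ^ (a : ℕ) * gβ ^ (b : ℕ) * gs ^ (k : ℕ) * gw ^ (l : ℕ) := by
  have n1 := fun hh => cent_block h (i := 0) (j := 4) hh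
  have n2 := fun hh => cent_block h (i := 8) (j := 4) hh
  have n3 := fun hh => cent_block h (i := 0) (j := 8) hh
  have v0 : (0 : Fin 12).val = 0 := rfl
  have v4 : (4 : Fin 12).val = 4 := rfl
  have v6 : (6 : Fin 12).val = 6 := rfl
  have v8 : (8 : Fin 12).val = 8 := rfl
  rw [v0, v4] at n1
  rw [v8, v4] at n2
  rw [v0, v8] at n3
  have hv4 : (π 4).val = 4 ∨ (π 4).val = 6 := by
    rcases h4 with h4 | h4 <;> rw [h4]
    · exact Or.inl rfl
    · exact Or.inr rfl
  obtain ⟨l, hl⟩ : ∃ l : Fin 2, (π 4).val = (if l = 0 then 4 else 6) := by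
    rcases hv4 with h | h
    · exact ⟨0, by rw [h]; rfl⟩
    · exact ⟨1, by rw [h]; rfl⟩
  have b0 := (π 0).isLt
  have b8 := (π 8).isLt
  by_cases hk : (π 0).val < 4
  · have h8 : 8 ≤ (π 8).val := by omega
    refine ⟨⟨(π 0).val, hk⟩, ⟨(π 8).val - 8, by omega⟩, 0, l, cyc_ext h (word_cyc _ _ _ _) ?_ ?_ ?_⟩
    · apply Fin.ext
      rw [(word_values _ _ _ _).1]; rfl
    · apply Fin.ext
      rw [(word_values _ _ _ _).2.1, hl]
    · apply Fin.ext
      rw [(word_values _ _ _ _).2.2]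
      simp; omega
  · have h0 : 8 ≤ (π 0).val := by omega
    refine ⟨⟨(π 8).val, by omega⟩, ⟨(π 0).val - 8, by omega⟩, 1, l, cyc_ext h (word_cyc _ _ _ _) ?_ ?_ ?_⟩
    · apply Fin.ext
      rw [(word_values _ _ _ _).1]
      simp; omega
    · apply Fin.ext
      rw [(word_values _ _ _ _).2.1, hl]
    · apply Fin.ext
      rw [(word_values _ _ _ _).2.2]; rfl

theorem gα_mem : gα ∈ Igroup := by
  have h : gα⁻¹ ∈ Igroup := by rw [← gen1]; exact Subgroup.subset_closure (by simp)
  exact (inv_mem_iff).1 h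

theorem gβ_mem : gβ ∈ Igroup := by rw [← gen2]; exact Subgroup.subset_closure (by simp)

theorem gs_mem : gs ∈ Igroup := by
  have h : gα ^ 2 * gβ * gs ∈ Igroup := by rw [← gen3]; exact Subgroup.subset_closure (by simp)
  exact (mul_mem_cancel_left (mul_mem (pow_mem gα_mem 2) gβ_mem)).1 h

theorem gw_mem : gw ∈ Igroup := by
  have h : gα ^ 3 * gβ * gs * gw ∈ Igroup := by rw [← gen4]; exact Subgroup.subset_closure (by simp)
  exact (mul_mem_cancel_left (mul_mem (mul_mem (pow_mem gα_mem 3) gβ_mem) gs_mem)).1 h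

set_option maxRecDepth 100000 in
theorem odd_word : ∀ a b : Fin 4, (a.val + b.val) % 2 = 1 → ∀ a' b' : Fin 4,
    (let h := gα ^ (a : ℕ) * gβ ^ (b : ℕ)
     let g := gα ^ (a' : ℕ) * gβ ^ (b' : ℕ) * gs
     (h ^ (a : ℕ) * ((g * h * g⁻¹) ^ (b : ℕ))⁻¹ = gα ∨ h ^ (a : ℕ) * ((g * h * g⁻¹) ^ (b : ℕ))⁻¹ = gα⁻¹) ∧
     (h ^ (b : ℕ) * ((g * h * g⁻¹) ^ (a : ℕ))⁻¹ = gβ ∨ h ^ (b : ℕ) * ((g * h * g⁻¹) ^ (a : ℕ))⁻¹ = gβ⁻¹)) := by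
  decide

theorem eq_Igroup {R : Subgroup (Equiv.Perm (Fin 12))} (hR : ∀ π ∈ R, ∀ i, π (cyc4 i) = cyc4 (π i))
    (hR4 : ∀ π ∈ R, π 4 = 4 ∨ π 4 = 6) (h3 : ∃ π ∈ R, π 4 = 6)
    (h2 : ∃ π ∈ R, π 4 = 4 ∧ 8 ≤ (π 0).val)
    (h1 : ∃ π ∈ R, π 4 = 4 ∧ (π 0).val < 4 ∧ ((π 0).val + (π 8).val) % 2 = 1) : R = Igroup := by
  apply le_antisymm
  · intro π hπ
    obtain ⟨a, b, k, l, rfl⟩ := word_form (hR π hπ) (hR4 π hπ)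
    exact mul_mem (mul_mem (mul_mem (pow_mem gα_mem _) (pow_mem gβ_mem _)) (pow_mem gs_mem _)) (pow_mem gw_mem _)
  · obtain ⟨π₁, m1, f1, g1, p1⟩ := h1
    obtain ⟨π₂, m2, f2, g2⟩ := h2
    obtain ⟨π₃, m3, f3⟩ := h3
    obtain ⟨a, b, k, l, e1⟩ := word_form (hR _ m1) (hR4 _ m1)
    obtain ⟨a', b', k', l', e2⟩ := word_form (hR _ m2) (hR4 _ m2)
    obtain ⟨a'', b'', k'', l'', e3⟩ := word_form (hR _ m3) (hR4 _ m3)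
    have w1 := word_values a b k l
    have w2 := word_values a' b' k' l'
    have w3 := word_values a'' b'' k'' l''
    rw [← e1, f1] at w1
    rw [← e2, f2] at w2
    rw [← e3, f3] at w3
    have hl : l = 0 := by
      by_contra hne; have := w1.2.1; rw [if_neg hne] at this; exact absurd this (by decide)
    have hl' : l' = 0 := by
      by_contra hne; have := w2.2.1; rw [if_neg hne] at this; exact absurd this (by decide)
    have hl'' : l'' = 1 := by
      have h : l'' ≠ 0 := by
        rintro hne; have := w3.2.1; rw [if_pos hne] at this; exact absurd this (by decide)
      omega
    have hk : k = 0 := by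
      by_contra hne; have := w1.1; rw [if_neg hne] at this; omega
    have hk' : k' = 1 := by
      have h : k' ≠ 0 := by
        rintro hne; have := w2.1; rw [if_pos hne] at this; omega
      omega
    subst hl hl' hl'' hk hk'
    have hab : (a.val + b.val) % 2 = 1 := by
      have h1 := w1.1
      have h2 := w1.2.2
      rw [if_pos rfl] at h1 h2
      omega
    have r1 : gα ^ (a : ℕ) * gβ ^ (b : ℕ) ∈ R := by
      have := m1; rw [e1] at this; simpa using this
    have r2 : gα ^ (a' : ℕ) * gβ ^ (b' : ℕ) * gs ∈ R := by
      have := m2; rw [e2] at this; simpa using this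
    obtain ⟨o1, o2⟩ := odd_word a b hab a' b'
    have rc := mul_mem (mul_mem r2 r1) (inv_mem r2)
    have rα : gα ∈ R := by
      have := mul_mem (pow_mem r1 a.val) (inv_mem (pow_mem rc b.val))
      rcases o1 with o | o
      · rw [o] at this; exact this
      · rw [o] at this; exact inv_mem_iff.1 this
    have rβ : gβ ∈ R := by
      have := mul_mem (pow_mem r1 b.val) (inv_mem (pow_mem rc a.val))
      rcases o2 with o | o
      · rw [o] at this; exact this
      · rw [o] at this; exact inv_mem_iff.1 this
    have rs : gs ∈ R := (mul_mem_cancel_left (mul_mem (pow_mem rα _) (pow_mem rβ _))).1 r2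
    have rw' : gw ∈ R := by
      have := m3
      rw [e3] at this
      have := (mul_mem_cancel_left (mul_mem (mul_mem (pow_mem rα _) (pow_mem rβ _)) (pow_mem rs _))).1 this
      simpa using this
    rw [Igroup, Subgroup.closure_le]
    rintro g (rfl | rfl | rfl | rfl)
    · rw [gen1]; exact inv_mem rα
    · rw [gen2]; exact rβ
    · rw [gen3]; exact mul_mem (mul_mem (pow_mem rα _) rβ) rs
    · rw [gen4]; exact mul_mem (mul_mem (mul_mem (pow_mem rα _) rβ) rs) rw'

open Polynomial

/-! ### Four-cycles of `x ↦ x^2 + c` -/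

section dyn

variable {K : Type*} [Field K] [CharZero K]

/-- The quartic factor of the dynatomic polynomial with trace `T`. -/
def quartT (c T x : K) : K :=
  x ^ 4 - T * x ^ 3 + ((T ^ 2 - T) / 2 + 2 * c) * x ^ 2 + ((T ^ 2 + T + 2) / 2 - c * T) * x
    + (c * T ^ 2 + c * T + 2 * c ^ 2 + 2 * c + 2) / 2

/-- `quartT` as a polynomial. -/
noncomputable def quartP (c T : K) : K[X] :=
  X ^ 4 + C (-T) * X ^ 3 + C ((T ^ 2 - T) / 2 + 2 * c) * X ^ 2 + C ((T ^ 2 + T + 2) / 2 - c * T) * X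
    + C ((c * T ^ 2 + c * T + 2 * c ^ 2 + 2 * c + 2) / 2)

theorem quartT_sum {c T x : K} (hT : T ^ 3 + (4 * c + 3) * T + 4 = 0) (h : quartT c T x = 0) :
    x + (x ^ 2 + c) + ((x ^ 2 + c) ^ 2 + c) + (((x ^ 2 + c) ^ 2 + c) ^ 2 + c) = T := by
  unfold quartT at h
  linear_combination ((1)*x^4 + (1)*x^3*T + (1/2)*x^2*T^2 + (1/2)*x^2*T + (2)*x^2*c + (1/2)*x*T^2 + (1)*x*T*c + (-1/2)*x*T + (-1)*x + (-1/4)*T^4 + (-1/2)*T^2*c + (-3/4)*T^2 + (-1/2)*T*c + (-2)*T + (1)*c^2 + (1)*c) * h + ((-1/4)*x^3*T^2 + (-1/2)*x^3*T + (1/8)*x^2*T^3 + (-1/8)*x^2*T^2 + (-1/4)*x^2*T + (1/2)*x^2 + (1/8)*x*T^3 + (-1/4)*x*T^2*c + (1/8)*x*T^2 + (-1/2)*x*T*c + (1/4)*x*T + (1/2)*x + (1/8)*T^3*c + (1/8)*T^2*c + (1/4)*T*c + (1/4)*T + (1/2)*c) * hT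

theorem quartT_map {c T x : K} (hT : T ^ 3 + (4 * c + 3) * T + 4 = 0) (h : quartT c T x = 0) :
    quartT c T (x ^ 2 + c) = 0 := by
  unfold quartT at h ⊢
  linear_combination ((1)*x^4 + (1)*x^3*T + (1/2)*x^2*T^2 + (-1/2)*x^2*T + (2)*x^2*c + (-1/2)*x*T^2 + (1)*x*T*c + (-1/2)*x*T + (-1)*x + (-1/4)*T^4 + (-1/2)*T^3 + (-1/2)*T^2*c + (-3/4)*T^2 + (-3/2)*T*c + (-5/2)*T + (1)*c^2 + (1)*c + (-1)) * h + ((-1/4)*x^3*T^2 + (-1/2)*x^3*T + (1/8)*x^2*T^3 + (1/8)*x^2*T^2 + (1/2)*x^2 + (1/8)*x*T^3 + (-1/4)*x*T^2*c + (3/8)*x*T^2 + (-1/2)*x*T*c + (1/2)*x*T + (1/2)*x + (1/8)*T^3*c + (3/8)*T^2*c + (1/2)*T*c + (1/4)*T + (1/2)*c + (1/2)) * hT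

/-- The data of a genuine four-cycle. -/
structure IsCyc (c T x0 x1 x2 x3 : K) : Prop where
  h01 : x1 = x0 ^ 2 + c
  h12 : x2 = x1 ^ 2 + c
  h23 : x3 = x2 ^ 2 + c
  h30 : x0 = x3 ^ 2 + c
  sum : x0 + x1 + x2 + x3 = T
  ne : x0 ≠ x2

theorem IsCyc.rot {c T x0 x1 x2 x3 : K} (h : IsCyc c T x0 x1 x2 x3) : IsCyc c T x1 x2 x3 x0 where
  h01 := h.h12
  h12 := h.h23
  h23 := h.h30
  h30 := h.h01
  sum := by rw [← h.sum]; ring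
  ne := by
    intro e
    apply h.ne
    rw [h.h30, h.h12, e]

theorem IsCyc.ne1 {c T x0 x1 x2 x3 : K} (h : IsCyc c T x0 x1 x2 x3) : x0 ≠ x1 := by
  intro e
  apply h.ne
  rw [h.h12, ← e, ← h.h01, e]

theorem IsCyc.mulneg {c T x0 x1 x2 x3 : K} (h : IsCyc c T x0 x1 x2 x3) : (x0 + x2) * (x1 + x3) = -1 := by
  have h1 : (x0 - x2) * (x0 + x2) = x1 - x3 := by rw [h.h01, h.h23]; ring
  have h2 : (x1 - x3) * (x1 + x3) = x2 - x0 := by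
    linear_combination -h.h12 + h.h30
  apply mul_left_cancel₀ (mul_ne_zero (sub_ne_zero.2 h.ne) (sub_ne_zero.2 h.rot.ne))
  linear_combination (x1 - x3) * (x1 + x3) * h1 + (x1 - x3) * h2

theorem exists_cyc [IsAlgClosed K] {c T : K} (hT : T ^ 3 + (4 * c + 3) * T + 4 = 0)
    (hT2 : T ≠ -2) (hc : 16 * c ^ 2 - 8 * c + 5 ≠ 0) : ∃ x0 x1 x2 x3 : K, IsCyc c T x0 x1 x2 x3 := by
  have hdeg : (quartP c T).degree = 4 := by
    unfold quartP; compute_degree!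
  obtain ⟨x, hx⟩ := IsAlgClosed.exists_root (quartP c T) (by rw [hdeg]; decide)
  have h : quartT c T x = 0 := by
    rw [IsRoot.def] at hx
    rw [← hx]
    simp only [quartP, quartT, eval_add, eval_mul, eval_pow, eval_X, eval_C]
    ring
  have s1 := quartT_sum hT h
  have s2 := quartT_sum hT (quartT_map hT h)
  refine ⟨x, x ^ 2 + c, (x ^ 2 + c) ^ 2 + c, ((x ^ 2 + c) ^ 2 + c) ^ 2 + c, rfl, rfl, rfl, ?_, s1, ?_⟩
  · linear_combination s1 - s2
  · intro e
    obtain ⟨y, hy⟩ : ∃ y, y = x ^ 2 + c := ⟨_, rfl⟩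
    rw [← hy] at e s1
    have e2 : (x - y) * (x + y + 1) = 0 := by linear_combination -hy + e
    rcases mul_eq_zero.1 e2 with e3 | e3
    · have e4 : y = x := by linear_combination -e3
      have hcx : c = x - x ^ 2 := by rw [e4] at hy; linear_combination -hy
      have hTx : T = 4 * x := by rw [← s1, ← e, ← hy, e4]; ring
      subst hTx
      unfold quartT at h
      subst hcx
      have q1 : (2 * x + 1) * (4 * x ^ 2 + 1) = 0 := by linear_combination h
      have q2 : (3 * x + 1) * (4 * x ^ 2 + 1) = 0 := by linear_combination (1/4) * hT
      have q3 : 4 * x ^ 2 + 1 = 0 := by linear_combination 3 * q1 - 2 * q2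
      apply hc
      linear_combination (4 * x ^ 2 - 8 * x + 5) * q3
    · apply hT2
      rw [← s1, ← e, ← hy]
      linear_combination 2 * e3

theorem Phi4_eval (c x : K) : ((x ^ 2 + c) ^ 2 + c - x) * (Phi4 c).eval x =
    (((x ^ 2 + c) ^ 2 + c) ^ 2 + c) ^ 2 + c - x := by
  simp only [Phi4, eval_add, eval_mul, eval_pow, eval_X, eval_C]
  ring

theorem IsCyc.root {c T x0 x1 x2 x3 : K} (h : IsCyc c T x0 x1 x2 x3) : (Phi4 c).eval x0 = 0 := by
  have e := Phi4_eval c x0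
  rw [← h.h01, ← h.h12, ← h.h23, ← h.h30, sub_self] at e
  exact (mul_eq_zero.1 e).resolve_left (sub_ne_zero.2 h.ne.symm)

/-- Trace of a point along its orbit. -/
def orbT (c y : K) : K := y + (y ^ 2 + c) + ((y ^ 2 + c) ^ 2 + c) + (((y ^ 2 + c) ^ 2 + c) ^ 2 + c)

theorem IsCyc.orbT_eq {c T x0 x1 x2 x3 : K} (h : IsCyc c T x0 x1 x2 x3) : orbT c x0 = T := by
  unfold orbT
  rw [← h.h01, ← h.h12, ← h.h23, h.sum]

end dyn

open Polynomial

/-! ### The twelve roots -/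

section twelve

variable {K : Type*} [Field K]

/-- The labelling of the twelve points of period four. -/
structure Twelve (c z : K) (x : Fin 12 → K) : Prop where
  inj : Function.Injective x
  cyc : ∀ i, x (cyc4 i) = x i ^ 2 + c
  c4 : x 4 + x 6 = -z
  c5 : x 5 + x 7 = z⁻¹
  sT : (x 0 + x 1 + x 2 + x 3) + (x 8 + x 9 + x 10 + x 11) = z - z⁻¹
  pT : (x 0 + x 1 + x 2 + x 3) * (x 8 + x 9 + x 10 + x 11) * (z⁻¹ - z) = -4

theorem exists_twelve [CharZero K] [IsAlgClosed K] {c z τ : K} (hz : z ≠ 0) (hτ : τ = z⁻¹ - z) (hτ0 : τ ≠ 0)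
    (hcub : τ ^ 3 + (4 * c + 3) * τ + 4 = 0) (hc1 : 4 * c + 5 ≠ 0) (hc2 : 16 * c ^ 2 - 8 * c + 5 ≠ 0)
    (ht1 : τ ^ 3 ≠ 2) (ht2 : τ ^ 3 ≠ -16) : ∃ x : Fin 12 → K, Twelve c z x := by
  obtain ⟨s, hs⟩ := IsAlgClosed.exists_pow_nat_eq (τ ^ 2 + 16 / τ) (n := 2) (by norm_num)
  have hs' : τ * s ^ 2 = τ ^ 3 + 16 := by rw [hs]; field_simp
  have hs0 : s ≠ 0 := by
    rintro rfl
    apply ht2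
    linear_combination -hs'
  obtain ⟨T2, hT2⟩ : ∃ T, T = (-τ + s) / 2 := ⟨_, rfl⟩
  obtain ⟨T3, hT3⟩ : ∃ T, T = (-τ - s) / 2 := ⟨_, rfl⟩
  have hsum : T2 + T3 = -τ := by rw [hT2, hT3]; ring
  have hprod : T2 * T3 * τ = -4 := by
    rw [hT2, hT3]; linear_combination (-1/4) * hs'
  have hne : T2 ≠ T3 := by
    intro h
    apply hs0
    linear_combination -hT2 + hT3 + h
  have cubT : ∀ T T' : K, T + T' = -τ → T * T' * τ = -4 → T ^ 3 + (4 * c + 3) * T + 4 = 0 ∧ T ≠ τ := by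
    intro T T' h1 h2
    have h3 : T' = -τ - T := by linear_combination h1
    subst h3
    constructor
    · apply mul_left_cancel₀ hτ0
      linear_combination T * hcub + (τ - T) * h2
    · rintro rfl
      apply ht1
      linear_combination (-1/2) * h2
  obtain ⟨k2, n2⟩ := cubT T2 T3 hsum hprod
  obtain ⟨k3, n3⟩ := cubT T3 T2 (by rw [← hsum]; ring) (by rw [← hprod]; ring)
  have ne2 : ∀ T : K, T ^ 3 + (4 * c + 3) * T + 4 = 0 → T ≠ -2 := by
    rintro T h rfl
    apply hc1
    linear_combination (-1/2) * h
  obtain ⟨y0, y1, y2, y3, hy⟩ := exists_cyc k2 (ne2 _ k2) hc2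
  obtain ⟨v0, v1, v2, v3, hv⟩ := exists_cyc k3 (ne2 _ k3) hc2
  obtain ⟨u0, u1, u2, u3, hu, hu4⟩ : ∃ u0 u1 u2 u3 : K, IsCyc c τ u0 u1 u2 u3 ∧ u0 + u2 = -z := by
    obtain ⟨u0, u1, u2, u3, hu⟩ := exists_cyc hcub (ne2 _ hcub) hc2
    have h1 := hu.mulneg
    have h2 := hu.sum
    have h3 : (u0 + u2 + z) * (u0 + u2 - z⁻¹) = 0 := by
      have hzz : z * z⁻¹ = 1 := mul_inv_cancel₀ hz
      linear_combination -h1 + (u0 + u2) * h2 + (u0 + u2) * hτ - hzz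
    rcases mul_eq_zero.1 h3 with h4 | h4
    · exact ⟨u0, u1, u2, u3, hu, by linear_combination h4⟩
    · exact ⟨u1, u2, u3, u0, hu.rot, by linear_combination h2 + hτ - h4⟩
  obtain ⟨x, hx⟩ : ∃ x : Fin 12 → K, x = ![y0, y1, y2, y3, u0, u1, u2, u3, v0, v1, v2, v3] := ⟨_, rfl⟩
  obtain ⟨Tb, hTb⟩ : ∃ Tb : Fin 12 → K, Tb = ![T2, T2, T2, T2, τ, τ, τ, τ, T3, T3, T3, T3] := ⟨_, rfl⟩
  have hI : ∀ i, IsCyc c (Tb i) (x i) (x (cyc4 i)) (x (cyc4 (cyc4 i))) (x (cyc4 (cyc4 (cyc4 i)))) := by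
    subst hx hTb
    intro i
    fin_cases i
    · exact hy
    · exact hy.rot
    · exact hy.rot.rot
    · exact hy.rot.rot.rot
    · exact hu
    · exact hu.rot
    · exact hu.rot.rot
    · exact hu.rot.rot.rot
    · exact hv
    · exact hv.rot
    · exact hv.rot.rot
    · exact hv.rot.rot.rot
  have hTb' : ∀ i, Tb i = ![T2, τ, T3] ⟨i.val / 4, by omega⟩ := by
    subst hTb
    intro i
    fin_cases i <;> rfl
  have hTinj : Function.Injective ![T2, τ, T3] := by
    intro i j hij
    fin_cases i <;> fin_cases j <;> simp at hij ⊢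
    · exact n2 hij
    · exact hne hij
    · exact n2 hij.symm
    · exact n3 hij.symm
    · exact hne hij.symm
    · exact n3 hij
  refine ⟨x, ?_, fun i => (hI i).h01, ?_, ?_, ?_, ?_⟩
  · intro i j hij
    have h1 : Tb i = Tb j := by rw [← (hI i).orbT_eq, ← (hI j).orbT_eq, hij]
    rw [hTb', hTb'] at h1
    have h2 := congrArg Fin.val (hTinj h1)
    rcases cyc_block i j h2 with h | h | h | h
    · exact h.symm
    · exact absurd (h ▸ hij) (hI i).ne1
    · exact absurd (h ▸ hij) (hI i).ne
    · exact absurd (h ▸ hij).symm (hI i).rot.rot.rot.ne1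
  · subst hx; exact hu4
  · subst hx
    show u1 + u3 = z⁻¹
    linear_combination hu.sum + hτ - hu4
  · subst hx
    show (y0 + y1 + y2 + y3) + (v0 + v1 + v2 + v3) = z - z⁻¹
    rw [hy.sum, hv.sum, hsum, hτ]; ring
  · subst hx
    show (y0 + y1 + y2 + y3) * (v0 + v1 + v2 + v3) * (z⁻¹ - z) = -4
    rw [hy.sum, hv.sum, ← hτ, hprod]

theorem cyc4_ne : ∀ i, cyc4 (cyc4 i) ≠ i := by decide

theorem cyc4_four : ∀ i, cyc4 (cyc4 (cyc4 (cyc4 i))) = i := by decide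

theorem Twelve.isCyc {c z : K} {x : Fin 12 → K} (h : Twelve c z x) (i : Fin 12) :
    IsCyc c (x i + x (cyc4 i) + x (cyc4 (cyc4 i)) + x (cyc4 (cyc4 (cyc4 i))))
      (x i) (x (cyc4 i)) (x (cyc4 (cyc4 i))) (x (cyc4 (cyc4 (cyc4 i)))) where
  h01 := h.cyc _
  h12 := h.cyc _
  h23 := h.cyc _
  h30 := by rw [← h.cyc, cyc4_four]
  sum := rfl
  ne := fun e => cyc4_ne i (h.inj e).symm

theorem Phi4_natDegree (c : K) : (Phi4 c).natDegree = 12 := by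
  unfold Phi4; compute_degree!

theorem Phi4_monic (c : K) : (Phi4 c).Monic := by
  unfold Phi4; monicity!

/-- The dynatomic polynomial is the product over the twelve points. -/
theorem Twelve.Phi4_eq [CharZero K] {c z : K} {x : Fin 12 → K} (h : Twelve c z x) :
    Phi4 c = ∏ i, (X - C (x i)) := by
  have hm : (∏ i, (X - C (x i))).Monic := monic_prod_of_monic _ _ (fun i _ => monic_X_sub_C _)
  refine Polynomial.eq_of_monic_of_dvd_of_natDegree_le hm (Phi4_monic c) ?_ ?_
  · refine Finset.prod_dvd_of_coprime ?_ ?_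
    · intro i _ j _ hij
      exact isCoprime_X_sub_C_of_isUnit_sub (sub_ne_zero.2 (fun e => hij (h.inj e))).isUnit
    · intro i _
      rw [dvd_iff_isRoot]
      exact (h.isCyc i).root
  · rw [Phi4_natDegree, natDegree_prod_of_monic _ _ (fun i _ => monic_X_sub_C _)]
    simp

end twelve

open Polynomial

/-! ### Descent of the labelling to the splitting field -/

theorem Phi4_map {K M : Type*} [Field K] [Field M] (φ : K →+* M) (c : K) :
    (Phi4 c).map φ = Phi4 (φ c) := by
  simp only [Phi4, Polynomial.map_add, Polynomial.map_mul, Polynomial.map_pow, map_X, map_C, map_add, map_mul,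
    map_pow, map_one, map_ofNat, Polynomial.map_one, Polynomial.map_ofNat]

theorem cube_ne_two {τ : ℚ} : τ ^ 3 ≠ 2 := by
  intro h
  have h1 : padicValRat 2 (τ ^ 3) = padicValRat 2 (2 : ℚ) := by rw [h]
  have h0 : τ ≠ 0 := by rintro rfl; norm_num at h
  have : Fact (Nat.Prime 2) := ⟨Nat.prime_two⟩
  rw [padicValRat.pow] at h1
  have h2 : padicValRat 2 (2 : ℚ) = 1 := by
    have := padicValRat.self (p := 2) (by norm_num)
    simpa using this
  rw [h2] at h1
  push_cast at h1
  omega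

theorem exists_twelve_split {L : Type} [Field L] [Algebra ℚ L] [Algebra.IsAlgebraic ℚ L]
    {c z τ : ℚ} (hsp : ((Phi4 c).map (algebraMap ℚ L)).Splits)
    (hz : z ≠ 0) (hτ : τ = z⁻¹ - z) (hτ0 : τ ≠ 0)
    (hcub : τ ^ 3 + (4 * c + 3) * τ + 4 = 0) (hc1 : 4 * c + 5 ≠ 0) (ht2 : τ ^ 3 ≠ -16) :
    ∃ x : Fin 12 → L, Twelve (algebraMap ℚ L c) (algebraMap ℚ L z) x := by
  let ψ : L →ₐ[ℚ] AlgebraicClosure ℚ := IsAlgClosed.lift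
  have hinj : Function.Injective (algebraMap ℚ (AlgebraicClosure ℚ)) := (algebraMap ℚ (AlgebraicClosure ℚ)).injective
  have hc2 : 16 * c ^ 2 - 8 * c + 5 ≠ 0 := by nlinarith [sq_nonneg (4 * c - 1)]
  obtain ⟨X, hX⟩ := exists_twelve (K := AlgebraicClosure ℚ) (c := algebraMap ℚ _ c) (z := algebraMap ℚ _ z)
    (τ := algebraMap ℚ _ τ) ((_root_.map_ne_zero _).2 hz) (by rw [hτ]; simp) ((_root_.map_ne_zero _).2 hτ0)
    (by
      have := congrArg (algebraMap ℚ (AlgebraicClosure ℚ)) hcub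
      simpa using this)
    (by
      intro h
      apply hc1
      apply hinj
      simpa using h)
    (by
      intro h
      apply hc2
      apply hinj
      simpa using h)
    (by
      intro h
      apply cube_ne_two (τ := τ)
      apply hinj
      simpa using h)
    (by
      intro h
      apply ht2
      apply hinj
      simpa using h)
  have hroots := hsp.roots_map (ψ : L →+* AlgebraicClosure ℚ)
  have hmap : ((Phi4 c).map (algebraMap ℚ L)).map (ψ : L →+* AlgebraicClosure ℚ)
      = Phi4 (algebraMap ℚ (AlgebraicClosure ℚ) c) := by
    rw [Polynomial.map_map, Phi4_map]
    simp
  rw [hmap] at hroots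
  have hex : ∀ i, ∃ y : L, ψ y = X i := by
    intro i
    have h1 : X i ∈ (Phi4 (algebraMap ℚ (AlgebraicClosure ℚ) c)).roots := by
      rw [mem_roots (Phi4_monic _).ne_zero]
      exact (hX.isCyc i).root
    rw [hroots, Multiset.mem_map] at h1
    obtain ⟨y, -, hy⟩ := h1
    exact ⟨y, hy⟩
  choose y hy using hex
  have hψ : Function.Injective ψ := ψ.toRingHom.injective
  refine ⟨y, ⟨?_, ?_, ?_, ?_, ?_, ?_⟩⟩
  · intro i j hij
    apply hX.inj
    rw [← hy, ← hy, hij]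
  · intro i
    apply hψ
    simp only [map_add, map_pow, hy, AlgHom.commutes]
    exact hX.cyc i
  · apply hψ
    simp only [map_add, map_neg, hy, AlgHom.commutes]
    exact hX.c4
  · apply hψ
    simp only [map_add, map_inv₀, hy, AlgHom.commutes]
    exact hX.c5
  · apply hψ
    simp only [map_add, map_sub, map_inv₀, hy, AlgHom.commutes]
    exact hX.sT
  · apply hψ
    simp only [map_add, map_sub, map_mul, map_neg, map_ofNat, map_inv₀, hy, AlgHom.commutes]
    exact hX.pT

open Polynomial

/-! ### The Galois group -/

theorem units_of_ne_one {u : ℤˣ} (h : u ≠ 1) : u = -1 := (Int.units_eq_one_or u).resolve_left h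

theorem surj3 {G : Type*} [Group G] (χ₁ χ₂ χ₃ : G →* ℤˣ) (h1 : ∃ g, χ₁ g = -1) (h2 : ∃ g, χ₂ g = -1)
    (h3 : ∃ g, χ₃ g = -1) (h12 : ∃ g, χ₁ g * χ₂ g = -1) (h13 : ∃ g, χ₁ g * χ₃ g = -1)
    (h23 : ∃ g, χ₂ g * χ₃ g = -1) (h123 : ∃ g, χ₁ g * χ₂ g * χ₃ g = -1) :
    (∃ g, χ₁ g = -1) ∧ (∃ g, χ₁ g = 1 ∧ χ₂ g = -1) ∧ (∃ g, χ₁ g = 1 ∧ χ₂ g = 1 ∧ χ₃ g = -1) := by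
  have s2 : ∃ g, χ₁ g = 1 ∧ χ₂ g = -1 := by
    obtain ⟨a, ha⟩ := h2
    obtain ⟨b, hb⟩ := h12
    rcases Int.units_eq_one_or (χ₁ a) with e | e
    · exact ⟨a, e, ha⟩
    · rcases Int.units_eq_one_or (χ₁ b) with f | f
      · exact ⟨b, f, by simpa [f] using hb⟩
      · refine ⟨a * b, by rw [map_mul, e, f]; decide, ?_⟩
        rw [f] at hb
        rw [map_mul, ha, hb]
  refine ⟨h1, s2, ?_⟩
  obtain ⟨g, g1, g2⟩ := s2
  obtain ⟨h, k1, k2⟩ : ∃ h, χ₁ h = -1 ∧ χ₂ h = 1 := by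
    obtain ⟨a, ha⟩ := h1
    rcases Int.units_eq_one_or (χ₂ a) with e | e
    · exact ⟨a, ha, e⟩
    · exact ⟨a * g, by rw [map_mul, ha, g1]; decide, by rw [map_mul, e, g2]; decide⟩
  -- choose a functional killing `g` and `h`
  have fin : ∀ φ : G →* ℤˣ, φ g = 1 → φ h = 1 → (∃ t, φ t = -1) →
      (∀ t, χ₁ t = 1 → χ₂ t = 1 → φ t = χ₃ t) → ∃ g, χ₁ g = 1 ∧ χ₂ g = 1 ∧ χ₃ g = -1 := by
    rintro φ e1 e2 ⟨t, ht⟩ e3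
    obtain ⟨t1, q1, q2⟩ : ∃ t1, φ t1 = -1 ∧ χ₂ t1 = 1 := by
      rcases Int.units_eq_one_or (χ₂ t) with e | e
      · exact ⟨t, ht, e⟩
      · exact ⟨t * g, by rw [map_mul, ht, e1]; decide, by rw [map_mul, e, g2]; decide⟩
    obtain ⟨t2, q3, q4, q5⟩ : ∃ t2, φ t2 = -1 ∧ χ₂ t2 = 1 ∧ χ₁ t2 = 1 := by
      rcases Int.units_eq_one_or (χ₁ t1) with e | e
      · exact ⟨t1, q1, q2, e⟩
      · exact ⟨t1 * h, by rw [map_mul, q1, e2]; decide, by rw [map_mul, q2, k2]; decide,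
          by rw [map_mul, e, k1]; decide⟩
    exact ⟨t2, q5, q4, by rw [← e3 t2 q5 q4, q3]⟩
  rcases Int.units_eq_one_or (χ₃ g) with x | x <;> rcases Int.units_eq_one_or (χ₃ h) with y | y
  · exact fin χ₃ x y h3 (fun _ _ _ => rfl)
  · refine fin (χ₁ * χ₃) ?_ ?_ h13 ?_
    · simp [g1, x]
    · simp [k1, y]
    · intro t e1 e2; simp [e1]
  · refine fin (χ₂ * χ₃) ?_ ?_ h23 ?_
    · simp [g2, x]
    · simp [k2, y]
    · intro t e1 e2; simp [e2]
  · refine fin (χ₁ * χ₂ * χ₃) ?_ ?_ h123 ?_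
    · simp [g1, g2, x]
    · simp [k1, k2, y]
    · intro t e1 e2; simp [e1, e2]

section gal

variable {L : Type} [Field L] [Algebra ℚ L] [CharZero L]

theorem sign_hom {s : L} {e : ℚ} (hs : s ^ 2 = algebraMap ℚ L e) (hs0 : s ≠ 0) :
    ∃ χ : (L ≃ₐ[ℚ] L) →* ℤˣ, ∀ σ, σ s = (((χ σ : ℤˣ) : ℤ) : L) * s := by
  classical
  have hne : -s ≠ s := by
    intro h
    apply hs0
    linear_combination (-1/2) * h
  have hpm : ∀ σ : L ≃ₐ[ℚ] L, σ s = s ∨ σ s = -s := by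
    intro σ
    have : (σ s) ^ 2 = s ^ 2 := by rw [← map_pow, hs, AlgEquiv.commutes]
    exact sq_eq_sq_iff_eq_or_eq_neg.1 this
  refine ⟨⟨⟨fun σ => if σ s = s then 1 else -1, ?_⟩, ?_⟩, ?_⟩
  · simp
  · intro σ θ
    rcases hpm σ with h1 | h1 <;> rcases hpm θ with h2 | h2 <;>
      simp [AlgEquiv.mul_apply, h1, h2, hne]
  · intro σ
    rcases hpm σ with h1 | h1 <;> simp [h1, hne]

theorem exists_moving [IsGalois ℚ L] [FiniteDimensional ℚ L] {s : L} {e : ℚ} (hs : s ^ 2 = algebraMap ℚ L e)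
    (he : ¬ IsSquare e) : ∃ σ : L ≃ₐ[ℚ] L, σ s ≠ s := by
  by_contra hcon
  push Not at hcon
  obtain ⟨y, hy⟩ := (IsGalois.mem_range_algebraMap_iff_fixed s).2 hcon
  apply he
  refine ⟨y, (algebraMap ℚ L).injective ?_⟩
  rw [← hs, ← hy, map_mul, pow_two]

theorem perm_hom {G X ι : Type*} [Group G] [MulAction G X] (x : ι → X) (hx : Function.Injective x)
    (h : ∀ (g : G) i, ∃ j, g • x i = x j) : ∃ ρ : G →* Equiv.Perm ι, ∀ g i, g • x i = x (ρ g i) := by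
  choose r hr using h
  let f : G →* Function.End ι :=
    { toFun := r
      map_one' := by
        funext i
        apply hx
        rw [← hr, one_smul]; rfl
      map_mul' := by
        intro a b
        funext i
        apply hx
        rw [← hr, mul_smul, hr b, hr a]; rfl }
  exact ⟨f.toHomPerm, fun g i => hr g i⟩

variable {c z : ℚ} {x : Fin 12 → L}

/-- Trace along a labelled cycle. -/
def trI (x : Fin 12 → L) (i : Fin 12) : L := x i + x (cyc4 i) + x (cyc4 (cyc4 i)) + x (cyc4 (cyc4 (cyc4 i)))

/-- Alternating trace along a labelled cycle. -/
def altI (x : Fin 12 → L) (i : Fin 12) : L := x i - x (cyc4 i) + x (cyc4 (cyc4 i)) - x (cyc4 (cyc4 (cyc4 i)))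

theorem trI_low (i : Fin 12) (h : i.val < 4) : trI x i = trI x 0 := by
  have : i = 0 ∨ i = 1 ∨ i = 2 ∨ i = 3 := by omega
  rcases this with rfl | rfl | rfl | rfl <;> simp [trI, cyc4] <;> ring

theorem trI_high (i : Fin 12) (h : 8 ≤ i.val) : trI x i = trI x 8 := by
  have : i = 8 ∨ i = 9 ∨ i = 10 ∨ i = 11 := by omega
  rcases this with rfl | rfl | rfl | rfl <;> simp [trI, cyc4] <;> ring

theorem altI_low (i : Fin 12) (h : i.val < 4) : altI x i = (-1) ^ i.val * altI x 0 := by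
  have : i = 0 ∨ i = 1 ∨ i = 2 ∨ i = 3 := by omega
  rcases this with rfl | rfl | rfl | rfl <;> simp [altI, cyc4] <;> ring

theorem altI_high (i : Fin 12) (h : 8 ≤ i.val) : altI x i = (-1) ^ i.val * altI x 8 := by
  have : i = 8 ∨ i = 9 ∨ i = 10 ∨ i = 11 := by omega
  rcases this with rfl | rfl | rfl | rfl <;> simp [altI, cyc4] <;> ring

theorem galois_main [IsGalois ℚ L] [FiniteDimensional ℚ L]
    (h : Twelve (algebraMap ℚ L c) (algebraMap ℚ L z) x) (hgen : Algebra.adjoin ℚ (Set.range x) = ⊤) (hz : z ≠ 0)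
    (hτ0 : z⁻¹ - z ≠ 0) {e₁ e₂ e₃ : ℚ} (E1 : e₁ = -z ^ 2 - 4 * c + 2 * z⁻¹)
    (E2 : e₂ = (z⁻¹ - z) ^ 2 + 16 * (z⁻¹ - z)⁻¹)
    (E3 : e₃ = 16 * (z⁻¹ - z)⁻¹ ^ 2 + 4 * (z⁻¹ - z) ^ 2 + 32 * (z⁻¹ - z)⁻¹ + 16)
    (n1 : ¬ IsSquare e₁) (n2 : ¬ IsSquare e₂) (n3 : ¬ IsSquare e₃) (n12 : ¬ IsSquare (e₁ * e₂))
    (n13 : ¬ IsSquare (e₁ * e₃)) (n23 : ¬ IsSquare (e₂ * e₃)) (n123 : ¬ IsSquare (e₁ * e₂ * e₃)) :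
    ∃ ρ : (L ≃ₐ[ℚ] L) →* Equiv.Perm (Fin 12), Function.Injective ρ ∧ (∀ σ i, σ (x i) = x (ρ σ i)) ∧
      ρ.range = Igroup := by
  have hroot : ∀ (σ : L ≃ₐ[ℚ] L) i, ∃ j, σ • x i = x j := by
    intro σ i
    have h1 : (Phi4 (algebraMap ℚ L c)).eval (σ (x i)) = 0 := by
      have h2 : (Phi4 (algebraMap ℚ L c)).eval (x i) = 0 := (h.isCyc i).root
      rw [← Phi4_map, eval_map_algebraMap] at h2 ⊢
      have h3 := congrArg σ h2
      rw [map_zero] at h3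
      rw [← h3]
      exact (Polynomial.aeval_algHom_apply (σ : L →ₐ[ℚ] L) (x i) (Phi4 c))
    rw [h.Phi4_eq, eval_prod, Finset.prod_eq_zero_iff] at h1
    obtain ⟨j, -, hj⟩ := h1
    exact ⟨j, by simpa [sub_eq_zero] using hj⟩
  obtain ⟨ρ, hρ'⟩ := perm_hom x h.inj hroot
  have hρ : ∀ (σ : L ≃ₐ[ℚ] L) i, σ (x i) = x (ρ σ i) := hρ'
  refine ⟨ρ, ?_, hρ, ?_⟩
  · rw [injective_iff_map_eq_one]
    intro σ hσ
    have : (σ : L →ₐ[ℚ] L) = AlgHom.id ℚ L := by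
      refine AlgHom.ext_of_adjoin_eq_top hgen ?_
      rintro _ ⟨i, rfl⟩
      have := hρ σ i
      rw [hσ] at this
      exact this
    ext y
    exact DFunLike.congr_fun this y
  have hcyc : ∀ σ i, ρ σ (cyc4 i) = cyc4 (ρ σ i) := by
    intro σ i
    apply h.inj
    rw [← hρ, h.cyc, h.cyc, map_add, map_pow, hρ, AlgEquiv.commutes]
  have hzL : algebraMap ℚ L z ≠ 0 := (_root_.map_ne_zero _).2 hz
  have hpair : ∀ i, x i + x (cyc4 (cyc4 i)) = -algebraMap ℚ L z →
      x i * x (cyc4 (cyc4 i)) = ((algebraMap ℚ L z) ^ 2 - (algebraMap ℚ L z)⁻¹ + 2 * algebraMap ℚ L c) / 2 := by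
    intro i hi
    have m := (h.isCyc i).mulneg
    have c1 := h.cyc i
    have c2 := h.cyc (cyc4 (cyc4 i))
    rw [hi] at m
    have ha : x (cyc4 i) + x (cyc4 (cyc4 (cyc4 i))) = (algebraMap ℚ L z)⁻¹ := by
      apply mul_left_cancel₀ hzL
      rw [mul_inv_cancel₀ hzL]
      linear_combination -m
    linear_combination (1/2) * (x i + x (cyc4 (cyc4 i)) - algebraMap ℚ L z) * hi + (1/2) * (c1 + c2 - ha)
  have h46 : cyc4 (cyc4 4) = 6 := by decide
  have h64 : cyc4 (cyc4 6) = 4 := by decide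
  have hp4 := hpair 4 (by rw [h46]; exact h.c4)
  rw [h46] at hp4
  have hR4 : ∀ σ, ρ σ 4 = 4 ∨ ρ σ 4 = 6 := by
    intro σ
    have e1 : x (ρ σ 4) + x (cyc4 (cyc4 (ρ σ 4))) = -algebraMap ℚ L z := by
      rw [← hcyc, ← hcyc, ← hρ, ← hρ, ← map_add, h46, h.c4, map_neg, AlgEquiv.commutes]
    have e2 := hpair _ e1
    have e3 : (x (ρ σ 4) - x 4) * (x (ρ σ 4) - x 6) = 0 := by
      linear_combination hp4 - e2 + x (ρ σ 4) * e1 - x (ρ σ 4) * h.c4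
    rcases mul_eq_zero.1 e3 with e | e
    · exact Or.inl (h.inj (sub_eq_zero.1 e))
    · exact Or.inr (h.inj (sub_eq_zero.1 e))
  have hR6 : ∀ σ, ρ σ 6 = cyc4 (cyc4 (ρ σ 4)) := by
    intro σ; rw [← hcyc, ← hcyc, h46]
  -- the three square roots
  obtain ⟨s1, hs1⟩ : ∃ s, s = x 4 - x 6 := ⟨_, rfl⟩
  obtain ⟨s2, hs2⟩ : ∃ s, s = trI x 0 - trI x 8 := ⟨_, rfl⟩
  obtain ⟨s3, hs3⟩ : ∃ s, s = altI x 0 * altI x 8 := ⟨_, rfl⟩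
  have hsT : trI x 0 + trI x 8 = algebraMap ℚ L z - (algebraMap ℚ L z)⁻¹ := h.sT
  have hpT : trI x 0 * trI x 8 * ((algebraMap ℚ L z)⁻¹ - algebraMap ℚ L z) = -4 := h.pT
  have hτL : (algebraMap ℚ L z)⁻¹ - algebraMap ℚ L z ≠ 0 := by
    rw [← map_inv₀, ← map_sub]; exact (_root_.map_ne_zero _).2 hτ0
  have hpT' : trI x 0 * trI x 8 = -4 * ((algebraMap ℚ L z)⁻¹ - algebraMap ℚ L z)⁻¹ := by
    rw [← hpT, mul_inv_cancel_right₀ hτL]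
  have q1 : s1 ^ 2 = algebraMap ℚ L e₁ := by
    rw [hs1, E1]
    simp only [map_add, map_sub, map_mul, map_neg, map_pow, map_inv₀, map_ofNat]
    linear_combination (x 4 + x 6 - algebraMap ℚ L z) * h.c4 - 4 * hp4
  have alt2 : ∀ i, altI x i ^ 2 = trI x i ^ 2 + 4 := by
    intro i
    have m := (h.isCyc i).mulneg
    unfold altI trI
    linear_combination -4 * m
  have q2 : s2 ^ 2 = algebraMap ℚ L e₂ := by
    rw [hs2, E2]
    simp only [map_add, map_sub, map_mul, map_pow, map_inv₀, map_ofNat]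
    linear_combination (trI x 0 + trI x 8 + algebraMap ℚ L z - (algebraMap ℚ L z)⁻¹) * hsT - 4 * hpT'
  have q3 : s3 ^ 2 = algebraMap ℚ L e₃ := by
    rw [hs3, E3, mul_pow, alt2, alt2]
    simp only [map_add, map_sub, map_mul, map_pow, map_inv₀, map_ofNat]
    linear_combination 4 * (trI x 0 + trI x 8 + algebraMap ℚ L z - (algebraMap ℚ L z)⁻¹) * hsT
      + (trI x 0 * trI x 8 - 4 * ((algebraMap ℚ L z)⁻¹ - algebraMap ℚ L z)⁻¹ - 8) * hpT'
  have nz : ∀ {s : L} {e : ℚ}, s ^ 2 = algebraMap ℚ L e → ¬ IsSquare e → s ≠ 0 := by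
    rintro s e hs hn rfl
    apply hn
    have : e = 0 := by
      apply (algebraMap ℚ L).injective
      rw [← hs]; simp
    rw [this]; exact ⟨0, by simp⟩
  have z1 := nz q1 n1
  have z2 := nz q2 n2
  have z3 := nz q3 n3
  obtain ⟨χ₁, x1⟩ := sign_hom q1 z1
  obtain ⟨χ₂, x2⟩ := sign_hom q2 z2
  obtain ⟨χ₃, x3⟩ := sign_hom q3 z3
  have key := surj3 χ₁ χ₂ χ₃
    (by
      obtain ⟨σ, hσ⟩ := exists_moving q1 n1
      refine ⟨σ, units_of_ne_one (fun e => hσ ?_)⟩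
      rw [x1, e]; simp)
    (by
      obtain ⟨σ, hσ⟩ := exists_moving q2 n2
      refine ⟨σ, units_of_ne_one (fun e => hσ ?_)⟩
      rw [x2, e]; simp)
    (by
      obtain ⟨σ, hσ⟩ := exists_moving q3 n3
      refine ⟨σ, units_of_ne_one (fun e => hσ ?_)⟩
      rw [x3, e]; simp)
    (by
      obtain ⟨σ, hσ⟩ := exists_moving (s := s1 * s2) (by rw [mul_pow, q1, q2, map_mul]) n12
      refine ⟨σ, units_of_ne_one (fun e => hσ ?_)⟩
      have e' : (((χ₁ σ : ℤˣ) : ℤ) : L) * (((χ₂ σ : ℤˣ) : ℤ) : L) = 1 := by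
        rw [← Int.cast_mul, ← Units.val_mul, e]; simp
      rw [map_mul, x1, x2]
      linear_combination s1 * s2 * e')
    (by
      obtain ⟨σ, hσ⟩ := exists_moving (s := s1 * s3) (by rw [mul_pow, q1, q3, map_mul]) n13
      refine ⟨σ, units_of_ne_one (fun e => hσ ?_)⟩
      have e' : (((χ₁ σ : ℤˣ) : ℤ) : L) * (((χ₃ σ : ℤˣ) : ℤ) : L) = 1 := by
        rw [← Int.cast_mul, ← Units.val_mul, e]; simp
      rw [map_mul, x1, x3]
      linear_combination s1 * s3 * e')
    (by
      obtain ⟨σ, hσ⟩ := exists_moving (s := s2 * s3) (by rw [mul_pow, q2, q3, map_mul]) n23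
      refine ⟨σ, units_of_ne_one (fun e => hσ ?_)⟩
      have e' : (((χ₂ σ : ℤˣ) : ℤ) : L) * (((χ₃ σ : ℤˣ) : ℤ) : L) = 1 := by
        rw [← Int.cast_mul, ← Units.val_mul, e]; simp
      rw [map_mul, x2, x3]
      linear_combination s2 * s3 * e')
    (by
      obtain ⟨σ, hσ⟩ := exists_moving (s := s1 * s2 * s3) (by rw [mul_pow, mul_pow, q1, q2, q3, map_mul, map_mul]) n123
      refine ⟨σ, units_of_ne_one (fun e => hσ ?_)⟩
      have e' : (((χ₁ σ : ℤˣ) : ℤ) : L) * (((χ₂ σ : ℤˣ) : ℤ) : L) * (((χ₃ σ : ℤˣ) : ℤ) : L) = 1 := by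
        rw [← Int.cast_mul, ← Int.cast_mul, ← Units.val_mul, ← Units.val_mul, e]; simp
      rw [map_mul, map_mul, x1, x2, x3]
      linear_combination s1 * s2 * s3 * e')
  obtain ⟨⟨σ₁, a1⟩, ⟨σ₂, b1, b2⟩, ⟨σ₃, c1, c2, c3⟩⟩ := key
  have act1 : ∀ σ, χ₁ σ = 1 → ρ σ 4 = 4 := by
    intro σ hσ
    refine (hR4 σ).resolve_right (fun e => z1 ?_)
    have := x1 σ
    rw [hσ, hs1, map_sub, hρ, hρ, hR6, e, h64] at this
    rw [hs1]
    simp only [Units.val_one, Int.cast_one] at this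
    linear_combination (-1/2) * this
  have act1' : ∀ σ, χ₁ σ = -1 → ρ σ 4 = 6 := by
    intro σ hσ
    refine (hR4 σ).resolve_left (fun e => z1 ?_)
    have := x1 σ
    rw [hσ, hs1, map_sub, hρ, hρ, hR6, e, h46] at this
    rw [hs1]
    simp only [Units.val_neg, Units.val_one, Int.cast_neg, Int.cast_one] at this
    linear_combination (1/2) * this
  have htr : ∀ σ i, σ (trI x i) = trI x (ρ σ i) := by
    intro σ i
    simp only [trI, map_add, hρ, hcyc]
  have halt : ∀ σ i, σ (altI x i) = altI x (ρ σ i) := by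
    intro σ i
    simp only [altI, map_add, map_sub, hρ, hcyc]
  have hfix : ∀ σ : L ≃ₐ[ℚ] L, σ (trI x 0) + σ (trI x 8) = trI x 0 + trI x 8 := by
    intro σ
    rw [← map_add, hsT, ← map_inv₀, ← map_sub, AlgEquiv.commutes]
  have hcent : ∀ σ, ρ σ ∈ cycCent := fun σ => hcyc σ
  have b4 : ∀ σ, (ρ σ 4).val / 4 = 1 := by
    intro σ
    rcases hR4 σ with e | e <;> rw [e] <;> rfl
  have bl : ∀ σ i, i.val / 4 ≠ 1 → (ρ σ i).val / 4 ≠ 1 := by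
    intro σ i hi e
    rw [← b4 σ] at e
    exact hi (cent_block (hcent σ) e)
  have low_or : ∀ σ, (ρ σ 0).val < 4 ∨ 8 ≤ (ρ σ 0).val := by
    intro σ
    have := bl σ 0 (by decide)
    omega
  have act2 : ∀ σ, χ₂ σ = 1 → (ρ σ 0).val < 4 := by
    intro σ hσ
    refine (low_or σ).resolve_right (fun e => z2 ?_)
    have h1 := x2 σ
    have h2 := htr σ 0
    have h3 := hfix σ
    rw [trI_high _ e] at h2
    rw [hσ, hs2, map_sub] at h1
    rw [hs2]
    simp only [Units.val_one, Int.cast_one] at h1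
    linear_combination (-1/2) * h1 + h2 - (1/2) * h3
  have act2' : ∀ σ, χ₂ σ = -1 → 8 ≤ (ρ σ 0).val := by
    intro σ hσ
    refine (low_or σ).resolve_left (fun e => z2 ?_)
    have h1 := x2 σ
    have h2 := htr σ 0
    have h3 := hfix σ
    rw [trI_low _ e] at h2
    rw [hσ, hs2, map_sub] at h1
    rw [hs2]
    simp only [Units.val_neg, Units.val_one, Int.cast_neg, Int.cast_one] at h1
    linear_combination (1/2) * h1 - h2 + (1/2) * h3
  refine eq_Igroup ?_ ?_ ?_ ?_ ?_
  · rintro _ ⟨σ, rfl⟩ i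
    exact hcyc σ i
  · rintro _ ⟨σ, rfl⟩
    exact hR4 σ
  · exact ⟨_, ⟨σ₁, rfl⟩, act1' _ a1⟩
  · exact ⟨_, ⟨σ₂, rfl⟩, act1 _ b1, act2' _ b2⟩
  · refine ⟨_, ⟨σ₃, rfl⟩, act1 _ c1, act2 _ c2, ?_⟩
    by_contra hpar
    apply z3
    have l0 := act2 _ c2
    have l8 : 8 ≤ (ρ σ₃ 8).val := by
      have u1 := bl σ₃ 8 (by decide)
      by_contra hlt
      have u2 : (ρ σ₃ 8).val / 4 = (ρ σ₃ 0).val / 4 := by omega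
      have u3 := cent_block (hcent σ₃) u2
      revert u3; decide
    have h1 := x3 σ₃
    have heven : Even ((ρ σ₃ 0).val + (ρ σ₃ 8).val) := by
      rw [Nat.even_iff]; omega
    rw [c3, hs3, map_mul, halt, halt, altI_low _ l0, altI_high _ l8,
      show ∀ a b c d : L, a * b * (c * d) = a * c * (b * d) by intros; ring, ← pow_add, heven.neg_one_pow] at h1
    rw [hs3]
    simp only [Units.val_neg, Units.val_one, Int.cast_neg, Int.cast_one] at h1
    linear_combination (1/2) * h1

end gal

open Polynomial

/-! ### Orbits and the final statement -/

theorem Igroup_pres {J : Finset (Fin 12)} (ha : ∀ j, j ∈ J ↔ gα j ∈ J) (hb : ∀ j, j ∈ J ↔ gβ j ∈ J)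
    (hs : ∀ j, j ∈ J ↔ gs j ∈ J) (hw : ∀ j, j ∈ J ↔ gw j ∈ J) {π : Equiv.Perm (Fin 12)} (h : π ∈ Igroup) :
    ∀ j, j ∈ J ↔ π j ∈ J := by
  let S : Subgroup (Equiv.Perm (Fin 12)) :=
    { carrier := {π | ∀ j, j ∈ J ↔ π j ∈ J}
      mul_mem' := by
        intro a b ha hb i
        rw [Equiv.Perm.mul_apply, ← ha, ← hb]
      one_mem' := fun i => Iff.rfl
      inv_mem' := by
        intro a ha i
        rw [ha (a⁻¹ i)]
        simp }
  have hα : gα ∈ S := ha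
  have hβ : gβ ∈ S := hb
  have hσ : gs ∈ S := hs
  have hω : gw ∈ S := hw
  have hle : Igroup ≤ S := by
    unfold Igroup
    rw [Subgroup.closure_le, gen1, gen2, gen3, gen4]
    intro g hg
    rcases hg with rfl | rfl | rfl | rfl
    · exact inv_mem hα
    · exact hβ
    · exact mul_mem (mul_mem (pow_mem hα 2) hβ) hσ
    · exact mul_mem (mul_mem (mul_mem (pow_mem hα 3) hβ) hσ) hω
  exact hle h

theorem word_mem (a b k l : ℕ) : gα ^ a * gβ ^ b * gs ^ k * gw ^ l ∈ Igroup :=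
  mul_mem (mul_mem (mul_mem (pow_mem gα_mem a) (pow_mem gβ_mem b)) (pow_mem gs_mem k)) (pow_mem gw_mem l)

theorem reach0 : ∀ j ∈ ({0, 1, 2, 3, 8, 9, 10, 11} : Finset (Fin 12)), ∃ (a b : Fin 4) (k l : Fin 2),
    (gα ^ (a : ℕ) * gβ ^ (b : ℕ) * gs ^ (k : ℕ) * gw ^ (l : ℕ)) 0 = j := by decide

theorem reach4 : ∀ j ∈ ({4, 6} : Finset (Fin 12)), ∃ (a b : Fin 4) (k l : Fin 2),
    (gα ^ (a : ℕ) * gβ ^ (b : ℕ) * gs ^ (k : ℕ) * gw ^ (l : ℕ)) 4 = j := by decide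

theorem reach5 : ∀ j ∈ ({5, 7} : Finset (Fin 12)), ∃ (a b : Fin 4) (k l : Fin 2),
    (gα ^ (a : ℕ) * gβ ^ (b : ℕ) * gs ^ (k : ℕ) * gw ^ (l : ℕ)) 5 = j := by decide

theorem minpoly_orbit {L : Type} [Field L] [Algebra ℚ L] [IsGalois ℚ L] {x : Fin 12 → L}
    (hx : Function.Injective x) (i₀ : Fin 12) (J : Finset (Fin 12))
    (h1 : ∀ σ : L ≃ₐ[ℚ] L, ∃ j ∈ J, σ (x i₀) = x j)
    (h2 : ∀ j ∈ J, ∃ σ : L ≃ₐ[ℚ] L, σ (x i₀) = x j) :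
    (minpoly ℚ (x i₀)).map (algebraMap ℚ L) = ∏ j ∈ J, (X - C (x j)) := by
  classical
  have hintg : IsIntegral ℚ (x i₀) := IsGalois.integral ℚ (x i₀)
  have hmon := minpoly.monic hintg
  have hsp : ((minpoly ℚ (x i₀)).map (algebraMap ℚ L)).Splits := IsGalois.splits ℚ (x i₀)
  have hsep : (minpoly ℚ (x i₀)).Separable := IsGalois.separable ℚ (x i₀)
  have hnd : ((minpoly ℚ (x i₀)).map (algebraMap ℚ L)).roots.Nodup := nodup_roots hsep.map
  have hroots : ((minpoly ℚ (x i₀)).map (algebraMap ℚ L)).roots = (J.image x).val := by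
    rw [Multiset.Nodup.ext hnd (J.image x).nodup]
    intro y
    have hne : (minpoly ℚ (x i₀)).map (algebraMap ℚ L) ≠ 0 := (hmon.map _).ne_zero
    rw [mem_roots hne, Finset.mem_val, Finset.mem_image]
    constructor
    · intro hy
      have hy' : aeval y (minpoly ℚ (x i₀)) = 0 := by
        rw [← eval_map_algebraMap]; exact hy
      obtain ⟨σ, hσ⟩ := minpoly.exists_algEquiv_of_root' hintg.isAlgebraic hy'
      obtain ⟨j, hj, e⟩ := h1 σ
      exact ⟨j, hj, by rw [← e, hσ]⟩
    · rintro ⟨j, hj, rfl⟩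
      obtain ⟨σ, hσ⟩ := h2 j hj
      rw [IsRoot.def, eval_map_algebraMap, ← hσ]
      have := aeval_algHom_apply (σ : L →ₐ[ℚ] L) (x i₀) (minpoly ℚ (x i₀))
      rw [minpoly.aeval, map_zero] at this
      exact this
  rw [Splits.eq_prod_roots_of_monic hsp (hmon.map _), hroots]
  rw [← Finset.prod_image (s := J) (g := x) (f := fun y => X - C y) (fun a _ b _ h => hx h)]
  rfl

theorem final_of_field {L : Type} [Field L] [Algebra ℚ L] [CharZero L] [IsGalois ℚ L] [FiniteDimensional ℚ L]
    {c : ℚ} {z' : L} {x : Fin 12 → L} (h : Twelve (algebraMap ℚ L c) z' x)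
    (ρ : (L ≃ₐ[ℚ] L) →* Equiv.Perm (Fin 12)) (hρ : ∀ σ i, σ (x i) = x (ρ σ i)) (hr : ρ.range = Igroup) :
    ∃ A B₁ B₂ : ℚ[X], Irreducible A ∧ Irreducible B₁ ∧ Irreducible B₂ ∧
      A.natDegree = 8 ∧ B₁.natDegree = 2 ∧ B₂.natDegree = 2 ∧ Phi4 c = A * B₁ * B₂ := by
  have hmem : ∀ σ, ρ σ ∈ Igroup := fun σ => by rw [← hr]; exact ⟨σ, rfl⟩
  have hex : ∀ π ∈ Igroup, ∃ σ, ρ σ = π := fun π hπ => by rw [← hr] at hπ; exact hπ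
  have key : ∀ (i₀ : Fin 12) (J : Finset (Fin 12)), i₀ ∈ J → (∀ j, j ∈ J ↔ gα j ∈ J) → (∀ j, j ∈ J ↔ gβ j ∈ J) →
      (∀ j, j ∈ J ↔ gs j ∈ J) → (∀ j, j ∈ J ↔ gw j ∈ J) → (∀ j ∈ J, ∃ (a b : Fin 4) (k l : Fin 2),
      (gα ^ (a : ℕ) * gβ ^ (b : ℕ) * gs ^ (k : ℕ) * gw ^ (l : ℕ)) i₀ = j) →
      (minpoly ℚ (x i₀)).map (algebraMap ℚ L) = ∏ j ∈ J, (X - C (x j)) := by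
    intro i₀ J h0 ha hb hs hw hreach
    refine minpoly_orbit h.inj i₀ J ?_ ?_
    · intro σ
      exact ⟨_, (Igroup_pres ha hb hs hw (hmem σ) i₀).1 h0, hρ σ i₀⟩
    · intro j hj
      obtain ⟨a, b, k, l, e⟩ := hreach j hj
      obtain ⟨σ, hσ⟩ := hex _ (word_mem a b k l)
      exact ⟨σ, by rw [hρ, hσ, e]⟩
  have k0 := key 0 {0, 1, 2, 3, 8, 9, 10, 11} (by decide) (by decide) (by decide) (by decide) (by decide) reach0
  have k4 := key 4 {4, 6} (by decide) (by decide) (by decide) (by decide) (by decide) reach4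
  have k5 := key 5 {5, 7} (by decide) (by decide) (by decide) (by decide) (by decide) reach5
  have hintg : ∀ i, IsIntegral ℚ (x i) := fun i => IsGalois.integral ℚ (x i)
  have deg : ∀ (i₀ : Fin 12) (J : Finset (Fin 12)),
      (minpoly ℚ (x i₀)).map (algebraMap ℚ L) = ∏ j ∈ J, (X - C (x j)) → (minpoly ℚ (x i₀)).natDegree = J.card := by
    intro i₀ J e
    have := congrArg natDegree e
    rw [natDegree_map, natDegree_finsetProd_X_sub_C_eq_card] at this
    exact this
  refine ⟨minpoly ℚ (x 0), minpoly ℚ (x 4), minpoly ℚ (x 5), minpoly.irreducible (hintg _),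
    minpoly.irreducible (hintg _), minpoly.irreducible (hintg _), (deg _ _ k0).trans rfl, (deg _ _ k4).trans rfl,
    (deg _ _ k5).trans rfl, ?_⟩
  apply Polynomial.map_injective (algebraMap ℚ L) (algebraMap ℚ L).injective
  rw [Polynomial.map_mul, Polynomial.map_mul, k0, k4, k5, Phi4_map, h.Phi4_eq]
  rw [← Finset.prod_union (by decide), ← Finset.prod_union (by decide)]
  exact Finset.prod_congr (by decide) (fun _ _ => rfl)

theorem isSq_of_mul_sq {e u : ℚ} (_hu : u ≠ 0) {d : ℚ} (h : e * u ^ 2 = d) (hd : ¬IsSquare d) : ¬IsSquare e := by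
  rintro ⟨r, rfl⟩
  exact hd ⟨r * u, by rw [← h]; ring⟩

theorem final_gen {L : Type} [Field L] [Algebra ℚ L] [CharZero L] [IsGalois ℚ L] [FiniteDimensional ℚ L]
    {c z : ℚ} (h0 : z ≠ 0) (h1 : z ≠ 1) (h2 : z ≠ -1)
    (hcz : c = (1 + 4 * z ^ 3 - z ^ 6) / (4 * z ^ 2 * (z ^ 2 - 1))) (hc5 : c ≠ -5/4) (hc155 : c ≠ -155/72)
    (hsp : ((Phi4 c).map (algebraMap ℚ L)).Splits)
    (hgen : Algebra.adjoin ℚ ((Phi4 c).rootSet L) = ⊤) :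
    (∃ A B₁ B₂ : ℚ[X], Irreducible A ∧ Irreducible B₁ ∧ Irreducible B₂ ∧
      A.natDegree = 8 ∧ B₁.natDegree = 2 ∧ B₂.natDegree = 2 ∧ Phi4 c = A * B₁ * B₂) ∧
    Nonempty ((L ≃ₐ[ℚ] L) ≃* Igroup) := by
  have h3 : z ≠ 3 := by
    rintro rfl; apply hc155; rw [hcz]; norm_num
  have h4 : z ≠ -1/3 := by
    rintro rfl; apply hc155; rw [hcz]; norm_num
  have ha : 1 - z ^ 2 ≠ 0 := by
    intro h
    have : (1 - z) * (1 + z) = 0 := by linear_combination h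
    rcases mul_eq_zero.1 this with h | h
    · exact h1 (by linear_combination -h)
    · exact h2 (by linear_combination h)
  have ha' : z ^ 2 - 1 ≠ 0 := fun h => ha (by linear_combination -h)
  have hτ : z⁻¹ - z = (1 - z ^ 2) / z := by field_simp
  have hτ0 : z⁻¹ - z ≠ 0 := by rw [hτ]; exact div_ne_zero ha h0
  have hc4 : c * (4 * z ^ 2 * (z ^ 2 - 1)) = 1 + 4 * z ^ 3 - z ^ 6 := by
    rw [hcz]; field_simp
  have hcub : (z⁻¹ - z) ^ 3 + (4 * c + 3) * (z⁻¹ - z) + 4 = 0 := by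
    rw [hτ]; field_simp; linear_combination -hc4
  obtain ⟨s1, s2, s3, s12, s13, s23, s123⟩ := rat_final h0 h1 h2 h3 h4 rfl rfl rfl rfl
  have t1 : (-z ^ 2 - 4 * c + 2 * z⁻¹) * (z * (1 - z ^ 2)) ^ 2 = (1 - z ^ 2) * ((1 - z ^ 2 + 2 * z) * (1 + z ^ 2)) := by
    field_simp; linear_combination hc4
  have t2 : ((z⁻¹ - z) ^ 2 + 16 * (z⁻¹ - z)⁻¹) * (z * (1 - z ^ 2)) ^ 2 = (1 - z ^ 2) * ((1 - z ^ 2) ^ 3 + 16 * z ^ 3) := by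
    rw [hτ]; field_simp
  have t3 : (16 * (z⁻¹ - z)⁻¹ ^ 2 + 4 * (z⁻¹ - z) ^ 2 + 32 * (z⁻¹ - z)⁻¹ + 16) * (z * (1 - z ^ 2) / 2) ^ 2 =
      (1 - z ^ 2) ^ 4 + 4 * (1 - z ^ 2) ^ 2 * z ^ 2 + 8 * (1 - z ^ 2) * z ^ 3 + 4 * z ^ 4 := by
    rw [hτ]; field_simp; ring
  obtain ⟨u, hu⟩ : ∃ u, u = z * (1 - z ^ 2) := ⟨_, rfl⟩
  have hu0 : u ≠ 0 := by rw [hu]; exact mul_ne_zero h0 ha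
  rw [← hu] at t1 t2 t3
  have hu2 : u / 2 ≠ 0 := div_ne_zero hu0 (by norm_num)
  have n2 := isSq_of_mul_sq hu0 t2 s2
  have ht2 : (z⁻¹ - z) ^ 3 ≠ -16 := by
    intro h
    apply n2
    have : (z⁻¹ - z) ^ 2 + 16 * (z⁻¹ - z)⁻¹ = 0 := by
      have : ((z⁻¹ - z) ^ 2 + 16 * (z⁻¹ - z)⁻¹) * (z⁻¹ - z) = 0 := by
        rw [add_mul, mul_assoc, inv_mul_cancel₀ hτ0]; linear_combination h
      exact (mul_eq_zero.1 this).resolve_right hτ0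
    rw [this]
    exact ⟨0, by norm_num⟩
  obtain ⟨x, hx⟩ := exists_twelve_split (L := L) hsp h0 rfl hτ0 hcub
    (fun h => hc5 (by linear_combination h / 4)) ht2
  have hgen' : Algebra.adjoin ℚ (Set.range x) = ⊤ := by
    rw [← hgen]
    congr 1
    ext y
    have hm : Phi4 c ≠ 0 := (Phi4_monic c).ne_zero
    rw [mem_rootSet_of_ne hm, ← eval_map_algebraMap, Phi4_map, hx.Phi4_eq, eval_prod, Finset.prod_eq_zero_iff]
    simp only [Set.mem_range, Finset.mem_univ, true_and, eval_sub, eval_X, eval_C, sub_eq_zero]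
    constructor
    · rintro ⟨i, rfl⟩; exact ⟨i, rfl⟩
    · rintro ⟨i, rfl⟩; exact ⟨i, rfl⟩
  obtain ⟨ρ, hinj, hρ, hr⟩ := galois_main hx hgen' h0 hτ0 rfl rfl rfl
    (isSq_of_mul_sq hu0 t1 s1) n2 (isSq_of_mul_sq hu2 t3 s3)
    (isSq_of_mul_sq (mul_ne_zero hu0 hu0) (by rw [← t1, ← t2]; ring) s12)
    (isSq_of_mul_sq (mul_ne_zero hu0 hu2) (by rw [← t1, ← t3]; ring) s13)
    (isSq_of_mul_sq (mul_ne_zero hu0 hu2) (by rw [← t2, ← t3]; ring) s23)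
    (isSq_of_mul_sq (mul_ne_zero (mul_ne_zero hu0 hu0) hu2) (by rw [← t1, ← t2, ← t3]; ring) s123)
  exact ⟨final_of_field hx ρ hρ hr, ⟨(MonoidHom.ofInjective hinj).trans (MulEquiv.subgroupCongr hr)⟩⟩

theorem final_split {c z : ℚ} {L : Type} [Field L] [Algebra ℚ L] [hS : IsSplittingField ℚ L (Phi4 c)]
    (h0 : z ≠ 0) (h1 : z ≠ 1) (h2 : z ≠ -1)
    (hcz : c = (1 + 4 * z ^ 3 - z ^ 6) / (4 * z ^ 2 * (z ^ 2 - 1))) (hc5 : c ≠ -5/4) (hc155 : c ≠ -155/72) :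
    (∃ A B₁ B₂ : ℚ[X], Irreducible A ∧ Irreducible B₁ ∧ Irreducible B₂ ∧
      A.natDegree = 8 ∧ B₁.natDegree = 2 ∧ B₂.natDegree = 2 ∧ Phi4 c = A * B₁ * B₂) ∧
    Nonempty ((L ≃ₐ[ℚ] L) ≃* Igroup) := by
  have i1 : CharZero L := algebraRat.charZero _
  have i2 : FiniteDimensional ℚ L := IsSplittingField.finiteDimensional L (Phi4 c)
  have i3 : Normal ℚ L := Normal.of_isSplittingField (Phi4 c)
  have i4 : IsGalois ℚ L := IsGalois.mk
  exact final_gen h0 h1 h2 hcz hc5 hc155 (IsSplittingField.splits L (Phi4 c)) (IsSplittingField.adjoin_rootSet L (Phi4 c))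

theorem phi4_galois_rho (c : ℚ)
    (hc : c ∉ ({-5, -5/2, -155/72, -2, -5/4, 0, 19/16} : Set ℚ))
    (hrho : ∃ r : ℚ, r ≠ 0 ∧ r ≠ 1 ∧ r ≠ -1 ∧
      c = (1 + 4 * r ^ 3 - r ^ 6) / (4 * r ^ 2 * (r ^ 2 - 1))) :
    (∃ A B₁ B₂ : ℚ[X], Irreducible A ∧ Irreducible B₁ ∧ Irreducible B₂ ∧
      A.natDegree = 8 ∧ B₁.natDegree = 2 ∧ B₂.natDegree = 2 ∧ Phi4 c = A * B₁ * B₂) ∧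
    Nonempty ((Phi4 c).Gal ≃* Igroup) := by
  obtain ⟨r, h0, h1, h2, hr⟩ := hrho
  simp only [Set.mem_insert_iff, Set.mem_singleton_iff, not_or] at hc
  exact @final_split c r (Phi4 c).SplittingField _ _ (IsSplittingField.splittingField (Phi4 c)) h0 h1 h2 hr
    hc.2.2.2.2.1 hc.2.2.1
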